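/- Let q, ℓ ∈ (1,∞] with α := 3/q + 2/ℓ − 1 ∈ [0,1), and let R > 0. There exists a constant C = C(q,ℓ) > 1 such that the following holds. Let b be a C¹ vector field on Q_R^{2,1} := [−R², 0] × B(0, 2R) with 𝒩 := 2 + sup_{0<R'≤2R} (R')^{−α}‖b‖_{L^ℓ_t L^q_x(Q_{R'})} < ∞, where Q_ρ := [−ρ², 0] × B(0, ρ). Let V be a Lipschitz weak solution of ∂ₜV − ΔV + b·∇V = 0 on Q_R^{2,1} such that at every point of Q_R^{2,1} either div b = 0 or V = 0. Then, with Θ := C^{−2}·𝒩^{−1}: osc_{Q_R^{1,Θ/2}} V ≤ (1 − exp(−𝒩^C)) · osc_{Q_R^{2,1}} V, where Q_R^{1,Θ/2} := [−ΘR²/2, 0] × B(0, R). -/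

import Mathlib

noncomputable section
open Real MeasureTheory Filter Metric Set
open scoped ENNReal NNReal Topology FourierTransform

/-- Three-dimensional Euclidean space. -/
abbrev E3 : Type := EuclideanSpace ℝ (Fin 3)

/-- The `i`-th partial derivative of a scalar function on `ℝ³`. -/
def pd (f : E3 → ℝ) (i : Fin 3) (x : E3) : ℝ :=
  fderiv ℝ f x (EuclideanSpace.single i 1)

/-- The Laplacian of a scalar function on `ℝ³`. -/
def lap (f : E3 → ℝ) (x : E3) : ℝ :=
  ∑ i : Fin 3, pd (fun y => pd f i y) i x

/-- `(u, pr)` is a classical solution of the Navier–Stokes equations on the time interval `I`. -/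
def IsNSSol (u : ℝ → E3 → E3) (pr : ℝ → E3 → ℝ) (I : Set ℝ) : Prop :=
  (ContDiff ℝ (⊤:ℕ∞) fun q : ℝ × E3 => u q.1 q.2) ∧
  (ContDiff ℝ (⊤:ℕ∞) fun q : ℝ × E3 => pr q.1 q.2) ∧
  (∀ t ∈ I, ∀ x : E3, ∀ i : Fin 3,
    deriv (fun s => u s x i) t - lap (fun y => u t y i) x
      + (∑ j : Fin 3, u t x j * pd (fun y => u t y i) j x) + pd (pr t) i x = 0) ∧
  (∀ t ∈ I, ∀ x : E3, (∑ i : Fin 3, pd (fun y => u t y i) i x) = 0)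

/-- Rotation by angle `θ` about the `x₃`-axis. -/
def rotZ (θ : ℝ) (x : E3) : E3 :=
  (WithLp.equiv 2 (Fin 3 → ℝ)).symm
    ![x 0 * Real.cos θ - x 1 * Real.sin θ, x 0 * Real.sin θ + x 1 * Real.cos θ, x 2]

/-- A time-dependent vector field is axisymmetric. -/
def AxiSym (u : ℝ → E3 → E3) : Prop := ∀ θ t x, u t (rotZ θ x) = rotZ θ (u t x)

/-- The weak `L^q` (quasi)norm `sup_{λ>0} λ · vol{|f| ≥ λ}^{1/q}`. -/
def wnorm' {F : Type*} [NormedAddCommGroup F] (f : E3 → F) (q : ℝ) : ℝ≥0∞ :=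
  ⨆ (l : ℝ) (_ : 0 < l), ENNReal.ofReal l * (volume {x : E3 | l ≤ ‖f x‖}) ^ (1 / q)

/-- The weak `L^3` norm. -/
def wnorm3 (f : E3 → E3) : ℝ≥0∞ := wnorm' f 3

/-- Distance to the `x₃`-axis. -/
def rr (x : E3) : ℝ := Real.sqrt (x 0 ^ 2 + x 1 ^ 2)

/-- The parabolic cylinder `Q_R^{λ,θ} = [-θR², 0] × B(0, λR)`. -/
def Qlt (R lam θ : ℝ) : Set (ℝ × E3) := Set.Icc (-(θ * R ^ 2)) 0 ×ˢ Metric.ball 0 (lam * R)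

/-- The parabolic cylinder `Q_R = [-R², 0] × B(0, R)`. -/
def Qc (R : ℝ) : Set (ℝ × E3) := Set.Icc (-(R ^ 2)) 0 ×ˢ Metric.ball 0 R

/-- The spatial `L^q` norm over a set `S` (with `q ∈ (0,∞]`). -/
def spaceNorm (g : E3 → E3) (q : ℝ≥0∞) (S : Set E3) : ℝ≥0∞ :=
  if q = ⊤ then essSup (fun x => (‖g x‖₊ : ℝ≥0∞)) (volume.restrict S)
  else (∫⁻ x in S, (‖g x‖₊ : ℝ≥0∞) ^ q.toReal) ^ (1 / q.toReal)

/-- The mixed norm `L^ℓ_t L^q_x` over `I × S`. -/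
def mixedNorm (b : ℝ → E3 → E3) (l q : ℝ≥0∞) (I : Set ℝ) (S : Set E3) : ℝ≥0∞ :=
  if l = ⊤ then essSup (fun t => spaceNorm (b t) q S) (volume.restrict I)
  else (∫⁻ t in I, spaceNorm (b t) q S ^ l.toReal) ^ (1 / l.toReal)

/-- Time partial derivative of a space-time function. -/
def pdt (V : ℝ × E3 → ℝ) (p : ℝ × E3) : ℝ := deriv (fun s => V (s, p.2)) p.1

/-- Spatial partial derivative of a space-time function. -/
def pdx (V : ℝ × E3 → ℝ) (i : Fin 3) (p : ℝ × E3) : ℝ :=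
  fderiv ℝ (fun y => V (p.1, y)) p.2 (EuclideanSpace.single i 1)

/-- The integrand `∂ₜV·φ + ∇V·∇φ + (b·∇V)·φ` of the weak formulation. -/
def weakInt (V : ℝ × E3 → ℝ) (b : ℝ → E3 → E3) (φ : ℝ × E3 → ℝ) (p : ℝ × E3) : ℝ :=
  pdt V p * φ p + (∑ i : Fin 3, pdx V i p * pdx φ i p) +
    (∑ i : Fin 3, b p.1 p.2 i * pdx V i p) * φ p

/-- `V` is a Lipschitz-class weak solution of `∂ₜV - ΔV + b·∇V = 0` on `Q`. -/
def WeakSolOn (V : ℝ × E3 → ℝ) (b : ℝ → E3 → E3) (Q : Set (ℝ × E3)) : Prop :=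
  ∀ φ : ℝ × E3 → ℝ, ContDiff ℝ (⊤:ℕ∞) φ → HasCompactSupport φ → tsupport φ ⊆ interior Q →
    (∫ p : ℝ × E3, weakInt V b φ p) = 0

/-- `V` is a weak subsolution of `∂ₜV - ΔV + b·∇V = 0` on `Q`. -/
def WeakSubSolOn (V : ℝ × E3 → ℝ) (b : ℝ → E3 → E3) (Q : Set (ℝ × E3)) : Prop :=
  ∀ φ : ℝ × E3 → ℝ, ContDiff ℝ (⊤:ℕ∞) φ → HasCompactSupport φ → tsupport φ ⊆ interior Q →
    (∀ p, 0 ≤ φ p) → (∫ p : ℝ × E3, weakInt V b φ p) ≤ 0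

/-- `V` is a weak supersolution of `∂ₜV - ΔV + b·∇V = 0` on `Q`. -/
def WeakSuperSolOn (V : ℝ × E3 → ℝ) (b : ℝ → E3 → E3) (Q : Set (ℝ × E3)) : Prop :=
  ∀ φ : ℝ × E3 → ℝ, ContDiff ℝ (⊤:ℕ∞) φ → HasCompactSupport φ → tsupport φ ⊆ interior Q →
    (∀ p, 0 ≤ φ p) → 0 ≤ (∫ p : ℝ × E3, weakInt V b φ p)

/-- Pointwise spatial divergence of a time-dependent vector field. -/
def divb (b : ℝ → E3 → E3) (p : ℝ × E3) : ℝ :=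
  ∑ i : Fin 3, fderiv ℝ (fun y => b p.1 y i) p.2 (EuclideanSpace.single i 1)

/-- Oscillation of a function over a set. -/
def osc {α : Type*} (f : α → ℝ) (S : Set α) : ℝ := sSup (f '' S) - sInf (f '' S)

section Mollify
variable {E : Type*} [NormedAddCommGroup E] [NormedSpace ℝ E] [FiniteDimensional ℝ E]
  [MeasurableSpace E] [BorelSpace E] {μ : Measure E} [μ.IsAddHaarMeasure]

/-- A standard sequence of smooth bumps at the origin shrinking to a point. -/
def molBump (E : Type*) [NormedAddCommGroup E] [NormedSpace ℝ E] [FiniteDimensional ℝ E] (n : ℕ) :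
    ContDiffBump (0 : E) where
  rIn := 1 / (2 * ((n : ℝ) + 1))
  rOut := 1 / ((n : ℝ) + 1)
  rIn_pos := by positivity
  rIn_lt_rOut := by
    have : (0:ℝ) ≤ n := n.cast_nonneg
    exact one_div_lt_one_div_of_lt (by positivity) (by linarith)

/-- The mollification of `g` at scale `1 / (n + 1)`. -/
def mol (μ : Measure E) (n : ℕ) (g : E → ℝ) (x : E) : ℝ :=
  ∫ t, (molBump E n).normed μ t * g (x - t) ∂μ

lemma molBump_rOut_tendsto : Tendsto (fun n => (molBump E n).rOut) atTop (𝓝 0) :=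
  tendsto_one_div_add_atTop_nhds_zero_nat

lemma mol_eq_conv (n : ℕ) (g : E → ℝ) :
    mol μ n g = convolution ((molBump E n).normed μ) g (ContinuousLinearMap.lsmul ℝ ℝ) μ := by
  ext x; simp [mol, convolution]

lemma mol_contDiff (n : ℕ) {g : E → ℝ} (hg : LocallyIntegrable g μ) :
    ContDiff ℝ (⊤ : ℕ∞) (mol μ n g) := by
  rw [mol_eq_conv]
  exact (molBump E n).hasCompactSupport_normed.contDiff_convolution_left _
    (molBump E n).contDiff_normed hg

lemma mol_bumpbound (n : ℕ) {g : E → ℝ} {x : E} {M : ℝ}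
    (h : ∀ y ∈ ball x (1 / ((n : ℝ) + 1)), |g y| ≤ M) : |mol μ n g x| ≤ M := by
  have hs : ∀ t, ‖(molBump E n).normed μ t * g (x - t)‖ ≤ (molBump E n).normed μ t * M := by
    intro t
    rw [norm_mul, Real.norm_of_nonneg ((molBump E n).nonneg_normed t)]
    by_cases ht : t ∈ ball (0 : E) (molBump E n).rOut
    · refine mul_le_mul_of_nonneg_left (h _ ?_) ((molBump E n).nonneg_normed t)
      simpa [mem_ball, dist_eq_norm, molBump] using ht
    · have : (molBump E n).normed μ t = 0 := by
        rw [← Function.notMem_support, (molBump E n).support_normed_eq]; exact ht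
      simp [this]
  calc |mol μ n g x| ≤ ∫ t, (molBump E n).normed μ t * M ∂μ :=
        norm_integral_le_of_norm_le ((molBump E n).integrable_normed (μ := μ) |>.mul_const M)
          (Eventually.of_forall hs)
    _ = M := by rw [integral_mul_const, (molBump E n).integral_normed (μ := μ), one_mul]

lemma mol_eq_zero (n : ℕ) {g : E → ℝ} {x : E}
    (h : ∀ y ∈ ball x (1 / ((n : ℝ) + 1)), g y = 0) : mol μ n g x = 0 := by
  have := mol_bumpbound (μ := μ) n (g := g) (x := x) (M := 0) (fun y hy => by simp [h y hy])
  simpa using this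

lemma mol_integrable (n : ℕ) {g : E → ℝ} (hg : LocallyIntegrable g μ) (x : E) :
    Integrable (fun t => (molBump E n).normed μ t * g (x - t)) μ := by
  have := ((molBump E n).hasCompactSupport_normed (μ := μ)).convolutionExists_left
    (ContinuousLinearMap.lsmul ℝ ℝ) (molBump E n).continuous_normed hg x
  simpa [ConvolutionExistsAt] using this

lemma mol_const_sub (n : ℕ) {g : E → ℝ} (hg : LocallyIntegrable g μ) (x : E) (c : ℝ) :
    mol μ n (fun y => g y - c) x = mol μ n g x - c := by
  unfold mol
  simp_rw [mul_sub]
  rw [integral_sub (mol_integrable n hg x) ((molBump E n).integrable_normed (μ := μ) |>.mul_const c),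
    integral_mul_const, (molBump E n).integral_normed (μ := μ), one_mul]

lemma mol_lip (n : ℕ) {g : E → ℝ} {K : ℝ≥0} (hg : LipschitzWith K g) :
    LipschitzWith K (mol μ n g) := by
  refine LipschitzWith.of_dist_le_mul fun x y => ?_
  have hl : LocallyIntegrable g μ := hg.continuous.locallyIntegrable
  rw [Real.dist_eq]
  unfold mol
  rw [← integral_sub (mol_integrable n hl x) (mol_integrable n hl y)]
  have hb := norm_integral_le_of_norm_le (μ := μ)
    (f := fun t => (molBump E n).normed μ t * g (x - t) - (molBump E n).normed μ t * g (y - t))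
    (((molBump E n).integrable_normed (μ := μ)).mul_const (K * dist x y))
    (Eventually.of_forall fun t => by
      rw [← mul_sub, norm_mul, Real.norm_of_nonneg ((molBump E n).nonneg_normed t)]
      refine mul_le_mul_of_nonneg_left ?_ ((molBump E n).nonneg_normed t)
      have := hg.dist_le_mul (x - t) (y - t)
      rwa [dist_sub_right, Real.dist_eq] at this)
  rwa [integral_mul_const, (molBump E n).integral_normed (μ := μ), one_mul] at hb

lemma mol_dist (n : ℕ) {g : E → ℝ} {K : ℝ≥0} (hg : LipschitzWith K g) (x : E) :
    |mol μ n g x - g x| ≤ K * (1 / ((n : ℝ) + 1)) := by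
  have hl : LocallyIntegrable g μ := hg.continuous.locallyIntegrable
  rw [← mol_const_sub n hl x (g x)]
  refine mol_bumpbound n fun y hy => ?_
  have := hg.dist_le_mul y x
  rw [Real.dist_eq] at this
  exact this.trans (mul_le_mul_of_nonneg_left (mem_ball.1 hy).le K.2)

lemma mol_tendsto_of_lip {g : E → ℝ} {K : ℝ≥0} (hg : LipschitzWith K g) (x : E) :
    Tendsto (fun n => mol μ n g x) atTop (𝓝 (g x)) := by
  rw [tendsto_iff_dist_tendsto_zero]
  refine squeeze_zero (fun n => dist_nonneg) (fun n => mol_dist n hg x) ?_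
  simpa using tendsto_one_div_add_atTop_nhds_zero_nat.const_mul (K : ℝ)

lemma mol_tendsto_ae {g : E → ℝ} (hg : LocallyIntegrable g μ) :
    ∀ᵐ x ∂μ, Tendsto (fun n => mol μ n g x) atTop (𝓝 (g x)) := by
  have := ContDiffBump.ae_convolution_tendsto_right_of_locallyIntegrable (μ := μ) (K := 2)
    (φ := fun n => molBump E n) (l := atTop) molBump_rOut_tendsto
    (Eventually.of_forall fun n => by
      simp only [molBump]; apply le_of_eq; field_simp) hg
  simpa [mol_eq_conv] using this

lemma Lip.measurable_fderiv {g : E → ℝ} (v : E) : Measurable fun x => fderiv ℝ g x v :=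
  measurable_fderiv_apply_const ℝ g v

lemma Lip.abs_fderiv_le {g : E → ℝ} {K : ℝ≥0} (hg : LipschitzWith K g) (x v : E) :
    |fderiv ℝ g x v| ≤ K * ‖v‖ :=
  ((fderiv ℝ g x).le_opNorm v).trans
    (mul_le_mul_of_nonneg_right (norm_fderiv_le_of_lipschitz ℝ hg) (norm_nonneg v))

lemma locallyIntegrable_of_bound {g : E → ℝ} (hm : Measurable g) {M : ℝ} (hb : ∀ x, |g x| ≤ M) :
    LocallyIntegrable g μ := by
  refine (locallyIntegrable_const M).mono hm.aestronglyMeasurable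
    (Eventually.of_forall fun x => ?_)
  exact (hb x).trans (le_abs_self M)

lemma Lip.locallyIntegrable_fderiv {g : E → ℝ} {K : ℝ≥0} (hg : LipschitzWith K g) (v : E) :
    LocallyIntegrable (fun x => fderiv ℝ g x v) μ :=
  locallyIntegrable_of_bound (Lip.measurable_fderiv v) (fun x => Lip.abs_fderiv_le hg x v)

lemma mol_fderiv (n : ℕ) {g : E → ℝ} {K : ℝ≥0} (hg : LipschitzWith K g) (x v : E) :
    fderiv ℝ (mol μ n g) x v = mol μ n (fun y => fderiv ℝ g y v) x := by
  have hl : LocallyIntegrable g μ := hg.continuous.locallyIntegrable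
  have hdiff : ∀ᵐ t ∂μ, DifferentiableAt ℝ g (x - t) :=
    (Measure.measurePreserving_sub_left μ x).quasiMeasurePreserving.ae hg.ae_differentiableAt
  have hmeas : AEStronglyMeasurable
      (fun t => ((molBump E n).normed μ t) • fderiv ℝ g (x - t)) μ := by
    refine ((molBump E n).continuous_normed.measurable.smul ?_).aestronglyMeasurable
    exact (measurable_fderiv ℝ g).comp (measurable_const.sub measurable_id)
  have key := hasFDerivAt_integral_of_dominated_loc_of_lip (μ := μ) (𝕜 := ℝ)
    (F := fun x t => (molBump E n).normed μ t * g (x - t))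
    (F' := fun t => ((molBump E n).normed μ t) • fderiv ℝ g (x - t)) (x₀ := x)
    (bound := fun t => K * (molBump E n).normed μ t) (s := univ) univ_mem
    (Eventually.of_forall fun y => (mol_integrable n hl y).aestronglyMeasurable)
    (mol_integrable n hl x) hmeas
    (Eventually.of_forall fun t => by
      refine LipschitzOnWith.of_dist_le_mul fun y _ z _ => ?_
      have := hg.dist_le_mul (y - t) (z - t)
      rw [dist_sub_right, Real.dist_eq] at this
      rw [Real.dist_eq, ← mul_sub, abs_mul]
      have h0 := (molBump E n).nonneg_normed (μ := μ) t
      simp only [Real.coe_nnabs, abs_mul, NNReal.abs_eq]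
      calc _ ≤ |(molBump E n).normed μ t| * (K * dist y z) := by gcongr
        _ = _ := by ring)
    ((molBump E n).integrable_normed.const_mul _)
    (by
      filter_upwards [hdiff] with t ht
      have h1 : HasFDerivAt (fun y => g (y - t)) (fderiv ℝ g (x - t)) x := by
        have := ht.hasFDerivAt.comp x ((hasFDerivAt_id x).sub_const t)
        exact this
      exact h1.const_mul _)
  have : fderiv ℝ (mol μ n g) x = ∫ t, ((molBump E n).normed μ t) • fderiv ℝ g (x - t) ∂μ :=
    key.2.fderiv
  rw [this, ContinuousLinearMap.integral_apply key.1]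
  simp [mol]

end Mollify

/-- The standard basis vectors of `ℝ³`. -/
abbrev e3 (i : Fin 3) : E3 := EuclideanSpace.single i 1

/-- Space-time. -/
abbrev SpT : Type := ℝ × E3

instance : (volume : Measure SpT).IsAddHaarMeasure :=
  inferInstanceAs (((volume : Measure ℝ).prod (volume : Measure E3)).IsAddHaarMeasure)

lemma e3_sum (x : E3) : x = ∑ i, x i • e3 i := by
  ext j
  simp [Finset.sum_apply, Pi.single_apply]

lemma clm_apply_eq (L : E3 →L[ℝ] ℝ) (x : E3) : L x = ∑ i, x i * L (e3 i) := by
  conv_lhs => rw [e3_sum x]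
  simp

/-- The vector representing a covector. -/
def covec (L : E3 →L[ℝ] ℝ) : E3 := WithLp.toLp 2 fun i => L (e3 i)

@[simp] lemma covec_apply (L : E3 →L[ℝ] ℝ) (i : Fin 3) : covec L i = L (e3 i) := rfl

lemma inner_covec (L : E3 →L[ℝ] ℝ) (x : E3) : inner ℝ (covec L) x = L x := by
  rw [clm_apply_eq, PiLp.inner_apply]; simp

lemma norm_covec (L : E3 →L[ℝ] ℝ) : ‖covec L‖ = ‖L‖ := by
  apply le_antisymm
  · have h := inner_covec L (covec L)
    rw [real_inner_self_eq_norm_sq] at h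
    have h2 : L (covec L) ≤ ‖L‖ * ‖covec L‖ := (le_abs_self _).trans (L.le_opNorm _)
    by_cases h0 : ‖covec L‖ = 0
    · rw [h0]; positivity
    · have : 0 < ‖covec L‖ := lt_of_le_of_ne (norm_nonneg _) (Ne.symm h0)
      nlinarith
  · refine L.opNorm_le_bound (norm_nonneg _) fun x => ?_
    rw [← inner_covec]; exact norm_inner_le_norm _ _

lemma sum_mul_eq_inner (L M : E3 →L[ℝ] ℝ) :
    ∑ i, L (e3 i) * M (e3 i) = inner ℝ (covec L) (covec M) := by
  rw [PiLp.inner_apply]; simp [mul_comm]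

lemma sum_sq_eq (L : E3 →L[ℝ] ℝ) : ∑ i, L (e3 i) * L (e3 i) = ‖L‖ ^ 2 := by
  rw [sum_mul_eq_inner, real_inner_self_eq_norm_sq, norm_covec]

lemma abs_sum_mul_le (L M : E3 →L[ℝ] ℝ) : |∑ i, L (e3 i) * M (e3 i)| ≤ ‖L‖ * ‖M‖ := by
  rw [sum_mul_eq_inner, ← norm_covec L, ← norm_covec M]; exact abs_real_inner_le_norm _ _

/-- The time derivative as a directional Fréchet derivative. -/
def dt (V : SpT → ℝ) (p : SpT) : ℝ := fderiv ℝ V p (1, 0)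

/-- The spatial derivative as a directional Fréchet derivative. -/
def dx (V : SpT → ℝ) (i : Fin 3) (p : SpT) : ℝ := fderiv ℝ V p (0, e3 i)

lemma dt_eq_pdt {V : SpT → ℝ} {p : SpT} (h : DifferentiableAt ℝ V p) :
    HasDerivAt (fun s => V (s, p.2)) (dt V p) p.1 := by
  have h1 : HasDerivAt (fun s : ℝ => ((s, p.2) : SpT)) (1, 0) p.1 :=
    (hasDerivAt_id p.1).prodMk (hasDerivAt_const p.1 p.2)
  exact HasFDerivAt.comp_hasDerivAt (f := fun s : ℝ => ((s, p.2) : SpT)) p.1 (h.hasFDerivAt) h1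

lemma slice_hasFDerivAt {V : SpT → ℝ} {t : ℝ} {x : E3} (h : DifferentiableAt ℝ V (t, x)) :
    HasFDerivAt (fun y => V (t, y)) ((fderiv ℝ V (t, x)).comp (ContinuousLinearMap.inr ℝ ℝ E3)) x := by
  have h1 : HasFDerivAt (fun y : E3 => ((t, y) : SpT)) (ContinuousLinearMap.inr ℝ ℝ E3) x :=
    (hasFDerivAt_const t x).prodMk (hasFDerivAt_id x)
  exact HasFDerivAt.comp (f := fun y : E3 => ((t, y) : SpT)) x h.hasFDerivAt h1

lemma dx_eq_slice {V : SpT → ℝ} {t : ℝ} {x : E3} (h : DifferentiableAt ℝ V (t, x)) (i : Fin 3) :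
    fderiv ℝ (fun y => V (t, y)) x (e3 i) = dx V i (t, x) := by
  rw [(slice_hasFDerivAt h).fderiv]; simp [dx]

lemma dt_measurable (V : SpT → ℝ) : Measurable (dt V) := measurable_fderiv_apply_const ℝ V _

lemma dx_measurable (V : SpT → ℝ) (i : Fin 3) : Measurable (dx V i) :=
  measurable_fderiv_apply_const ℝ V _

lemma dt_bound {V : SpT → ℝ} {K : ℝ≥0} (hV : LipschitzWith K V) (p : SpT) : |dt V p| ≤ K := by
  unfold dt
  have := Lip.abs_fderiv_le hV p (1, 0)
  simpa [Prod.norm_def] using this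

lemma dx_bound {V : SpT → ℝ} {K : ℝ≥0} (hV : LipschitzWith K V) (i : Fin 3) (p : SpT) :
    |dx V i p| ≤ K := by
  unfold dx
  have := Lip.abs_fderiv_le hV p (0, e3 i)
  simpa [Prod.norm_def] using this

/-- The integrand of the weak formulation through Fréchet derivatives. -/
def weakF (V : SpT → ℝ) (b : ℝ → E3 → E3) (φ : SpT → ℝ) (p : SpT) : ℝ :=
  dt V p * φ p + (∑ i : Fin 3, dx V i p * dx φ i p) +
    (∑ i : Fin 3, b p.1 p.2 i * dx V i p) * φ p

lemma weakInt_ae_eq {V φ : SpT → ℝ} {K L : ℝ≥0} (hV : LipschitzWith K V) (hφ : LipschitzWith L φ)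
    (b : ℝ → E3 → E3) : weakInt V b φ =ᵐ[volume] weakF V b φ := by
  filter_upwards [hV.ae_differentiableAt, hφ.ae_differentiableAt] with p h1 h2
  have h3 : pdt V p = dt V p := (dt_eq_pdt h1).deriv
  have h4 : ∀ i, pdx V i p = dx V i p := fun i => dx_eq_slice h1 i
  have h5 : ∀ i, pdx φ i p = dx φ i p := fun i => dx_eq_slice h2 i
  simp only [weakInt, weakF, h3, h4, h5]

/-- The open parabolic cylinder. -/
def Om : Set SpT := Ioo (-1 : ℝ) 0 ×ˢ ball (0 : E3) 2

lemma isOpen_Om : IsOpen Om := isOpen_Ioo.prod isOpen_ball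

lemma interior_Qlt_one : interior (Qlt 1 2 1) = Om := by
  rw [Qlt, interior_prod_eq, interior_Icc, isOpen_ball.interior_eq, Om]; norm_num

lemma Om_subset_Qlt : Om ⊆ Qlt 1 2 1 := interior_Qlt_one ▸ interior_subset

/-- Globally Lipschitz weak solutions, tested with Lipschitz functions. -/
structure WSol (V : SpT → ℝ) (b : ℝ → E3 → E3) (K : ℝ≥0) : Prop where
  lip : LipschitzWith K V
  cont : ContinuousOn (fun p : SpT => b p.1 p.2) (Qlt 1 2 1)
  weak : WeakSolOn V b (Qlt 1 2 1)

lemma dx_of_notMem_tsupport {φ : SpT → ℝ} {p : SpT} (hp : p ∉ tsupport φ) (i : Fin 3) :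
    dx φ i p = 0 := by
  have : fderiv ℝ φ p = 0 := by
    have h := support_fderiv_subset ℝ (f := φ)
    by_contra hc
    exact hp (h (Function.mem_support.2 hc))
  simp [dx, this]

lemma weakF_of_notMem {V φ : SpT → ℝ} {b : ℝ → E3 → E3} {p : SpT} (hp : p ∉ tsupport φ) :
    weakF V b φ p = 0 := by
  simp [weakF, dx_of_notMem_tsupport hp, image_eq_zero_of_notMem_tsupport hp]

lemma weakF_aesm {V φ : SpT → ℝ} {b : ℝ → E3 → E3} (hφ : Continuous φ) {S : Set SpT}
    (hS : MeasurableSet S) (hb : ContinuousOn (fun p : SpT => b p.1 p.2) S) :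
    AEStronglyMeasurable (weakF V b φ) (volume.restrict S) := by
  have h1 : ∀ i, AEStronglyMeasurable (fun p : SpT => b p.1 p.2 i) (volume.restrict S) := by
    intro i
    refine ContinuousOn.aestronglyMeasurable ?_ hS
    exact ((EuclideanSpace.proj i : E3 →L[ℝ] ℝ).continuous.comp_continuousOn hb)
  have h2 : ∀ V : SpT → ℝ, ∀ i, AEStronglyMeasurable (dx V i) (volume.restrict S) := fun V i =>
    (dx_measurable V i).aestronglyMeasurable
  refine ((((dt_measurable V).aestronglyMeasurable.mul hφ.aestronglyMeasurable).add ?_).add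
    (AEStronglyMeasurable.mul ?_ hφ.aestronglyMeasurable))
  · exact Finset.aestronglyMeasurable_fun_sum _ fun i _ => (h2 V i).mul (h2 φ i)
  · exact Finset.aestronglyMeasurable_fun_sum _ fun i _ => (h1 i).mul (h2 V i)

lemma weakF_bound {V φ : SpT → ℝ} {b : ℝ → E3 → E3} {K L : ℝ≥0} (hV : LipschitzWith K V)
    (hφ : LipschitzWith L φ) {p : SpT} {M B : ℝ} (hM : |φ p| ≤ M) (hB : ‖b p.1 p.2‖ ≤ B) :
    |weakF V b φ p| ≤ K * M + 3 * (K * L) + 3 * (B * K) * M := by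
  have hM0 : 0 ≤ M := (abs_nonneg _).trans hM
  have hB0 : 0 ≤ B := (norm_nonneg _).trans hB
  have hb : ∀ i, |b p.1 p.2 i| ≤ B := fun i => (PiLp.norm_apply_le _ i).trans hB
  have h1 : |∑ i : Fin 3, dx V i p * dx φ i p| ≤ 3 * (K * L) := by
    refine (Finset.abs_sum_le_sum_abs _ _).trans ?_
    refine (Finset.sum_le_sum (g := fun _ => (K * L : ℝ)) fun i _ => ?_).trans (by simp)
    rw [abs_mul]
    exact mul_le_mul (dx_bound hV i p) (dx_bound hφ i p) (abs_nonneg _) K.2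
  have h2 : |∑ i : Fin 3, b p.1 p.2 i * dx V i p| ≤ 3 * (B * K) := by
    refine (Finset.abs_sum_le_sum_abs _ _).trans ?_
    refine (Finset.sum_le_sum (g := fun _ => (B * K : ℝ)) fun i _ => ?_).trans (by simp)
    rw [abs_mul]
    exact mul_le_mul (hb i) (dx_bound hV i p) (abs_nonneg _) hB0
  unfold weakF
  refine (abs_add_le _ _).trans (add_le_add ((abs_add_le _ _).trans (add_le_add ?_ h1)) ?_)
  · rw [abs_mul]; exact mul_le_mul (dt_bound hV p) hM (abs_nonneg _) K.2
  · rw [abs_mul]; exact mul_le_mul h2 hM (abs_nonneg _) (by positivity)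

/-- The weak formulation holds for compactly supported Lipschitz test functions. -/
lemma WSol.lipschitz_test {V : SpT → ℝ} {b : ℝ → E3 → E3} {K : ℝ≥0} (h : WSol V b K) {φ : SpT → ℝ}
    {L : ℝ≥0} (hφ : LipschitzWith L φ) (hc : HasCompactSupport φ) (hs : tsupport φ ⊆ Om) :
    ∫ p, weakF V b φ p = 0 := by
  obtain ⟨δ, hδ, hδs⟩ := hc.exists_cthickening_subset_open isOpen_Om hs
  set S := cthickening δ (tsupport φ) with hSdef
  have hScpt : IsCompact S := hc.cthickening
  have hbS : ContinuousOn (fun p : SpT => b p.1 p.2) S := h.cont.mono (hδs.trans Om_subset_Qlt)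
  obtain ⟨B, hB⟩ := hScpt.exists_bound_of_continuousOn hbS
  obtain ⟨M, hM⟩ := hc.exists_bound_of_continuous hφ.continuous
  have hsupp : ∀ n : ℕ, 1 / ((n : ℝ) + 1) ≤ δ → ∀ p ∉ S, mol volume n φ =ᶠ[𝓝 p] 0 := by
    intro n hn p hp
    have hopen : IsOpen Sᶜ := isClosed_cthickening.isOpen_compl
    filter_upwards [hopen.mem_nhds hp] with q hq
    refine mol_eq_zero n fun y hy => ?_
    by_contra hy0
    apply hq
    refine mem_cthickening_of_dist_le q y δ _ (subset_tsupport _ hy0) ?_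
    rw [dist_comm]; exact (mem_ball.1 hy).le.trans hn
  have hts : ∀ n : ℕ, 1 / ((n : ℝ) + 1) ≤ δ → tsupport (mol volume n φ) ⊆ S := by
    intro n hn p hp
    by_contra hpS
    exact (notMem_tsupport_iff_eventuallyEq.2 (hsupp n hn p hpS)) hp
  have hev : ∀ᶠ n : ℕ in atTop, 1 / ((n : ℝ) + 1) ≤ δ :=
    (tendsto_one_div_add_atTop_nhds_zero_nat.eventually (ge_mem_nhds hδ))
  have hlim : Tendsto (fun n : ℕ => ∫ p in S, weakF V b (mol volume n φ) p) atTop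
      (𝓝 (∫ p in S, weakF V b φ p)) := by
    refine tendsto_integral_of_dominated_convergence
      (fun _ => K * M + 3 * (K * L) + 3 * (B * K) * M) (fun n => ?_) ?_ (fun n => ?_) ?_
    · exact weakF_aesm (mol_lip n hφ).continuous hScpt.measurableSet hbS
    · exact integrableOn_const hScpt.measure_lt_top.ne
    · filter_upwards [ae_restrict_mem hScpt.measurableSet] with p hp
      exact weakF_bound h.lip (mol_lip n hφ) (mol_bumpbound n fun y _ => hM y) (hB p hp)
    · have hconv : ∀ i, ∀ᵐ p : SpT, Tendsto (fun n => dx (mol volume n φ) i p) atTop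
          (𝓝 (dx φ i p)) := by
        intro i
        filter_upwards [mol_tendsto_ae (Lip.locallyIntegrable_fderiv (μ := volume) hφ
          ((0, e3 i) : SpT))] with p hp
        simpa only [dx, mol_fderiv _ hφ] using hp
      refine ae_restrict_of_ae ?_
      filter_upwards [ae_all_iff.2 hconv] with p hp
      have h0 := mol_tendsto_of_lip (μ := volume) hφ p
      exact ((h0.const_mul _).add (tendsto_finsetSum _ fun i _ => (hp i).const_mul _)).add
        (h0.const_mul _)
  have hzero : ∀ᶠ n : ℕ in atTop, ∫ p in S, weakF V b (mol volume n φ) p = 0 := by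
    filter_upwards [hev] with n hn
    rw [setIntegral_eq_integral_of_forall_compl_eq_zero
      fun p hp => weakF_of_notMem fun hp' => hp (hts n hn hp')]
    rw [← integral_congr_ae (weakInt_ae_eq h.lip (mol_lip n hφ) b)]
    refine h.weak _ (mol_contDiff n hφ.continuous.locallyIntegrable)
      (HasCompactSupport.of_support_subset_isCompact hScpt
        ((subset_tsupport _).trans (hts n hn))) ?_
    rw [interior_Qlt_one]
    exact (hts n hn).trans hδs
  rw [← setIntegral_eq_integral_of_forall_compl_eq_zero (s := S)
    fun p hp => weakF_of_notMem fun hp' => hp (self_subset_cthickening _ hp')]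
  exact tendsto_nhds_unique (hlim.congr' hzero) tendsto_const_nhds |>.symm ▸ rfl

lemma LipschitzWith.mul_of_bound {α : Type*} [PseudoMetricSpace α] {f g : α → ℝ} {K L M N : ℝ≥0}
    (hf : LipschitzWith K f) (hg : LipschitzWith L g) (hM : ∀ x, |f x| ≤ M) (hN : ∀ x, |g x| ≤ N) :
    LipschitzWith (M * L + K * N) (fun x => f x * g x) := by
  refine LipschitzWith.of_dist_le_mul fun x y => ?_
  have h1 := hf.dist_le_mul x y
  have h2 := hg.dist_le_mul x y
  rw [Real.dist_eq] at *
  have : f x * g x - f y * g y = f x * (g x - g y) + (f x - f y) * g y := by ring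
  rw [this]
  refine (abs_add_le _ _).trans ?_
  rw [abs_mul, abs_mul]
  push_cast
  have h3 : |f x| * |g x - g y| ≤ M * (L * dist x y) :=
    mul_le_mul (hM x) h2 (abs_nonneg _) M.2
  have h4 : |f x - f y| * |g y| ≤ K * dist x y * N :=
    mul_le_mul h1 (hN y) (abs_nonneg _) (by positivity)
  nlinarith

lemma WSol.integrableOn {V : SpT → ℝ} {b : ℝ → E3 → E3} {K : ℝ≥0} (h : WSol V b K) {φ : SpT → ℝ}
    {L : ℝ≥0} (hφ : LipschitzWith L φ) {M : ℝ} (hM : ∀ p, |φ p| ≤ M) {r : ℝ} (hr : r < 2) :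
    IntegrableOn (weakF V b φ) (Icc (-1 : ℝ) 0 ×ˢ closedBall (0 : E3) r) := by
  set S := Icc (-1 : ℝ) 0 ×ˢ closedBall (0 : E3) r
  have hS : IsCompact S := isCompact_Icc.prod (isCompact_closedBall _ _)
  have hb : ContinuousOn (fun p : SpT => b p.1 p.2) S := by
    refine h.cont.mono (prod_mono ?_ ?_)
    · simp
    · simpa using closedBall_subset_ball hr
  obtain ⟨B, hB⟩ := hS.exists_bound_of_continuousOn hb
  refine IntegrableOn.of_bound hS.measure_lt_top (weakF_aesm hφ.continuous hS.measurableSet hb)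
    (K * M + 3 * (K * L) + 3 * (B * K) * M) ?_
  filter_upwards [ae_restrict_mem hS.measurableSet] with p hp
  exact weakF_bound h.lip hφ (hM p) (hB p hp)

lemma weakF_eq_zero {V φ : SpT → ℝ} {b : ℝ → E3 → E3} {r : ℝ}
    (h0 : ∀ t x, r ≤ ‖x‖ → φ (t, x) = 0) {p : SpT} (hp : r < ‖p.2‖) : weakF V b φ p = 0 := by
  apply weakF_of_notMem
  rw [notMem_tsupport_iff_eventuallyEq]
  have : IsOpen {p : SpT | r < ‖p.2‖} := isOpen_lt continuous_const (by fun_prop)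
  filter_upwards [this.mem_nhds hp] with q hq
  exact h0 q.1 q.2 (le_of_lt hq)

lemma WSol.slice {V : SpT → ℝ} {b : ℝ → E3 → E3} {K : ℝ≥0} (h : WSol V b K) {φ : SpT → ℝ}
    {L : ℝ≥0} (hφ : LipschitzWith L φ) {M : ℝ≥0} (hM : ∀ p, |φ p| ≤ M) {r : ℝ} (hr : r < 2)
    (h0 : ∀ t x, r ≤ ‖x‖ → φ (t, x) = 0) :
    ∀ᵐ t : ℝ, t ∈ Ioo (-1 : ℝ) 0 → ∫ x, weakF V b φ (t, x) = 0 := by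
  have hintg := h.integrableOn hφ hM hr
  have hslice : ∀ t, ∫ x in closedBall (0 : E3) r, weakF V b φ (t, x)
      = ∫ x, weakF V b φ (t, x) := fun t => by
    refine setIntegral_eq_integral_of_forall_compl_eq_zero fun x hx => weakF_eq_zero h0 ?_
    simpa using hx
  have hloc : IntegrableOn (fun t => ∫ x, weakF V b φ (t, x)) (Icc (-1 : ℝ) 0) := by
    rw [IntegrableOn, Measure.volume_eq_prod, ← Measure.prod_restrict] at hintg
    have h2 := hintg.integral_prod_left
    simp only [hslice] at h2
    exact h2
  refine isOpen_Ioo.ae_eq_zero_of_integral_contDiff_smul_eq_zero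
    (hloc.mono_set Ioo_subset_Icc_self).locallyIntegrableOn fun θ hθ hθc hθs => ?_
  obtain ⟨Lθ, hLθ⟩ := ContDiff.lipschitzWith_of_hasCompactSupport (𝕂 := ℝ) hθc hθ (by simp)
  obtain ⟨Mθ, hMθ⟩ := hθc.exists_bound_of_continuous hθ.continuous
  have hMθ' : ∀ t, |θ t| ≤ Mθ.toNNReal := fun t => (hMθ t).trans (Real.le_coe_toNNReal _)
  have hθ1 : LipschitzWith (Lθ * 1) (fun p : SpT => θ p.1) := hLθ.comp LipschitzWith.prod_fst
  have hprod := hθ1.mul_of_bound hφ (fun p => hMθ' p.1) hM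
  set Φ : SpT → ℝ := fun p => θ p.1 * φ p
  have hsub : tsupport Φ ⊆ tsupport θ ×ˢ closedBall (0 : E3) r := by
    refine closure_minimal (fun p hp => ⟨?_, ?_⟩)
      ((isClosed_tsupport θ).prod isClosed_closedBall)
    · refine subset_tsupport _ fun h => hp ?_
      simp [Φ, h]
    · by_contra hx
      refine hp ?_
      have : r ≤ ‖p.2‖ := by
        simp only [mem_closedBall, dist_zero_right, not_le] at hx; exact hx.le
      simp [Φ, h0 p.1 p.2 this]
  have hcpt : HasCompactSupport Φ :=
    HasCompactSupport.of_support_subset_isCompact (hθc.isCompact.prod (isCompact_closedBall _ _))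
      ((subset_tsupport _).trans hsub)
  have hOm : tsupport Φ ⊆ Om :=
    hsub.trans (prod_mono hθs (closedBall_subset_ball hr))
  have hz := h.lipschitz_test hprod hcpt hOm
  have hae : weakF V b Φ =ᵐ[volume] fun p => θ p.1 * weakF V b φ p := by
    filter_upwards [hφ.ae_differentiableAt] with p hp
    have hθp : HasFDerivAt (fun p : SpT => θ p.1) ((fderiv ℝ θ p.1).comp
        (ContinuousLinearMap.fst ℝ ℝ E3)) p :=
      ((hθ.differentiable (by simp)).differentiableAt.hasFDerivAt).comp p hasFDerivAt_fst
    have hd : ∀ i, dx Φ i p = θ p.1 * dx φ i p := fun i => by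
      have h3 : fderiv ℝ Φ p = _ := (hθp.mul hp.hasFDerivAt).fderiv
      simp [dx, h3]
    have h4 : ∑ i, dx V i p * (θ p.1 * dx φ i p) = θ p.1 * ∑ i, dx V i p * dx φ i p := by
      rw [Finset.mul_sum]; exact Finset.sum_congr rfl fun i _ => by ring
    simp only [weakF, hd, h4, Φ]
    ring
  rw [integral_congr_ae hae] at hz
  have hint2 : Integrable (fun p : SpT => θ p.1 * weakF V b φ p) := by
    have h1 : IntegrableOn (fun p : SpT => θ p.1 * weakF V b φ p)
        (Icc (-1 : ℝ) 0 ×ˢ closedBall (0 : E3) r) :=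
      hintg.bdd_mul (hθ1.continuous.aestronglyMeasurable) (Eventually.of_forall fun p => hMθ p.1)
    refine (integrableOn_iff_integrable_of_support_subset ?_).1 h1
    intro p hp
    refine ⟨?_, ?_⟩
    · apply Ioo_subset_Icc_self
      exact hθs (subset_tsupport _ fun h => hp (by simp [h]))
    · by_contra hx
      exact hp (by simp [weakF_eq_zero (V := V) (b := b) h0 (p := p) (by simpa using hx)])
  rw [Measure.volume_eq_prod] at hz hint2
  rw [integral_prod _ hint2] at hz
  simpa only [smul_eq_mul, ← integral_const_mul] using hz

lemma ae_ae_differentiableAt {V : SpT → ℝ} {K : ℝ≥0} (hV : LipschitzWith K V) :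
    ∀ᵐ t : ℝ, ∀ᵐ x : E3, DifferentiableAt ℝ V (t, x) := by
  have := hV.ae_differentiableAt (μ := (volume : Measure SpT))
  rw [Measure.volume_eq_prod] at this
  exact Measure.ae_ae_of_ae_prod this

lemma lipschitz_slice {V : SpT → ℝ} {K : ℝ≥0} (hV : LipschitzWith K V) (t : ℝ) :
    LipschitzWith K (fun x => V (t, x)) := by
  have := hV.comp (LipschitzWith.prodMk_left t : LipschitzWith 1 (Prod.mk t : E3 → SpT))
  rwa [mul_one] at this

lemma lipschitz_tslice {V : SpT → ℝ} {K : ℝ≥0} (hV : LipschitzWith K V) (x : E3) :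
    LipschitzWith K (fun t => V (t, x)) := by
  have := hV.comp (LipschitzWith.prodMk_right x : LipschitzWith 1 (fun t : ℝ => ((t, x) : SpT)))
  rwa [mul_one] at this

/-- The derivative of `f` in the direction `w`. -/
def dd (w : SpT) (f : SpT → ℝ) (p : SpT) : ℝ := fderiv ℝ f p w

lemma dt_eq_dd (f : SpT → ℝ) : dt f = dd (1, 0) f := rfl

lemma dx_eq_dd (f : SpT → ℝ) (i : Fin 3) : dx f i = dd (0, e3 i) f := rfl

section dd
variable {w w' : SpT} {f g : SpT → ℝ}

lemma dd_contDiff (hf : ContDiff ℝ (⊤ : ℕ∞) f) : ContDiff ℝ (⊤ : ℕ∞) (dd w f) :=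
  (hf.fderiv_right (m := (⊤ : ℕ∞)) (by simp)).clm_apply contDiff_const

lemma smooth_diff (hf : ContDiff ℝ (⊤ : ℕ∞) f) : Differentiable ℝ f :=
  hf.differentiable (by simp)

lemma dd_hasCompactSupport (hf : HasCompactSupport f) : HasCompactSupport (dd w f) :=
  hf.fderiv_apply ℝ w

lemma dd_comm (hf : ContDiff ℝ (⊤ : ℕ∞) f) (p : SpT) : dd w (dd w' f) p = dd w' (dd w f) p := by
  have hd : Differentiable ℝ (fderiv ℝ f) :=
    (hf.fderiv_right (m := (⊤ : ℕ∞)) (by simp)).differentiable (by simp)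
  have key : ∀ w w' : SpT, dd w (dd w' f) p = fderiv ℝ (fderiv ℝ f) p w w' := by
    intro w w'
    have : HasFDerivAt (fun q => fderiv ℝ f q w') _ p :=
      (hd p).hasFDerivAt.clm_apply (hasFDerivAt_const w' p)
    unfold dd
    rw [this.fderiv]; simp
  rw [key, key]
  have hs : IsSymmSndFDerivAt ℝ f p := hf.contDiffAt.isSymmSndFDerivAt (by simp; exact WithTop.coe_le_coe.2 le_top)
  exact hs w w'

lemma dd_add (hf : Differentiable ℝ f) (hg : Differentiable ℝ g) :
    dd w (fun p => f p + g p) = fun p => dd w f p + dd w g p := by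
  ext p; simp [dd, fderiv_fun_add (hf p) (hg p)]

lemma dd_sub (hf : Differentiable ℝ f) (hg : Differentiable ℝ g) :
    dd w (fun p => f p - g p) = fun p => dd w f p - dd w g p := by
  ext p; simp [dd, fderiv_fun_sub (hf p) (hg p)]

lemma dd_mul (hf : Differentiable ℝ f) (hg : Differentiable ℝ g) :
    dd w (fun p => f p * g p) = fun p => f p * dd w g p + g p * dd w f p := by
  ext p; simp [dd, fderiv_fun_mul (hf p) (hg p)]

lemma dd_const (c : ℝ) : dd w (fun _ => c) = fun _ => 0 := by
  ext p; simp [dd]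

lemma dd_exp (hf : Differentiable ℝ f) :
    dd w (fun p => exp (f p)) = fun p => exp (f p) * dd w f p := by
  ext p
  have : HasFDerivAt (fun p => exp (f p)) _ p := (hf p).hasFDerivAt.exp
  simp [dd, this.fderiv]

lemma integral_dd_eq_zero (hf : ContDiff ℝ (⊤ : ℕ∞) f) (hc : HasCompactSupport f) :
    ∫ p, dd w f p = 0 := by
  have h1 : Integrable (dd w f) :=
    (dd_contDiff hf).continuous.integrable_of_hasCompactSupport (dd_hasCompactSupport hc)
  have h2 : Integrable f := hf.continuous.integrable_of_hasCompactSupport hc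
  have := integral_mul_fderiv_eq_neg_fderiv_mul_of_integrable (𝕜 := ℝ) (μ := (volume : Measure SpT))
    (f := fun _ : SpT => (1 : ℝ)) (g := f) (v := w) (by simp) (by simp only [one_mul]; exact h1)
    (by simpa using h2) (fun _ _ => by fun_prop) (fun _ _ => smooth_diff hf _)
  simpa [dd] using this

end dd

/-- A weight with affine derivatives. -/
structure QWeight (ψ : SpT → ℝ) (G : Fin 3 → SpT → ℝ) (T : SpT → ℝ) (A : Fin 3 → Fin 3 → ℝ)
    (κ : ℝ) : Prop where
  smooth : ContDiff ℝ (⊤ : ℕ∞) ψ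
  smoothG : ∀ i, ContDiff ℝ (⊤ : ℕ∞) (G i)
  smoothT : ContDiff ℝ (⊤ : ℕ∞) T
  dxψ : ∀ i, dd (0, e3 i) ψ = G i
  dtψ : dd (1, 0) ψ = T
  dxG : ∀ i j, dd (0, e3 j) (G i) = fun _ => A i j
  dtG : ∀ i, dd (1, 0) (G i) = fun _ => 0
  dxT : ∀ i, dd (0, e3 i) T = fun _ => 0
  dtT : dd (1, 0) T = fun _ => -2 * κ
  symm : ∀ i j, A i j = A j i

section Carleman
variable {ψ : SpT → ℝ} {G : Fin 3 → SpT → ℝ} {T : SpT → ℝ} {A : Fin 3 → Fin 3 → ℝ} {κ : ℝ}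
  {v : SpT → ℝ}

/-- The zeroth order coefficient of the symmetric part of the conjugated operator. -/
def wpot (G : Fin 3 → SpT → ℝ) (T : SpT → ℝ) (s : ℝ) (p : SpT) : ℝ :=
  s ^ 2 * ∑ i, G i p ^ 2 + s * T p

/-- The symmetric part of the conjugated heat operator. -/
def symP (G : Fin 3 → SpT → ℝ) (T : SpT → ℝ) (s : ℝ) (v : SpT → ℝ) (p : SpT) : ℝ :=
  -(∑ i, dd (0, e3 i) (dd (0, e3 i) v) p) - wpot G T s p * v p

/-- The antisymmetric part of the conjugated heat operator. -/
def asymP (G : Fin 3 → SpT → ℝ) (A : Fin 3 → Fin 3 → ℝ) (s : ℝ) (v : SpT → ℝ) (p : SpT) : ℝ :=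
  dd (1, 0) v p + 2 * s * (∑ i, G i p * dd (0, e3 i) v p) + s * (∑ i, A i i) * v p

lemma QWeight.wpot_smooth (h : QWeight ψ G T A κ) (s : ℝ) : ContDiff ℝ (⊤ : ℕ∞) (wpot G T s) := by
  have h1 := h.smoothG; have h2 := h.smoothT
  unfold wpot
  fun_prop

lemma QWeight.dt_wpot (h : QWeight ψ G T A κ) (s : ℝ) (p : SpT) :
    dd (1, 0) (wpot G T s) p = -2 * κ * s := by
  have h1 : ∀ i, Differentiable ℝ (G i) := fun i => smooth_diff (h.smoothG i)
  have h2 := smooth_diff h.smoothT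
  have : wpot G T s = fun p => s ^ 2 * (G 0 p * G 0 p) + s ^ 2 * (G 1 p * G 1 p) +
      s ^ 2 * (G 2 p * G 2 p) + s * T p := by
    ext p; simp only [wpot, Fin.sum_univ_three]; ring
  rw [this]
  simp (disch := fun_prop) only [dd_add, dd_mul, dd_const, h.dtG, h.dtT]
  ring

lemma QWeight.dx_wpot (h : QWeight ψ G T A κ) (s : ℝ) (j : Fin 3) (p : SpT) :
    dd (0, e3 j) (wpot G T s) p = 2 * s ^ 2 * ∑ i, A i j * G i p := by
  have h1 : ∀ i, Differentiable ℝ (G i) := fun i => smooth_diff (h.smoothG i)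
  have h2 := smooth_diff h.smoothT
  have : wpot G T s = fun p => s ^ 2 * (G 0 p * G 0 p) + s ^ 2 * (G 1 p * G 1 p) +
      s ^ 2 * (G 2 p * G 2 p) + s * T p := by
    ext p; simp only [wpot, Fin.sum_univ_three]; ring
  rw [this]
  simp (disch := fun_prop) only [dd_add, dd_mul, dd_const, h.dxG, h.dxT, Fin.sum_univ_three]
  ring

lemma QWeight.commutator (h : QWeight ψ G T A κ) (s : ℝ) (hv : ContDiff ℝ (⊤ : ℕ∞) v)
    (hc : HasCompactSupport v) :
    ∫ p, (2 * (symP G T s v p * asymP G A s v p) - (4 * s * (∑ i, ∑ j, A i j *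
        dd (0, e3 i) v p * dd (0, e3 j) v p) + 4 * s ^ 3 * (∑ i, ∑ j, A i j * G i p * G j p) *
        v p ^ 2 - 2 * κ * s * v p ^ 2)) = 0 := by
  set d : Fin 3 → SpT → ℝ := fun i => dd (0, e3 i) v with hd
  set τ : SpT → ℝ := dd (1, 0) v with hτ
  set a := wpot G T s with ha
  have sa : ContDiff ℝ (⊤ : ℕ∞) a := h.wpot_smooth s
  have sd : ∀ i, ContDiff ℝ (⊤ : ℕ∞) (d i) := fun i => dd_contDiff hv
  have sτ : ContDiff ℝ (⊤ : ℕ∞) τ := dd_contDiff hv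
  have sG := h.smoothG
  have cd : ∀ i, HasCompactSupport (d i) := fun i => dd_hasCompactSupport hc
  set trA : ℝ := A 0 0 + A 1 1 + A 2 2 with htr
  let F : Fin 3 → SpT → ℝ := fun i p => d i p * (-2 * τ p - 4 * s * (G 0 p * d 0 p + G 1 p * d 1 p +
    G 2 p * d 2 p) - 2 * s * trA * v p) + v p * ((-2 * s) * (a p * (G i p * v p))) +
    2 * s * (G i p * (d 0 p * d 0 p)) + 2 * s * (G i p * (d 1 p * d 1 p)) +
    2 * s * (G i p * (d 2 p * d 2 p))
  let Ft : SpT → ℝ := fun p => d 0 p * d 0 p + d 1 p * d 1 p + d 2 p * d 2 p - v p * (a p * v p)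
  have sF : ∀ i, ContDiff ℝ (⊤ : ℕ∞) (F i) := fun i => by
    have := sd i; have := sG i; simp only [F]; fun_prop
  have sFt : ContDiff ℝ (⊤ : ℕ∞) Ft := by simp only [Ft]; fun_prop
  have cF : ∀ i, HasCompactSupport (F i) := fun i => by
    refine ((((cd i).mul_right).add hc.mul_right).add ?_).add ?_ |>.add ?_ <;>
      exact (((cd _).mul_right).mul_left).mul_left
  have cFt : HasCompactSupport Ft := by
    have e1 := (((cd 0).mul_right (f' := d 0)).add ((cd 1).mul_right (f' := d 1))).add
      ((cd 2).mul_right (f' := d 2))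
    exact e1.sub hc.mul_right
  have z : ∀ i, ∫ p, dd (0, e3 i) (F i) p = 0 := fun i => integral_dd_eq_zero (sF i) (cF i)
  have zt : ∫ p, dd (1, 0) Ft p = 0 := integral_dd_eq_zero sFt cFt
  have int : ∀ i, Integrable (dd (0, e3 i) (F i)) := fun i =>
    (dd_contDiff (sF i)).continuous.integrable_of_hasCompactSupport (dd_hasCompactSupport (cF i))
  have intt : Integrable (dd (1, 0) Ft) :=
    (dd_contDiff sFt).continuous.integrable_of_hasCompactSupport (dd_hasCompactSupport cFt)
  have hsum : ∫ p, (dd (0, e3 0) (F 0) p + dd (0, e3 1) (F 1) p + dd (0, e3 2) (F 2) p +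
      dd (1, 0) Ft p) = 0 := by
    have e1 := integral_add ((int 0).add (int 1) |>.add (int 2)) intt
    have e2 := integral_add ((int 0).add (int 1)) (int 2)
    have e3 := integral_add (int 0) (int 1)
    simp only [Pi.add_apply] at e1 e2 e3
    rw [e1, e2, e3, z, z, z, zt]; simp
  refine Eq.trans ?_ hsum
  congr 1
  ext p
  have h1 : ∀ i, Differentiable ℝ (G i) := fun i => smooth_diff (h.smoothG i)
  have h2 : ∀ i, Differentiable ℝ (d i) := fun i => smooth_diff (sd i)
  have h3 := smooth_diff sτ
  have h4 := smooth_diff sa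
  have h5 := smooth_diff hv
  have hax : ∀ i, dd (0, e3 i) a p = 2 * s ^ 2 * ∑ k, A k i * G k p := fun i => h.dx_wpot s i p
  have hat : dd (1, 0) a p = -2 * κ * s := h.dt_wpot s p
  have c1 : ∀ i j, dd (0, e3 i) (d j) p = dd (0, e3 j) (d i) p := fun i j => dd_comm hv p
  have c2 : ∀ i, dd (0, e3 i) τ p = dd (1, 0) (d i) p := fun i => dd_comm hv p
  have c3 : ∀ i, dd (0, e3 i) v = d i := fun i => rfl
  simp (disch := fun_prop) only [F, Ft, dd_add, dd_sub, dd_mul, dd_const, h.dxG]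
  simp only [symP, asymP, ← ha, c3, ← hτ, hax, hat, c2, Fin.sum_univ_three, c1 1 0, c1 2 0, c1 2 1,
    h.symm 1 0, h.symm 2 0, h.symm 2 1, htr]
  ring

lemma symP_energy (s : ℝ) (hv : ContDiff ℝ (⊤ : ℕ∞) v)
    (hc : HasCompactSupport v) :
    ∫ p, ((∑ i, dd (0, e3 i) v p ^ 2) - symP G T s v p * v p - wpot G T s p * v p ^ 2) = 0 := by
  have hz : ∀ i, ∫ p, dd (0, e3 i) (fun q => v q * dd (0, e3 i) v q) p = 0 := fun i =>
    integral_dd_eq_zero (hv.mul (dd_contDiff hv)) hc.mul_right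
  have int : ∀ i, Integrable (dd (0, e3 i) (fun q => v q * dd (0, e3 i) v q)) := fun i =>
    (dd_contDiff (hv.mul (dd_contDiff hv))).continuous.integrable_of_hasCompactSupport
      (dd_hasCompactSupport hc.mul_right)
  have hsum : ∫ p, ∑ i, dd (0, e3 i) (fun q => v q * dd (0, e3 i) v q) p = 0 := by
    rw [integral_finsetSum _ fun i _ => int i]; simp [hz]
  refine Eq.trans ?_ hsum
  congr 1
  ext p
  have h1 : ∀ i, Differentiable ℝ (dd (0, e3 i) v) := fun i => smooth_diff (dd_contDiff hv)
  have h5 := smooth_diff hv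
  simp (disch := fun_prop) only [dd_mul]
  simp only [symP, Fin.sum_univ_three]
  ring

end Carleman

lemma dd_of_notMem {w : SpT} {f : SpT → ℝ} {p : SpT} (hp : p ∉ tsupport f) : dd w f p = 0 :=
  image_eq_zero_of_notMem_tsupport fun h => hp (tsupport_fderiv_apply_subset ℝ w h)

lemma tsupport_dd_subset (w : SpT) (f : SpT → ℝ) : tsupport (dd w f) ⊆ tsupport f :=
  tsupport_fderiv_apply_subset ℝ w

lemma integrable_of_zero_off {f g : SpT → ℝ} (hf : Continuous f) (hg : HasCompactSupport g)
    (h : ∀ p, p ∉ tsupport g → f p = 0) : Integrable f :=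
  hf.integrable_of_hasCompactSupport (HasCompactSupport.intro hg h)

/-- The heat operator. -/
def heatP (u : SpT → ℝ) (p : SpT) : ℝ :=
  dd (1, 0) u p - ∑ i, dd (0, e3 i) (dd (0, e3 i) u) p

lemma heatP_contDiff {u : SpT → ℝ} (hu : ContDiff ℝ (⊤ : ℕ∞) u) :
    ContDiff ℝ (⊤ : ℕ∞) (heatP u) := by
  have h1 : ContDiff ℝ (⊤ : ℕ∞) (dd (1, 0) u) := dd_contDiff hu
  have h2 : ∀ i, ContDiff ℝ (⊤ : ℕ∞) (dd (0, e3 i) (dd (0, e3 i) u)) :=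
    fun i => dd_contDiff (dd_contDiff hu)
  exact h1.sub (ContDiff.sum fun i _ => h2 i)

section Carleman
variable {ψ : SpT → ℝ} {G : Fin 3 → SpT → ℝ} {T : SpT → ℝ} {A : Fin 3 → Fin 3 → ℝ} {κ : ℝ}

lemma QWeight.carleman_conj (h : QWeight ψ G T A κ) {c₀ T₀ s : ℝ} (hs : 1 ≤ s) (hκ : 0 ≤ κ)
    (hsc : 5 * T₀ + 25 / 4 + 2 * κ ≤ s * (c₀ / 2))
    (hA : ∀ ξ : Fin 3 → ℝ, -(∑ i, ξ i ^ 2) ≤ ∑ i, ∑ j, A i j * ξ i * ξ j)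
    {v : SpT → ℝ} (hv : ContDiff ℝ (⊤ : ℕ∞) v) (hc : HasCompactSupport v)
    (hG : ∀ p ∈ tsupport v, c₀ ≤ 4 * (∑ i, ∑ j, A i j * G i p * G j p) - 5 * ∑ i, G i p ^ 2)
    (hT : ∀ p ∈ tsupport v, T p ≤ T₀) :
    ∫ p, (s * (∑ i, dd (0, e3 i) v p ^ 2) + c₀ / 2 * s ^ 3 * v p ^ 2) ≤
      ∫ p, (symP G T s v p + asymP G A s v p) ^ 2 := by
  have hcomm := h.commutator s hv hc
  have hen := symP_energy (G := G) (T := T) s hv hc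
  have sG := fun i => (h.smoothG i).continuous
  have sT := h.smoothT.continuous
  have sv := hv.continuous
  have s1 : ∀ w, Continuous (dd w v) := fun w => (dd_contDiff hv).continuous
  have s2 : ∀ i, Continuous (dd (0, e3 i) (dd (0, e3 i) v)) := fun i =>
    (dd_contDiff (dd_contDiff hv)).continuous
  have z0 : ∀ p, p ∉ tsupport v → v p = 0 := fun p hp => image_eq_zero_of_notMem_tsupport hp
  have z1 : ∀ p, p ∉ tsupport v → ∀ w, dd w v p = 0 := fun p hp w => dd_of_notMem hp
  have z2 : ∀ p, p ∉ tsupport v → ∀ i, dd (0, e3 i) (dd (0, e3 i) v) p = 0 := fun p hp i =>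
    dd_of_notMem fun h' => hp (tsupport_dd_subset _ _ h')
  have sS : Continuous (symP G T s v) := by unfold symP wpot; fun_prop
  have sA : Continuous (asymP G A s v) := by unfold asymP; fun_prop
  have sw : Continuous (wpot G T s) := by unfold wpot; fun_prop
  have zS : ∀ p, p ∉ tsupport v → symP G T s v p = 0 := fun p hp => by
    simp [symP, z0 p hp, z2 p hp]
  have zA : ∀ p, p ∉ tsupport v → asymP G A s v p = 0 := fun p hp => by
    simp [asymP, z0 p hp, z1 p hp]
  have i1 : Integrable fun p => (2 * (symP G T s v p * asymP G A s v p) -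
      (4 * s * (∑ i, ∑ j, A i j * dd (0, e3 i) v p * dd (0, e3 j) v p) +
        4 * s ^ 3 * (∑ i, ∑ j, A i j * G i p * G j p) * v p ^ 2 - 2 * κ * s * v p ^ 2)) :=
    integrable_of_zero_off (by fun_prop) hc fun p hp => by simp [zS p hp, z0 p hp, z1 p hp]
  have i2 : Integrable fun p => ((∑ i, dd (0, e3 i) v p ^ 2) - symP G T s v p * v p -
      wpot G T s p * v p ^ 2) :=
    integrable_of_zero_off (by fun_prop) hc fun p hp => by simp [zS p hp, z0 p hp, z1 p hp]
  have i3 : Integrable fun p => (s * (∑ i, dd (0, e3 i) v p ^ 2) + c₀ / 2 * s ^ 3 * v p ^ 2) :=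
    integrable_of_zero_off (by fun_prop) hc fun p hp => by simp [z0 p hp, z1 p hp]
  have i4 : Integrable fun p => (symP G T s v p + asymP G A s v p) ^ 2 :=
    integrable_of_zero_off (by fun_prop) hc fun p hp => by simp [zS p hp, zA p hp]
  have key : ∫ p, ((2 * (symP G T s v p * asymP G A s v p) -
      (4 * s * (∑ i, ∑ j, A i j * dd (0, e3 i) v p * dd (0, e3 j) v p) +
        4 * s ^ 3 * (∑ i, ∑ j, A i j * G i p * G j p) * v p ^ 2 - 2 * κ * s * v p ^ 2)) -
      5 * s * ((∑ i, dd (0, e3 i) v p ^ 2) - symP G T s v p * v p - wpot G T s p * v p ^ 2)) ≤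
      ∫ p, ((symP G T s v p + asymP G A s v p) ^ 2 -
        (s * (∑ i, dd (0, e3 i) v p ^ 2) + c₀ / 2 * s ^ 3 * v p ^ 2)) := by
    refine integral_mono (i1.sub (i2.const_mul _)) (i4.sub i3) fun p => ?_
    simp only
    by_cases hp : p ∈ tsupport v
    · have a1 := hA fun i => dd (0, e3 i) v p
      have a2 := hG p hp
      have a3 := hT p hp
      simp only [wpot]
      set D := ∑ i, dd (0, e3 i) v p ^ 2
      set AD := ∑ i, ∑ j, A i j * dd (0, e3 i) v p * dd (0, e3 j) v p
      set AG := ∑ i, ∑ j, A i j * G i p * G j p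
      set GG := ∑ i, G i p ^ 2
      set S := symP G T s v p
      set B := asymP G A s v p
      set x := v p
      have e1 : 0 ≤ 4 * s * (AD + D) := by have : 0 ≤ AD + D := by linarith
                                           positivity
      have e2 : 0 ≤ s ^ 3 * x ^ 2 * (4 * AG - 5 * GG - c₀) :=
        mul_nonneg (by positivity) (by linarith)
      have e3' : 0 ≤ 5 * s ^ 2 * x ^ 2 * (T₀ - T p) := mul_nonneg (by positivity) (by linarith)
      have e4 : 0 ≤ s ^ 2 * x ^ 2 * (s * (c₀ / 2) - (5 * T₀ + 25 / 4 + 2 * κ)) :=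
        mul_nonneg (by positivity) (by linarith)
      have e5 : 0 ≤ 2 * κ * x ^ 2 * (s ^ 2 - s) :=
        mul_nonneg (by positivity) (by nlinarith)
      nlinarith [sq_nonneg (S - 5 / 2 * s * x), sq_nonneg B]
    · simp [zS p hp, zA p hp, z0 p hp, z1 p hp]
  rw [integral_sub i1 (i2.const_mul _), integral_sub i4 i3, integral_const_mul, hcomm, hen] at key
  linarith

lemma QWeight.conj_eq (h : QWeight ψ G T A κ) (s : ℝ) {u : SpT → ℝ}
    (hu : ContDiff ℝ (⊤ : ℕ∞) u) (p : SpT) :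
    symP G T s (fun q => exp (s * ψ q) * u q) p + asymP G A s (fun q => exp (s * ψ q) * u q) p =
      exp (s * ψ p) * heatP u p := by
  have d1 := smooth_diff hu
  have d2 := smooth_diff h.smooth
  have d3 := fun i => smooth_diff (h.smoothG i)
  have d4 : ∀ w, Differentiable ℝ (dd w u) := fun w => smooth_diff (dd_contDiff hu)
  have tr : ∀ i, A i i = A i i := fun _ => rfl
  simp (disch := fun_prop) only [symP, asymP, heatP, wpot, dd_mul, dd_exp, dd_const, dd_add, h.dxψ,
    h.dtψ, h.dxG, Fin.sum_univ_three]
  ring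

lemma QWeight.dd_conj (h : QWeight ψ G T A κ) (s : ℝ) {u : SpT → ℝ}
    (hu : ContDiff ℝ (⊤ : ℕ∞) u) (p : SpT) (i : Fin 3) :
    dd (0, e3 i) (fun q => exp (s * ψ q) * u q) p =
      exp (s * ψ p) * (dd (0, e3 i) u p + s * u p * G i p) := by
  have d1 := smooth_diff hu
  have d2 := smooth_diff h.smooth
  simp (disch := fun_prop) only [dd_mul, dd_exp, dd_const, h.dxψ]
  ring

/-- Carleman inequality for the heat operator and a quadratic weight. -/
lemma QWeight.carleman (h : QWeight ψ G T A κ) {c₀ T₀ G₀ s : ℝ} (hs : 1 ≤ s) (hκ : 0 ≤ κ)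
    (hc₀ : 0 < c₀) (hG₀ : 0 ≤ G₀)
    (hsc : 5 * T₀ + 25 / 4 + 2 * κ ≤ s * (c₀ / 2))
    (hA : ∀ ξ : Fin 3 → ℝ, -(∑ i, ξ i ^ 2) ≤ ∑ i, ∑ j, A i j * ξ i * ξ j)
    {u : SpT → ℝ} (hu : ContDiff ℝ (⊤ : ℕ∞) u) (hc : HasCompactSupport u)
    (hG : ∀ p ∈ tsupport u, c₀ ≤ 4 * (∑ i, ∑ j, A i j * G i p * G j p) - 5 * ∑ i, G i p ^ 2)
    (hT : ∀ p ∈ tsupport u, T p ≤ T₀) (hGb : ∀ p ∈ tsupport u, ∑ i, G i p ^ 2 ≤ G₀) :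
    ∫ p, exp (2 * s * ψ p) * (s * (∑ i, dd (0, e3 i) u p ^ 2) + s ^ 3 * u p ^ 2) ≤
      (2 + 2 * (2 * G₀ + 1) / c₀) * ∫ p, exp (2 * s * ψ p) * heatP u p ^ 2 := by
  set v : SpT → ℝ := fun q => exp (s * ψ q) * u q with hvdef
  have sψ := h.smooth
  have hv : ContDiff ℝ (⊤ : ℕ∞) v := by simp only [hvdef]; fun_prop
  have hcv : HasCompactSupport v := hc.mul_left
  have hsub : tsupport v ⊆ tsupport u := closure_mono fun p hp => by
    simp only [hvdef, Function.mem_support] at hp ⊢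
    exact right_ne_zero_of_mul hp
  have key := h.carleman_conj hs hκ hsc hA hv hcv (fun p hp => hG p (hsub hp))
    (fun p hp => hT p (hsub hp))
  have e2 : ∀ p, exp (2 * s * ψ p) = exp (s * ψ p) ^ 2 := fun p => by
    rw [← exp_nat_mul]; congr 1; push_cast; ring
  have e1 : ∫ p, exp (2 * s * ψ p) * heatP u p ^ 2 =
      ∫ p, (symP G T s v p + asymP G A s v p) ^ 2 := by
    congr 1; ext p
    rw [hvdef, h.conj_eq s hu p, e2]; ring
  rw [e1]
  refine le_trans ?_ (mul_le_mul_of_nonneg_left key (by positivity))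
  rw [← integral_const_mul]
  have s1 : ∀ w, Continuous (dd w v) := fun w => (dd_contDiff hv).continuous
  have s1' : ∀ w, Continuous (dd w u) := fun w => (dd_contDiff hu).continuous
  have s3 := hv.continuous
  have s3' := hu.continuous
  have s4 := sψ.continuous
  refine integral_mono (integrable_of_zero_off (by fun_prop) hc fun p hp => ?_)
    (integrable_of_zero_off (by fun_prop) hcv fun p hp => ?_) fun p => ?_
  · simp [dd_of_notMem hp, image_eq_zero_of_notMem_tsupport hp]
  · simp [dd_of_notMem hp, image_eq_zero_of_notMem_tsupport hp]
  simp only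
  by_cases hp : p ∈ tsupport u
  · have hd : ∀ i, dd (0, e3 i) v p =
        exp (s * ψ p) * (dd (0, e3 i) u p + s * u p * G i p) := fun i => h.dd_conj s hu p i
    have hg := hGb p hp
    simp only [hd, e2]
    simp only [hvdef]
    simp only [Fin.sum_univ_three] at hg ⊢
    set E := exp (s * ψ p)
    set x := u p
    set a0 := dd (0, e3 0) u p
    set a1 := dd (0, e3 1) u p
    set a2 := dd (0, e3 2) u p
    set g0 := G 0 p
    set g1 := G 1 p
    set g2 := G 2 p
    have c1 : (2 + 2 * (2 * G₀ + 1) / c₀) * (c₀ / 2) = c₀ + (2 * G₀ + 1) := by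
      field_simp
    have c2 : 0 ≤ 2 * (2 * G₀ + 1) / c₀ := by positivity
    set K := 2 * (2 * G₀ + 1) / c₀
    set D := (E * (a0 + s * x * g0)) ^ 2 + (E * (a1 + s * x * g1)) ^ 2 +
      (E * (a2 + s * x * g2)) ^ 2 with hD
    have hrw : (2 + K) * (s * D + c₀ / 2 * s ^ 3 * (E * x) ^ 2) =
        2 * s * D + K * (s * D) + (c₀ + (2 * G₀ + 1)) * (s ^ 3 * (E * x) ^ 2) := by
      rw [← c1]; ring
    rw [hrw]
    have q : ∀ a g : ℝ, E ^ 2 * a ^ 2 ≤ 2 * (E * (a + s * x * g)) ^ 2 +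
        2 * (s ^ 2 * (E * x) ^ 2 * g ^ 2) := fun a g => by
      nlinarith [sq_nonneg (E * (a + 2 * s * x * g))]
    have f1 : 0 ≤ K * (s * D) := by positivity
    have f2 : E ^ 2 * (a0 ^ 2 + a1 ^ 2 + a2 ^ 2) ≤ 2 * D + 2 * s ^ 2 * (E * x) ^ 2 * G₀ := by
      have := mul_le_mul_of_nonneg_left hg (show 0 ≤ 2 * s ^ 2 * (E * x) ^ 2 by positivity)
      nlinarith [q a0 g0, q a1 g1, q a2 g2]
    have f3 := mul_le_mul_of_nonneg_left f2 (show 0 ≤ s by linarith)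
    have f4 : 0 ≤ c₀ * (s ^ 3 * (E * x) ^ 2) := by positivity
    nlinarith
  · have : p ∉ tsupport v := fun h' => hp (hsub h')
    simp [dd_of_notMem hp, dd_of_notMem this, image_eq_zero_of_notMem_tsupport hp,
      image_eq_zero_of_notMem_tsupport this]

end Carleman

/-- The quadratic weight. -/
def qψ (ν y : E3) (R₀ κ t₀ : ℝ) (p : SpT) : ℝ :=
  R₀ ^ 2 - 2 * R₀ * inner ℝ (p.2 - y) ν + 3 / 2 * inner ℝ (p.2 - y) ν ^ 2
    - 1 / 2 * inner ℝ (p.2 - y) (p.2 - y) - κ * (p.1 - t₀) ^ 2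

/-- The spatial gradient of the quadratic weight. -/
def qG (ν y : E3) (R₀ : ℝ) (i : Fin 3) (p : SpT) : ℝ :=
  -2 * R₀ * ν i + 3 * inner ℝ (p.2 - y) ν * ν i - (p.2 - y) i

/-- The time derivative of the quadratic weight. -/
def qT (κ t₀ : ℝ) (p : SpT) : ℝ := -2 * κ * (p.1 - t₀)

/-- The spatial Hessian of the quadratic weight. -/
def qA (ν : E3) (i j : Fin 3) : ℝ := 3 * ν i * ν j - if i = j then 1 else 0

lemma inner_e3 (x : E3) (i : Fin 3) : inner ℝ (e3 i) x = x i := by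
  simp [e3, PiLp.inner_apply]

lemma inner_e3' (x : E3) (i : Fin 3) : inner ℝ x (e3 i) = x i := by
  rw [real_inner_comm, inner_e3]

lemma qWeight (ν y : E3) (R₀ κ t₀ : ℝ) :
    QWeight (qψ ν y R₀ κ t₀) (qG ν y R₀) (qT κ t₀) (qA ν) κ := by
  have hin : ∀ p : SpT, HasFDerivAt (fun p : SpT => inner ℝ (p.2 - y) ν)
      ((innerSL ℝ ν).comp (ContinuousLinearMap.snd ℝ ℝ E3)) p := fun p => by
    have := ((hasFDerivAt_snd (𝕜 := ℝ) (p := p)).sub_const y).inner ℝ (hasFDerivAt_const ν p)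
    refine this.congr_fderiv ?_
    ext w <;> simp [real_inner_comm]
  have hin2 : ∀ p : SpT, HasFDerivAt (fun p : SpT => inner ℝ (p.2 - y) (p.2 - y))
      ((2 : ℝ) • (innerSL ℝ (p.2 - y)).comp (ContinuousLinearMap.snd ℝ ℝ E3)) p := fun p => by
    have h1 := (hasFDerivAt_snd (𝕜 := ℝ) (p := p)).sub_const y
    have := h1.inner ℝ h1
    refine this.congr_fderiv ?_
    ext w <;> simp [real_inner_comm, two_mul, inner_sub_left, inner_sub_right]
  have hco : ∀ (i : Fin 3) (p : SpT), HasFDerivAt (fun p : SpT => (p.2 - y) i)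
      ((innerSL ℝ (e3 i)).comp (ContinuousLinearMap.snd ℝ ℝ E3)) p := fun i p => by
    have := ((innerSL ℝ (e3 i)).comp (ContinuousLinearMap.snd ℝ ℝ E3)).hasFDerivAt (x := p)
    have h2 := this.sub_const (y i)
    refine h2.congr_of_eventuallyEq (Eventually.of_forall fun q => ?_)
    simp [inner_e3]
  have hψd : ∀ p : SpT, HasFDerivAt (qψ ν y R₀ κ t₀) _ p := fun p =>
    (((((hin p).const_mul (2 * R₀)).const_sub (R₀ ^ 2)).add (((hin p).pow 2).const_mul (3 / 2))).sub
      ((hin2 p).const_mul (1 / 2))).sub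
      ((((hasFDerivAt_fst (𝕜 := ℝ) (p := p)).sub_const t₀).pow 2).const_mul κ)
  have hGd : ∀ i (p : SpT), HasFDerivAt (qG ν y R₀ i) _ p := fun i p =>
    ((((hin p).const_mul 3).mul_const (ν i)).const_add (-2 * R₀ * ν i)).sub (hco i p)
  have hTd : ∀ (p : SpT), HasFDerivAt (qT κ t₀) _ p := fun p =>
    ((hasFDerivAt_fst (𝕜 := ℝ) (p := p)).sub_const t₀).const_mul (-2 * κ)
  have c1 : ContDiff ℝ (⊤ : ℕ∞) (fun p : SpT => (inner ℝ (p.2 - y) ν : ℝ)) :=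
    ContDiff.inner ℝ (by fun_prop) (by fun_prop)
  have c2 : ContDiff ℝ (⊤ : ℕ∞) (fun p : SpT => (inner ℝ (p.2 - y) (p.2 - y) : ℝ)) :=
    ContDiff.inner ℝ (by fun_prop) (by fun_prop)
  refine ⟨?_, ?_, ?_, ?_, ?_, ?_, ?_, ?_, ?_, ?_⟩
  · unfold qψ; fun_prop
  · intro i; unfold qG; fun_prop
  · unfold qT; fun_prop
  · intro i; ext p
    rw [dd, (hψd p).fderiv]
    simp [qG, inner_e3', inner_sub_left, real_inner_comm]
    ring
  · ext p
    rw [dd, (hψd p).fderiv]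
    simp [qT]
    ring
  · intro i j; ext p
    rw [dd, (hGd i p).fderiv]
    have : inner ℝ (e3 i) (e3 j) = if i = j then (1 : ℝ) else 0 := by
      rw [inner_e3]; simp [e3]
    simp [qA, inner_e3', this]
    ring
  · intro i; ext p
    rw [dd, (hGd i p).fderiv]
    simp
  · intro i; ext p
    rw [dd, (hTd p).fderiv]
    simp
  · ext p
    rw [dd, (hTd p).fderiv]
    simp
  · intro i j
    simp [qA, eq_comm]; ring

lemma mol_eq_sub {E : Type*} [NormedAddCommGroup E] [NormedSpace ℝ E] [FiniteDimensional ℝ E]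
    [MeasurableSpace E] [BorelSpace E] {μ : Measure E} [μ.IsAddHaarMeasure] (n : ℕ) (g : E → ℝ)
    (q : E) : mol μ n g q = ∫ z, (molBump E n).normed μ (q - z) * g z ∂μ := by
  rw [mol, ← integral_sub_left_eq_self _ μ q]
  simp

lemma dd_mol (n : ℕ) {g : SpT → ℝ} (hg : LocallyIntegrable g) (w q : SpT) :
    dd w (mol volume n g) q =
      ∫ z, dd w ((molBump SpT n).normed volume) (q - z) * g z := by
  set β := (molBump SpT n).normed (volume : Measure SpT) with hβ
  have hcβ : HasCompactSupport β := (molBump SpT n).hasCompactSupport_normed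
  have hsβ : ContDiff ℝ (⊤ : ℕ∞) β := (molBump SpT n).contDiff_normed
  have h1 := hcβ.hasFDerivAt_convolution_left (μ := volume) (ContinuousLinearMap.lsmul ℝ ℝ)
    (hsβ.of_le (by exact_mod_cast le_top)) hg q
  have h2 : ConvolutionExistsAt (fderiv ℝ β) g q
      ((ContinuousLinearMap.lsmul ℝ ℝ : ℝ →L[ℝ] ℝ →L[ℝ] ℝ).precompL SpT) volume :=
    (hcβ.fderiv ℝ).convolutionExists_left _ (hsβ.continuous_fderiv (by simp)) hg q
  rw [dd, mol_eq_conv, h1.fderiv, convolution, ContinuousLinearMap.integral_apply h2,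
    ← integral_sub_left_eq_self _ volume q]
  congr 1; ext z
  simp [ContinuousLinearMap.precompL_apply, dd]

lemma WSol.heatP_mol {V : SpT → ℝ} {b : ℝ → E3 → E3} {K : ℝ≥0} (h : WSol V b K) {n : ℕ} {q : SpT}
    (hq : closedBall q (1 / ((n : ℝ) + 1)) ⊆ Om) {f : SpT → ℝ}
    (hf : ∀ z ∈ ball q (1 / ((n : ℝ) + 1)), f z = ∑ i, b z.1 z.2 i * dx V i z)
    (hfl : LocallyIntegrable f) :
    heatP (mol volume n V) q = -mol volume n f q := by
  set β := (molBump SpT n).normed (volume : Measure SpT) with hβ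
  have hcβ : HasCompactSupport β := (molBump SpT n).hasCompactSupport_normed
  have hsβ : ContDiff ℝ (⊤ : ℕ∞) β := (molBump SpT n).contDiff_normed
  set φ : SpT → ℝ := fun z => β (q - z) with hφ
  have hβ0 : ∀ z, z ∉ ball q (1 / ((n : ℝ) + 1)) → φ z = 0 := fun z hz => by
    rw [hφ, ← Function.notMem_support (f := fun z => β (q - z))]
    simp only [Function.mem_support, not_not]
    rw [← Function.notMem_support, hβ, (molBump SpT n).support_normed_eq]
    simpa [mem_ball, dist_eq_norm, molBump, norm_sub_rev] using hz
  have hsφ : ContDiff ℝ (⊤ : ℕ∞) φ := hsβ.comp (by fun_prop)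
  have hts : tsupport φ ⊆ closedBall q (1 / ((n : ℝ) + 1)) := by
    refine closure_minimal (fun z hz => ?_) isClosed_closedBall
    by_contra hz'
    exact hz (hβ0 z fun h' => hz' (ball_subset_closedBall h'))
  have hcφ : HasCompactSupport φ :=
    (isCompact_closedBall _ _).of_isClosed_subset (isClosed_tsupport _) hts
  obtain ⟨L, hL⟩ := hsφ.lipschitzWith_of_hasCompactSupport hcφ (by simp)
  have hz := h.lipschitz_test hL hcφ (hts.trans hq)
  have hdφ : ∀ (w z : SpT), dd w φ z = -dd w β (q - z) := fun w z => by
    have h1 : HasFDerivAt β _ (q - z) := (smooth_diff hsβ (q - z)).hasFDerivAt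
    have h2 : HasFDerivAt φ _ z := h1.comp z ((hasFDerivAt_id z).const_sub q)
    rw [dd, h2.fderiv]; simp [dd]
  have hlV : LocallyIntegrable V := h.lip.continuous.locallyIntegrable
  have hld : ∀ w : SpT, LocallyIntegrable (dd w V) := fun w => Lip.locallyIntegrable_fderiv h.lip w
  have e1 : ∀ w : SpT, dd w (mol volume n V) = mol volume n (dd w V) := fun w => by
    ext p; exact mol_fderiv n h.lip p w
  have i0 : ∀ {g : SpT → ℝ} {ζ : SpT → ℝ}, LocallyIntegrable g → Continuous ζ →
      HasCompactSupport ζ → Integrable fun z => ζ z * g z := fun hg hζ hζc => by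
    simpa using hg.integrable_smul_left_of_hasCompactSupport hζ hζc
  have it : Integrable fun z => φ z * dd (1, 0) V z := i0 (hld _) hsφ.continuous hcφ
  have ix : ∀ i, Integrable fun z => dd (0, e3 i) φ z * dd (0, e3 i) V z := fun i =>
    i0 (hld _) (dd_contDiff hsφ).continuous (dd_hasCompactSupport hcφ)
  have ifl : Integrable fun z => φ z * f z := i0 hfl hsφ.continuous hcφ
  have e2 : dd (1, 0) (mol volume n V) q = ∫ z, φ z * dd (1, 0) V z := by
    rw [e1, mol_eq_sub]
  have e3' : ∀ i, dd (0, e3 i) (dd (0, e3 i) (mol volume n V)) q =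
      -∫ z, dd (0, e3 i) φ z * dd (0, e3 i) V z := fun i => by
    rw [e1, dd_mol n (hld _), ← integral_neg]
    congr 1; ext z; rw [hdφ]; ring
  have e4 : mol volume n f q = ∫ z, φ z * f z := mol_eq_sub n f q
  have ia : Integrable fun z => φ z * dd (1, 0) V z + ∑ i, dd (0, e3 i) φ z * dd (0, e3 i) V z :=
    it.add (integrable_finsetSum _ fun i _ => ix i)
  rw [heatP, e2, e4]
  simp only [e3', Finset.sum_neg_distrib, sub_neg_eq_add]
  rw [← integral_finsetSum _ fun i _ => ix i, ← integral_add it (integrable_finsetSum _ fun i _ => ix i),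
    eq_neg_iff_add_eq_zero, ← integral_add ia ifl]
  refine Eq.trans ?_ hz
  congr 1; ext z
  simp only [weakF, dt_eq_dd, dx_eq_dd]
  have : φ z * f z = φ z * ∑ i, b z.1 z.2 i * dx V i z := by
    by_cases hzb : z ∈ ball q (1 / ((n : ℝ) + 1))
    · rw [hf z hzb]
    · rw [hβ0 z hzb]; simp
  rw [this]
  simp only [dx_eq_dd, Fin.sum_univ_three]
  ring

lemma heatP_mul {χ v : SpT → ℝ} (hχ : ContDiff ℝ (⊤ : ℕ∞) χ) (hv : ContDiff ℝ (⊤ : ℕ∞) v)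
    (p : SpT) : heatP (fun q => χ q * v q) p =
      χ p * heatP v p + v p * heatP χ p - 2 * ∑ i, dd (0, e3 i) χ p * dd (0, e3 i) v p := by
  have h1 := smooth_diff hχ
  have h2 := smooth_diff hv
  have h3 : ∀ w, Differentiable ℝ (dd w χ) := fun w => smooth_diff (dd_contDiff hχ)
  have h4 : ∀ w, Differentiable ℝ (dd w v) := fun w => smooth_diff (dd_contDiff hv)
  simp (disch := fun_prop) only [heatP, dd_mul, dd_add, Fin.sum_univ_three]
  ring

lemma heatP_of_notMem {u : SpT → ℝ} {p : SpT} (hp : p ∉ tsupport u) : heatP u p = 0 := by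
  simp only [heatP, dd_of_notMem hp,
    fun i => dd_of_notMem (w := (0, e3 i)) fun h' => hp (tsupport_dd_subset (0, e3 i) u h')]
  simp

section
variable {ψ : SpT → ℝ} {G : Fin 3 → SpT → ℝ} {T : SpT → ℝ} {A : Fin 3 → Fin 3 → ℝ} {κ : ℝ}

/-- The terms in `heatP (χ V)` produced by differentiating the cutoff. -/
def cutErr (χ V : SpT → ℝ) (p : SpT) : ℝ :=
  V p * heatP χ p - 2 * ∑ i, dd (0, e3 i) χ p * dd (0, e3 i) V p

lemma sq_abs_le {a b : ℝ} (h : |a| ≤ b) : a ^ 2 ≤ b ^ 2 := by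
  rw [← sq_abs a]; exact pow_le_pow_left₀ (abs_nonneg _) h 2

lemma WSol.carleman_lim {V : SpT → ℝ} {b : ℝ → E3 → E3} {K : ℝ≥0} (h : WSol V b K)
    (hψ : QWeight ψ G T A κ) (s : ℝ) (hs : 0 ≤ s) {Cc : ℝ} {χ : SpT → ℝ} (hχ : ContDiff ℝ (⊤ : ℕ∞) χ)
    (hc : HasCompactSupport χ) {f : SpT → ℝ} (hf : Integrable f) {M r : ℝ} (hM : ∀ p, |f p| ≤ M)
    (hr : 0 < r) (hrO : ∀ q ∈ tsupport χ, closedBall q r ⊆ Om)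
    (hfb : ∀ q ∈ tsupport χ, ∀ z ∈ closedBall q r, f z = ∑ i, b z.1 z.2 i * dx V i z)
    (hcar : ∀ u : SpT → ℝ, ContDiff ℝ (⊤ : ℕ∞) u → HasCompactSupport u → tsupport u ⊆ tsupport χ →
      ∫ p, exp (2 * s * ψ p) * (s * (∑ i, dd (0, e3 i) u p ^ 2) + s ^ 3 * u p ^ 2) ≤
      Cc * ∫ p, exp (2 * s * ψ p) * heatP u p ^ 2) :
    ∫ p, exp (2 * s * ψ p) * (s * (∑ i, (χ p * dd (0, e3 i) V p + V p * dd (0, e3 i) χ p) ^ 2)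
        + s ^ 3 * (χ p * V p) ^ 2) ≤
      Cc * ∫ p, exp (2 * s * ψ p) * (-(χ p * f p) + cutErr χ V p) ^ 2 := by
  have hlV : LocallyIntegrable V := h.lip.continuous.locallyIntegrable
  have hVc := h.lip.continuous
  have hχc := hχ.continuous
  have hψc := hψ.smooth.continuous
  have hdχ : ∀ w, Continuous (dd w χ) := fun w => (dd_contDiff hχ).continuous
  have hPχ : Continuous (heatP χ) := (heatP_contDiff hχ).continuous
  set v : ℕ → SpT → ℝ := fun n => mol volume n V with hv
  have sv : ∀ n, ContDiff ℝ (⊤ : ℕ∞) (v n) := fun n => mol_contDiff n hlV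
  have hdv : ∀ n w, dd w (v n) = mol volume n (dd w V) := fun n w => by
    ext p; exact mol_fderiv n h.lip p w
  have hb1 : ∀ n p, |v n p| ≤ |V p| + K := fun n p => by
    have h1 := mol_dist (μ := (volume : Measure SpT)) n h.lip p
    have h2 : (K : ℝ) * (1 / ((n : ℝ) + 1)) ≤ K := by
      refine mul_le_of_le_one_right K.2 ?_
      rw [div_le_one (by positivity)]; linarith [(n.cast_nonneg : (0:ℝ) ≤ n)]
    have h3 : |v n p| - |V p| ≤ |v n p - V p| := abs_sub_abs_le_abs_sub _ _
    have h4 : |v n p - V p| ≤ K * (1 / ((n : ℝ) + 1)) := h1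
    linarith
  have hb2 : ∀ n i p, |dd (0, e3 i) (v n) p| ≤ K := fun n i p => by
    rw [hdv]; exact mol_bumpbound n fun y _ => dx_bound h.lip i y
  have hb3 : ∀ n p, |mol volume n f p| ≤ M := fun n p => mol_bumpbound n fun y _ => hM y
  set u : ℕ → SpT → ℝ := fun n p => χ p * v n p with hu
  have su : ∀ n, ContDiff ℝ (⊤ : ℕ∞) (u n) := fun n => hχ.mul (sv n)
  have cu : ∀ n, HasCompactSupport (u n) := fun n => hc.mul_right
  have tu : ∀ n, tsupport (u n) ⊆ tsupport χ := fun n => closure_mono fun p hp => by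
    simp only [hu, Function.mem_support] at hp ⊢
    exact left_ne_zero_of_mul hp
  have hdu : ∀ n i p, dd (0, e3 i) (u n) p =
      χ p * mol volume n (dd (0, e3 i) V) p + v n p * dd (0, e3 i) χ p := fun n i p => by
    rw [hu]; simp only
    rw [dd_mul (smooth_diff hχ) (smooth_diff (sv n)), hdv]
  obtain ⟨N, hN⟩ := exists_nat_one_div_lt hr
  have hPu : ∀ n, N ≤ n → ∀ p, heatP (u n) p = -(χ p * mol volume n f p) + (v n p * heatP χ p -
      2 * ∑ i, dd (0, e3 i) χ p * mol volume n (dd (0, e3 i) V) p) := fun n hn p => by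
    by_cases hp : p ∈ tsupport χ
    · have hrn : 1 / ((n : ℝ) + 1) ≤ r := by
        refine le_trans ?_ hN.le
        have : (N : ℝ) ≤ n := by exact_mod_cast hn
        gcongr
      rw [hu]; simp only
      rw [heatP_mul hχ (sv n), hv]; simp only
      rw [h.heatP_mol ((closedBall_subset_closedBall hrn).trans (hrO p hp))
        (fun z hz => hfb p hp z (closedBall_subset_closedBall hrn (ball_subset_closedBall hz)))
        hf.locallyIntegrable]
      simp only [hv] at hdv
      simp only [hdv]
      ring
    · rw [heatP_of_notMem fun h' => hp (tu n h'), heatP_of_notMem hp,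
        image_eq_zero_of_notMem_tsupport hp]
      simp [dd_of_notMem hp]
  have ae1 : ∀ᵐ p, ∀ i, Tendsto (fun n => mol volume n (dd (0, e3 i) V) p) atTop
      (𝓝 (dd (0, e3 i) V p)) :=
    ae_all_iff.2 fun i => mol_tendsto_ae (Lip.locallyIntegrable_fderiv h.lip _)
  have ae2 := mol_tendsto_ae (μ := (volume : Measure SpT)) hf.locallyIntegrable
  have tv : ∀ p, Tendsto (fun n => v n p) atTop (𝓝 (V p)) := fun p => mol_tendsto_of_lip h.lip p
  have L1 : Tendsto (fun n => ∫ p, exp (2 * s * ψ p) * (s * (∑ i, dd (0, e3 i) (u n) p ^ 2) +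
      s ^ 3 * u n p ^ 2)) atTop (𝓝 (∫ p, exp (2 * s * ψ p) * (s * (∑ i, (χ p * dd (0, e3 i) V p +
        V p * dd (0, e3 i) χ p) ^ 2) + s ^ 3 * (χ p * V p) ^ 2))) := by
    refine tendsto_integral_of_dominated_convergence (fun p => exp (2 * s * ψ p) * (s * (∑ i,
      (|χ p| * K + (|V p| + K) * |dd (0, e3 i) χ p|) ^ 2) + s ^ 3 * (|χ p| * (|V p| + K)) ^ 2))
      (fun n => ?_) ?_ (fun n => Eventually.of_forall fun p => ?_) ?_
    · have e1 := (su n).continuous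
      have e2 : ∀ w, Continuous (dd w (u n)) := fun w => (dd_contDiff (su n)).continuous
      exact Continuous.aestronglyMeasurable (by fun_prop)
    · refine integrable_of_zero_off (by fun_prop) hc fun p hp => ?_
      simp [dd_of_notMem hp, image_eq_zero_of_notMem_tsupport hp]
    · rw [Real.norm_of_nonneg (by positivity)]
      have e1 : ∀ i, dd (0, e3 i) (u n) p ^ 2 ≤
          (|χ p| * K + (|V p| + K) * |dd (0, e3 i) χ p|) ^ 2 := fun i => by
        refine sq_abs_le ?_
        rw [hdu, ← hdv]
        refine (abs_add_le _ _).trans ?_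
        rw [abs_mul, abs_mul]
        gcongr
        · exact hb2 n i p
        · exact hb1 n p
      have e2 : u n p ^ 2 ≤ (|χ p| * (|V p| + K)) ^ 2 := by
        refine sq_abs_le ?_
        rw [hu, abs_mul]
        gcongr; exact hb1 n p
      exact mul_le_mul_of_nonneg_left (add_le_add (mul_le_mul_of_nonneg_left
        (Finset.sum_le_sum fun i _ => e1 i) hs) (mul_le_mul_of_nonneg_left e2 (by positivity)))
        (exp_pos _).le
    · filter_upwards [ae1] with p hp
      simp only [hdu]
      have e1 : ∀ i, Tendsto (fun n => (χ p * mol volume n (dd (0, e3 i) V) p +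
          v n p * dd (0, e3 i) χ p) ^ 2) atTop (𝓝 ((χ p * dd (0, e3 i) V p +
        V p * dd (0, e3 i) χ p) ^ 2)) := fun i =>
        (((hp i).const_mul _).add ((tv p).mul_const _)).pow 2
      exact (((tendsto_finsetSum _ fun i _ => e1 i).const_mul _).add
        ((((tv p).const_mul _).pow 2).const_mul _)).const_mul _
  have L2 : Tendsto (fun n => ∫ p, exp (2 * s * ψ p) * (-(χ p * mol volume n f p) +
      (v n p * heatP χ p - 2 * ∑ i, dd (0, e3 i) χ p * mol volume n (dd (0, e3 i) V) p)) ^ 2) atTop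
      (𝓝 (∫ p, exp (2 * s * ψ p) * (-(χ p * f p) + cutErr χ V p) ^ 2)) := by
    refine tendsto_integral_of_dominated_convergence (fun p => exp (2 * s * ψ p) *
      (|χ p| * M + ((|V p| + K) * |heatP χ p| + 2 * ∑ i, |dd (0, e3 i) χ p| * K)) ^ 2)
      (fun n => ?_) ?_ (fun n => Eventually.of_forall fun p => ?_) ?_
    · have e1 := (sv n).continuous
      have e2 : ∀ i, Continuous (mol volume n (dd (0, e3 i) V)) := fun i =>
        (mol_contDiff n (Lip.locallyIntegrable_fderiv h.lip _)).continuous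
      have e4 : Continuous (mol volume n f) := (mol_contDiff n hf.locallyIntegrable).continuous
      exact Continuous.aestronglyMeasurable (by fun_prop)
    · refine integrable_of_zero_off (by fun_prop) hc fun p hp => ?_
      simp [dd_of_notMem hp, image_eq_zero_of_notMem_tsupport hp, heatP_of_notMem hp]
    · rw [Real.norm_of_nonneg (by positivity)]
      refine mul_le_mul_of_nonneg_left (sq_abs_le ?_) (exp_pos _).le
      refine (abs_add_le _ _).trans (add_le_add ?_ ((abs_sub _ _).trans (add_le_add ?_ ?_)))
      · rw [abs_neg, abs_mul]; gcongr; exact hb3 n p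
      · rw [abs_mul]; gcongr; exact hb1 n p
      · rw [abs_mul, abs_two]
        gcongr
        refine (Finset.abs_sum_le_sum_abs _ _).trans (Finset.sum_le_sum fun i _ => ?_)
        rw [abs_mul, ← hdv]; gcongr; exact hb2 n i p
    · filter_upwards [ae1, ae2] with p hp hp2
      exact (((hp2.const_mul _).neg.add (((tv p).mul_const _).sub ((tendsto_finsetSum _ fun i _ =>
        (hp i).const_mul _).const_mul _))).pow 2).const_mul _
  refine le_of_tendsto_of_tendsto L1 (L2.const_mul Cc) ?_
  filter_upwards [eventually_ge_atTop N] with n hn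
  have := hcar (u n) (su n) (cu n) (tu n)
  simpa only [hPu n hn] using this

end

section
variable {ψ : SpT → ℝ} {G : Fin 3 → SpT → ℝ} {T : SpT → ℝ} {A : Fin 3 → Fin 3 → ℝ} {κ : ℝ}

lemma WSol.exists_drift {V : SpT → ℝ} {b : ℝ → E3 → E3} {K : ℝ≥0} (h : WSol V b K) {S : Set SpT}
    (hS : IsCompact S) (hSO : S ⊆ Om) :
    ∃ (f : SpT → ℝ) (B r M : ℝ), 0 < r ∧ Integrable f ∧ (∀ p, |f p| ≤ M) ∧
      (∀ q ∈ S, closedBall q r ⊆ Om) ∧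
      (∀ q ∈ S, ∀ z ∈ closedBall q r, f z = ∑ i, b z.1 z.2 i * dx V i z) ∧
      ∀ z, f z ^ 2 ≤ B ^ 2 * ∑ i, dx V i z ^ 2 := by
  obtain ⟨r, hr, hrs⟩ := hS.exists_cthickening_subset_open isOpen_Om hSO
  set S' := cthickening r S with hS'
  have hS'c : IsCompact S' := hS.cthickening
  have hb : ContinuousOn (fun p : SpT => b p.1 p.2) S' := h.cont.mono (hrs.trans Om_subset_Qlt)
  obtain ⟨B, hB⟩ := hS'c.exists_bound_of_continuousOn hb
  set g : SpT → ℝ := fun z => ∑ i, b z.1 z.2 i * dx V i z with hg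
  have hsq : ∀ z ∈ S', g z ^ 2 ≤ B ^ 2 * ∑ i, dx V i z ^ 2 := fun z hz => by
    have h1 := Finset.sum_mul_sq_le_sq_mul_sq Finset.univ (fun i => b z.1 z.2 i) (fun i => dx V i z)
    refine h1.trans (mul_le_mul_of_nonneg_right ?_ (Finset.sum_nonneg fun i _ => sq_nonneg _))
    have h2 : ∑ i, b z.1 z.2 i ^ 2 = ‖b z.1 z.2‖ ^ 2 := by
      rw [EuclideanSpace.norm_sq_eq]; simp
    rw [h2]
    exact pow_le_pow_left₀ (norm_nonneg _) (hB z hz) 2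
  have hgM : ∀ z ∈ S', |g z| ≤ √(B ^ 2 * (3 * K ^ 2)) := fun z hz => by
    rw [← Real.sqrt_sq_eq_abs]
    refine Real.sqrt_le_sqrt ((hsq z hz).trans (mul_le_mul_of_nonneg_left ?_ (sq_nonneg _)))
    refine (Finset.sum_le_sum (g := fun _ => (K : ℝ) ^ 2) fun i _ => ?_).trans (by simp)
    rw [← sq_abs]
    exact pow_le_pow_left₀ (abs_nonneg _) (dx_bound h.lip i z) 2
  have hcb : ∀ q ∈ S, closedBall q r ⊆ S' := fun q hq => closedBall_subset_cthickening hq r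
  refine ⟨S'.indicator g, B, r, √(B ^ 2 * (3 * K ^ 2)), hr, ?_, fun p => ?_,
    fun q hq => (hcb q hq).trans hrs, fun q hq z hz => indicator_of_mem (hcb q hq hz) _,
    fun z => ?_⟩
  · rw [integrable_indicator_iff hS'c.measurableSet]
    refine IntegrableOn.of_bound hS'c.measure_lt_top ?_ (√(B ^ 2 * (3 * K ^ 2))) ?_
    · refine Finset.aestronglyMeasurable_fun_sum _ fun i _ => AEStronglyMeasurable.mul ?_
        (dx_measurable V i).aestronglyMeasurable
      refine ContinuousOn.aestronglyMeasurable ?_ hS'c.measurableSet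
      exact (EuclideanSpace.proj i : E3 →L[ℝ] ℝ).continuous.comp_continuousOn hb
    · filter_upwards [ae_restrict_mem hS'c.measurableSet] with p hp using hgM p hp
  · by_cases hp : p ∈ S'
    · rw [indicator_of_mem hp]; exact hgM p hp
    · rw [indicator_of_notMem hp, abs_zero]; positivity
  · by_cases hp : z ∈ S'
    · rw [indicator_of_mem hp]; exact hsq z hp
    · rw [indicator_of_notMem hp]
      simp only [ne_eq, OfNat.ofNat_ne_zero, not_false_eq_true, zero_pow]
      exact mul_nonneg (sq_nonneg _) (Finset.sum_nonneg fun i _ => sq_nonneg _)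

lemma drift_absorb (c x y E B s C : ℝ) (a d : Fin 3 → ℝ) (hC : 0 ≤ C)
    (hy : y ^ 2 ≤ B ^ 2 * ∑ i, a i ^ 2) (hs : 4 * C * B ^ 2 ≤ s) :
    C * (-(c * y) + E) ^ 2 ≤ s * (∑ i, (c * a i + x * d i) ^ 2) +
      (4 * C * B ^ 2 + 2 * C) * (E ^ 2 + x ^ 2 * ∑ i, d i ^ 2) := by
  have g2 : c ^ 2 * (∑ i, a i ^ 2) ≤ 2 * (∑ i, (c * a i + x * d i) ^ 2) +
      2 * (x ^ 2 * ∑ i, d i ^ 2) := by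
    simp only [Finset.mul_sum, ← Finset.sum_add_distrib]
    exact Finset.sum_le_sum fun i _ => by nlinarith [sq_nonneg (c * a i + 2 * x * d i)]
  have hD0 : 0 ≤ ∑ i, (c * a i + x * d i) ^ 2 := Finset.sum_nonneg fun i _ => sq_nonneg _
  have hN0 : 0 ≤ x ^ 2 * ∑ i, d i ^ 2 :=
    mul_nonneg (sq_nonneg _) (Finset.sum_nonneg fun i _ => sq_nonneg _)
  generalize (∑ i, (c * a i + x * d i) ^ 2) = D at *
  generalize (x ^ 2 * ∑ i, d i ^ 2) = N at *
  generalize (∑ i, a i ^ 2) = a2 at *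
  have g1 : c ^ 2 * y ^ 2 ≤ c ^ 2 * (B ^ 2 * a2) := mul_le_mul_of_nonneg_left hy (sq_nonneg _)
  have g3 : (-(c * y) + E) ^ 2 ≤ 2 * (c ^ 2 * y ^ 2) + 2 * E ^ 2 := by
    linarith [add_sq (c * y) E, sq_nonneg (c * y + E), mul_pow c y 2]
  have g5 := mul_le_mul_of_nonneg_left g2 (sq_nonneg B)
  have g4 : (-(c * y) + E) ^ 2 ≤ 4 * B ^ 2 * D + 4 * B ^ 2 * N + 2 * E ^ 2 := by linarith
  have h1 := mul_le_mul_of_nonneg_left g4 hC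
  have h2 := mul_le_mul_of_nonneg_right hs hD0
  have h3 : 0 ≤ C * B ^ 2 * E ^ 2 := by positivity
  have h4 : 0 ≤ C * N := by positivity
  linarith

set_option maxHeartbeats 1000000 in
lemma WSol.carleman_absorbed {V : SpT → ℝ} {b : ℝ → E3 → E3} {K : ℝ≥0} (h : WSol V b K)
    (hψ : QWeight ψ G T A κ) {c₀ T₀ G₀ : ℝ} (hκ : 0 ≤ κ) (hc₀ : 0 < c₀) (hG₀ : 0 ≤ G₀)
    (hA : ∀ ξ : Fin 3 → ℝ, -(∑ i, ξ i ^ 2) ≤ ∑ i, ∑ j, A i j * ξ i * ξ j)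
    {χ : SpT → ℝ} (hχ : ContDiff ℝ (⊤ : ℕ∞) χ) (hc : HasCompactSupport χ) (hO : tsupport χ ⊆ Om)
    (hG : ∀ p ∈ tsupport χ, c₀ ≤ 4 * (∑ i, ∑ j, A i j * G i p * G j p) - 5 * ∑ i, G i p ^ 2)
    (hT : ∀ p ∈ tsupport χ, T p ≤ T₀) (hGb : ∀ p ∈ tsupport χ, ∑ i, G i p ^ 2 ≤ G₀) :
    ∃ s₁ C : ℝ, 1 ≤ s₁ ∧ ∀ s, s₁ ≤ s → s ^ 3 * ∫ p, exp (2 * s * ψ p) * (χ p * V p) ^ 2 ≤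
      C * ∫ p, exp (2 * s * ψ p) * (cutErr χ V p ^ 2 + V p ^ 2 * ∑ i, dd (0, e3 i) χ p ^ 2) := by
  obtain ⟨f, B, r, M, hr, hfi, hM, hrO, hfb, hfsq⟩ := h.exists_drift hc hO
  set Cc := 2 + 2 * (2 * G₀ + 1) / c₀ with hCc
  have hCc0 : 0 ≤ Cc := by positivity
  refine ⟨max (max 1 ((5 * T₀ + 25 / 4 + 2 * κ) / (c₀ / 2))) (4 * Cc * B ^ 2),
    4 * Cc * B ^ 2 + 2 * Cc, le_max_of_le_left (le_max_left _ _), fun s hs => ?_⟩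
  have hs1 : 1 ≤ s := ((le_max_left _ _).trans (le_max_left _ _)).trans hs
  have hs2 : (5 * T₀ + 25 / 4 + 2 * κ) / (c₀ / 2) ≤ s :=
    ((le_max_right _ _).trans (le_max_left _ _)).trans hs
  have hs3 : 4 * Cc * B ^ 2 ≤ s := (le_max_right _ _).trans hs
  rw [div_le_iff₀ (by positivity)] at hs2
  have key := h.carleman_lim hψ s (by linarith) hχ hc hfi hM hr hrO hfb (Cc := Cc)
    fun u hu hcu htu => hψ.carleman hs1 hκ hc₀ hG₀ hs2 hA hu hcu (fun p hp => hG p (htu hp))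
      (fun p hp => hT p (htu hp)) (fun p hp => hGb p (htu hp))
  have hVc := h.lip.continuous
  have hχc := hχ.continuous
  have hψc := hψ.smooth.continuous
  have hdχ : ∀ w, Continuous (dd w χ) := fun w => (dd_contDiff hχ).continuous
  have hPχ : Continuous (heatP χ) := (heatP_contDiff hχ).continuous
  have mdV : ∀ i, AEStronglyMeasurable (dd (0, e3 i) V) := fun i =>
    (dx_measurable V i).aestronglyMeasurable
  have bdV : ∀ i p, |dd (0, e3 i) V p| ≤ K := fun i p => dx_bound h.lip i p
  have cm : ∀ {g : SpT → ℝ}, Continuous g → AEStronglyMeasurable g := fun hg =>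
    hg.aestronglyMeasurable
  have mE : AEStronglyMeasurable (cutErr χ V) := by
    unfold cutErr
    refine (cm (by fun_prop)).sub ((Finset.aestronglyMeasurable_fun_sum _ fun i _ => ?_).const_mul _)
    exact (cm (hdχ _)).mul (mdV i)
  have bE : ∀ p, |cutErr χ V p| ≤ |V p| * |heatP χ p| + 2 * ∑ i, |dd (0, e3 i) χ p| * K := fun p => by
    refine (abs_sub _ _).trans (add_le_add ?_ ?_)
    · rw [abs_mul]
    · rw [abs_mul, abs_two]
      gcongr
      refine (Finset.abs_sum_le_sum_abs _ _).trans (Finset.sum_le_sum fun i _ => ?_)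
      rw [abs_mul]; gcongr; exact bdV i p
  have i1 : Integrable fun p => exp (2 * s * ψ p) *
      (∑ i, (χ p * dd (0, e3 i) V p + V p * dd (0, e3 i) χ p) ^ 2) := by
    refine Integrable.mono' (g := fun p => exp (2 * s * ψ p) * (∑ i, (|χ p| * K +
      |V p| * |dd (0, e3 i) χ p|) ^ 2)) (integrable_of_zero_off (by fun_prop) hc fun p hp => ?_) ?_
      (Eventually.of_forall fun p => ?_)
    · simp [dd_of_notMem hp, image_eq_zero_of_notMem_tsupport hp]
    · refine (cm (by fun_prop)).mul (Finset.aestronglyMeasurable_fun_sum _ fun i _ => ?_)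
      exact (((cm hχc).mul (mdV i)).add (cm (by fun_prop))).pow 2
    · rw [Real.norm_of_nonneg (by positivity)]
      refine mul_le_mul_of_nonneg_left (Finset.sum_le_sum fun i _ => sq_abs_le ?_) (exp_pos _).le
      refine (abs_add_le _ _).trans ?_
      rw [abs_mul, abs_mul]; gcongr; exact bdV i p
  have i2 : Integrable fun p => exp (2 * s * ψ p) * (χ p * V p) ^ 2 :=
    integrable_of_zero_off (by fun_prop) hc fun p hp => by
      simp [image_eq_zero_of_notMem_tsupport hp]
  have i3 : Integrable fun p => exp (2 * s * ψ p) * (cutErr χ V p ^ 2 +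
      V p ^ 2 * ∑ i, dd (0, e3 i) χ p ^ 2) := by
    refine Integrable.mono' (g := fun p => exp (2 * s * ψ p) * ((|V p| * |heatP χ p| +
      2 * ∑ i, |dd (0, e3 i) χ p| * K) ^ 2 + V p ^ 2 * ∑ i, dd (0, e3 i) χ p ^ 2))
      (integrable_of_zero_off (by fun_prop) hc fun p hp => ?_) ?_ (Eventually.of_forall fun p => ?_)
    · simp [dd_of_notMem hp, heatP_of_notMem hp]
    · exact (cm (by fun_prop)).mul ((mE.pow 2).add (cm (by fun_prop)))
    · rw [Real.norm_of_nonneg (by positivity)]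
      exact mul_le_mul_of_nonneg_left (add_le_add (sq_abs_le (bE p)) le_rfl) (exp_pos _).le
  have e0 : ∫ p, exp (2 * s * ψ p) * (s * (∑ i, (χ p * dd (0, e3 i) V p + V p * dd (0, e3 i) χ p) ^ 2)
      + s ^ 3 * (χ p * V p) ^ 2) = s * (∫ p, exp (2 * s * ψ p) *
      (∑ i, (χ p * dd (0, e3 i) V p + V p * dd (0, e3 i) χ p) ^ 2)) +
      s ^ 3 * ∫ p, exp (2 * s * ψ p) * (χ p * V p) ^ 2 := by
    rw [← integral_const_mul, ← integral_const_mul,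
      ← integral_add (i1.const_mul _) (i2.const_mul _)]
    congr 1; ext p; ring
  have e1 : Cc * ∫ p, exp (2 * s * ψ p) * (-(χ p * f p) + cutErr χ V p) ^ 2 ≤
      s * (∫ p, exp (2 * s * ψ p) *
      (∑ i, (χ p * dd (0, e3 i) V p + V p * dd (0, e3 i) χ p) ^ 2)) + (4 * Cc * B ^ 2 + 2 * Cc) *
      ∫ p, exp (2 * s * ψ p) * (cutErr χ V p ^ 2 + V p ^ 2 * ∑ i, dd (0, e3 i) χ p ^ 2) := by
    rw [← integral_const_mul, ← integral_const_mul, ← integral_const_mul,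
      ← integral_add (i1.const_mul _) (i3.const_mul _)]
    refine integral_mono_of_nonneg (Eventually.of_forall fun p => by positivity)
      ((i1.const_mul _).add (i3.const_mul _)) (Eventually.of_forall fun p => ?_)
    have hf2 := hfsq p
    simp only [dx_eq_dd] at hf2
    have := mul_le_mul_of_nonneg_left (drift_absorb (χ p) (V p) (f p) (cutErr χ V p) B s Cc
      (fun i => dd (0, e3 i) V p) (fun i => dd (0, e3 i) χ p) hCc0 hf2 hs3)
      (exp_pos (2 * s * ψ p)).le
    calc _ = exp (2 * s * ψ p) * (Cc * (-(χ p * f p) + cutErr χ V p) ^ 2) := by ring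
      _ ≤ _ := this
      _ = _ := by ring
  linarith

lemma WSol.uc_weight {V : SpT → ℝ} {b : ℝ → E3 → E3} {K : ℝ≥0} (h : WSol V b K)
    (hψ : QWeight ψ G T A κ) {c₀ T₀ G₀ m₀ : ℝ} (hκ : 0 ≤ κ) (hc₀ : 0 < c₀) (hG₀ : 0 ≤ G₀)
    (hA : ∀ ξ : Fin 3 → ℝ, -(∑ i, ξ i ^ 2) ≤ ∑ i, ∑ j, A i j * ξ i * ξ j)
    {χ : SpT → ℝ} (hχ : ContDiff ℝ (⊤ : ℕ∞) χ) (hc : HasCompactSupport χ) (hO : tsupport χ ⊆ Om)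
    (hG : ∀ p ∈ tsupport χ, c₀ ≤ 4 * (∑ i, ∑ j, A i j * G i p * G j p) - 5 * ∑ i, G i p ^ 2)
    (hT : ∀ p ∈ tsupport χ, T p ≤ T₀) (hGb : ∀ p ∈ tsupport χ, ∑ i, G i p ^ 2 ≤ G₀)
    (hsm : ∀ p ∈ tsupport χ, m₀ < ψ p → (V p = 0 ∧ ∀ i, dd (0, e3 i) V p = 0) ∨
      (heatP χ p = 0 ∧ ∀ i, dd (0, e3 i) χ p = 0)) {q : SpT} (hq : m₀ < ψ q) (hq' : χ q ≠ 0) :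
    V q = 0 := by
  obtain ⟨s₁, C, hs₁, key⟩ := h.carleman_absorbed hψ hκ hc₀ hG₀ hA hχ hc hO hG hT hGb
  by_contra hV
  have hVc := h.lip.continuous
  have hχc := hχ.continuous
  have hψc := hψ.smooth.continuous
  have hdχ : ∀ w, Continuous (dd w χ) := fun w => (dd_contDiff hχ).continuous
  have hPχ : Continuous (heatP χ) := (heatP_contDiff hχ).continuous
  have bdV : ∀ i p, |dd (0, e3 i) V p| ≤ K := fun i p => dx_bound h.lip i p
  set N : SpT → ℝ := fun p => (|V p| * |heatP χ p| + 2 * ∑ i, |dd (0, e3 i) χ p| * K) ^ 2 +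
    V p ^ 2 * ∑ i, dd (0, e3 i) χ p ^ 2 with hN
  have iN : Integrable N := integrable_of_zero_off (by fun_prop) hc fun p hp => by
    simp [hN, dd_of_notMem hp, heatP_of_notMem hp]
  set O : Set SpT := {p | m₀ < ψ p} with hOdef
  have hOo : IsOpen O := isOpen_lt continuous_const hψc
  set Y : SpT → ℝ := O.indicator fun p => (χ p * V p) ^ 2 with hY
  have iY0 : Integrable fun p => (χ p * V p) ^ 2 :=
    integrable_of_zero_off (by fun_prop) hc fun p hp => by simp [image_eq_zero_of_notMem_tsupport hp]
  have iY : Integrable Y := iY0.indicator hOo.measurableSet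
  have Y0 : 0 ≤ Y := fun p => indicator_nonneg (fun _ _ => sq_nonneg _) p
  have Ypos : 0 < ∫ p, Y p := by
    rw [integral_pos_iff_support_of_nonneg Y0 iY]
    have ho : IsOpen (O ∩ {p | χ p * V p ≠ 0}) :=
      hOo.inter (isOpen_ne_fun (by fun_prop) continuous_const)
    refine (ho.measure_pos volume ⟨q, hq, mul_ne_zero hq' hV⟩).trans_le (measure_mono fun p hp => ?_)
    simp only [Function.mem_support, hY]
    rw [indicator_of_mem hp.1]
    exact pow_ne_zero 2 hp.2
  have step : ∀ s, s₁ ≤ s → s * ∫ p, Y p ≤ |C| * ∫ p, N p := fun s hs => by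
    have hs1 : 1 ≤ s := hs₁.trans hs
    have k := key s hs
    have l1 : exp (2 * s * m₀) * ∫ p, Y p ≤ ∫ p, exp (2 * s * ψ p) * (χ p * V p) ^ 2 := by
      rw [← integral_const_mul]
      refine integral_mono (iY.const_mul _) (integrable_of_zero_off (by fun_prop) hc fun p hp => by
        simp [image_eq_zero_of_notMem_tsupport hp]) fun p => ?_
      simp only [hY]
      by_cases hp : p ∈ O
      · rw [indicator_of_mem hp]
        have : m₀ ≤ ψ p := le_of_lt hp
        gcongr
      · rw [indicator_of_notMem hp]; simp; positivity
    have l2 : ∫ p, exp (2 * s * ψ p) * (cutErr χ V p ^ 2 + V p ^ 2 * ∑ i, dd (0, e3 i) χ p ^ 2) ≤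
        exp (2 * s * m₀) * ∫ p, N p := by
      rw [← integral_const_mul]
      refine integral_mono_of_nonneg (Eventually.of_forall fun p => by positivity)
        (iN.const_mul _) (Eventually.of_forall fun p => ?_)
      simp only
      have hN0 : 0 ≤ N p := by simp only [hN]; positivity
      by_cases hp : p ∈ tsupport χ
      · by_cases hpm : m₀ < ψ p
        · rcases hsm p hp hpm with ⟨a1, a2⟩ | ⟨a1, a2⟩
          · simp only [cutErr, a1, a2]; simp; positivity
          · simp only [cutErr, a1, a2]; simp; positivity
        · have : ψ p ≤ m₀ := not_lt.1 hpm
          have hle : cutErr χ V p ^ 2 + V p ^ 2 * ∑ i, dd (0, e3 i) χ p ^ 2 ≤ N p := by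
            refine add_le_add (sq_abs_le ?_) le_rfl
            refine (abs_sub _ _).trans (add_le_add ?_ ?_)
            · rw [abs_mul]
            · rw [abs_mul, abs_two]
              gcongr
              refine (Finset.abs_sum_le_sum_abs _ _).trans (Finset.sum_le_sum fun i _ => ?_)
              rw [abs_mul]; gcongr; exact bdV i p
          gcongr
      · simp [cutErr, dd_of_notMem hp, heatP_of_notMem hp]; positivity
    have hI0 : 0 ≤ ∫ p, exp (2 * s * ψ p) * (cutErr χ V p ^ 2 +
        V p ^ 2 * ∑ i, dd (0, e3 i) χ p ^ 2) := integral_nonneg fun p => by positivity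
    have k2 : s ^ 3 * (exp (2 * s * m₀) * ∫ p, Y p) ≤ |C| * (exp (2 * s * m₀) * ∫ p, N p) :=
      (mul_le_mul_of_nonneg_left l1 (by positivity)).trans (k.trans
        ((mul_le_mul_of_nonneg_right (le_abs_self C) hI0).trans
          (mul_le_mul_of_nonneg_left l2 (abs_nonneg _))))
    have k3 : exp (2 * s * m₀) * (s ^ 3 * ∫ p, Y p) ≤ exp (2 * s * m₀) * (|C| * ∫ p, N p) := by
      linarith
    have k4 := le_of_mul_le_mul_left k3 (exp_pos _)
    have : s ≤ s ^ 3 := by nlinarith [mul_self_nonneg s]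
    exact (mul_le_mul_of_nonneg_right this Ypos.le).trans k4
  have h0 : 0 ≤ |C| * ∫ p, N p := mul_nonneg (abs_nonneg _)
    (integral_nonneg fun p => by simp only [hN]; positivity)
  have := step (s₁ + (|C| * (∫ p, N p) + 1) / ∫ p, Y p) (by
    have : 0 ≤ (|C| * (∫ p, N p) + 1) / ∫ p, Y p := by positivity
    linarith)
  rw [add_mul, div_mul_cancel₀ _ Ypos.ne'] at this
  have : 0 ≤ s₁ * ∫ p, Y p := by positivity
  linarith

end

lemma dd_of_eventuallyEq {f g : SpT → ℝ} {q : SpT} (h : f =ᶠ[𝓝 q] g) (w : SpT) :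
    dd w f =ᶠ[𝓝 q] dd w g := by
  filter_upwards [h.fderiv (𝕜 := ℝ)] with x hx
  simp only [dd, hx]

lemma dd_const_fun (c : ℝ) (w : SpT) : dd w (fun _ => c) = fun _ => 0 := by
  ext q; simp [dd]

lemma heatP_of_eventuallyEq_const {f : SpT → ℝ} {q : SpT} {c : ℝ} (h : f =ᶠ[𝓝 q] fun _ => c) :
    heatP f q = 0 := by
  have h1 : ∀ w, dd w f =ᶠ[𝓝 q] fun _ => 0 := fun w => by
    have := dd_of_eventuallyEq h w; rwa [dd_const_fun] at this
  have h2 : ∀ w, dd w (dd w f) =ᶠ[𝓝 q] fun _ => 0 := fun w => by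
    have := dd_of_eventuallyEq (h1 w) w; rwa [dd_const_fun] at this
  simp [heatP, (h1 _).eq_of_nhds, (h2 _).eq_of_nhds]

lemma WSol.uc_step {V : SpT → ℝ} {b : ℝ → E3 → E3} {K : ℝ≥0} (h : WSol V b K)
    {ν y : E3} {e ρ' t₀ δ : ℝ} (hν : ‖ν‖ = 1) (he : 0 < e) (hδ : 0 < δ)
    (hρ' : (8 * e) ^ 2 - ρ' ^ 2 ≤ e ^ 2 / 500) (hρ0 : 0 ≤ ρ')
    (hOm : Icc (t₀ - δ) (t₀ + δ) ×ˢ closedBall (y + (8 * e) • ν) e ⊆ Om)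
    (hV : ∀ t x, |t - t₀| < δ → ‖x - y‖ < ρ' → V (t, x) = 0) :
    ∀ᶠ q in 𝓝 (t₀, y + (8 * e) • ν), V q = 0 := by
  set P : E3 := y + (8 * e) • ν with hP
  set κ : ℝ := 4 * e ^ 2 / δ ^ 2 with hκ
  have hκ0 : 0 ≤ κ := by positivity
  let η : ContDiffBump P := ⟨e / 4, e / 2, by positivity, by linarith⟩
  let θ : ContDiffBump t₀ := ⟨δ / 2, 3 * δ / 4, by positivity, by linarith⟩
  set χ : SpT → ℝ := fun q => θ q.1 * η q.2 with hχdef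
  have hχ : ContDiff ℝ (⊤ : ℕ∞) χ :=
    (θ.contDiff.comp contDiff_fst).mul (η.contDiff.comp contDiff_snd)
  have hts : tsupport χ ⊆ closedBall t₀ (3 * δ / 4) ×ˢ closedBall P (e / 2) := by
    refine closure_minimal (fun q hq => ?_) (isClosed_closedBall.prod isClosed_closedBall)
    simp only [Function.mem_support, hχdef, mul_ne_zero_iff] at hq
    have h1 : q.1 ∈ Function.support θ := hq.1
    have h2 : q.2 ∈ Function.support η := hq.2
    rw [θ.support_eq] at h1; rw [η.support_eq] at h2
    exact ⟨ball_subset_closedBall h1, ball_subset_closedBall h2⟩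
  have hc : HasCompactSupport χ :=
    ((isCompact_closedBall _ _).prod (isCompact_closedBall _ _)).of_isClosed_subset
      (isClosed_tsupport _) hts
  have htO : tsupport χ ⊆ Om := fun q hq => by
    have h1 := hts hq
    rw [mem_prod, mem_closedBall, Real.dist_eq, abs_le] at h1
    refine hOm ⟨⟨by linarith [h1.1.1], by linarith [h1.1.2]⟩, ?_⟩
    exact closedBall_subset_closedBall (by linarith) h1.2
  -- geometry
  set d : SpT → ℝ := fun q => ‖q.2 - P‖ with hd
  set a : SpT → ℝ := fun q => -inner ℝ (q.2 - P) ν with ha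
  have had : ∀ q, |a q| ≤ d q := fun q => by
    have := abs_real_inner_le_norm (q.2 - P) ν
    simpa [ha, hd, hν] using this
  have hνν : inner ℝ ν ν = (1 : ℝ) := by rw [real_inner_self_eq_norm_sq, hν]; norm_num
  have hz : ∀ q : SpT, q.2 - y = (q.2 - P) + (8 * e) • ν := fun q => by rw [hP]; abel
  have hm : ∀ q : SpT, inner ℝ (q.2 - y) ν = 8 * e - a q := fun q => by
    rw [hz, inner_add_left, inner_smul_left, hνν]; simp [ha]; ring
  have hzz : ∀ q : SpT, inner ℝ (q.2 - y) (q.2 - y) = d q ^ 2 - 16 * e * a q + (8 * e) ^ 2 :=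
    fun q => by
    rw [hz, inner_add_left, inner_add_right, inner_add_right, inner_smul_left, inner_smul_right,
      inner_smul_right, inner_smul_left, hνν, real_inner_comm (q.2 - P) ν, real_inner_self_eq_norm_sq]
    simp only [hd, ha, conj_trivial]
    ring
  have hzn : ∀ q : SpT, ‖q.2 - y‖ ^ 2 = d q ^ 2 - 16 * e * a q + (8 * e) ^ 2 := fun q => by
    rw [← real_inner_self_eq_norm_sq, hzz]
  have hψv : ∀ q : SpT, qψ ν y (9 * e) κ t₀ q = (e + a q) ^ 2 - 1 / 2 * (d q ^ 2 - a q ^ 2)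
      - κ * (q.1 - t₀) ^ 2 := fun q => by
    rw [qψ, hm, hzz]; ring
  have hνsum : ∑ i, ν i ^ 2 = 1 := by
    have := EuclideanSpace.norm_sq_eq ν
    rw [hν] at this; simp at this; linarith
  have hmsum : ∀ q : SpT, ∑ i, (q.2 - y) i * ν i = 8 * e - a q := fun q => by
    rw [← hm, PiLp.inner_apply]; simp [mul_comm]
  have hzsum : ∀ q : SpT, ∑ i, (q.2 - y) i ^ 2 = d q ^ 2 - 16 * e * a q + (8 * e) ^ 2 := fun q => by
    rw [← hzn, EuclideanSpace.norm_sq_eq]; simp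
  have hGsq : ∀ q : SpT, ∑ i, qG ν y (9 * e) i q ^ 2 = 4 * (e + a q) ^ 2 + (d q ^ 2 - a q ^ 2) :=
    fun q => by
    have e1 : ∑ i, qG ν y (9 * e) i q ^ 2 = (3 * (8 * e - a q) - 18 * e) ^ 2 * ∑ i, ν i ^ 2 -
        2 * (3 * (8 * e - a q) - 18 * e) * (∑ i, (q.2 - y) i * ν i) + ∑ i, (q.2 - y) i ^ 2 := by
      simp only [qG, hm, Fin.sum_univ_three]; ring
    rw [e1, hνsum, hmsum, hzsum]; ring
  have hAform : ∀ ξ : Fin 3 → ℝ, ∑ i, ∑ j, qA ν i j * ξ i * ξ j =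
      3 * (∑ i, ν i * ξ i) ^ 2 - ∑ i, ξ i ^ 2 := fun ξ => by
    simp [qA, Fin.sum_univ_three]; ring
  have hνG : ∀ q : SpT, ∑ i, ν i * qG ν y (9 * e) i q = -2 * (e + a q) := fun q => by
    have e1 : ∑ i, ν i * qG ν y (9 * e) i q = (3 * (8 * e - a q) - 18 * e) * (∑ i, ν i ^ 2) -
        ∑ i, (q.2 - y) i * ν i := by
      simp only [qG, hm, Fin.sum_univ_three]; ring
    rw [e1, hνsum, hmsum]; ring
  have hsup : ∀ q ∈ tsupport χ, |q.1 - t₀| ≤ 3 * δ / 4 ∧ d q ≤ e / 2 := fun q hq => by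
    have h1 := hts hq
    rw [mem_prod, mem_closedBall, Real.dist_eq, mem_closedBall, dist_eq_norm] at h1
    exact h1
  have hcψ := (qWeight ν y (9 * e) κ t₀).smooth.continuous
  have hχ1 : ∀ q : SpT, |q.1 - t₀| < δ / 2 → d q < e / 4 → χ =ᶠ[𝓝 q] fun _ => 1 := fun q h1 h2 => by
    have o : IsOpen (ball t₀ (δ / 2) ×ˢ ball P (e / 4)) := isOpen_ball.prod isOpen_ball
    filter_upwards [o.mem_nhds (x := q) ⟨by rwa [mem_ball, Real.dist_eq],
      by rwa [mem_ball, dist_eq_norm]⟩] with z hz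
    simp only [hχdef]
    rw [θ.one_of_mem_closedBall (ball_subset_closedBall hz.1),
      η.one_of_mem_closedBall (ball_subset_closedBall hz.2), one_mul]
  have main : ∀ q : SpT, e ^ 2 - e ^ 2 / 100 < qψ ν y (9 * e) κ t₀ q → χ q ≠ 0 → V q = 0 :=
    fun q hq hq' => h.uc_weight (qWeight ν y (9 * e) κ t₀) (c₀ := 3 * e ^ 2) (T₀ := 2 * κ * δ)
      (G₀ := 10 * e ^ 2) hκ0 (by positivity) (by positivity)
      (fun ξ => by rw [hAform]; nlinarith [sq_nonneg (∑ i, ν i * ξ i)]) hχ hc htO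
      (fun q hq => by
        obtain ⟨-, h2⟩ := hsup q hq
        have h3 := abs_le.1 (had q)
        rw [hAform, hνG, hGsq]
        nlinarith [mul_nonneg (sub_nonneg.2 h2) he.le, mul_nonneg (by linarith : 0 ≤ a q + d q)
          (by linarith : 0 ≤ e / 2 + a q), mul_nonneg (by linarith : 0 ≤ a q + d q) he.le])
      (fun q hq => by
        obtain ⟨h1, -⟩ := hsup q hq
        rw [qT]
        have := (abs_le.1 h1).1
        nlinarith)
      (fun q hq => by
        obtain ⟨-, h2⟩ := hsup q hq
        have h3 := abs_le.1 (had q)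
        rw [hGsq]
        nlinarith)
      (fun q hq hm => by
        obtain ⟨h1, h2⟩ := hsup q hq
        have h3 := abs_le.1 (had q)
        have hd0 : 0 ≤ d q := norm_nonneg _
        by_cases hr : ‖q.2 - y‖ < ρ'
        · left
          have : V =ᶠ[𝓝 q] fun _ => 0 := by
            have o : IsOpen (ball t₀ δ ×ˢ ball y ρ') := isOpen_ball.prod isOpen_ball
            filter_upwards [o.mem_nhds (x := q) ⟨by
              rw [mem_ball, Real.dist_eq]; linarith, by rwa [mem_ball, dist_eq_norm]⟩] with z hz
            refine hV z.1 z.2 ?_ ?_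
            · rw [← Real.dist_eq]; exact hz.1
            · rw [← dist_eq_norm]; exact hz.2
          exact ⟨this.eq_of_nhds, fun i => by
            rw [(dd_of_eventuallyEq this _).eq_of_nhds, dd_const_fun]⟩
        · right
          have hr2 : ρ' ^ 2 ≤ ‖q.2 - y‖ ^ 2 := pow_le_pow_left₀ hρ0 (not_lt.1 hr) 2
          rw [hzn] at hr2
          have ha1 : 16 * e * a q ≤ d q ^ 2 + e ^ 2 / 500 := by linarith
          have hsp : (e + a q) ^ 2 - 1 / 2 * (d q ^ 2 - a q ^ 2) ≤
              e ^ 2 - 3 / 10 * d q ^ 2 + e ^ 2 / 2500 := by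
            rcases le_total 0 (a q) with h0 | h0
            · nlinarith [mul_nonneg h0 (by linarith : 0 ≤ e / 2 - a q)]
            · nlinarith [mul_nonneg (neg_nonneg.2 h0) (by linarith : 0 ≤ e / 2 + a q)]
          rw [hψv] at hm
          have hd4 : d q < e / 4 := by
            by_contra hcon
            have : (e / 4) ^ 2 ≤ d q ^ 2 := pow_le_pow_left₀ (by positivity) (not_lt.1 hcon) 2
            have : 0 ≤ κ * (q.1 - t₀) ^ 2 := by positivity
            nlinarith
          have ht4 : |q.1 - t₀| < δ / 2 := by
            by_contra hcon
            have h5 : (δ / 2) ^ 2 ≤ (q.1 - t₀) ^ 2 := by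
              rw [← sq_abs (q.1 - t₀)]
              exact pow_le_pow_left₀ (by positivity) (not_lt.1 hcon) 2
            have h6 := mul_le_mul_of_nonneg_left h5 hκ0
            have h7 : κ * (δ / 2) ^ 2 = e ^ 2 := by rw [hκ]; field_simp; norm_num
            nlinarith
          have := hχ1 q ht4 hd4
          exact ⟨heatP_of_eventuallyEq_const this, fun i => by
            rw [(dd_of_eventuallyEq this _).eq_of_nhds, dd_const_fun]⟩) hq hq'
  have hψ0 : qψ ν y (9 * e) κ t₀ (t₀, P) = e ^ 2 := by
    rw [hψv]; simp [ha, hd]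
  have ev1 : ∀ᶠ q in 𝓝 ((t₀, P) : SpT), e ^ 2 - e ^ 2 / 100 < qψ ν y (9 * e) κ t₀ q := by
    refine hcψ.continuousAt.eventually (lt_mem_nhds ?_)
    rw [hψ0]; have : 0 < e ^ 2 := by positivity
    linarith
  have ev2 := hχ1 (t₀, P) (by simp; positivity) (by simp [hd]; positivity)
  filter_upwards [ev1, ev2] with q h1 h2
  exact main q h1 (by rw [h2]; norm_num)

lemma WSol.uc_slice {V : SpT → ℝ} {b : ℝ → E3 → E3} {K : ℝ≥0} (h : WSol V b K)
    {t₀ : ℝ} (ht : t₀ ∈ Ioo (-1 : ℝ) 0) {x₀ : E3} (hx₀ : x₀ ∈ ball (0 : E3) 2)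
    (hV : ∀ᶠ q in 𝓝 (t₀, x₀), V q = 0) : ∀ x ∈ ball (0 : E3) 2, V (t₀, x) = 0 := by
  set O : Set SpT := {q | ∀ᶠ q' in 𝓝 q, V q' = 0} with hO
  have hOo : IsOpen O := isOpen_setOfPred_eventually_nhds
  set Z : Set E3 := {x | ((t₀, x) : SpT) ∈ O} with hZ
  have hZo : IsOpen Z := hOo.preimage (by fun_prop : Continuous fun x : E3 => ((t₀, x) : SpT))
  suffices ball (0 : E3) 2 ⊆ Z from fun x hx =>
    Eventually.self_of_nhds (p := fun q => V q = 0) (this hx)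
  refine (convex_ball (0 : E3) 2).isPreconnected.subset_of_closure_inter_subset hZo
    ⟨x₀, hx₀, hV⟩ fun z ⟨hzc, hzb⟩ => ?_
  by_contra hzZ
  rw [mem_ball_zero_iff] at hzb
  obtain ⟨y, hy, hyz⟩ := Metric.mem_closure_iff.1 hzc ((2 - ‖z‖) / 4) (by linarith)
  obtain ⟨p, hp, hyp⟩ := hZo.isClosed_compl.exists_infDist_eq_dist ⟨z, hzZ⟩ y
  have hρz : dist y p ≤ dist z y := by
    rw [← hyp, dist_comm]; exact infDist_le_dist_of_mem hzZ
  set ρ := dist y p with hρ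
  have hρ0 : 0 < ρ := dist_pos.2 fun h' => hp (h' ▸ hy)
  have hball : ball y ρ ⊆ Z := fun x hx => by
    by_contra hxZ
    have := infDist_le_dist_of_mem (x := y) (show x ∈ Zᶜ from hxZ)
    rw [hyp, dist_comm] at this
    exact absurd hx (not_lt.2 this)
  set ρ' := ρ * (1 - 1 / 64000) with hρ'
  have hcomp : IsCompact (({t₀} : Set ℝ) ×ˢ closedBall y ρ') :=
    isCompact_singleton.prod (isCompact_closedBall _ _)
  have hsub : ({t₀} : Set ℝ) ×ˢ closedBall y ρ' ⊆ O := by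
    rintro ⟨t, x⟩ ⟨h1, h2⟩
    rw [mem_singleton_iff] at h1
    simp only at h1 h2
    subst h1
    exact hball (closedBall_subset_ball (by linarith) h2)
  obtain ⟨δ, hδ, hδO⟩ := hcomp.exists_thickening_subset_open hOo hsub
  have hν : ‖ρ⁻¹ • (p - y)‖ = 1 := by
    rw [norm_smul, norm_inv, Real.norm_of_nonneg hρ0.le, ← dist_eq_norm, dist_comm]
    exact inv_mul_cancel₀ hρ0.ne'
  have hpe : y + (8 * (ρ / 8)) • (ρ⁻¹ • (p - y)) = p := by
    rw [smul_smul, mul_div_cancel₀ _ (by norm_num : (8 : ℝ) ≠ 0), mul_inv_cancel₀ hρ0.ne', one_smul]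
    abel
  refine hp ?_
  have key := h.uc_step (ν := ρ⁻¹ • (p - y)) (y := y) (e := ρ / 8) (ρ' := ρ') (t₀ := t₀)
    (δ := min δ (min ((t₀ + 1) / 2) (-t₀ / 2))) hν (by positivity)
    (lt_min hδ (lt_min (by linarith [ht.1]) (by linarith [ht.2])))
    (by rw [hρ']; nlinarith [sq_nonneg ρ]) (by rw [hρ']; nlinarith) ?_ ?_
  · rwa [hpe] at key
  · rw [hpe]
    have m1 := (min_le_right δ (min ((t₀ + 1) / 2) (-t₀ / 2))).trans (min_le_left _ _)
    have m2 := (min_le_right δ (min ((t₀ + 1) / 2) (-t₀ / 2))).trans (min_le_right _ _)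
    rintro ⟨t, x⟩ ⟨h1, h2⟩
    refine ⟨⟨?_, ?_⟩, ?_⟩
    · linarith [h1.1, ht.1]
    · linarith [h1.2, ht.2]
    · rw [mem_ball_zero_iff]
      simp only [mem_closedBall] at h2
      have t1 : dist x 0 ≤ dist x p + (dist p y + (dist y z + dist z 0)) :=
        (dist_triangle _ p _).trans (add_le_add le_rfl ((dist_triangle _ y _).trans
          (add_le_add le_rfl (dist_triangle _ z _))))
      rw [dist_zero_right, dist_zero_right, dist_comm p y, dist_comm y z] at t1
      simp only at t1 ⊢
      linarith
  · intro t x h1 h2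
    have : ((t, x) : SpT) ∈ O := hδO (mem_thickening_iff.2 ⟨(t₀, x), ⟨rfl, by
      rw [mem_closedBall, dist_eq_norm]; exact h2.le⟩, by
      rw [Prod.dist_eq]; simp only [dist_self, max_lt_iff]
      exact ⟨by rw [Real.dist_eq]; exact h1.trans_le (min_le_left _ _), hδ⟩⟩)
    exact Eventually.self_of_nhds (p := fun q => V q = 0) this

lemma WSol.dichotomy {V : SpT → ℝ} {b : ℝ → E3 → E3} {K : ℝ≥0} (h : WSol V b K)
    (hb : ContDiffOn ℝ 1 (fun p : SpT => b p.1 p.2) (Qlt 1 2 1))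
    (hd : ∀ p ∈ Om, divb b p = 0 ∨ V p = 0) {t : ℝ} (ht : t ∈ Ioo (-1 : ℝ) 0) :
    (∀ x ∈ ball (0 : E3) 2, divb b (t, x) = 0) ∨ ∀ x ∈ ball (0 : E3) 2, V (t, x) = 0 := by
  have hbO := hb.mono Om_subset_Qlt
  have hdiv : ∀ p ∈ Om, divb b p = ∑ i, (fderiv ℝ (fun p : SpT => b p.1 p.2) p (0, e3 i)) i :=
    fun p hp => by
    have hda : DifferentiableAt ℝ (fun p : SpT => b p.1 p.2) p :=
      (hbO.contDiffAt (isOpen_Om.mem_nhds hp)).differentiableAt (by norm_num)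
    refine Finset.sum_congr rfl fun i _ => ?_
    have h1 : HasFDerivAt (fun y : E3 => ((p.1, y) : SpT)) (ContinuousLinearMap.inr ℝ ℝ E3) p.2 :=
      hasFDerivAt_prodMk_right p.1 p.2
    have h3 : HasFDerivAt ((fun p : SpT => b p.1 p.2) ∘ fun y : E3 => ((p.1, y) : SpT)) _ p.2 :=
      HasFDerivAt.comp p.2 hda.hasFDerivAt h1
    have h2 : HasFDerivAt (fun y : E3 => b p.1 y i) _ p.2 :=
      HasFDerivAt.comp p.2 (EuclideanSpace.proj i : E3 →L[ℝ] ℝ).hasFDerivAt h3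
    rw [h2.fderiv]
    simp
  have hcont : ContinuousOn (divb b) Om := by
    refine ContinuousOn.congr ?_ hdiv
    have := hbO.continuousOn_fderiv_of_isOpen isOpen_Om le_rfl
    refine continuousOn_finsetSum _ fun i _ => ?_
    exact (EuclideanSpace.proj i : E3 →L[ℝ] ℝ).continuous.comp_continuousOn
      (this.clm_apply continuousOn_const)
  by_cases hall : ∀ x ∈ ball (0 : E3) 2, divb b (t, x) = 0
  · exact Or.inl hall
  · right
    push Not at hall
    obtain ⟨x, hx, hne⟩ := hall
    have hp : ((t, x) : SpT) ∈ Om := ⟨ht, hx⟩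
    refine h.uc_slice ht hx ?_
    have ca : ContinuousAt (divb b) (t, x) := hcont.continuousAt (isOpen_Om.mem_nhds hp)
    filter_upwards [ca.eventually_ne hne, isOpen_Om.mem_nhds hp] with q hq hqO
    exact (hd q hqO).resolve_left hq

lemma integrable_of_ball {f : E3 → ℝ} {r M : ℝ}
    (hm : AEStronglyMeasurable f (volume.restrict (closedBall (0 : E3) r)))
    (hb : ∀ x ∈ closedBall (0 : E3) r, |f x| ≤ M) (h0 : ∀ x ∉ closedBall (0 : E3) r, f x = 0) :
    Integrable f := by
  have : IntegrableOn f (closedBall (0 : E3) r) := by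
    refine IntegrableOn.of_bound measure_closedBall_lt_top hm M ?_
    filter_upwards [ae_restrict_mem measurableSet_closedBall] with x hx using hb x hx
  refine (integrableOn_iff_integrable_of_support_subset fun x hx => ?_).1 this
  by_contra h
  exact hx (h0 x h)

lemma exists_lip_comp {α : Type*} [PseudoMetricSpace α] {H H1 : ℝ → ℝ}
    (hH : ∀ u, u ∈ Ioo (0:ℝ) 2 → HasDerivAt H (H1 u) u) (hH1 : ContinuousOn H1 (Ioo 0 2)) {δ : ℝ} (hδ : 0 < δ)
    {U : α → ℝ} {K : ℝ≥0} (hU : LipschitzWith K U) (lb : ∀ p, δ ≤ U p) (ub : ∀ p, U p ≤ 1) :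
    ∃ L M : ℝ≥0, LipschitzWith L (fun p => H (U p)) ∧ ∀ p, |H (U p)| ≤ M := by
  have hsub : Icc δ 1 ⊆ Ioo (0 : ℝ) 2 := fun u hu =>
    ⟨hδ.trans_le hu.1, hu.2.trans_lt one_lt_two⟩
  obtain ⟨L, hL⟩ := isCompact_Icc.exists_bound_of_continuousOn (hH1.mono hsub)
  have hHc : ContinuousOn H (Icc δ 1) := fun u hu =>
    (hH u (hsub hu)).continuousAt.continuousWithinAt
  obtain ⟨M, hM⟩ := isCompact_Icc.exists_bound_of_continuousOn hHc
  have h1 : LipschitzOnWith L.toNNReal H (Icc δ 1) := by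
    refine (convex_Icc δ 1).lipschitzOnWith_of_nnnorm_hasDerivWithin_le (f' := H1)
      (fun u hu => (hH u (hsub hu)).hasDerivWithinAt) fun u hu => ?_
    rw [← NNReal.coe_le_coe, coe_nnnorm]
    exact (hL u hu).trans (Real.le_coe_toNNReal _)
  refine ⟨L.toNNReal * K, M.toNNReal, ?_, fun p => (hM _ ⟨lb p, ub p⟩).trans (Real.le_coe_toNNReal _)⟩
  have := h1.comp (hU.lipschitzOnWith (s := univ)) (fun p _ => ⟨lb p, ub p⟩)
  exact lipschitzOnWith_univ.1 this

lemma fderiv_eq_zero_of_ball {f : E3 → ℝ} {r : ℝ} (h0 : ∀ x, r ≤ ‖x‖ → f x = 0) {x : E3}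
    (hx : r < ‖x‖) : fderiv ℝ f x = 0 := by
  have : f =ᶠ[𝓝 x] fun _ => 0 := by
    filter_upwards [(isOpen_lt continuous_const continuous_norm).mem_nhds hx] with y hy
    exact h0 y (le_of_lt hy)
  rw [this.fderiv_eq]; simp

lemma drift_ibp {β : E3 → E3} (hβ : ContDiffOn ℝ 1 β (ball 0 2))
    (hdiv : ∀ x ∈ ball (0 : E3) 2, ∑ i, fderiv ℝ (fun y => β y i) x (e3 i) = 0) {Φ : E3 → ℝ}
    {L : ℝ≥0} (hΦ : LipschitzWith L Φ) {r : ℝ} (hr0 : 0 < r) (hr : r < 2)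
    (h0 : ∀ x, r ≤ ‖x‖ → Φ x = 0) :
    ∫ x, ∑ i, β x i * fderiv ℝ Φ x (e3 i) = 0 := by
  let χ : ContDiffBump (0 : E3) := ⟨r + (2 - r) / 3, r + 2 * (2 - r) / 3, by linarith, by linarith⟩
  have hcβ : ∀ i, ContDiff ℝ 1 fun x => χ x * β x i := fun i => by
    rw [contDiff_iff_contDiffAt]
    intro x
    by_cases hx : x ∈ ball (0 : E3) 2
    · have h1 : ContDiffAt ℝ 1 β x := hβ.contDiffAt (isOpen_ball.mem_nhds hx)
      have h2 : ContDiffAt ℝ 1 (fun x => β x i) x :=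
        ((EuclideanSpace.proj i : E3 →L[ℝ] ℝ).contDiff.contDiffAt).comp x h1
      exact (χ.contDiff.contDiffAt).mul h2
    · have hx' : x ∉ tsupport χ := by
        rw [χ.tsupport_eq]; simp only [mem_closedBall, mem_ball, not_le, not_lt] at *
        show r + 2 * (2 - r) / 3 < _
        linarith
      have := notMem_tsupport_iff_eventuallyEq.1 hx'
      refine (contDiffAt_const (c := (0 : ℝ))).congr_of_eventuallyEq ?_
      filter_upwards [this] with y hy
      rw [hy]; simp
  have hcs : ∀ i, HasCompactSupport fun x => χ x * β x i := fun i => χ.hasCompactSupport.mul_right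
  have hlip : ∀ i, ∃ Li, LipschitzWith Li fun x => χ x * β x i := fun i =>
    (hcβ i).lipschitzWith_of_hasCompactSupport (hcs i) (by norm_num)
  have hΦc : HasCompactSupport Φ := HasCompactSupport.intro (isCompact_closedBall (0 : E3) r)
    fun x hx => h0 x (by simp only [mem_closedBall, dist_zero_right, not_le] at hx; exact hx.le)
  have key : ∀ i, ∫ x, (χ x * β x i) * fderiv ℝ Φ x (e3 i) =
      -∫ x, fderiv ℝ (fun x => χ x * β x i) x (e3 i) * Φ x := fun i => by
    obtain ⟨Li, hLi⟩ := hlip i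
    have := hLi.integral_lineDeriv_mul_eq (μ := volume) hΦ hΦc (-e3 i)
    have e1 : ∀ᵐ x, lineDeriv ℝ (fun x => χ x * β x i) x (-e3 i) * Φ x =
        -(fderiv ℝ (fun x => χ x * β x i) x (e3 i) * Φ x) := Eventually.of_forall fun x => by
      rw [(((hcβ i).differentiable (by norm_num)) x).lineDeriv_eq_fderiv]; simp
    have e2 : ∀ᵐ x, lineDeriv ℝ Φ x (- -e3 i) * (χ x * β x i) =
        (χ x * β x i) * fderiv ℝ Φ x (e3 i) := by
      filter_upwards [hΦ.ae_differentiableAt] with x hx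
      rw [hx.lineDeriv_eq_fderiv, neg_neg]; ring
    rw [integral_congr_ae e1, integral_congr_ae e2, integral_neg] at this
    exact this.symm
  have hr1 : ∀ x : E3, ‖x‖ ≤ r → χ =ᶠ[𝓝 x] fun _ => 1 := fun x hx => by
    filter_upwards [isOpen_ball.mem_nhds (show x ∈ ball (0 : E3) (r + (2 - r) / 3) by
      rw [mem_ball_zero_iff]; linarith)] with y hy
    exact χ.one_of_mem_closedBall (ball_subset_closedBall hy)
  have iL : ∀ i, Integrable fun x => (χ x * β x i) * fderiv ℝ Φ x (e3 i) := fun i => by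
    have h1 : Integrable fun x => χ x * β x i := (hcβ i).continuous.integrable_of_hasCompactSupport (hcs i)
    refine h1.mul_bdd (c := L) ?_ ?_
    · exact (measurable_fderiv_apply_const ℝ Φ _).aestronglyMeasurable
    · refine Eventually.of_forall fun x => ((fderiv ℝ Φ x).le_opNorm _).trans ?_
      simpa using norm_fderiv_le_of_lipschitz ℝ hΦ
  have iR : ∀ i, Integrable fun x => fderiv ℝ (fun x => χ x * β x i) x (e3 i) * Φ x := fun i => by
    refine Continuous.integrable_of_hasCompactSupport ?_ hΦc.mul_left
    exact (((hcβ i).continuous_fderiv (by norm_num)).clm_apply continuous_const).mul hΦ.continuous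
  calc ∫ x, ∑ i, β x i * fderiv ℝ Φ x (e3 i)
      = ∫ x, ∑ i, (χ x * β x i) * fderiv ℝ Φ x (e3 i) := by
        congr 1; ext x
        refine Finset.sum_congr rfl fun i _ => ?_
        rcases le_or_gt ‖x‖ r with hx | hx
        · rw [(hr1 x hx).eq_of_nhds]; ring
        · rw [fderiv_eq_zero_of_ball h0 hx]; simp
    _ = -∑ i, ∫ x, fderiv ℝ (fun x => χ x * β x i) x (e3 i) * Φ x := by
        rw [integral_finsetSum _ fun i _ => iL i, ← Finset.sum_neg_distrib]
        exact Finset.sum_congr rfl fun i _ => key i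
    _ = -∫ x, ∑ i, fderiv ℝ (fun x => χ x * β x i) x (e3 i) * Φ x := by
        rw [integral_finsetSum _ fun i _ => iR i]
    _ = 0 := by
        rw [neg_eq_zero]
        refine Eq.trans (integral_congr_ae (Eventually.of_forall fun x => ?_))
          (integral_zero E3 ℝ)
        simp only
        rcases lt_or_ge ‖x‖ r with hx | hx
        · rw [← Finset.sum_mul]
          have : ∀ i, fderiv ℝ (fun x => χ x * β x i) x = fderiv ℝ (fun x => β x i) x := fun i => by
            refine Filter.EventuallyEq.fderiv_eq ?_
            filter_upwards [hr1 x hx.le] with y hy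
            rw [hy, one_mul]
          simp only [this]
          rw [hdiv x (by rw [mem_ball_zero_iff]; linarith), zero_mul]
        · simp [h0 x hx]

/-- The spatial gradient of a space-time function. -/
def gradS (U : SpT → ℝ) (t : ℝ) (x : E3) : E3 →L[ℝ] ℝ := fderiv ℝ (fun y => U (t, y)) x

lemma gradS_bound {U : SpT → ℝ} {K : ℝ≥0} (hU : LipschitzWith K U) (t : ℝ) (x : E3) :
    ‖gradS U t x‖ ≤ K := norm_fderiv_le_of_lipschitz ℝ (lipschitz_slice hU t)

/-- The weighted integral of a function of the solution over time slices. -/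
def sliceInt (H : ℝ → ℝ) (U : SpT → ℝ) (ψ : E3 → ℝ) (t : ℝ) : ℝ := ∫ x, H (U (t, x)) * ψ x

lemma integrable_cutoff {ψ : E3 → ℝ} (hψ : Continuous ψ) {r : ℝ} (h0 : ∀ x, r ≤ ‖x‖ → ψ x = 0) :
    Integrable ψ :=
  hψ.integrable_of_hasCompactSupport (HasCompactSupport.intro (isCompact_closedBall (0 : E3) r)
    fun x hx => h0 x (by simp only [mem_closedBall, dist_zero_right, not_le] at hx; exact hx.le))

lemma sliceInt_lip {H : ℝ → ℝ} {U : SpT → ℝ} {ψ : E3 → ℝ} {LH MH : ℝ≥0}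
    (hL : LipschitzWith LH fun p => H (U p)) (hM : ∀ p, |H (U p)| ≤ MH) (hψ : Continuous ψ) {r : ℝ}
    (h0 : ∀ x, r ≤ ‖x‖ → ψ x = 0) : ∃ L, LipschitzWith L (sliceInt H U ψ) := by
  have hi := integrable_cutoff hψ h0
  have hi2 : ∀ t, Integrable fun x => H (U (t, x)) * ψ x := fun t =>
    hi.bdd_mul ((lipschitz_slice hL t).continuous.aestronglyMeasurable)
      (Eventually.of_forall fun x => hM (t, x))
  refine ⟨LH * (∫ x, |ψ x|).toNNReal, LipschitzWith.of_dist_le_mul fun t s => ?_⟩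
  rw [dist_eq_norm, sliceInt, sliceInt, ← integral_sub (hi2 t) (hi2 s)]
  have hpos : 0 ≤ ∫ x, |ψ x| := integral_nonneg fun x => abs_nonneg _
  push_cast
  rw [Real.coe_toNNReal _ hpos, mul_right_comm, ← integral_const_mul]
  refine norm_integral_le_of_norm_le (hi.abs.const_mul _) (Eventually.of_forall fun x => ?_)
  rw [← sub_mul, norm_mul]
  refine mul_le_mul_of_nonneg_right ?_ (abs_nonneg _)
  have := (lipschitz_tslice hL x).dist_le_mul t s
  rwa [dist_eq_norm] at this

lemma sliceInt_hasDerivAt {H H1 : ℝ → ℝ} (hH : ∀ u, u ∈ Ioo (0:ℝ) 2 → HasDerivAt H (H1 u) u)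
    {U : SpT → ℝ} (hpos : ∀ p, U p ∈ Ioo (0:ℝ) 2) {ψ : E3 → ℝ} {LH MH : ℝ≥0}
    (hL : LipschitzWith LH fun p => H (U p)) (hM : ∀ p, |H (U p)| ≤ MH) (hψ : Continuous ψ) {r : ℝ}
    (h0 : ∀ x, r ≤ ‖x‖ → ψ x = 0) {t : ℝ} (ht : ∀ᵐ x : E3, DifferentiableAt ℝ U (t, x))
    (hm : AEStronglyMeasurable (fun x => H1 (U (t, x)) * dt U (t, x) * ψ x)) :
    HasDerivAt (sliceInt H U ψ) (∫ x, H1 (U (t, x)) * dt U (t, x) * ψ x) t := by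
  have hi := integrable_cutoff hψ h0
  have hi2 : ∀ t, Integrable fun x => H (U (t, x)) * ψ x := fun t =>
    hi.bdd_mul ((lipschitz_slice hL t).continuous.aestronglyMeasurable)
      (Eventually.of_forall fun x => hM (t, x))
  refine (hasDerivAt_integral_of_dominated_loc_of_lip (μ := volume)
    (F := fun t x => H (U (t, x)) * ψ x) (bound := fun x => LH * |ψ x|) (ball_mem_nhds t one_pos)
    (Eventually.of_forall fun s => (hi2 s).aestronglyMeasurable) (hi2 t) hm
    (Eventually.of_forall fun x => ?_) (hi.abs.const_mul _) ?_).2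
  · refine LipschitzOnWith.of_dist_le_mul fun s _ s' _ => ?_
    have := (lipschitz_tslice hL x).dist_le_mul s s'
    rw [dist_eq_norm] at this ⊢
    rw [← sub_mul, norm_mul, Real.coe_nnabs, abs_mul, abs_abs, NNReal.abs_eq, mul_right_comm]
    exact mul_le_mul_of_nonneg_right this (abs_nonneg _)
  · filter_upwards [ht] with x hx
    have h1 := dt_eq_pdt hx
    exact ((hH _ (hpos (t, x))).comp t h1).mul_const (ψ x)

lemma lin_fderiv_integrable {β : E3 → E3} (hβ : ContinuousOn β (ball 0 2)) {Φ : E3 → ℝ}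
    {L : ℝ≥0} (hΦ : LipschitzWith L Φ) {r : ℝ} (hr : r < 2) {g : E3 → ℝ}
    (h0 : ∀ x, r < ‖x‖ → g x = 0 ∨ fderiv ℝ Φ x = 0) (hg : AEStronglyMeasurable g) {M : ℝ} (hM : ∀ x, |g x| ≤ M) :
    Integrable fun x => g x * fderiv ℝ Φ x (β x) := by
  have hβ' : ContinuousOn β (closedBall 0 r) := hβ.mono (closedBall_subset_ball hr)
  obtain ⟨C, hC⟩ := (isCompact_closedBall (0 : E3) r).exists_bound_of_continuousOn hβ'
  have hM0 : 0 ≤ M := (abs_nonneg _).trans (hM 0)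
  refine integrable_of_ball (r := r) (M := M * (L * C)) ?_ (fun x hx => ?_) fun x hx => ?_
  · refine hg.restrict.mul ?_
    have h1 : ∀ i, AEStronglyMeasurable (fun x => β x i) (volume.restrict (closedBall (0 : E3) r)) :=
      fun i => ContinuousOn.aestronglyMeasurable
        ((EuclideanSpace.proj i : E3 →L[ℝ] ℝ).continuous.comp_continuousOn hβ')
        measurableSet_closedBall
    simp only [clm_apply_eq _ (β _)]
    exact Finset.aestronglyMeasurable_fun_sum _ fun i _ => (h1 i).mul
      (measurable_fderiv_apply_const ℝ Φ (e3 i)).aestronglyMeasurable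
  · rw [abs_mul]
    refine mul_le_mul (hM x) ?_ (abs_nonneg _) hM0
    refine ((fderiv ℝ Φ x).le_opNorm _).trans ?_
    exact mul_le_mul (norm_fderiv_le_of_lipschitz ℝ hΦ) (hC x hx) (norm_nonneg _) L.2
  · rcases h0 x (by simpa using hx) with h | h <;> simp [h]

lemma norm_fderiv_integrable {β : E3 → E3} (hβ : ContinuousOn β (ball 0 2)) {Φ : E3 → ℝ}
    {L : ℝ≥0} (hΦ : LipschitzWith L Φ) {r : ℝ} (hr : r < 2) (h0 : ∀ x, r ≤ ‖x‖ → Φ x = 0)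
    {g : E3 → ℝ} (hg : AEStronglyMeasurable g) {M : ℝ} (hM : ∀ x, |g x| ≤ M) :
    Integrable fun x => g x * (‖β x‖ * ‖fderiv ℝ Φ x‖) := by
  have hβ' : ContinuousOn β (closedBall 0 r) := hβ.mono (closedBall_subset_ball hr)
  obtain ⟨C, hC⟩ := (isCompact_closedBall (0 : E3) r).exists_bound_of_continuousOn hβ'
  have hM0 : 0 ≤ M := (abs_nonneg _).trans (hM 0)
  refine integrable_of_ball (r := r) (M := M * (C * L)) ?_ (fun x hx => ?_) fun x hx => ?_
  · exact hg.restrict.mul ((hβ'.aestronglyMeasurable measurableSet_closedBall).norm.mul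
      (measurable_fderiv ℝ Φ).norm.aestronglyMeasurable)
  · rw [abs_mul, abs_mul, abs_norm, abs_norm]
    have := hC x hx
    refine mul_le_mul (hM x) ?_ (by positivity) hM0
    exact mul_le_mul this (norm_fderiv_le_of_lipschitz ℝ hΦ) (norm_nonneg _)
      ((norm_nonneg _).trans this)
  · rw [fderiv_eq_zero_of_ball h0 (by simpa using hx)]; simp

lemma drift_slice_bound {β : E3 → E3} (hβ : ContDiffOn ℝ 1 β (ball 0 2)) {H H1 : ℝ → ℝ}
    (hH : ∀ u, u ∈ Ioo (0:ℝ) 2 → HasDerivAt H (H1 u) u) (hH1 : ContinuousOn H1 (Ioo 0 2))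
    {δ : ℝ} (hδ : 0 < δ) {u : E3 → ℝ} {K : ℝ≥0}
    (hu : LipschitzWith K u) (lb : ∀ p, δ ≤ u p) (ub : ∀ p, u p ≤ 1)
    (hd : (∀ x ∈ ball (0 : E3) 2, ∑ i, fderiv ℝ (fun y => β y i) x (e3 i) = 0) ∨
      ∃ c, ∀ x ∈ ball (0 : E3) 2, u x = c) {ψ : E3 → ℝ} {L : ℝ≥0} (hψ : LipschitzWith L ψ)
    (hψ1 : ∀ x, |ψ x| ≤ 1) (h0 : ∀ x, 7 / 4 ≤ ‖x‖ → ψ x = 0) (c : ℝ) :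
    -∫ x, H1 (u x) * fderiv ℝ u x (β x) * ψ x ≤
      ∫ x, |H (u x) - c| * (‖β x‖ * ‖fderiv ℝ ψ x‖) := by
  rcases hd with hd | ⟨c0, hc0⟩
  · obtain ⟨LH, MH, hLH, hMH⟩ := exists_lip_comp hH hH1 hδ hu lb ub
    have hLc : LipschitzWith LH fun x => H (u x) - c := by
      simpa using hLH.sub (LipschitzWith.const c)
    have hMc : ∀ x, |H (u x) - c| ≤ (MH + ‖c‖₊ : ℝ≥0) := fun x => by
      push_cast
      exact (abs_sub _ _).trans (add_le_add (hMH x) le_rfl)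
    set Φ : E3 → ℝ := fun x => (H (u x) - c) * ψ x with hΦdef
    have hΦ := LipschitzWith.mul_of_bound (N := 1) hLc hψ hMc (by simpa using hψ1)
    have hΦ0 : ∀ x, 7 / 4 ≤ ‖x‖ → Φ x = 0 := fun x hx => by simp [hΦdef, h0 x hx]
    have key := drift_ibp hβ hd hΦ (by norm_num : (0:ℝ) < 7 / 4) (by norm_num) hΦ0
    simp only [← clm_apply_eq _ (β _)] at key
    have iA : Integrable fun x => fderiv ℝ Φ x (β x) := by
      simpa using lin_fderiv_integrable hβ.continuousOn hΦ (by norm_num : (7:ℝ)/4 < 2)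
        (g := fun _ => 1) (fun x hx => Or.inr (fderiv_eq_zero_of_ball hΦ0 hx)) aestronglyMeasurable_const (M := 1) (by simp)
    have iE := lin_fderiv_integrable hβ.continuousOn hψ (by norm_num : (7:ℝ)/4 < 2)
      (fun x hx => Or.inr (fderiv_eq_zero_of_ball h0 hx)) hLc.continuous.aestronglyMeasurable hMc
    have e : ∀ᵐ x : E3, H1 (u x) * fderiv ℝ u x (β x) * ψ x =
        fderiv ℝ Φ x (β x) - (H (u x) - c) * fderiv ℝ ψ x (β x) := by
      filter_upwards [hu.ae_differentiableAt, hψ.ae_differentiableAt] with x h1 h2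
      have h3 := (((hH _ ⟨hδ.trans_le (lb x), (ub x).trans_lt one_lt_two⟩).comp_hasFDerivAt x h1.hasFDerivAt).sub_const c).mul
        h2.hasFDerivAt
      have h4 : HasFDerivAt Φ _ x := h3
      rw [h4.fderiv]
      simp
      ring
    rw [integral_congr_ae e, integral_sub iA iE, key, zero_sub, neg_neg]
    refine integral_mono iE (norm_fderiv_integrable hβ.continuousOn hψ
      (by norm_num : (7:ℝ)/4 < 2) h0 hLc.continuous.abs.aestronglyMeasurable
      (M := (MH + ‖c‖₊ : ℝ≥0)) (by simpa using hMc)) fun x => ?_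
    refine (le_abs_self _).trans ?_
    rw [abs_mul]
    refine mul_le_mul_of_nonneg_left ?_ (abs_nonneg _)
    rw [mul_comm]
    exact (fderiv ℝ ψ x).le_opNorm _
  · have : ∀ᵐ x : E3, H1 (u x) * fderiv ℝ u x (β x) * ψ x = 0 := by
      refine Eventually.of_forall fun x => ?_
      by_cases hx : x ∈ ball (0 : E3) 2
      · have : u =ᶠ[𝓝 x] fun _ => c0 := by
          filter_upwards [isOpen_ball.mem_nhds hx] with y hy using hc0 y hy
        rw [this.fderiv_eq]; simp
      · rw [h0 x]
        · simp
        · simp only [mem_ball, dist_zero_right, not_lt] at hx; linarith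
    rw [integral_congr_ae this]
    simp only [integral_zero, neg_zero]
    exact integral_nonneg fun x => by positivity

/-- Data for a bounded Lipschitz function to which the energy method applies: `B` bounds the
drift on the region of interest. -/
structure Slab (U B : SpT → ℝ) (K : ℝ≥0) (δ : ℝ) : Prop where
  lip : LipschitzWith K U
  hδ : 0 < δ
  lb : ∀ p, δ ≤ U p
  ub : ∀ p, U p ≤ 1
  Bm : Measurable B
  B0 : ∀ p, 0 ≤ B p
  Bb : ∃ M, ∀ p, B p ≤ M
  Bs : ∀ p, 2 ≤ ‖p.2‖ → B p = 0
  si : ∀ H H1 H2 : ℝ → ℝ, (∀ u, u ∈ Ioo (0:ℝ) 2 → HasDerivAt H (H1 u) u) →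
    (∀ u, u ∈ Ioo (0:ℝ) 2 → HasDerivAt H1 (H2 u) u) → ContinuousOn H2 (Ioo 0 2) →
    ∀ (ψ : E3 → ℝ) (L : ℝ≥0), LipschitzWith L ψ → (∀ x, 0 ≤ ψ x) → (∀ x, ψ x ≤ 1) →
    (∀ x, 7 / 4 ≤ ‖x‖ → ψ x = 0) →
    ∀ᵐ t, t ∈ Ioo (-1 : ℝ) 0 → ∀ c, deriv (sliceInt H U ψ) t ≤
      -(∫ x, H2 (U (t, x)) * ‖gradS U t x‖ ^ 2 * ψ x) +
      (∫ x, |H1 (U (t, x))| * ‖gradS U t x‖ * ‖fderiv ℝ ψ x‖) +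
      ∫ x, |H (U (t, x)) - c| * (B (t, x) * ‖fderiv ℝ ψ x‖)

lemma gradS_slice_measurable {U : SpT → ℝ} (t : ℝ) : Measurable (gradS U t) :=
  measurable_fderiv ℝ _

lemma WSol.energy {U : SpT → ℝ} {b : ℝ → E3 → E3} {K : ℝ≥0} (h : WSol U b K)
    (hb : ContDiffOn ℝ 1 (fun p : SpT => b p.1 p.2) (Qlt 1 2 1))
    (hd : ∀ t ∈ Ioo (-1 : ℝ) 0, (∀ x ∈ ball (0 : E3) 2, divb b (t, x) = 0) ∨
      ∃ c, ∀ x ∈ ball (0 : E3) 2, U (t, x) = c)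
    {δ : ℝ} (hδ : 0 < δ) (lb : ∀ p, δ ≤ U p) (ub : ∀ p, U p ≤ 1)
    {H H1 H2 : ℝ → ℝ} (hH : ∀ u, u ∈ Ioo (0:ℝ) 2 → HasDerivAt H (H1 u) u)
    (hH1 : ∀ u, u ∈ Ioo (0:ℝ) 2 → HasDerivAt H1 (H2 u) u) (hH2 : ContinuousOn H2 (Ioo 0 2))
    {ψ : E3 → ℝ} {L : ℝ≥0} (hψ : LipschitzWith L ψ) (hψ0 : ∀ x, 0 ≤ ψ x) (hψ1 : ∀ x, ψ x ≤ 1)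
    (h0 : ∀ x, 7 / 4 ≤ ‖x‖ → ψ x = 0) :
    ∀ᵐ t, t ∈ Ioo (-1 : ℝ) 0 → ∀ c, deriv (sliceInt H U ψ) t ≤
      -(∫ x, H2 (U (t, x)) * ‖gradS U t x‖ ^ 2 * ψ x) +
      (∫ x, |H1 (U (t, x))| * ‖gradS U t x‖ * ‖fderiv ℝ ψ x‖) +
      ∫ x, |H (U (t, x)) - c| * (‖b t x‖ * ‖fderiv ℝ ψ x‖) := by
  have hH1c : ContinuousOn H1 (Ioo 0 2) := fun u hu => (hH1 u hu).continuousAt.continuousWithinAt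
  have hψa : ∀ x, |ψ x| ≤ 1 := fun x => by rw [abs_of_nonneg (hψ0 x)]; exact hψ1 x
  obtain ⟨LH, MH, hLH, hMH⟩ := exists_lip_comp hH hH1c hδ h.lip lb ub
  obtain ⟨L1, M1, hL1, hM1⟩ := exists_lip_comp hH1 hH2 hδ h.lip lb ub
  obtain ⟨M2, hM2⟩ : ∃ M2 : ℝ, ∀ p, |H2 (U p)| ≤ M2 := by
    obtain ⟨C, hC⟩ := (isCompact_Icc (a := δ) (b := 1)).exists_bound_of_continuousOn
      (hH2.mono fun x hx => ⟨hδ.trans_le hx.1, hx.2.trans_lt one_lt_two⟩)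
    exact ⟨C, fun p => hC _ ⟨lb p, ub p⟩⟩
  have hLψ : LipschitzWith L fun p : SpT => ψ p.2 := by
    have := hψ.comp (LipschitzWith.prod_snd : LipschitzWith 1 (Prod.snd : SpT → E3))
    rwa [mul_one] at this
  have hφ := LipschitzWith.mul_of_bound (N := 1) hL1 hLψ hM1 (fun p => by simpa using hψa p.2)
  set φ : SpT → ℝ := fun p => H1 (U p) * ψ p.2 with hφdef
  have hφM : ∀ p, |φ p| ≤ M1 := fun p => by
    rw [hφdef, abs_mul]
    simpa using mul_le_mul (hM1 p) (hψa p.2) (abs_nonneg _) M1.2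
  have hφ0 : ∀ t x, 7 / 4 ≤ ‖x‖ → φ (t, x) = 0 := fun t x hx => by simp [hφdef, h0 x hx]
  filter_upwards [h.slice hφ hφM (by norm_num : (7:ℝ) / 4 < 2) hφ0, ae_ae_differentiableAt h.lip]
    with t h1 hdiff ht c
  specialize h1 ht
  have hQ : ∀ x ∈ ball (0 : E3) 2, (t, x) ∈ Qlt 1 2 1 := fun x hx =>
    Om_subset_Qlt ⟨ht, hx⟩
  have hβ : ContDiffOn ℝ 1 (b t) (ball 0 2) :=
    hb.comp (f := fun x : E3 => ((t, x) : SpT)) (by fun_prop) hQ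
  have us := lipschitz_slice h.lip t
  have hUc := us.continuous
  have hcont : ∀ {F : ℝ → ℝ}, ContinuousOn F (Ioo 0 2) → Continuous fun x => F (U (t, x)) :=
    fun {F} hF => hF.comp_continuous hUc fun x => ⟨hδ.trans_le (lb _), (ub _).trans_lt one_lt_two⟩
  have hHc : ContinuousOn H (Ioo 0 2) := fun u hu => (hH u hu).continuousAt.continuousWithinAt
  have hψi := integrable_cutoff hψ.continuous h0
  have gb : ∀ x, ‖gradS U t x‖ ≤ K := gradS_bound h.lip t
  -- integrability of the four terms
  have i1 : Integrable fun x => H1 (U (t, x)) * dt U (t, x) * ψ x := by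
    refine hψi.bdd_mul (c := M1 * K) ?_ (Eventually.of_forall fun x => ?_)
    · exact (hcont hH1c).aestronglyMeasurable.mul
        ((dt_measurable U).comp measurable_prodMk_left).aestronglyMeasurable
    · rw [norm_mul]
      exact mul_le_mul (hM1 _) (dt_bound h.lip _) (norm_nonneg _) M1.2
  have i2 : Integrable fun x => H2 (U (t, x)) * ‖gradS U t x‖ ^ 2 * ψ x := by
    refine hψi.bdd_mul (c := M2 * K ^ 2) ?_ (Eventually.of_forall fun x => ?_)
    · exact (hcont hH2).aestronglyMeasurable.mul
        ((gradS_slice_measurable t).norm.pow_const 2).aestronglyMeasurable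
    · rw [norm_mul]
      refine mul_le_mul (hM2 _) ?_ (norm_nonneg _) ((abs_nonneg _).trans (hM2 (t, 0)))
      rw [norm_pow, norm_norm]
      exact pow_le_pow_left₀ (norm_nonneg _) (gb x) 2
  have i3m : Measurable fun x => ∑ i, gradS U t x (e3 i) * fderiv ℝ ψ x (e3 i) :=
    Finset.measurable_fun_sum _ fun i _ =>
      (measurable_fderiv_apply_const ℝ _ _).mul (measurable_fderiv_apply_const ℝ _ _)
  have i3 : Integrable fun x => |H1 (U (t, x))| * ‖gradS U t x‖ * ‖fderiv ℝ ψ x‖ := by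
    refine integrable_of_ball (r := 7 / 4) (M := M1 * K * L) ?_ (fun x hx => ?_) fun x hx => ?_
    · exact (((hcont hH1c).abs.measurable.mul (gradS_slice_measurable t).norm).mul
        (measurable_fderiv ℝ ψ).norm).aestronglyMeasurable
    · simp only [abs_mul, abs_abs, abs_norm]
      exact mul_le_mul (mul_le_mul (hM1 _) (gb x) (norm_nonneg _) M1.2)
        (norm_fderiv_le_of_lipschitz ℝ hψ) (norm_nonneg _) (by positivity)
    · rw [fderiv_eq_zero_of_ball h0 (by simpa using hx)]; simp
  have i3' : Integrable fun x => H1 (U (t, x)) *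
      ∑ i, gradS U t x (e3 i) * fderiv ℝ ψ x (e3 i) := by
    refine i3.mono' ((hcont hH1c).measurable.mul i3m).aestronglyMeasurable
      (Eventually.of_forall fun x => ?_)
    rw [norm_mul, mul_assoc]
    exact mul_le_mul_of_nonneg_left (abs_sum_mul_le _ _) (abs_nonneg _)
  have i4 : Integrable fun x => H1 (U (t, x)) * gradS U t x (b t x) * ψ x := by
    have := lin_fderiv_integrable (g := fun x => H1 (U (t, x)) * ψ x) (M := M1) hβ.continuousOn us
      (by norm_num : (7:ℝ)/4 < 2) (fun x hx => Or.inl (by rw [h0 x hx.le, mul_zero]))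
      ((hcont hH1c).mul hψ.continuous).aestronglyMeasurable (fun x => hφM (t, x))
    refine this.congr (Eventually.of_forall fun x => ?_)
    simp only [gradS]
    ring
  have hder := sliceInt_hasDerivAt hH (fun p => ⟨hδ.trans_le (lb p), (ub p).trans_lt one_lt_two⟩) hLH hMH hψ.continuous h0 hdiff
    i1.aestronglyMeasurable
  have hexp : ∀ᵐ x : E3, weakF U b φ (t, x) = H1 (U (t, x)) * dt U (t, x) * ψ x +
      H2 (U (t, x)) * ‖gradS U t x‖ ^ 2 * ψ x +
      H1 (U (t, x)) * ∑ i, gradS U t x (e3 i) * fderiv ℝ ψ x (e3 i) +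
      H1 (U (t, x)) * gradS U t x (b t x) * ψ x := by
    filter_upwards [hdiff, hψ.ae_differentiableAt] with x hx hxψ
    have hφd : DifferentiableAt ℝ φ (t, x) := by
      have e1 := (hH1 _ ⟨hδ.trans_le (lb (t, x)), (ub (t, x)).trans_lt one_lt_two⟩).differentiableAt.comp (t, x) hx
      exact e1.mul (hxψ.comp (t, x) differentiableAt_snd)
    have hφs : HasFDerivAt (fun y => φ (t, y)) _ x :=
      ((hH1 _ ⟨hδ.trans_le (lb (t, x)), (ub (t, x)).trans_lt one_lt_two⟩).comp_hasFDerivAt x (slice_hasFDerivAt hx)).mul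
        hxψ.hasFDerivAt
    have e2 : ∀ i, dx φ i (t, x) = H1 (U (t, x)) * fderiv ℝ ψ x (e3 i) +
        ψ x * (H2 (U (t, x)) * gradS U t x (e3 i)) := fun i => by
      rw [← dx_eq_slice hφd, hφs.fderiv, gradS, (slice_hasFDerivAt hx).fderiv]
      simp
    have e3' : ∀ i, dx U i (t, x) = gradS U t x (e3 i) := fun i => (dx_eq_slice hx i).symm
    have e4 := clm_apply_eq (gradS U t x) (b t x)
    have e5 := sum_sq_eq (gradS U t x)
    have e6 : φ (t, x) = H1 (U (t, x)) * ψ x := rfl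
    simp only [weakF, e2, e3', e6]
    rw [e4, ← e5]
    simp only [Fin.sum_univ_three]
    ring
  rw [integral_congr_ae hexp, integral_add (f := fun x => H1 (U (t, x)) * dt U (t, x) * ψ x +
      H2 (U (t, x)) * ‖gradS U t x‖ ^ 2 * ψ x +
      H1 (U (t, x)) * ∑ i, gradS U t x (e3 i) * fderiv ℝ ψ x (e3 i)) ((i1.add i2).add i3') i4,
    integral_add (f := fun x => H1 (U (t, x)) * dt U (t, x) * ψ x +
      H2 (U (t, x)) * ‖gradS U t x‖ ^ 2 * ψ x) (i1.add i2) i3', integral_add i1 i2] at h1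
  have hdr := drift_slice_bound hβ hH hH1c hδ us (fun x => lb (t, x)) (fun x => ub (t, x))
    (hd t ht) hψ hψa h0 c
  have h3 : -(∫ x, H1 (U (t, x)) * ∑ i, gradS U t x (e3 i) * fderiv ℝ ψ x (e3 i)) ≤
      ∫ x, |H1 (U (t, x))| * ‖gradS U t x‖ * ‖fderiv ℝ ψ x‖ := by
    rw [← integral_neg]
    refine integral_mono i3'.neg i3 fun x => ?_
    refine (neg_le_abs _).trans ?_
    rw [abs_mul, mul_assoc]
    exact mul_le_mul_of_nonneg_left (abs_sum_mul_le _ _) (abs_nonneg _)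
  rw [hder.deriv]
  have hdr' : -(∫ x, H1 (U (t, x)) * gradS U t x (b t x) * ψ x) ≤
    ∫ x, |H (U (t, x)) - c| * (‖b t x‖ * ‖fderiv ℝ ψ x‖) := hdr
  linarith

/-- The drift magnitude, cut off to a compact cylinder. -/
def driftB (b : ℝ → E3 → E3) : SpT → ℝ :=
  (Icc (-1 : ℝ) 0 ×ˢ closedBall (0 : E3) (15 / 8)).indicator fun p => ‖b p.1 p.2‖

lemma WSol.slab {U : SpT → ℝ} {b : ℝ → E3 → E3} {K : ℝ≥0} (h : WSol U b K)
    (hb : ContDiffOn ℝ 1 (fun p : SpT => b p.1 p.2) (Qlt 1 2 1))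
    (hd : ∀ t ∈ Ioo (-1 : ℝ) 0, (∀ x ∈ ball (0 : E3) 2, divb b (t, x) = 0) ∨
      ∃ c, ∀ x ∈ ball (0 : E3) 2, U (t, x) = c)
    {δ : ℝ} (hδ : 0 < δ) (lb : ∀ p, δ ≤ U p) (ub : ∀ p, U p ≤ 1) : Slab U (driftB b) K δ := by
  have hS : IsCompact (Icc (-1 : ℝ) 0 ×ˢ closedBall (0 : E3) (15 / 8)) :=
    isCompact_Icc.prod (isCompact_closedBall _ _)
  have hbS : ContinuousOn (fun p : SpT => b p.1 p.2)
      (Icc (-1 : ℝ) 0 ×ˢ closedBall (0 : E3) (15 / 8)) := by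
    refine h.cont.mono (prod_mono ?_ ?_)
    · simp
    · simpa using closedBall_subset_ball (by norm_num)
  obtain ⟨M, hM⟩ := hS.exists_bound_of_continuousOn hbS
  have hM0 : 0 ≤ M := (norm_nonneg _).trans (hM (0, 0) (by norm_num))
  refine ⟨h.lip, hδ, lb, ub, ?_, fun p => indicator_nonneg (fun p _ => norm_nonneg _) p,
    ⟨M, fun p => ?_⟩, fun p hp => ?_, ?_⟩
  · have : Measurable (driftB b) := by
      refine measurable_of_restrict_of_restrict_compl hS.measurableSet ?_ ?_
      · have e : (Icc (-1 : ℝ) 0 ×ˢ closedBall (0 : E3) (15 / 8)).domRestrict (driftB b) =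
            (Icc (-1 : ℝ) 0 ×ˢ closedBall (0 : E3) (15 / 8)).domRestrict fun p => ‖b p.1 p.2‖ := by
          ext p; simp [driftB, domRestrict_apply]
        rw [e]
        exact (continuousOn_iff_continuous_domRestrict.1 hbS.norm).measurable
      · have e : (Icc (-1 : ℝ) 0 ×ˢ closedBall (0 : E3) (15 / 8))ᶜ.domRestrict (driftB b) =
            fun _ => 0 := by
          ext p; simp only [driftB, domRestrict_apply]; exact indicator_of_notMem p.2 _
        rw [e]
        exact measurable_const
    exact this
  · rw [driftB]
    by_cases hp : p ∈ Icc (-1 : ℝ) 0 ×ˢ closedBall (0 : E3) (15 / 8)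
    · rw [indicator_of_mem hp]; exact hM p hp
    · rw [indicator_of_notMem hp]; exact hM0
  · refine indicator_of_notMem (fun hp' => ?_) _
    have := hp'.2
    simp only [mem_closedBall, dist_zero_right] at this
    linarith
  · intro H H1 H2 hH hH1 hH2 ψ L hψ hψ0 hψ1 h0
    filter_upwards [h.energy hb hd hδ lb ub hH hH1 hH2 hψ hψ0 hψ1 h0] with t ht ht' c
    refine (ht ht' c).trans_eq ?_
    congr 1
    refine integral_congr_ae (Eventually.of_forall fun x => ?_)
    by_cases hx : 7 / 4 < ‖x‖
    · simp [fderiv_eq_zero_of_ball h0 hx]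
    · have : (t, x) ∈ Icc (-1 : ℝ) 0 ×ˢ closedBall (0 : E3) (15 / 8) :=
        ⟨⟨ht'.1.le, ht'.2.le⟩, by simp only [mem_closedBall, dist_zero_right]; linarith⟩
      simp only [driftB, indicator_of_mem this]

lemma mol_grad_tendsto {g : E3 → ℝ} {K : ℝ≥0} (hg : LipschitzWith K g) :
    ∀ᵐ x, Tendsto (fun n => ‖fderiv ℝ (mol volume n g) x‖ ^ 2) atTop (𝓝 (‖fderiv ℝ g x‖ ^ 2)) := by
  have : ∀ᵐ x, ∀ i, Tendsto (fun n => mol volume n (fun y => fderiv ℝ g y (e3 i)) x) atTop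
      (𝓝 (fderiv ℝ g x (e3 i))) := by
    rw [ae_all_iff]
    exact fun i => mol_tendsto_ae (Lip.locallyIntegrable_fderiv hg _)
  filter_upwards [this] with x hx
  simp only [← sum_sq_eq, mol_fderiv _ hg]
  exact tendsto_finsetSum _ fun i _ => (hx i).mul (hx i)

lemma sobolev_smooth : ∃ C : ℝ, 0 < C ∧ ∀ F : E3 → ℝ, ContDiff ℝ 1 F → HasCompactSupport F →
    ∫ x, F x ^ 6 ≤ C * (∫ x, ‖fderiv ℝ F x‖ ^ 2) ^ 3 := by
  set c : ℝ≥0 := SNormLESNormFDerivOfEqConst ℝ (volume : Measure E3) ((2 : ℝ≥0) : ℝ) with hc0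
  refine ⟨(c : ℝ) ^ 6 + 1, by positivity, fun F hF hc => ?_⟩
  have h := eLpNorm_le_eLpNorm_fderiv_of_eq (volume : Measure E3) (p := 2) (p' := 6) hF hc
    (by norm_num) (by simp) (by simp; norm_num)
  rw [← hc0] at h
  have m1 : MemLp F (6 : ℝ≥0) := hF.continuous.memLp_of_hasCompactSupport hc
  have m2 : MemLp (fderiv ℝ F) (2 : ℝ≥0) :=
    (hF.continuous_fderiv one_ne_zero).memLp_of_hasCompactSupport (hc.fderiv ℝ)
  rw [m1.eLpNorm_eq_integral_rpow_norm (by simp) (by simp),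
    m2.eLpNorm_eq_integral_rpow_norm (by simp) (by simp)] at h
  have n1 : 0 ≤ ∫ x, F x ^ 6 := integral_nonneg fun x => by positivity
  have n2 : 0 ≤ ∫ x, ‖fderiv ℝ F x‖ ^ 2 := integral_nonneg fun x => by positivity
  have e1 : (∫ x, ‖F x‖ ^ (((6 : ℝ≥0) : ℝ≥0∞)).toReal) = ∫ x, F x ^ 6 := by
    refine integral_congr_ae (Eventually.of_forall fun x => ?_)
    have : (((6 : ℝ≥0) : ℝ≥0∞)).toReal = ((6 : ℕ) : ℝ) := by simp
    simp only [this, Real.rpow_natCast, norm_eq_abs]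
    exact Even.pow_abs (by decide) _
  have e2 : (∫ x, ‖fderiv ℝ F x‖ ^ (((2 : ℝ≥0) : ℝ≥0∞)).toReal) = ∫ x, ‖fderiv ℝ F x‖ ^ 2 := by
    refine integral_congr_ae (Eventually.of_forall fun x => ?_)
    have : (((2 : ℝ≥0) : ℝ≥0∞)).toReal = ((2 : ℕ) : ℝ) := by simp
    simp only [this, Real.rpow_natCast]
  have t1 : (((6 : ℝ≥0) : ℝ≥0∞)).toReal = 6 := by simp
  have t2 : (((2 : ℝ≥0) : ℝ≥0∞)).toReal = 2 := by simp
  rw [e1, e2, t1, t2, ← show ENNReal.ofReal (c : ℝ) = (c : ℝ≥0∞) from ENNReal.ofReal_coe_nnreal, ← ENNReal.ofReal_mul (by positivity),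
    ENNReal.ofReal_le_ofReal_iff (by positivity)] at h
  have h6 := pow_le_pow_left₀ (by positivity) h 6
  rw [mul_pow, ← Real.rpow_natCast _ 6, ← Real.rpow_mul n1,
    ← Real.rpow_natCast (_ ^ (2:ℝ)⁻¹) 6, ← Real.rpow_mul n2] at h6
  norm_num at h6
  have h3 : (∫ x, ‖fderiv ℝ F x‖ ^ 2) ^ (3 : ℝ) = (∫ x, ‖fderiv ℝ F x‖ ^ 2) ^ 3 := by
    rw [← Real.rpow_natCast]; norm_num
  have n3 : 0 ≤ (∫ x, ‖fderiv ℝ F x‖ ^ 2) ^ 3 := by positivity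
  try rw [h3] at h6
  linarith

lemma sobolev_lip : ∃ C : ℝ, 0 < C ∧ ∀ (F : E3 → ℝ) (L : ℝ≥0), LipschitzWith L F →
    (∀ x, 2 ≤ ‖x‖ → F x = 0) → ∫ x, F x ^ 6 ≤ C * (∫ x, ‖fderiv ℝ F x‖ ^ 2) ^ 3 := by
  obtain ⟨C, hC, h⟩ := sobolev_smooth
  refine ⟨C, hC, fun F L hF h0 => ?_⟩
  have hl : LocallyIntegrable F := hF.continuous.locallyIntegrable
  have hz : ∀ n, ∀ x, 3 ≤ ‖x‖ → mol volume n F x = 0 := fun n x hx => mol_eq_zero n fun y hy => by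
    refine h0 y ?_
    have h1 : (1 : ℝ) / (n + 1) ≤ 1 := by
      rw [div_le_one (by positivity)]
      linarith [(n.cast_nonneg : (0:ℝ) ≤ n)]
    have h2 : ‖y - x‖ < 1 / (n + 1) := by simpa [dist_eq_norm] using hy
    have h3 := norm_sub_norm_le x y
    rw [norm_sub_rev] at h3
    linarith
  have hcs : ∀ n, HasCompactSupport (mol volume n F) := fun n =>
    HasCompactSupport.intro (isCompact_closedBall (0 : E3) 3)
    fun x hx => hz n x (by simp only [mem_closedBall, dist_zero_right, not_le] at hx; exact hx.le)
  have hn : ∀ n, _ := fun n => h (mol volume n F) ((mol_contDiff n hl).of_le (by simp)) (hcs n)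
  have hb : ∀ n x, |mol volume n F x| ≤ 6 * L := fun n x => by
    by_cases hx : 3 ≤ ‖x‖
    · rw [hz n x hx]; simp
    · have hv : ‖(EuclideanSpace.single 0 3 : E3)‖ = 3 := by simp
      have := (mol_lip (μ := volume) n hF).dist_le_mul x (EuclideanSpace.single 0 3)
      rw [hz n _ hv.ge, Real.dist_eq, sub_zero] at this
      have h2 : dist x (EuclideanSpace.single 0 3 : E3) ≤ 6 := by
        rw [dist_eq_norm]; refine (norm_sub_le _ _).trans ?_; rw [hv]; linarith
      nlinarith [L.2]
  have l1 : Tendsto (fun n => ∫ x, mol volume n F x ^ 6) atTop (𝓝 (∫ x, F x ^ 6)) := by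
    refine tendsto_integral_of_dominated_convergence
      ((closedBall (0:E3) 3).indicator fun _ => ((6 : ℝ) * L) ^ 6)
      (fun n => ((mol_contDiff n hl).continuous.pow 6).aestronglyMeasurable)
      ((integrable_indicator_iff measurableSet_closedBall).2
        (integrableOn_const measure_closedBall_lt_top.ne)) (fun n => ?_) ?_
    · refine Eventually.of_forall fun x => ?_
      by_cases hx : x ∈ closedBall (0:E3) 3
      · rw [indicator_of_mem hx, norm_pow]
        exact pow_le_pow_left₀ (norm_nonneg _) (hb n x) 6
      · rw [indicator_of_notMem hx, hz n x]
        · simp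
        · simp only [mem_closedBall, dist_zero_right, not_le] at hx; exact hx.le
    · exact Eventually.of_forall fun x => (mol_tendsto_of_lip hF x).pow 6
  have l2 : Tendsto (fun n => ∫ x, ‖fderiv ℝ (mol volume n F) x‖ ^ 2) atTop
      (𝓝 (∫ x, ‖fderiv ℝ F x‖ ^ 2)) := by
    refine tendsto_integral_of_dominated_convergence
      ((closedBall (0:E3) 3).indicator fun _ => (L : ℝ) ^ 2)
      (fun n => ((measurable_fderiv ℝ _).norm.pow_const 2).aestronglyMeasurable)
      ((integrable_indicator_iff measurableSet_closedBall).2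
        (integrableOn_const measure_closedBall_lt_top.ne)) (fun n => ?_) (mol_grad_tendsto hF)
    refine Eventually.of_forall fun x => ?_
    by_cases hx : x ∈ closedBall (0:E3) 3
    · rw [indicator_of_mem hx, norm_pow, norm_norm]
      exact pow_le_pow_left₀ (norm_nonneg _) (norm_fderiv_le_of_lipschitz ℝ (mol_lip n hF)) 2
    · rw [indicator_of_notMem hx, fderiv_eq_zero_of_ball (hz n)]
      · simp
      · simpa using hx
  exact le_of_tendsto_of_tendsto' l1 ((l2.pow 3).const_mul C) hn

lemma sq_interval_integral_le {h : ℝ → ℝ} (hc : Continuous h) :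
    (∫ s in (0:ℝ)..1, h s) ^ 2 ≤ ∫ s in (0:ℝ)..1, h s ^ 2 := by
  set m := ∫ s in (0:ℝ)..1, h s with hm
  have h0 : 0 ≤ ∫ s in (0:ℝ)..1, (h s - m) ^ 2 :=
    intervalIntegral.integral_nonneg zero_le_one fun s _ => sq_nonneg _
  have i1 : IntervalIntegrable (fun s => h s ^ 2) volume 0 1 := (hc.pow 2).intervalIntegrable _ _
  have i2 : IntervalIntegrable (fun s => 2 * m * h s) volume 0 1 :=
    (hc.const_mul _).intervalIntegrable _ _
  have e : ∀ s, (h s - m) ^ 2 = h s ^ 2 - 2 * m * h s + m ^ 2 := fun s => by ring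
  simp only [e] at h0
  rw [intervalIntegral.integral_add (i1.sub i2) (by simp), intervalIntegral.integral_sub i1 i2,
    intervalIntegral.integral_const_mul, intervalIntegral.integral_const, ← hm] at h0
  simp only [sub_zero, one_smul] at h0
  nlinarith

lemma segment_sq_le {g : E3 → ℝ} (hg : ContDiff ℝ 1 g) (x y : E3) :
    ENNReal.ofReal ((g x - g y) ^ 2) ≤ ENNReal.ofReal (‖y - x‖ ^ 2) *
      ∫⁻ s in Icc (0:ℝ) 1, ENNReal.ofReal (‖fderiv ℝ g ((1 - s) • x + s • y)‖ ^ 2) := by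
  have hd : ∀ s : ℝ, HasDerivAt (fun s : ℝ => g ((1 - s) • x + s • y))
      (fderiv ℝ g ((1 - s) • x + s • y) (y - x)) s := fun s => by
    have h1 : HasDerivAt (fun s : ℝ => (1 - s) • x + s • y) (y - x) s := by
      have : HasDerivAt (fun s : ℝ => (1 - s) • x + s • y) ((-1 : ℝ) • x + (1 : ℝ) • y) s :=
        (((hasDerivAt_id s).const_sub 1).smul_const x).add ((hasDerivAt_id s).smul_const y)
      rwa [show (-1 : ℝ) • x + (1 : ℝ) • y = y - x by module] at this
    exact ((hg.differentiable one_ne_zero).differentiableAt.hasFDerivAt).comp_hasDerivAt s h1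
  have hgc := hg.continuous_fderiv one_ne_zero
  have hc1 : Continuous fun s : ℝ => fderiv ℝ g ((1 - s) • x + s • y) := by
    exact hgc.comp (by fun_prop)
  have hc : Continuous fun s : ℝ => fderiv ℝ g ((1 - s) • x + s • y) (y - x) := by
    exact hc1.clm_apply continuous_const
  have ftc : ∫ s in (0:ℝ)..1, fderiv ℝ g ((1 - s) • x + s • y) (y - x) = g y - g x := by
    rw [intervalIntegral.integral_eq_sub_of_hasDerivAt (fun s _ => hd s)
      (hc.intervalIntegrable _ _)]
    simp
  have h2 := sq_interval_integral_le hc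
  rw [ftc] at h2
  have h3 : (g x - g y) ^ 2 ≤ ∫ s in (0:ℝ)..1, ‖y - x‖ ^ 2 *
      ‖fderiv ℝ g ((1 - s) • x + s • y)‖ ^ 2 := by
    rw [← neg_sub, neg_sq]
    refine h2.trans (intervalIntegral.integral_mono_on zero_le_one
      ((hc.pow 2).intervalIntegrable _ _)
      (((hc1.norm.pow 2).const_mul _).intervalIntegrable _ _) fun s _ => ?_)
    rw [← mul_pow, ← sq_abs]
    refine pow_le_pow_left₀ (abs_nonneg _) ?_ 2
    rw [mul_comm]
    exact (fderiv ℝ g _).le_opNorm _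
  rw [intervalIntegral.integral_const_mul, intervalIntegral.integral_of_le zero_le_one,
    ← integral_Icc_eq_integral_Ioc] at h3
  refine (ENNReal.ofReal_le_ofReal h3).trans_eq ?_
  rw [ENNReal.ofReal_mul (by positivity), ofReal_integral_eq_lintegral_ofReal]
  · exact ((hc1.norm.pow 2).continuousOn).integrableOn_Icc
  · exact Eventually.of_forall fun s => by positivity

lemma lintegral_affine_le {N : E3 → ℝ≥0∞} (hN : Measurable N) {s : ℝ} (hs : 1 / 2 ≤ s) (a : E3) :
    ∫⁻ y, N (a + s • y) ≤ 8 * ∫⁻ y, N y := by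
  have hs0 : s ≠ 0 := by linarith
  have h1 : ∫⁻ y, N (a + s • y) = ∫⁻ y, N (a + y) ∂(Measure.map (fun y => s • y) volume) := by
    exact (lintegral_map (f := fun y => N (a + y)) (hN.comp (measurable_const_add a))
      (measurable_const_smul s)).symm
  rw [h1, Measure.map_addHaar_smul volume hs0, lintegral_smul_measure,
    lintegral_add_left_eq_self]
  simp only [smul_eq_mul]
  refine mul_le_mul_left ?_ _
  rw [show (8 : ℝ≥0∞) = ENNReal.ofReal 8 by simp]
  refine ENNReal.ofReal_le_ofReal ?_
  have h3 : (1 / 2 : ℝ) ^ 3 ≤ s ^ 3 := pow_le_pow_left₀ (by norm_num) hs 3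
  rw [finrank_euclideanSpace_fin, abs_of_pos (by positivity)]
  exact inv_le_of_inv_le₀ (by norm_num) (by linarith)

lemma poincare_smooth : ∃ C : ℝ, 0 < C ∧ ∀ (g ψ : E3 → ℝ), ContDiff ℝ 1 g → Measurable ψ →
    (∀ x, 0 ≤ ψ x) → (∀ x, ψ x ≤ 1) → (∀ x, 2 ≤ ‖x‖ → ψ x = 0) →
    (∀ x y, ∀ s ∈ Icc (0 : ℝ) 1, min (ψ x) (ψ y) ≤ ψ ((1 - s) • x + s • y)) →
    ∫⁻ x, ∫⁻ y, ENNReal.ofReal ((g x - g y) ^ 2 * (ψ x * ψ y)) ≤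
      ENNReal.ofReal C * ∫⁻ x, ENNReal.ofReal (‖fderiv ℝ g x‖ ^ 2 * ψ x) := by
  set v : ℝ≥0∞ := volume (ball (0 : E3) 2) with hv
  have hvt : v ≠ ⊤ := measure_ball_lt_top.ne
  refine ⟨256 * v.toReal + 1, by positivity, fun g ψ hg hψm hψ0 hψ1 hψ2 hq => ?_⟩
  set N : E3 → ℝ≥0∞ := fun z => ENNReal.ofReal (‖fderiv ℝ g z‖ ^ 2 * ψ z) with hN
  have hNm : Measurable N :=
    (((measurable_fderiv ℝ g).norm.pow_const 2).mul hψm).ennreal_ofReal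
  set χ : E3 → ℝ≥0∞ := (ball (0 : E3) 2).indicator fun _ => 1 with hχ
  have hχm : Measurable χ := measurable_const.indicator measurableSet_ball
  have hpt : ∀ x y, ENNReal.ofReal ((g x - g y) ^ 2 * (ψ x * ψ y)) ≤
      ∫⁻ s in Icc (0:ℝ) 1, 16 * (χ x * χ y * N ((1 - s) • x + s • y)) := fun x y => by
    by_cases hx : x ∈ ball (0 : E3) 2
    swap
    · rw [hψ2 x (by simpa using hx)]; simp
    by_cases hy : y ∈ ball (0 : E3) 2
    swap
    · rw [hψ2 y (by simpa using hy)]; simp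
    rw [ENNReal.ofReal_mul (sq_nonneg _)]
    refine (mul_le_mul_left (segment_sq_le hg x y) _).trans ?_
    simp only [hχ, indicator_of_mem hx, indicator_of_mem hy, one_mul]
    have hm1 : Measurable fun s : ℝ => (1 - s) • x + s • y := by fun_prop
    rw [lintegral_const_mul (f := fun s : ℝ => N ((1 - s) • x + s • y)) _ (hNm.comp hm1), mul_assoc]
    refine mul_le_mul' ?_ ?_
    · rw [show (16 : ℝ≥0∞) = ENNReal.ofReal 16 by simp]
      refine ENNReal.ofReal_le_ofReal ?_
      have h1 : ‖y - x‖ ≤ 4 := by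
        simp only [mem_ball, dist_zero_right] at hx hy
        exact (norm_sub_le _ _).trans (by linarith)
      nlinarith [norm_nonneg (y - x)]
    · rw [mul_comm, ← lintegral_const_mul' _ _ ENNReal.ofReal_ne_top]
      refine setLIntegral_mono (hNm.comp hm1) fun s hs => ?_
      rw [← ENNReal.ofReal_mul (mul_nonneg (hψ0 x) (hψ0 y)), mul_comm]
      refine ENNReal.ofReal_le_ofReal (mul_le_mul_of_nonneg_left ?_ (by positivity))
      refine le_trans ?_ (hq x y s hs)
      refine le_min ?_ ?_
      · nlinarith [hψ0 x, hψ1 y]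
      · nlinarith [hψ0 y, hψ1 x]
  have hjm : Measurable fun p : (E3 × E3) × ℝ => 16 * (χ p.1.1 * χ p.1.2 *
      N ((1 - p.2) • p.1.1 + p.2 • p.1.2)) := by
    have : Measurable fun p : (E3 × E3) × ℝ => (1 - p.2) • p.1.1 + p.2 • p.1.2 := by fun_prop
    exact (((hχm.comp measurable_fst.fst).mul (hχm.comp measurable_fst.snd)).mul
      (hNm.comp this)).const_mul _
  have hχint : ∫⁻ x, χ x = v := by
    rw [hχ, lintegral_indicator measurableSet_ball]; simp [hv]
  have hχ1 : ∀ x, χ x ≤ 1 := fun x => indicator_le_self' (fun _ _ => zero_le) x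
  have hs1 : ∀ s ∈ Icc (0:ℝ) 1, ∫⁻ x, ∫⁻ y, χ x * χ y * N ((1 - s) • x + s • y) ≤
      v * (8 * ∫⁻ z, N z) := fun s hs => by
    have hm2 : Measurable fun p : E3 × E3 => χ p.1 * χ p.2 * N ((1 - s) • p.1 + s • p.2) := by
      have : Measurable fun p : E3 × E3 => (1 - s) • p.1 + s • p.2 := by fun_prop
      exact ((hχm.comp measurable_fst).mul (hχm.comp measurable_snd)).mul (hNm.comp this)
    rcases le_total (1 / 2) s with h | h
    · calc ∫⁻ x, ∫⁻ y, χ x * χ y * N ((1 - s) • x + s • y)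
          ≤ ∫⁻ x, χ x * (8 * ∫⁻ z, N z) := by
            refine lintegral_mono fun x => ?_
            refine le_trans ?_ (mul_le_mul_right (lintegral_affine_le hNm h ((1 - s) • x)) _)
            have hm1 : Measurable fun y : E3 => (1 - s) • x + s • y := by fun_prop
            rw [← lintegral_const_mul (f := fun y : E3 => N ((1 - s) • x + s • y)) _
              (hNm.comp hm1)]
            refine lintegral_mono fun y => ?_
            refine mul_le_mul_left ?_ _
            exact (mul_le_mul_right (hχ1 y) _).trans_eq (mul_one _)
        _ = _ := by rw [lintegral_mul_const _ hχm, hχint]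
    · rw [lintegral_lintegral_swap hm2.aemeasurable]
      calc ∫⁻ y, ∫⁻ x, χ x * χ y * N ((1 - s) • x + s • y)
          ≤ ∫⁻ y, χ y * (8 * ∫⁻ z, N z) := by
            refine lintegral_mono fun y => ?_
            refine le_trans ?_ (mul_le_mul_right
              (lintegral_affine_le hNm (s := 1 - s) (by linarith) (s • y)) _)
            have hm1 : Measurable fun x : E3 => s • y + (1 - s) • x := by fun_prop
            rw [← lintegral_const_mul (f := fun x : E3 => N (s • y + (1 - s) • x)) _
              (hNm.comp hm1)]
            refine lintegral_mono fun x => ?_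
            simp only [add_comm (s • y)]
            refine mul_le_mul_left ?_ _
            exact (mul_le_mul_left (hχ1 x) _).trans_eq (one_mul _)
        _ = _ := by rw [lintegral_mul_const _ hχm, hχint]
  calc ∫⁻ x, ∫⁻ y, ENNReal.ofReal ((g x - g y) ^ 2 * (ψ x * ψ y))
      ≤ ∫⁻ x, ∫⁻ y, ∫⁻ s in Icc (0:ℝ) 1, 16 * (χ x * χ y * N ((1 - s) • x + s • y)) :=
        lintegral_mono fun x => lintegral_mono fun y => hpt x y
    _ = ∫⁻ p : E3 × E3, ∫⁻ s in Icc (0:ℝ) 1,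
          16 * (χ p.1 * χ p.2 * N ((1 - s) • p.1 + s • p.2)) :=
        (lintegral_prod (fun p : E3 × E3 => ∫⁻ s in Icc (0:ℝ) 1,
          16 * (χ p.1 * χ p.2 * N ((1 - s) • p.1 + s • p.2)))
          (Measurable.lintegral_prod_right hjm).aemeasurable).symm
    _ = ∫⁻ s in Icc (0:ℝ) 1, ∫⁻ p : E3 × E3,
          16 * (χ p.1 * χ p.2 * N ((1 - s) • p.1 + s • p.2)) :=
        lintegral_lintegral_swap hjm.aemeasurable
    _ ≤ ∫⁻ s in Icc (0:ℝ) 1, 16 * (v * (8 * ∫⁻ z, N z)) := by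
        refine setLIntegral_mono measurable_const fun s hs => ?_
        have hm2 : Measurable fun p : E3 × E3 => χ p.1 * χ p.2 * N ((1 - s) • p.1 + s • p.2) := by
          have : Measurable fun p : E3 × E3 => (1 - s) • p.1 + s • p.2 := by fun_prop
          exact ((hχm.comp measurable_fst).mul (hχm.comp measurable_snd)).mul (hNm.comp this)
        rw [lintegral_const_mul _ hm2, Measure.volume_eq_prod, lintegral_prod _ hm2.aemeasurable]
        exact mul_le_mul_right (hs1 s hs) _
    _ = 16 * (v * (8 * ∫⁻ z, N z)) := by simp
    _ = (128 * v) * ∫⁻ z, N z := by ring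
    _ ≤ _ := by
        refine mul_le_mul_left ?_ _
        rw [← ENNReal.ofReal_toReal hvt, show (128 : ℝ≥0∞) = ENNReal.ofReal 128 by simp,
          ← ENNReal.ofReal_mul (by norm_num)]
        refine ENNReal.ofReal_le_ofReal ?_
        rw [ENNReal.toReal_ofReal ENNReal.toReal_nonneg]
        nlinarith [ENNReal.toReal_nonneg (a := v)]

lemma poincare_mean : ∃ C : ℝ, 0 < C ∧ ∀ (g ψ : E3 → ℝ) (L : ℝ≥0), LipschitzWith L g →
    Continuous ψ →
    (∀ x, 0 ≤ ψ x) → (∀ x, ψ x ≤ 1) → (∀ x, 2 ≤ ‖x‖ → ψ x = 0) →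
    (∀ x y, ∀ s ∈ Icc (0 : ℝ) 1, min (ψ x) (ψ y) ≤ ψ ((1 - s) • x + s • y)) →
    0 < ∫ x, ψ x →
    (∫ x, ψ x) * ∫ x, (g x - (∫ x, g x * ψ x) / ∫ x, ψ x) ^ 2 * ψ x ≤
      C * ∫ x, ‖fderiv ℝ g x‖ ^ 2 * ψ x := by
  obtain ⟨C, hC, hP⟩ := poincare_smooth
  refine ⟨C, hC, fun g ψ L hg hψ hψ0 hψ1 hψ2 hq hm => ?_⟩
  have hl : LocallyIntegrable g := hg.continuous.locallyIntegrable
  have hψi := integrable_cutoff hψ hψ2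
  have hgr : Integrable fun x => ‖fderiv ℝ g x‖ ^ 2 * ψ x := by
    refine hψi.bdd_mul (c := (L : ℝ) ^ 2)
      ((measurable_fderiv ℝ g).norm.pow_const 2).aestronglyMeasurable
      (Eventually.of_forall fun x => ?_)
    rw [norm_pow, norm_norm]
    exact pow_le_pow_left₀ (norm_nonneg _) (norm_fderiv_le_of_lipschitz ℝ hg) 2
  have hlim : Tendsto (fun n => ENNReal.ofReal C *
      ∫⁻ x, ENNReal.ofReal (‖fderiv ℝ (mol volume n g) x‖ ^ 2 * ψ x)) atTop
      (𝓝 (ENNReal.ofReal C * ∫⁻ x, ENNReal.ofReal (‖fderiv ℝ g x‖ ^ 2 * ψ x))) := by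
    refine ENNReal.Tendsto.const_mul ?_ (Or.inr ENNReal.ofReal_ne_top)
    refine tendsto_lintegral_of_dominated_convergence (fun x => ENNReal.ofReal (L ^ 2 * ψ x))
      (fun n => (((measurable_fderiv ℝ _).norm.pow_const 2).mul hψ.measurable).ennreal_ofReal)
      (fun n => Eventually.of_forall fun x => ?_) ?_ ?_
    · refine ENNReal.ofReal_le_ofReal (mul_le_mul_of_nonneg_right ?_ (hψ0 x))
      exact pow_le_pow_left₀ (norm_nonneg _) (norm_fderiv_le_of_lipschitz ℝ (mol_lip n hg)) 2
    · exact ((hψi.const_mul _).lintegral_lt_top).ne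
    · filter_upwards [mol_grad_tendsto hg] with x hx
      exact ENNReal.tendsto_ofReal (hx.mul_const _)
  have hmain : ∫⁻ p : E3 × E3, ENNReal.ofReal ((g p.1 - g p.2) ^ 2 * (ψ p.1 * ψ p.2)) ≤
      ENNReal.ofReal C * ∫⁻ x, ENNReal.ofReal (‖fderiv ℝ g x‖ ^ 2 * ψ x) := by
    have hmc : ∀ n, Continuous (mol volume n g) := fun n => (mol_contDiff n hl).continuous
    have hmeas : ∀ n, Measurable fun p : E3 × E3 => ENNReal.ofReal
        ((mol volume n g p.1 - mol volume n g p.2) ^ 2 * (ψ p.1 * ψ p.2)) := fun n => by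
      have h1 := hmc n
      exact (Continuous.measurable (by fun_prop)).ennreal_ofReal
    have e : ∀ p : E3 × E3, ENNReal.ofReal ((g p.1 - g p.2) ^ 2 * (ψ p.1 * ψ p.2)) =
        liminf (fun n => ENNReal.ofReal
          ((mol volume n g p.1 - mol volume n g p.2) ^ 2 * (ψ p.1 * ψ p.2))) atTop := fun p => by
      refine (Tendsto.liminf_eq ?_).symm
      exact ENNReal.tendsto_ofReal ((((mol_tendsto_of_lip hg p.1).sub
        (mol_tendsto_of_lip hg p.2)).pow 2).mul_const _)
    simp only [e]
    refine (lintegral_liminf_le hmeas).trans ?_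
    rw [← hlim.liminf_eq]
    refine liminf_le_liminf (Eventually.of_forall fun n => ?_)
    rw [Measure.volume_eq_prod, lintegral_prod _ (hmeas n).aemeasurable]
    exact hP _ _ ((mol_contDiff n hl).of_le (by simp)) hψ.measurable hψ0 hψ1 hψ2 hq
  have hgψ : Integrable fun x => g x * ψ x := integrable_cutoff (r := 2)
    (hg.continuous.mul hψ) fun x hx => by rw [hψ2 x hx, mul_zero]
  have hg2ψ : Integrable fun x => g x ^ 2 * ψ x := integrable_cutoff (r := 2)
    ((hg.continuous.pow 2).mul hψ) fun x hx => by rw [hψ2 x hx, mul_zero]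
  have hcc : Integrable fun p : E3 × E3 => (g p.1 - g p.2) ^ 2 * (ψ p.1 * ψ p.2) := by
    have := hg.continuous
    refine Continuous.integrable_of_hasCompactSupport (by fun_prop) ?_
    refine HasCompactSupport.intro ((isCompact_closedBall (0 : E3) 2).prod
      (isCompact_closedBall (0 : E3) 2)) fun p hp => ?_
    simp only [mem_prod, mem_closedBall, dist_zero_right, not_and_or, not_le] at hp
    rcases hp with hp | hp <;> simp [hψ2 _ hp.le]
  set m := ∫ x, ψ x
  set a := ∫ x, g x * ψ x
  set b := ∫ x, g x ^ 2 * ψ x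
  have hI : ∫ p : E3 × E3, (g p.1 - g p.2) ^ 2 * (ψ p.1 * ψ p.2) = 2 * (b * m) - 2 * a ^ 2 := by
    rw [Measure.volume_eq_prod] at hcc ⊢
    rw [integral_prod _ hcc]
    have e1 : ∀ x, ∫ y, (g x - g y) ^ 2 * (ψ x * ψ y) =
        g x ^ 2 * ψ x * m - 2 * (g x * ψ x) * a + ψ x * b := fun x => by
      have e2 : ∀ y, (g x - g y) ^ 2 * (ψ x * ψ y) = g x ^ 2 * ψ x * ψ y -
        2 * (g x * ψ x) * (g y * ψ y) + ψ x * (g y ^ 2 * ψ y) := fun y => by ring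
      simp only [e2]
      rw [integral_add (f := fun y => g x ^ 2 * ψ x * ψ y - 2 * (g x * ψ x) * (g y * ψ y))
        ((hψi.const_mul _).sub (hgψ.const_mul _)) (hg2ψ.const_mul _),
        integral_sub (hψi.const_mul _) (hgψ.const_mul _)]
      simp only [integral_const_mul]
      rfl
    simp only [e1]
    rw [integral_add (f := fun x => g x ^ 2 * ψ x * m - 2 * (g x * ψ x) * a)
        ((hg2ψ.mul_const _).sub ((hgψ.const_mul _).mul_const _)) (hψi.mul_const _),
        integral_sub (hg2ψ.mul_const _) ((hgψ.const_mul _).mul_const _)]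
    simp only [integral_mul_const, integral_const_mul]
    change b * m - 2 * a * a + m * b = _
    ring
  have hJ : ∫ x, (g x - a / m) ^ 2 * ψ x = b - a ^ 2 / m := by
    have e2 : ∀ y, (g y - a / m) ^ 2 * ψ y = g y ^ 2 * ψ y -
        2 * (a / m) * (g y * ψ y) + (a / m) ^ 2 * ψ y := fun y => by ring
    simp only [e2]
    rw [integral_add (f := fun y => g y ^ 2 * ψ y - 2 * (a / m) * (g y * ψ y))
        (hg2ψ.sub (hgψ.const_mul _)) (hψi.const_mul _), integral_sub hg2ψ (hgψ.const_mul _)]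
    simp only [integral_const_mul]
    change b - 2 * (a / m) * a + (a / m) ^ 2 * m = _
    field_simp
    ring
  rw [← ofReal_integral_eq_lintegral_ofReal hcc (Eventually.of_forall fun p =>
    mul_nonneg (sq_nonneg _) (mul_nonneg (hψ0 _) (hψ0 _))),
    ← ofReal_integral_eq_lintegral_ofReal hgr (Eventually.of_forall fun x =>
    mul_nonneg (sq_nonneg _) (hψ0 _)), ← ENNReal.ofReal_mul hC.le,
    ENNReal.ofReal_le_ofReal_iff (mul_nonneg hC.le (integral_nonneg fun x =>
    mul_nonneg (sq_nonneg _) (hψ0 _))), hI] at hmain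
  rw [hJ]
  have h1 : m * (b - a ^ 2 / m) = b * m - a ^ 2 := by field_simp
  have h2 : 0 ≤ ∫ p : E3 × E3, (g p.1 - g p.2) ^ 2 * (ψ p.1 * ψ p.2) :=
    integral_nonneg fun p => mul_nonneg (sq_nonneg _) (mul_nonneg (hψ0 _) (hψ0 _))
  rw [hI] at h2
  rw [h1]
  linarith

lemma integral_le_prod_rpow {α ι : Type*} [MeasurableSpace α] {μ : Measure α} [Fintype ι]
    {f : ι → α → ℝ} {θ : ι → ℝ} {g : α → ℝ} (hf : ∀ i, Integrable (f i) μ) (f0 : ∀ i x, 0 ≤ f i x)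
    (h0 : ∀ i, 0 ≤ θ i) (h1 : ∑ i, θ i = 1) (hg : ∀ᵐ x ∂μ, g x ≤ ∏ i, f i x ^ θ i) :
    ∫ x, g x ∂μ ≤ ∏ i, (∫ x, f i x ∂μ) ^ θ i := by
  have hpos : 0 ≤ ∏ i, (∫ x, f i x ∂μ) ^ θ i :=
    Finset.prod_nonneg fun i _ => rpow_nonneg (integral_nonneg (f0 i)) _
  by_cases hgi : Integrable g μ
  · have hp : Integrable (fun x => max (g x) 0) μ := hgi.pos_part
    refine (integral_mono_ae (g := fun x => max (g x) 0) hgi hp (Eventually.of_forall fun x => le_max_left _ _)).trans ?_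
    rw [integral_eq_lintegral_of_nonneg_ae (f := fun x => max (g x) 0) (Eventually.of_forall fun x => le_max_right _ _)
      hp.aestronglyMeasurable]
    refine ENNReal.toReal_le_of_le_ofReal hpos ?_
    calc ∫⁻ x, ENNReal.ofReal (max (g x) 0) ∂μ
        ≤ ∫⁻ x, ∏ i, ENNReal.ofReal (f i x) ^ θ i ∂μ := by
          refine lintegral_mono_ae ?_
          filter_upwards [hg] with x hx
          have e : ∏ i, ENNReal.ofReal (f i x) ^ θ i = ENNReal.ofReal (∏ i, f i x ^ θ i) := by
            rw [ENNReal.ofReal_prod_of_nonneg fun i _ => rpow_nonneg (f0 i x) _]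
            exact Finset.prod_congr rfl fun i _ => ENNReal.ofReal_rpow_of_nonneg (f0 i x) (h0 i)
          rw [e]
          exact ENNReal.ofReal_le_ofReal
            (max_le hx (Finset.prod_nonneg fun i _ => rpow_nonneg (f0 i x) _))
      _ ≤ ∏ i, (∫⁻ x, ENNReal.ofReal (f i x) ∂μ) ^ θ i :=
          ENNReal.lintegral_prod_norm_pow_le _ (fun i _ => (hf i).aemeasurable.ennreal_ofReal) h1
            fun i _ => h0 i
      _ = ENNReal.ofReal (∏ i, (∫ x, f i x ∂μ) ^ θ i) := by
          rw [ENNReal.ofReal_prod_of_nonneg fun i _ => rpow_nonneg (integral_nonneg (f0 i)) _]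
          refine Finset.prod_congr rfl fun i _ => ?_
          rw [← ENNReal.ofReal_rpow_of_nonneg (integral_nonneg (f0 i)) (h0 i),
            ofReal_integral_eq_lintegral_ofReal (hf i) (Eventually.of_forall (f0 i))]
  · rwa [integral_undef hgi]

lemma sub_le_integral_of_deriv_le {W Φ : ℝ → ℝ} {K : ℝ≥0} {a b : ℝ} (hab : a ≤ b)
    (hW : LipschitzOnWith K W (Icc a b)) (hΦ : IntervalIntegrable Φ volume a b)
    (h : ∀ᵐ t, t ∈ Ioo a b → deriv W t ≤ Φ t) : W b - W a ≤ ∫ t in a..b, Φ t := by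
  have hac : AbsolutelyContinuousOnInterval W a b := by
    apply LipschitzOnWith.absolutelyContinuousOnInterval (K := K)
    rwa [uIcc_of_le hab]
  rw [← hac.integral_deriv_eq_sub]
  refine intervalIntegral.integral_mono_ae_restrict hab hac.intervalIntegrable_deriv hΦ ?_
  rw [← restrict_Ioo_eq_restrict_Icc] 
  exact (ae_restrict_iff' measurableSet_Ioo).2 h

/-- Radial cutoff equal to `1` on the ball of radius `r` and vanishing outside the ball of
radius `s`. -/
def cut (r s : ℝ) (x : E3) : ℝ := max 0 (min 1 ((s - ‖x‖) / (s - r)))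

lemma cut_nonneg (r s : ℝ) (x : E3) : 0 ≤ cut r s x := le_max_left _ _

lemma cut_le_one (r s : ℝ) (x : E3) : cut r s x ≤ 1 := max_le zero_le_one (min_le_left _ _)

lemma cut_eq_one {r s : ℝ} (h : r < s) {x : E3} (hx : ‖x‖ ≤ r) : cut r s x = 1 := by
  have : 1 ≤ (s - ‖x‖) / (s - r) := by rw [le_div_iff₀ (by linarith)]; linarith
  rw [cut, min_eq_left this, max_eq_right zero_le_one]

lemma cut_eq_zero {r s : ℝ} (h : r < s) {x : E3} (hx : s ≤ ‖x‖) : cut r s x = 0 := by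
  have : (s - ‖x‖) / (s - r) ≤ 0 := div_nonpos_of_nonpos_of_nonneg (by linarith) (by linarith)
  rw [cut, max_eq_left ((min_le_right _ _).trans this)]

lemma cut_lip {r s : ℝ} (h : r < s) : LipschitzWith (s - r)⁻¹.toNNReal (cut r s) := by
  have h0 : 0 < s - r := sub_pos.2 h
  have h1 : LipschitzWith (s - r)⁻¹.toNNReal fun x : E3 => (s - ‖x‖) / (s - r) := by
    refine LipschitzWith.of_dist_le_mul fun x y => ?_
    rw [Real.coe_toNNReal _ (inv_nonneg.2 h0.le), Real.dist_eq, ← sub_div, abs_div,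
      abs_of_pos h0, div_eq_inv_mul]
    refine mul_le_mul_of_nonneg_left ?_ (inv_nonneg.2 h0.le)
    have := abs_norm_sub_norm_le y x
    rw [dist_comm, dist_eq_norm]
    rwa [show s - ‖x‖ - (s - ‖y‖) = ‖y‖ - ‖x‖ by ring]
  exact (h1.const_min 1).const_max 0

lemma cut_quasi {r s : ℝ} (h : r < s) (x y : E3) {τ : ℝ} (hτ : τ ∈ Icc (0 : ℝ) 1) :
    min (cut r s x) (cut r s y) ≤ cut r s ((1 - τ) • x + τ • y) := by
  have h0 : 0 < s - r := sub_pos.2 h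
  have hn : ‖(1 - τ) • x + τ • y‖ ≤ max ‖x‖ ‖y‖ := by
    refine (norm_add_le _ _).trans ?_
    rw [norm_smul, norm_smul, Real.norm_of_nonneg hτ.1, Real.norm_of_nonneg (sub_nonneg.2 hτ.2)]
    have h1 := mul_le_mul_of_nonneg_left (le_max_left ‖x‖ ‖y‖) (sub_nonneg.2 hτ.2)
    have h2 := mul_le_mul_of_nonneg_left (le_max_right ‖x‖ ‖y‖) hτ.1
    linarith
  have mono : ∀ {z w : E3}, ‖z‖ ≤ ‖w‖ → cut r s w ≤ cut r s z := fun {z w} hzw =>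
    max_le_max le_rfl (min_le_min le_rfl (by gcongr))
  rcases le_total ‖x‖ ‖y‖ with hxy | hxy
  · rw [max_eq_right hxy] at hn
    exact (min_le_right _ _).trans (mono hn)
  · rw [max_eq_left hxy] at hn
    exact (min_le_left _ _).trans (mono hn)

lemma lip_pow {X : Type*} [PseudoMetricSpace X] {f : X → ℝ} {L : ℝ≥0} (hf : LipschitzWith L f)
    (h1 : ∀ x, |f x| ≤ 1) (n : ℕ) : LipschitzWith (n * L) fun x => f x ^ n := by
  induction n with
  | zero => simp
  | succ n ih =>
    have h2 : ∀ x, |f x ^ n| ≤ (1 : ℝ≥0) := fun x => by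
      rw [abs_pow]; exact pow_le_one₀ (abs_nonneg _) (h1 x)
    have := LipschitzWith.mul_of_bound ih hf h2 (N := 1) (fun x => by simpa using h1 x)
    convert this using 1
    · push_cast; ring
    · ext x; exact pow_succ _ _

lemma norm_fderiv_pow_le {E : Type*} [NormedAddCommGroup E] [NormedSpace ℝ E] {f : E → ℝ} {L : ℝ≥0}
    (hf : LipschitzWith L f) (h0 : ∀ x, 0 ≤ f x) (n : ℕ) {x : E} (hx : DifferentiableAt ℝ f x) :
    ‖fderiv ℝ (fun x => f x ^ n) x‖ ≤ n * L * f x ^ (n - 1) := by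
  rw [(hx.hasFDerivAt.pow n).fderiv, norm_smul, nsmul_eq_mul, norm_mul, norm_pow, RCLike.norm_natCast,
    Real.norm_of_nonneg (h0 x)]
  have := norm_fderiv_le_of_lipschitz ℝ hf (x₀ := x)
  have h3 : 0 ≤ (n : ℝ) * f x ^ (n - 1) := mul_nonneg n.cast_nonneg (pow_nonneg (h0 x) _)
  calc _ ≤ n * f x ^ (n - 1) * L := mul_le_mul_of_nonneg_left this h3
    _ = _ := by ring

lemma integrable_mul_cutoff {F ψ : E3 → ℝ} {r M : ℝ} (hm : Measurable F) (hM : ∀ x, |F x| ≤ M)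
    (hψ : Continuous ψ) (h0 : ∀ x, r ≤ ‖x‖ → ψ x = 0) : Integrable fun x => F x * ψ x :=
  (integrable_cutoff hψ h0).bdd_mul hm.aestronglyMeasurable (Eventually.of_forall hM)

lemma norm_fderiv_mul_sq_le {E : Type*} [NormedAddCommGroup E] [NormedSpace ℝ E] {f g : E → ℝ}
    {x : E} (hf : DifferentiableAt ℝ f x) (hg : DifferentiableAt ℝ g x) :
    ‖fderiv ℝ (fun x => f x * g x) x‖ ^ 2 ≤
      2 * (‖fderiv ℝ f x‖ ^ 2 * g x ^ 2) + 2 * (f x ^ 2 * ‖fderiv ℝ g x‖ ^ 2) := by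
  rw [fderiv_fun_mul hf hg]
  have h1 : ‖f x • fderiv ℝ g x + g x • fderiv ℝ f x‖ ≤
      |f x| * ‖fderiv ℝ g x‖ + |g x| * ‖fderiv ℝ f x‖ := by
    refine (norm_add_le _ _).trans ?_
    rw [norm_smul, norm_smul, norm_eq_abs, norm_eq_abs]
  calc _ ≤ (|f x| * ‖fderiv ℝ g x‖ + |g x| * ‖fderiv ℝ f x‖) ^ 2 :=
        pow_le_pow_left₀ (norm_nonneg _) h1 2
    _ ≤ 2 * ((|g x| * ‖fderiv ℝ f x‖) ^ 2) + 2 * ((|f x| * ‖fderiv ℝ g x‖) ^ 2) := by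
        nlinarith [sq_nonneg (|f x| * ‖fderiv ℝ g x‖ - |g x| * ‖fderiv ℝ f x‖)]
    _ = _ := by rw [mul_pow, mul_pow, sq_abs, sq_abs]; ring

lemma sobolev_cut : ∃ C : ℝ, 0 < C ∧ ∀ (F φ : E3 → ℝ) (K L M : ℝ≥0) (n : ℕ), LipschitzWith K F →
    (∀ x, |F x| ≤ M) → LipschitzWith L φ → (∀ x, 0 ≤ φ x) → (∀ x, φ x ≤ 1) →
    (∀ x, 7 / 4 ≤ ‖x‖ → φ x = 0) → 2 ≤ n →
    ∫ x, (F x * φ x ^ n) ^ 6 ≤ C * ((∫ x, ‖fderiv ℝ F x‖ ^ 2 * φ x ^ (2 * n)) +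
      n ^ 2 * L ^ 2 * ∫ x, F x ^ 2 * φ x ^ (2 * n - 2)) ^ 3 := by
  obtain ⟨C, hC, h⟩ := sobolev_lip
  refine ⟨C * 8, by positivity, fun F φ K L M n hF hM hφ h0 h1 hz hn => ?_⟩
  have hφa : ∀ x, |φ x| ≤ 1 := fun x => by rw [abs_of_nonneg (h0 x)]; exact h1 x
  have hpow := lip_pow hφ hφa n
  have hp1 : ∀ x, |φ x ^ n| ≤ (1 : ℝ≥0) := fun x => by
    rw [abs_pow]; exact pow_le_one₀ (abs_nonneg _) (hφa x)
  have hG := LipschitzWith.mul_of_bound hF hpow hM hp1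
  have hz' : ∀ k, k ≠ 0 → ∀ x, 7 / 4 ≤ ‖x‖ → φ x ^ k = 0 := fun k hk x hx => by
    rw [hz x hx, zero_pow hk]
  have key := h _ _ hG fun x hx => by
    rw [hz' n (by omega) x (by linarith), mul_zero]
  refine key.trans ?_
  have i1 : Integrable fun x => ‖fderiv ℝ F x‖ ^ 2 * φ x ^ (2 * n) :=
    integrable_mul_cutoff (M := K ^ 2) ((measurable_fderiv ℝ F).norm.pow_const 2)
      (fun x => by
        rw [abs_of_nonneg (sq_nonneg _)]
        exact pow_le_pow_left₀ (norm_nonneg _) (norm_fderiv_le_of_lipschitz ℝ hF) 2)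
      (hφ.continuous.pow _) (hz' _ (by omega))
  have i2 : Integrable fun x => F x ^ 2 * φ x ^ (2 * n - 2) :=
    integrable_mul_cutoff (M := M ^ 2) (hF.continuous.measurable.pow_const 2)
      (fun x => by
        rw [abs_of_nonneg (sq_nonneg _), ← sq_abs]
        exact pow_le_pow_left₀ (abs_nonneg _) (hM x) 2)
      (hφ.continuous.pow _) (hz' _ (by omega))
  have hb : ∫ x, ‖fderiv ℝ (fun x => F x * φ x ^ n) x‖ ^ 2 ≤
      ∫ x, (2 * (‖fderiv ℝ F x‖ ^ 2 * φ x ^ (2 * n)) +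
        2 * n ^ 2 * L ^ 2 * (F x ^ 2 * φ x ^ (2 * n - 2))) := by
    refine integral_mono_of_nonneg (Eventually.of_forall fun x => sq_nonneg _)
      ((i1.const_mul _).add (i2.const_mul _)) ?_
    filter_upwards [hF.ae_differentiableAt, hφ.ae_differentiableAt] with x hx hx'
    refine (norm_fderiv_mul_sq_le (g := fun x => φ x ^ n) hx (hx'.fun_pow n)).trans ?_
    have h3 := pow_le_pow_left₀ (norm_nonneg _) (norm_fderiv_pow_le hφ h0 n hx') 2
    have e1 : (φ x ^ n) ^ 2 = φ x ^ (2 * n) := by rw [← pow_mul, mul_comm]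
    have e2 : (φ x ^ (n - 1)) ^ 2 = φ x ^ (2 * n - 2) := by
      rw [← pow_mul]; congr 1; omega
    rw [e1]
    refine add_le_add le_rfl ?_
    rw [mul_assoc 2, mul_assoc 2]
    refine mul_le_mul_of_nonneg_left ?_ zero_le_two
    calc F x ^ 2 * ‖fderiv ℝ (fun x => φ x ^ n) x‖ ^ 2
        ≤ F x ^ 2 * (n * L * φ x ^ (n - 1)) ^ 2 := mul_le_mul_of_nonneg_left h3 (sq_nonneg _)
      _ = _ := by rw [mul_pow, e2]; ring
  rw [integral_add (i1.const_mul _) (i2.const_mul _), integral_const_mul, integral_const_mul] at hb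
  have hp : 0 ≤ ∫ x, ‖fderiv ℝ (fun x => F x * φ x ^ n) x‖ ^ 2 :=
    integral_nonneg fun x => sq_nonneg _
  calc _ ≤ C * (2 * (∫ x, ‖fderiv ℝ F x‖ ^ 2 * φ x ^ (2 * n)) +
      2 * n ^ 2 * L ^ 2 * ∫ x, F x ^ 2 * φ x ^ (2 * n - 2)) ^ 3 := by gcongr
    _ = _ := by ring

lemma fderiv_comp_slice {H : ℝ → ℝ} {H' : ℝ} {U : SpT → ℝ} {t : ℝ} {x : E3}
    (hH : HasDerivAt H H' (U (t, x))) (hx : DifferentiableAt ℝ (fun y => U (t, y)) x) :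
    fderiv ℝ (fun y => H (U (t, y))) x = H' • gradS U t x :=
  (hH.comp_hasFDerivAt x hx.hasFDerivAt).fderiv

lemma measurable_slice_integral {F : SpT → ℝ} (hF : Measurable F) :
    Measurable fun t => ∫ x, F (t, x) :=
  (hF.stronglyMeasurable.integral_prod_right' (ν := volume)).measurable

/-- The cutoff used in the logarithmic estimate. -/
def cutL : E3 → ℝ := cut (5 / 4) (7 / 4)

lemma cutL_lip : LipschitzWith 2 cutL := by
  have := cut_lip (r := 5 / 4) (s := 7 / 4) (by norm_num)
  rwa [show ((7 / 4 - 5 / 4 : ℝ)⁻¹).toNNReal = 2 by norm_num] at this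

lemma cutL_nonneg (x : E3) : 0 ≤ cutL x := cut_nonneg _ _ _

lemma cutL_le_one (x : E3) : cutL x ≤ 1 := cut_le_one _ _ _

lemma cutL_abs_le (x : E3) : |cutL x| ≤ 1 := by
  rw [abs_of_nonneg (cutL_nonneg x)]; exact cutL_le_one x

lemma cutL_pow_eq_zero {n : ℕ} (hn : n ≠ 0) (x : E3) (hx : 7 / 4 ≤ ‖x‖) : cutL x ^ n = 0 := by
  rw [show cutL x = 0 from cut_eq_zero (by norm_num) hx, zero_pow hn]

lemma cutL_eq_one {x : E3} (hx : x ∈ closedBall (0 : E3) (5 / 4)) : cutL x = 1 :=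
  cut_eq_one (by norm_num) (by simpa using hx)

lemma cutL_pow_le {n k : ℕ} (h : k ≤ n) (x : E3) : cutL x ^ n ≤ cutL x ^ k :=
  pow_le_pow_of_le_one (cutL_nonneg x) (cutL_le_one x) h

lemma cutL_pow_integrable {n : ℕ} (hn : n ≠ 0) : Integrable fun x => cutL x ^ n :=
  integrable_cutoff (cutL_lip.continuous.pow n) (cutL_pow_eq_zero hn)

lemma integrable_mul_cutL {F : E3 → ℝ} {M : ℝ} (hm : Measurable F) (hM : ∀ x, |F x| ≤ M) {n : ℕ}
    (hn : n ≠ 0) : Integrable fun x => F x * cutL x ^ n :=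
  integrable_mul_cutoff hm hM (cutL_lip.continuous.pow n) (cutL_pow_eq_zero hn)

lemma cutL_mass_pos (n : ℕ) (hn : n ≠ 0) : 0 < ∫ x, cutL x ^ n := by
  have h1 : ∫ x in closedBall (0 : E3) (5 / 4), (1 : ℝ) ≤ ∫ x, cutL x ^ n := by
    rw [← integral_indicator measurableSet_closedBall]
    refine integral_mono_of_nonneg (Eventually.of_forall fun x => indicator_nonneg (by simp) _)
      (cutL_pow_integrable hn) (Eventually.of_forall fun x => ?_)
    by_cases hx : x ∈ closedBall (0 : E3) (5 / 4)
    · simp [indicator_of_mem hx, cutL_eq_one hx]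
    · simp only [indicator_of_notMem hx]
      exact pow_nonneg (cutL_nonneg x) _
  refine lt_of_lt_of_le ?_ h1
  simp only [integral_const, MeasurableSet.univ, smul_eq_mul, mul_one, measureReal_restrict_apply,
    univ_inter]
  exact ENNReal.toReal_pos (measure_closedBall_pos _ _ (by norm_num)).ne'
    measure_closedBall_lt_top.ne

lemma cutL_fderiv_le (n : ℕ) : ∀ᵐ x, ‖fderiv ℝ (fun x => cutL x ^ n) x‖ ≤
    2 * n * cutL x ^ (n - 1) := by
  filter_upwards [cutL_lip.ae_differentiableAt] with x hx
  refine (norm_fderiv_pow_le cutL_lip cutL_nonneg n hx).trans_eq ?_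
  push_cast; ring

lemma grad_sq_integrable {w : E3 → ℝ} {K : ℝ≥0} (hw : LipschitzWith K w) {n : ℕ} (hn : n ≠ 0) :
    Integrable fun x => ‖fderiv ℝ w x‖ ^ 2 * cutL x ^ n :=
  integrable_mul_cutL (M := K ^ 2) ((measurable_fderiv ℝ w).norm.pow_const 2)
    (fun x => by
      rw [abs_of_nonneg (sq_nonneg _)]
      exact pow_le_pow_left₀ (norm_nonneg _) (norm_fderiv_le_of_lipschitz ℝ hw) 2) hn

/-- Poincaré and Sobolev inequalities for the deviation from the weighted mean. -/
lemma cutL_poincare_sobolev (j : ℕ) (hj : 1 ≤ j) : ∃ C : ℝ, 0 < C ∧ ∀ (w : E3 → ℝ) (K M : ℝ≥0),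
    LipschitzWith K w → (∀ x, |w x| ≤ M) →
    (∫ x, (w x - (∫ x, w x * cutL x ^ (4 * j)) / ∫ x, cutL x ^ (4 * j)) ^ 2 * cutL x ^ (4 * j) ≤
      C * ∫ x, ‖fderiv ℝ w x‖ ^ 2 * cutL x ^ (4 * j)) ∧
    ∫ x, ((w x - (∫ x, w x * cutL x ^ (4 * j)) / ∫ x, cutL x ^ (4 * j)) * cutL x ^ (3 * j)) ^ 6 ≤
      C * (∫ x, ‖fderiv ℝ w x‖ ^ 2 * cutL x ^ (4 * j)) ^ 3 := by
  obtain ⟨CP, hCP, hP⟩ := poincare_mean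
  obtain ⟨CS, hCS, hS⟩ := sobolev_cut
  have hm := cutL_mass_pos (4 * j) (by omega)
  set m := ∫ x, cutL x ^ (4 * j) with hmdef
  set C1 := CP / m with hC1
  have hC1p : 0 < C1 := by positivity
  refine ⟨C1 + CS * (1 + 36 * j ^ 2 * C1) ^ 3, by positivity, fun w K M hw hM => ?_⟩
  set c := (∫ x, w x * cutL x ^ (4 * j)) / m with hc
  set E := ∫ x, ‖fderiv ℝ w x‖ ^ 2 * cutL x ^ (4 * j) with hE
  have hE0 : 0 ≤ E := integral_nonneg fun x => mul_nonneg (sq_nonneg _) (pow_nonneg (cutL_nonneg x) _)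
  have h1 : ∫ x, (w x - c) ^ 2 * cutL x ^ (4 * j) ≤ C1 * E := by
    have := hP w (fun x => cutL x ^ (4 * j)) K hw (cutL_lip.continuous.pow _)
      (fun x => pow_nonneg (cutL_nonneg x) _) (fun x => pow_le_one₀ (cutL_nonneg x) (cutL_le_one x))
      (fun x hx => cutL_pow_eq_zero (by omega) x (by linarith))
      (fun x y s hs => by
        have h2 := cut_quasi (r := 5 / 4) (s := 7 / 4) (by norm_num) x y hs
        rcases min_le_iff.1 h2 with h3 | h3
        · exact (min_le_left _ _).trans (pow_le_pow_left₀ (cutL_nonneg x) h3 _)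
        · exact (min_le_right _ _).trans (pow_le_pow_left₀ (cutL_nonneg y) h3 _)) hm
    rw [hC1, div_mul_eq_mul_div, le_div_iff₀ hm, mul_comm]
    exact this
  have hw' : LipschitzWith K fun x => w x - c := by
    simpa using hw.sub (LipschitzWith.const c)
  have hM' : ∀ x, |w x - c| ≤ (M + ⟨|c|, abs_nonneg c⟩ : ℝ≥0) := fun x =>
    (abs_sub _ _).trans (add_le_add (hM x) le_rfl)
  have hfd : ∀ x, fderiv ℝ (fun x => w x - c) x = fderiv ℝ w x := fun x => fderiv_sub_const c
  have hcM : ∀ x, |(w x - c) ^ 2| ≤ ((M + ⟨|c|, abs_nonneg c⟩ : ℝ≥0) : ℝ) ^ 2 := fun x => by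
    rw [abs_pow]; exact pow_le_pow_left₀ (abs_nonneg _) (hM' x) 2
  have h2 := hS (fun x => w x - c) cutL K 2 _ (3 * j) hw' hM' cutL_lip cutL_nonneg cutL_le_one
    (fun x hx => by simpa using cutL_pow_eq_zero one_ne_zero x hx) (by omega)
  refine ⟨h1.trans (mul_le_mul_of_nonneg_right (le_add_of_nonneg_right (by positivity)) hE0),
    h2.trans ?_⟩
  simp only [hfd]
  have h3 : ∫ x, ‖fderiv ℝ w x‖ ^ 2 * cutL x ^ (2 * (3 * j)) ≤ E :=
    integral_mono (grad_sq_integrable hw (by omega)) (grad_sq_integrable hw (by omega)) fun x =>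
      mul_le_mul_of_nonneg_left (cutL_pow_le (by omega) x) (sq_nonneg _)
  have h4 : ∫ x, (w x - c) ^ 2 * cutL x ^ (2 * (3 * j) - 2) ≤ C1 * E := by
    refine le_trans (integral_mono ?_ ?_ fun x =>
      mul_le_mul_of_nonneg_left (cutL_pow_le (by omega) x) (sq_nonneg _)) h1
    · exact integrable_mul_cutL (hw'.continuous.measurable.pow_const 2) hcM (by omega)
    · exact integrable_mul_cutL (hw'.continuous.measurable.pow_const 2) hcM (by omega)
  have h3' : 0 ≤ ∫ x, ‖fderiv ℝ w x‖ ^ 2 * cutL x ^ (2 * (3 * j)) :=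
    integral_nonneg fun x => mul_nonneg (sq_nonneg _) (pow_nonneg (cutL_nonneg x) _)
  have h4' : 0 ≤ ∫ x, (w x - c) ^ 2 * cutL x ^ (2 * (3 * j) - 2) :=
    integral_nonneg fun x => mul_nonneg (sq_nonneg _) (pow_nonneg (cutL_nonneg x) _)
  calc _ ≤ CS * (E + ((3 * j : ℕ) : ℝ) ^ 2 * ((2 : ℝ≥0) : ℝ) ^ 2 * (C1 * E)) ^ 3 := by gcongr
    _ = CS * (1 + 36 * j ^ 2 * C1) ^ 3 * E ^ 3 := by push_cast; ring
    _ ≤ _ := mul_le_mul_of_nonneg_right (le_add_of_nonneg_left hC1p.le) (by positivity)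

lemma rpow_le_one_add_rpow {T a b : ℝ} (hT : 0 ≤ T) (ha : 0 ≤ a) (hab : a ≤ b) :
    T ^ a ≤ 1 + T ^ b := by
  rcases le_total T 1 with h | h
  · exact (rpow_le_one hT h ha).trans (le_add_of_nonneg_right (rpow_nonneg hT _))
  · exact (rpow_le_rpow_of_exponent_le h hab).trans (le_add_of_nonneg_left zero_le_one)

lemma young_absorb {s X E : ℝ} (hs0 : 0 < s) (hs1 : s < 1) (hX : 0 ≤ X) (hE : 0 ≤ E) :
    X * E ^ s ≤ 1 / 4 * E + (4 ^ s * X) ^ (1 / (1 - s)) := by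
  have h4 : 0 ≤ (4 : ℝ) ^ s * X := mul_nonneg (rpow_nonneg (by norm_num) _) hX
  have hY : 0 ≤ ((4 : ℝ) ^ s * X) ^ (1 / (1 - s)) := rpow_nonneg h4 _
  have h := Real.geom_mean_le_arith_mean2_weighted (w₁ := s) (w₂ := 1 - s) (p₁ := E / 4)
    (p₂ := ((4 : ℝ) ^ s * X) ^ (1 / (1 - s))) hs0.le (by linarith) (by positivity) hY (by ring)
  have e : ((((4 : ℝ) ^ s * X) ^ (1 / (1 - s))) ^ (1 - s)) = 4 ^ s * X := by
    rw [← rpow_mul h4, one_div, inv_mul_cancel₀ (by linarith), rpow_one]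
  rw [e, div_rpow hE (by norm_num)] at h
  have h4s : (4 : ℝ) ^ s ≠ 0 := (rpow_pos_of_pos (by norm_num) _).ne'
  have e2 : E ^ s / 4 ^ s * (4 ^ s * X) = X * E ^ s := by field_simp
  rw [e2] at h
  nlinarith

lemma young_drift {σ q l K : ℝ} (hσ0 : 0 < σ) (hσ1 : σ < 1) (hq : 0 < q)
    (hl : 2 / (2 - σ) ≤ l) (hK : 0 ≤ K) : ∃ C : ℝ, 0 < C ∧ ∀ T W E : ℝ, 0 ≤ T → 0 ≤ W → 0 ≤ E →
      K * T ^ (1 / q) * W ^ (1 - σ) * E ^ (σ / 2) ≤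
        1 / 4 * E + C * (1 + T ^ (l / q)) * (1 + W) ^ ((1 - σ) * (2 / (2 - σ))) := by
  have h2 : 0 < 2 - σ := by linarith
  refine ⟨(4 ^ (σ / 2) * K) ^ (2 / (2 - σ)) + 1, by positivity, fun T W E hT hW hE => ?_⟩
  have hX : 0 ≤ K * T ^ (1 / q) * W ^ (1 - σ) := by positivity
  refine (young_absorb (by linarith) (by linarith) hX hE).trans (add_le_add le_rfl ?_)
  have e : 1 / (1 - σ / 2) = 2 / (2 - σ) := by field_simp
  rw [e, show 4 ^ (σ / 2) * (K * T ^ (1 / q) * W ^ (1 - σ)) =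
    (4 ^ (σ / 2) * K) * T ^ (1 / q) * W ^ (1 - σ) by ring, mul_rpow (by positivity) (by positivity),
    mul_rpow (by positivity) (by positivity), ← rpow_mul hT, ← rpow_mul hW]
  have h1 : T ^ (1 / q * (2 / (2 - σ))) ≤ 1 + T ^ (l / q) := by
    refine rpow_le_one_add_rpow hT (by positivity) ?_
    rw [div_mul_eq_mul_div, one_mul]
    gcongr
  have h3 : W ^ ((1 - σ) * (2 / (2 - σ))) ≤ (1 + W) ^ ((1 - σ) * (2 / (2 - σ))) :=
    rpow_le_rpow hW (by linarith) (mul_nonneg (by linarith) (by positivity))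
  have h5 : 0 ≤ (4 ^ (σ / 2) * K) ^ (2 / (2 - σ)) := by positivity
  gcongr
  linarith

lemma cutL_drift_pointwise {σ u B φ q : ℝ} {j : ℕ} (hσ0 : 0 < σ) (hσ1 : σ < 1) (hq : 0 < q)
    (hj : 1 ≤ j) (hjσ : 1 ≤ j * σ) (hB : 0 ≤ B) (h0 : 0 ≤ φ) (h1 : φ ≤ 1) :
    |u| * (B * φ ^ (4 * j - 1)) ≤
      (B ^ q) ^ (1 / q) * (|u| * φ ^ (4 * j)) ^ (1 - σ) * ((u * φ ^ (3 * j)) ^ 6) ^ (σ / 6) := by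
  have hu := abs_nonneg u
  have e1 : (B ^ q) ^ (1 / q) = B := by
    rw [← rpow_mul hB, mul_one_div_cancel hq.ne', rpow_one]
  have e2 : ((u * φ ^ (3 * j)) ^ 6) ^ (σ / 6) = (|u| * φ ^ (3 * j)) ^ σ := by
    have : (u * φ ^ (3 * j)) ^ 6 = (|u| * φ ^ (3 * j)) ^ (6 : ℝ) := by
      rw [show (6 : ℝ) = ((6 : ℕ) : ℝ) by norm_num, rpow_natCast, mul_pow, mul_pow,
        Even.pow_abs (by decide)]
    rw [this, ← rpow_mul (by positivity), mul_div_cancel₀ _ (by norm_num)]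
  rw [e1, e2]
  rcases h0.eq_or_lt with h | h
  · rw [← h, zero_pow (by omega)]
    simp only [mul_zero]
    positivity
  rw [mul_rpow hu (by positivity), mul_rpow hu (by positivity), ← rpow_natCast, ← rpow_natCast,
    ← rpow_natCast, ← rpow_mul h0, ← rpow_mul h0]
  have e3 : |u| ^ (1 - σ) * |u| ^ σ = |u| := by
    rw [← rpow_add' hu (by linarith), sub_add_cancel, rpow_one]
  have e4 : φ ^ (((4 * j : ℕ) : ℝ) * (1 - σ)) * φ ^ (((3 * j : ℕ) : ℝ) * σ) =
      φ ^ ((4 * j : ℝ) - j * σ) := by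
    rw [← rpow_add h]; congr 1; push_cast; ring
  have e5 : φ ^ (((4 * j - 1 : ℕ) : ℝ)) ≤ φ ^ ((4 * j : ℝ) - j * σ) := by
    refine rpow_le_rpow_of_exponent_ge h h1 ?_
    rw [Nat.cast_sub (by omega)]; push_cast; linarith
  calc |u| * (B * φ ^ (((4 * j - 1 : ℕ) : ℝ))) ≤ |u| * (B * φ ^ ((4 * j : ℝ) - j * σ)) := by gcongr
    _ = B * (|u| ^ (1 - σ) * |u| ^ σ) *
        (φ ^ (((4 * j : ℕ) : ℝ) * (1 - σ)) * φ ^ (((3 * j : ℕ) : ℝ) * σ)) := by rw [e3, e4]; ring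
    _ = _ := by ring

lemma drift_rpow_integrable {B : E3 → ℝ} {N q : ℝ} (hq : 0 < q) (hBm : Measurable B)
    (hB0 : ∀ x, 0 ≤ B x) (hBN : ∀ x, B x ≤ N) (hBs : ∀ x, 2 ≤ ‖x‖ → B x = 0) :
    Integrable fun x => B x ^ q := by
  refine integrable_of_ball (r := 2) (M := N ^ q) (hBm.pow_const q).aestronglyMeasurable
    (fun x _ => ?_) fun x hx => ?_
  · rw [abs_of_nonneg (rpow_nonneg (hB0 x) _)]
    exact rpow_le_rpow (hB0 x) (hBN x) hq.le
  · rw [hBs x (by simp only [mem_closedBall, dist_zero_right, not_le] at hx; exact hx.le),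
      zero_rpow hq.ne']

lemma cutL_grad_term (j : ℕ) (hj : 1 ≤ j) : ∃ C : ℝ, 0 < C ∧ ∀ (w : E3 → ℝ) (K : ℝ≥0),
    LipschitzWith K w →
    ∫ x, ‖fderiv ℝ w x‖ * ‖fderiv ℝ (fun x => cutL x ^ (4 * j)) x‖ ≤
      1 / 4 * (∫ x, ‖fderiv ℝ w x‖ ^ 2 * cutL x ^ (4 * j)) + C := by
  have hm := cutL_mass_pos (4 * j - 2) (by omega)
  refine ⟨64 * j ^ 2 * ∫ x, cutL x ^ (4 * j - 2), by positivity, fun w K hw => ?_⟩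
  have i1 := grad_sq_integrable hw (n := 4 * j) (by omega)
  have i2 := cutL_pow_integrable (n := 4 * j - 2) (by omega)
  rw [← integral_const_mul, ← integral_const_mul, ← integral_add (i1.const_mul _) (i2.const_mul _)]
  refine integral_mono_of_nonneg (Eventually.of_forall fun x => by positivity)
    ((i1.const_mul _).add (i2.const_mul _)) ?_
  filter_upwards [cutL_fderiv_le (4 * j)] with x hx
  have h0 := cutL_nonneg x
  have e1 : cutL x ^ (4 * j - 1) = cutL x ^ (2 * j) * cutL x ^ (2 * j - 1) := by
    rw [← pow_add]; congr 1; omega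
  have e2 : cutL x ^ (4 * j) = (cutL x ^ (2 * j)) ^ 2 := by rw [← pow_mul]; congr 1; omega
  have e3 : cutL x ^ (4 * j - 2) = (cutL x ^ (2 * j - 1)) ^ 2 := by rw [← pow_mul]; congr 1; omega
  refine (mul_le_mul_of_nonneg_left hx (norm_nonneg _)).trans ?_
  rw [e1, e2, e3]
  push_cast
  nlinarith [sq_nonneg (1 / 2 * ‖fderiv ℝ w x‖ * cutL x ^ (2 * j) - 8 * j * cutL x ^ (2 * j - 1))]

/-- The static part of the logarithmic estimate: absorption of the cutoff and drift terms. -/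
lemma cutL_log_static {q l : ℝ} (hq : 3 / 2 < q) (hl : 1 < l) (hql : 3 / (2 * q) + 1 / l < 1) :
    ∃ (C γ : ℝ) (j : ℕ), 0 < C ∧ 0 < γ ∧ γ < 1 ∧ 1 ≤ j ∧ ∀ (w B : E3 → ℝ) (K M : ℝ≥0) (N : ℝ),
      LipschitzWith K w → (∀ x, 0 ≤ w x) → (∀ x, w x ≤ M) → Measurable B → (∀ x, 0 ≤ B x) →
      (∀ x, B x ≤ N) → (∀ x, 2 ≤ ‖x‖ → B x = 0) →
      ((∫ x, ‖fderiv ℝ w x‖ * ‖fderiv ℝ (fun x => cutL x ^ (4 * j)) x‖) +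
        (∫ x, |w x - (∫ x, w x * cutL x ^ (4 * j)) / ∫ x, cutL x ^ (4 * j)| *
          (B x * ‖fderiv ℝ (fun x => cutL x ^ (4 * j)) x‖)) ≤
        1 / 2 * (∫ x, ‖fderiv ℝ w x‖ ^ 2 * cutL x ^ (4 * j)) +
          C * (1 + (∫ x, B x ^ q) ^ (l / q)) * (1 + ∫ x, w x * cutL x ^ (4 * j)) ^ γ) ∧
      ∀ A : Set E3, MeasurableSet A → A ⊆ closedBall 0 (5 / 4) → (∀ x ∈ A, w x ≤ log 2) →
        2 * log 2 * (∫ x, cutL x ^ (4 * j)) ≤ ∫ x, w x * cutL x ^ (4 * j) →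
        (volume A).toReal * (∫ x, w x * cutL x ^ (4 * j)) ^ 2 ≤
          C * ∫ x, ‖fderiv ℝ w x‖ ^ 2 * cutL x ^ (4 * j) := by
  have hq0 : 0 < q := by linarith
  have hl0 : 0 < l := by linarith
  obtain ⟨σ, hσ⟩ : ∃ σ, σ = 6 / (5 * q) := ⟨_, rfl⟩
  have hσ0 : 0 < σ := by rw [hσ]; positivity
  have hσ1 : σ < 1 := by rw [hσ, div_lt_one (by positivity)]; linarith
  have hσl : 2 / (2 - σ) ≤ l := by
    have h1 : 2 - σ = 2 * (1 - 3 / (5 * q)) := by rw [hσ]; field_simp; ring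
    have h2 : 3 / (5 * q) ≤ 3 / (2 * q) := by gcongr; norm_num
    have h3 : 1 / l ≤ 1 - 3 / (5 * q) := by linarith
    have h5 : 0 < 1 / l := by positivity
    rw [h1, div_le_iff₀ (by linarith)]
    have h4 : l * (1 / l) ≤ l * (1 - 3 / (5 * q)) := mul_le_mul_of_nonneg_left h3 hl0.le
    rw [mul_one_div_cancel hl0.ne'] at h4
    linarith
  obtain ⟨j, hj⟩ : ∃ j : ℕ, j = ⌈1 / σ⌉₊ := ⟨_, rfl⟩
  have hjσ : 1 ≤ j * σ := by
    have : 1 / σ ≤ j := hj ▸ Nat.le_ceil _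
    rwa [div_le_iff₀ hσ0] at this
  have hj1 : 1 ≤ j := by rw [hj]; exact Nat.one_le_ceil_iff.2 (by positivity)
  obtain ⟨C1, hC1, h1⟩ := cutL_poincare_sobolev j hj1
  obtain ⟨C2, hC2, h2⟩ := cutL_grad_term j hj1
  obtain ⟨C3, hC3, h3⟩ := young_drift (K := 8 * j * 2 ^ (1 - σ) * C1 ^ (σ / 6)) hσ0 hσ1 hq0 hσl
    (by positivity)
  have hm := cutL_mass_pos (4 * j) (by omega)
  set m := ∫ x, cutL x ^ (4 * j) with hmdef
  have hγ0 : 0 < (1 - σ) * (2 / (2 - σ)) := mul_pos (by linarith) (div_pos two_pos (by linarith))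
  refine ⟨C2 + C3 + 4 * m ^ 2 * C1, (1 - σ) * (2 / (2 - σ)), j, by positivity, hγ0, ?_, hj1,
    fun w B K M N hw w0 wM hBm hB0 hBN hBs => ?_⟩
  · rw [← mul_div_assoc, div_lt_one (by linarith)]; linarith
  have wa : ∀ x, |w x| ≤ M := fun x => by rw [abs_of_nonneg (w0 x)]; exact wM x
  obtain ⟨hP, hS⟩ := h1 w K M hw wa
  set W := ∫ x, w x * cutL x ^ (4 * j) with hW
  set E := ∫ x, ‖fderiv ℝ w x‖ ^ 2 * cutL x ^ (4 * j) with hE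
  have hE0 : 0 ≤ E := integral_nonneg fun x => mul_nonneg (sq_nonneg _) (pow_nonneg (cutL_nonneg x) _)
  have hW0 : 0 ≤ W := integral_nonneg fun x => mul_nonneg (w0 x) (pow_nonneg (cutL_nonneg x) _)
  have iw := integrable_mul_cutL hw.continuous.measurable wa (n := 4 * j) (by omega)
  have im := cutL_pow_integrable (n := 4 * j) (by omega)
  have hub : ∀ x, |w x - W / m| ≤ M + W / m := fun x => by
    refine (abs_sub _ _).trans (add_le_add (wa x) (abs_of_nonneg (by positivity)).le)
  have hum : Measurable fun x => w x - W / m := hw.continuous.measurable.sub_const _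
  have i1 := drift_rpow_integrable hq0 hBm hB0 hBN hBs
  have i2 : Integrable fun x => |w x - W / m| * cutL x ^ (4 * j) :=
    integrable_mul_cutL hum.abs (fun x => (abs_abs _).le.trans (hub x)) (by omega)
  have i3 : Integrable fun x => ((w x - W / m) * cutL x ^ (3 * j)) ^ 6 := by
    have : Integrable fun x => (w x - W / m) ^ 6 * cutL x ^ (18 * j) :=
      integrable_mul_cutL (M := (M + W / m) ^ 6) (hum.pow_const 6) (fun x => by
        rw [abs_pow]; exact pow_le_pow_left₀ (abs_nonneg _) (hub x) 6) (by omega)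
    refine this.congr (Eventually.of_forall fun x => ?_)
    simp only [mul_pow, ← pow_mul]
    congr 2; omega
  have hu2 : ∫ x, |w x - W / m| * cutL x ^ (4 * j) ≤ 2 * W := by
    calc _ ≤ ∫ x, (w x * cutL x ^ (4 * j) + W / m * cutL x ^ (4 * j)) := by
          refine integral_mono i2 (iw.add (im.const_mul _)) fun x => ?_
          simp only [← add_mul]
          refine mul_le_mul_of_nonneg_right ?_ (pow_nonneg (cutL_nonneg x) _)
          refine (abs_sub _ _).trans_eq ?_
          rw [abs_of_nonneg (w0 x), abs_of_nonneg (by positivity)]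
      _ = 2 * W := by
          rw [integral_add iw (im.const_mul _), integral_const_mul, div_mul_cancel₀ _ hm.ne']
          ring
  constructor
  · have hD : ∫ x, |w x - W / m| * (B x * ‖fderiv ℝ (fun x => cutL x ^ (4 * j)) x‖) ≤
        1 / 4 * E + C3 * (1 + (∫ x, B x ^ q) ^ (l / q)) * (1 + W) ^ ((1 - σ) * (2 / (2 - σ))) := by
      refine le_trans ?_ (h3 (∫ x, B x ^ q) W E
        (integral_nonneg fun x => rpow_nonneg (hB0 x) _) hW0 hE0)
      have hh := integral_le_prod_rpow (μ := volume)
        (f := ![fun x => B x ^ q, fun x => |w x - W / m| * cutL x ^ (4 * j),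
          fun x => ((w x - W / m) * cutL x ^ (3 * j)) ^ 6]) (θ := ![1 / q, 1 - σ, σ / 6])
        (g := fun x => (8 * j : ℝ)⁻¹ * (|w x - W / m| *
          (B x * ‖fderiv ℝ (fun x => cutL x ^ (4 * j)) x‖)))
        (fun i => by fin_cases i <;> assumption)
        (fun i x => by
          have := cutL_nonneg x
          have := hB0 x
          fin_cases i
          · exact rpow_nonneg (hB0 x) _
          · exact mul_nonneg (abs_nonneg _) (pow_nonneg (cutL_nonneg x) _)
          · exact Even.pow_nonneg (by decide) _)
        (fun i => by fin_cases i <;> simp <;> linarith)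
        (by
          simp only [Fin.sum_univ_three, Matrix.cons_val_zero, Matrix.cons_val_one, Matrix.cons_val]
          rw [hσ]; field_simp; ring)
        (by
          filter_upwards [cutL_fderiv_le (4 * j)] with x hx
          simp only [Fin.prod_univ_three, Matrix.cons_val_zero, Matrix.cons_val_one, Matrix.cons_val]
          refine le_trans ?_ (cutL_drift_pointwise (j := j) hσ0 hσ1 hq0 hj1 hjσ (hB0 x)
            (cutL_nonneg x) (cutL_le_one x))
          rw [inv_mul_le_iff₀ (by positivity)]
          have h5 := mul_le_mul_of_nonneg_left (mul_le_mul_of_nonneg_left hx (hB0 x))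
            (abs_nonneg (w x - W / m))
          refine h5.trans_eq ?_
          push_cast; ring)
      simp only [Fin.prod_univ_three, Matrix.cons_val_zero, Matrix.cons_val_one, Matrix.cons_val]
        at hh
      rw [integral_const_mul, inv_mul_le_iff₀ (by positivity)] at hh
      refine hh.trans ?_
      have hT : 0 ≤ ∫ x, B x ^ q := integral_nonneg fun x => rpow_nonneg (hB0 x) _
      have hS' : (∫ x, ((w x - W / m) * cutL x ^ (3 * j)) ^ 6) ^ (σ / 6) ≤
          C1 ^ (σ / 6) * E ^ (σ / 2) := by
        refine (rpow_le_rpow (integral_nonneg fun x => Even.pow_nonneg (by decide) _) hS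
          (by positivity)).trans_eq ?_
        rw [mul_rpow hC1.le (by positivity), ← rpow_natCast E, ← rpow_mul hE0]
        congr 2; push_cast; ring
      have hu2' : (∫ x, |w x - W / m| * cutL x ^ (4 * j)) ^ (1 - σ) ≤ 2 ^ (1 - σ) * W ^ (1 - σ) := by
        rw [← mul_rpow zero_le_two hW0]
        exact rpow_le_rpow (integral_nonneg fun x =>
          mul_nonneg (abs_nonneg _) (pow_nonneg (cutL_nonneg x) _)) hu2 (by linarith)
      calc _ ≤ 8 * j * ((∫ x, B x ^ q) ^ (1 / q) * (2 ^ (1 - σ) * W ^ (1 - σ)) *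
            (C1 ^ (σ / 6) * E ^ (σ / 2))) := by
            gcongr
        _ = _ := by ring
    have hG := h2 w K hw
    have hT : 0 ≤ (∫ x, B x ^ q) ^ (l / q) :=
      rpow_nonneg (integral_nonneg fun x => rpow_nonneg (hB0 x) _) _
    have hWγ : 1 ≤ (1 + W) ^ ((1 - σ) * (2 / (2 - σ))) := one_le_rpow (by linarith) hγ0.le
    have h6 : 1 ≤ (1 + (∫ x, B x ^ q) ^ (l / q)) * (1 + W) ^ ((1 - σ) * (2 / (2 - σ))) :=
      one_le_mul_of_one_le_of_one_le (by linarith) hWγ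
    have h7 := mul_le_mul_of_nonneg_left h6 hC2.le
    have h8 := mul_nonneg (by positivity : 0 ≤ 4 * m ^ 2 * C1) (zero_le_one.trans h6)
    refine (add_le_add hG hD).trans ?_
    linarith
  · intro A hA hAs hAw hc
    have h5 : (volume A).toReal * (W / (2 * m)) ^ 2 ≤ ∫ x, (w x - W / m) ^ 2 * cutL x ^ (4 * j) := by
      have hAf : volume A ≠ ⊤ := ((measure_mono hAs).trans_lt measure_closedBall_lt_top).ne
      calc _ = ∫ x in A, (W / (2 * m)) ^ 2 := by simp [measureReal_def]
        _ = ∫ x, A.indicator (fun _ => (W / (2 * m)) ^ 2) x := (integral_indicator hA).symm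
        _ ≤ _ := by
          refine integral_mono_of_nonneg (Eventually.of_forall fun x =>
            indicator_nonneg (fun _ _ => sq_nonneg _) _) (integrable_mul_cutL
              (M := (M + W / m) ^ 2) (hum.pow_const 2) (fun x => by
                rw [abs_pow]; exact pow_le_pow_left₀ (abs_nonneg _) (hub x) 2) (by omega))
              (Eventually.of_forall fun x => ?_)
          by_cases hx : x ∈ A
          · simp only [indicator_of_mem hx, cutL_eq_one (hAs hx), one_pow, mul_one]
            have h6 := hAw x hx
            have h7 : 2 * log 2 ≤ W / m := by rwa [le_div_iff₀ hm]
            have h8 : W / (2 * m) = W / m / 2 := by field_simp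
            rw [h8, ← neg_sq (w x - W / m)]
            refine pow_le_pow_left₀ (by positivity) ?_ 2
            linarith
          · simp only [indicator_of_notMem hx]
            exact mul_nonneg (sq_nonneg _) (pow_nonneg (cutL_nonneg x) _)
    have h6 := h5.trans hP
    rw [div_pow, mul_div_assoc', div_le_iff₀ (by positivity)] at h6
    have h7 : 0 ≤ (C2 + C3) * E := by positivity
    nlinarith

/-- The time density of the drift norm. -/
def driftPow (B : SpT → ℝ) (q l : ℝ) (t : ℝ) : ℝ := (∫ x, B (t, x) ^ q) ^ (l / q)

lemma Slab.driftPow_nonneg {U B : SpT → ℝ} {K : ℝ≥0} {δ : ℝ} (h : Slab U B K δ) (q l t : ℝ) :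
    0 ≤ driftPow B q l t :=
  rpow_nonneg (integral_nonneg fun _ => rpow_nonneg (h.B0 _) _) _

lemma Slab.slice_measurable {U B : SpT → ℝ} {K : ℝ≥0} {δ : ℝ} (h : Slab U B K δ) (t : ℝ) :
    Measurable fun x => B (t, x) := h.Bm.comp measurable_prodMk_left

lemma hasDerivAt_neg_log {u : ℝ} (hu : u ∈ Ioo (0 : ℝ) 2) :
    HasDerivAt (fun u => -log u) (-u⁻¹) u := (hasDerivAt_log hu.1.ne').neg

lemma hasDerivAt_neg_inv {u : ℝ} (hu : u ∈ Ioo (0 : ℝ) 2) :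
    HasDerivAt (fun u : ℝ => -u⁻¹) (u ^ 2)⁻¹ u := by
  have := (hasDerivAt_inv hu.1.ne').fun_neg
  rwa [neg_neg] at this

lemma log_dynamic {q l : ℝ} (hq : 3 / 2 < q) (hl : 1 < l) (hql : 3 / (2 * q) + 1 / l < 1) :
    ∃ (C c γ : ℝ) (j : ℕ), 0 < C ∧ 0 < c ∧ 0 < γ ∧ γ < 1 ∧ 1 ≤ j ∧
      ∀ (U B : SpT → ℝ) (K : ℝ≥0) (δ : ℝ), Slab U B K δ →
      (∃ K', LipschitzWith K' (sliceInt (fun u => -log u) U fun x => cutL x ^ (4 * j))) ∧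
      (∀ t, 0 ≤ sliceInt (fun u => -log u) U (fun x => cutL x ^ (4 * j)) t) ∧
      ∀ᵐ t, t ∈ Ioo (-1 : ℝ) 0 →
        deriv (sliceInt (fun u => -log u) U fun x => cutL x ^ (4 * j)) t ≤
          C * (1 + driftPow B q l t) *
            (1 + sliceInt (fun u => -log u) U (fun x => cutL x ^ (4 * j)) t) ^ γ ∧
        (2 * log 2 * (∫ x, cutL x ^ (4 * j)) ≤
            sliceInt (fun u => -log u) U (fun x => cutL x ^ (4 * j)) t →
          deriv (sliceInt (fun u => -log u) U fun x => cutL x ^ (4 * j)) t ≤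
          C * (1 + driftPow B q l t) *
            (1 + sliceInt (fun u => -log u) U (fun x => cutL x ^ (4 * j)) t) ^ γ -
          c * (volume {x | x ∈ closedBall (0 : E3) (5 / 4) ∧ 1 / 2 ≤ U (t, x)}).toReal *
            sliceInt (fun u => -log u) U (fun x => cutL x ^ (4 * j)) t ^ 2) := by
  obtain ⟨C, γ, j, hC, hγ0, hγ1, hj, h⟩ := cutL_log_static hq hl hql
  refine ⟨C, 1 / (2 * C), γ, j, hC, by positivity, hγ0, hγ1, hj, fun U B K δ hU => ?_⟩
  set ψ : E3 → ℝ := fun x => cutL x ^ (4 * j) with hψ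
  have hH : ∀ u, u ∈ Ioo (0 : ℝ) 2 → HasDerivAt (fun u => -log u) (-u⁻¹) u :=
    fun u hu => hasDerivAt_neg_log hu
  have hH1 : ∀ u, u ∈ Ioo (0 : ℝ) 2 → HasDerivAt (fun u : ℝ => -u⁻¹) (u ^ 2)⁻¹ u :=
    fun u hu => hasDerivAt_neg_inv hu
  have hH1c : ContinuousOn (fun u : ℝ => -u⁻¹) (Ioo 0 2) := fun u hu =>
    (hH1 u hu).continuousAt.continuousWithinAt
  have hH2 : ContinuousOn (fun u : ℝ => (u ^ 2)⁻¹) (Ioo 0 2) :=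
    (continuousOn_id.pow 2).inv₀ fun u hu => pow_ne_zero 2 (ne_of_gt hu.1)
  obtain ⟨LH, MH, hLH, hMH⟩ := exists_lip_comp hH hH1c hU.hδ hU.lip hU.lb hU.ub
  have hψL := lip_pow cutL_lip cutL_abs_le (4 * j)
  have hψ0 : ∀ x, 0 ≤ ψ x := fun x => pow_nonneg (cutL_nonneg x) _
  have hψ1 : ∀ x, ψ x ≤ 1 := fun x => pow_le_one₀ (cutL_nonneg x) (cutL_le_one x)
  have hψz : ∀ x, 7 / 4 ≤ ‖x‖ → ψ x = 0 := cutL_pow_eq_zero (by omega)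
  have hpos : ∀ p, 0 < U p := fun p => hU.hδ.trans_le (hU.lb p)
  have w0 : ∀ p, 0 ≤ -log (U p) := fun p =>
    neg_nonneg.2 (log_nonpos (hpos p).le (hU.ub p))
  have hW0 : ∀ t, 0 ≤ sliceInt (fun u => -log u) U ψ t := fun t =>
    integral_nonneg fun x => mul_nonneg (w0 _) (hψ0 x)
  obtain ⟨N, hN⟩ := hU.Bb
  refine ⟨sliceInt_lip hLH hMH hψL.continuous hψz, hW0, ?_⟩
  filter_upwards [hU.si _ _ _ hH hH1 hH2 ψ _ hψL hψ0 hψ1 hψz] with t ht ht'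
  set W := sliceInt (fun u => -log u) U ψ t with hW
  have hwl : LipschitzWith LH fun x => -log (U (t, x)) := lipschitz_slice hLH t
  obtain ⟨hs, hA⟩ := h (fun x => -log (U (t, x))) (fun x => B (t, x)) LH MH N hwl (fun x => w0 _)
    (fun x => (le_abs_self _).trans (hMH _)) (hU.slice_measurable t) (fun x => hU.B0 _)
    (fun x => hN _) (fun x hx => hU.Bs _ hx)
  have ht := ht ht' ((∫ x, -log (U (t, x)) * ψ x) / ∫ x, ψ x)
  have hg : ∀ᵐ x, fderiv ℝ (fun y => -log (U (t, y))) x = (-(U (t, x))⁻¹) • gradS U t x := by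
    filter_upwards [(lipschitz_slice hU.lip t).ae_differentiableAt] with x hx
    exact fderiv_comp_slice (H := fun u => -log u)
      (hH _ ⟨hpos _, (hU.ub _).trans_lt one_lt_two⟩) hx
  have e1 : ∫ x, ((U (t, x)) ^ 2)⁻¹ * ‖gradS U t x‖ ^ 2 * ψ x =
      ∫ x, ‖fderiv ℝ (fun y => -log (U (t, y))) x‖ ^ 2 * cutL x ^ (4 * j) := by
    refine integral_congr_ae ?_
    filter_upwards [hg] with x hx
    rw [hx, norm_smul, norm_neg, norm_inv, norm_of_nonneg (hpos _).le, mul_pow, inv_pow]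
  have e2 : ∫ x, |-(U (t, x))⁻¹| * ‖gradS U t x‖ * ‖fderiv ℝ ψ x‖ =
      ∫ x, ‖fderiv ℝ (fun y => -log (U (t, y))) x‖ * ‖fderiv ℝ ψ x‖ := by
    refine integral_congr_ae ?_
    filter_upwards [hg] with x hx
    rw [hx, norm_smul, norm_eq_abs]
  rw [e1, e2] at ht
  have hE0 : 0 ≤ ∫ x, ‖fderiv ℝ (fun y => -log (U (t, y))) x‖ ^ 2 * cutL x ^ (4 * j) :=
    integral_nonneg fun x => mul_nonneg (sq_nonneg _) (pow_nonneg (cutL_nonneg x) _)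
  have hs' : _ ≤ 1 / 2 * (∫ x, ‖fderiv ℝ (fun y => -log (U (t, y))) x‖ ^ 2 * cutL x ^ (4 * j)) +
    C * (1 + driftPow B q l t) * (1 + W) ^ γ := hs
  refine ⟨by linarith, fun hc => ?_⟩
  have hA' := hA {x | x ∈ closedBall (0 : E3) (5 / 4) ∧ 1 / 2 ≤ U (t, x)}
    (measurableSet_closedBall.inter (measurableSet_le measurable_const
      (lipschitz_slice hU.lip t).continuous.measurable)) (fun x hx => hx.1) (fun x hx => by
      have := log_le_log (by norm_num) hx.2
      rw [one_div, log_inv] at this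
      linarith) hc
  have hA'' : (volume {x | x ∈ closedBall (0 : E3) (5 / 4) ∧ 1 / 2 ≤ U (t, x)}).toReal * W ^ 2 ≤
    C * ∫ x, ‖fderiv ℝ (fun y => -log (U (t, y))) x‖ ^ 2 * cutL x ^ (4 * j) := hA'
  have h9 : 1 / (2 * C) * (volume {x | x ∈ closedBall (0 : E3) (5 / 4) ∧ 1 / 2 ≤ U (t, x)}).toReal *
      W ^ 2 ≤ 1 / 2 * ∫ x, ‖fderiv ℝ (fun y => -log (U (t, y))) x‖ ^ 2 * cutL x ^ (4 * j) := by
    rw [mul_assoc, div_mul_eq_mul_div, div_le_iff₀ (by positivity)]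
    linarith
  linarith

lemma ode_low_time {W a β : ℝ → ℝ} {K : ℝ≥0} {C c γ M0 D s e κ Λ : ℝ} (hW : LipschitzWith K W)
    (hC : 0 < C) (hγ1 : γ < 1) (hse : s ≤ e) (hs : -1 ≤ s) (he : e ≤ 0)
    (hβ0 : ∀ t, 0 ≤ β t) (hβi : IntervalIntegrable β volume (-1) 0) (hβ : ∫ t in (-1)..0, β t ≤ D)
    (hai : IntervalIntegrable a volume s e) (ha : κ ≤ ∫ t in s..e, a t)
    (hd : ∀ᵐ t, t ∈ Ioo (-1 : ℝ) 0 → M0 ≤ W t →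
      deriv W t ≤ C * (1 + β t) * (1 + W t) ^ γ - c * a t * W t ^ 2) (hc : 0 < c)
    (hΛ1 : 1 ≤ Λ) (hΛM : M0 ≤ Λ) (hΛ : 1 + 2 * C * (1 + D) < c * κ * Λ) :
    ∃ t ∈ Icc s e, W t ≤ Λ := by
  by_contra! hcon
  have hpos : ∀ t ∈ Icc s e, 0 < W t := fun t ht => by linarith [hcon t ht]
  have hLip : LipschitzOnWith K (fun t => -(W t)⁻¹) (Icc s e) := by
    refine LipschitzOnWith.of_dist_le_mul fun x hx y hy => ?_
    have hx1 := hcon x hx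
    have hy1 := hcon y hy
    have hx0 := hpos x hx
    have hy0 := hpos y hy
    have e1 : -(W x)⁻¹ - -(W y)⁻¹ = (W x - W y) / (W x * W y) := by
      field_simp; ring
    rw [Real.dist_eq, e1, abs_div, abs_of_pos (mul_pos hx0 hy0), div_le_iff₀ (mul_pos hx0 hy0)]
    refine (hW.dist_le_mul x y).trans (le_mul_of_one_le_right (by positivity) ?_)
    exact one_le_mul_of_one_le_of_one_le (by linarith) (by linarith)
  have hsub : uIcc s e ⊆ uIcc (-1) 0 := by
    rw [uIcc_of_le hse, uIcc_of_le (by norm_num)]; exact Icc_subset_Icc hs he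
  have hβi' : IntervalIntegrable β volume s e := hβi.mono_set hsub
  have hβ' : ∫ t in s..e, β t ≤ D := by
    refine le_trans ?_ hβ
    exact intervalIntegral.integral_mono_interval hs hse he
      (Eventually.of_forall hβ0) hβi
  have h1i : IntervalIntegrable (fun t => 1 + β t) volume s e :=
    intervalIntegrable_const.add hβi'
  have key := sub_le_integral_of_deriv_le (Φ := fun t => 2 * C / Λ * (1 + β t) - c * a t) hse hLip
    ((h1i.const_mul _).sub (hai.const_mul _)) (by
      filter_upwards [hd, hW.ae_differentiableAt] with t h1 h2 ht
      have ht' : t ∈ Icc s e := Ioo_subset_Icc_self ht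
      have hw := hcon t ht'
      have hw0 := hpos t ht'
      have hder : deriv (fun t => -(W t)⁻¹) t = deriv W t / W t ^ 2 := by
        have := (h2.hasDerivAt.fun_inv hw0.ne').fun_neg.deriv
        rw [this]; ring
      have h3 := h1 ⟨by linarith [ht.1], by linarith [ht.2]⟩ (by linarith)
      rw [hder, div_le_iff₀ (by positivity)]
      have h4 : (1 + W t) ^ γ ≤ 2 * W t := by
        refine (rpow_le_rpow_of_exponent_le (by linarith) hγ1.le).trans ?_
        rw [rpow_one]; linarith
      have h5 : W t ≤ W t ^ 2 / Λ := by
        rw [le_div_iff₀ (by linarith)]; nlinarith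
      have h6 : 0 ≤ C * (1 + β t) := mul_nonneg hC.le (by linarith [hβ0 t])
      calc deriv W t ≤ C * (1 + β t) * (2 * (W t ^ 2 / Λ)) - c * a t * W t ^ 2 := by
            refine h3.trans (sub_le_sub_right (mul_le_mul_of_nonneg_left ?_ h6) _)
            linarith
        _ = _ := by ring)
  rw [intervalIntegral.integral_sub (h1i.const_mul _) (hai.const_mul _),
    intervalIntegral.integral_const_mul, intervalIntegral.integral_const_mul,
    intervalIntegral.integral_add intervalIntegrable_const hβi'] at key
  simp only [intervalIntegral.integral_const, smul_eq_mul, mul_one] at key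
  have hΛ0 : 0 < Λ := by linarith
  have h7 : (W e)⁻¹ ≤ 1 / Λ := by
    rw [one_div]; exact inv_anti₀ hΛ0 (hcon e (right_mem_Icc.2 hse)).le
  have h8 : 0 ≤ (W s)⁻¹ := inv_nonneg.2 (hpos s (left_mem_Icc.2 hse)).le
  have h9 : 2 * C / Λ * (e - s + ∫ t in s..e, β t) ≤ 2 * C / Λ * (1 + D) := by
    refine mul_le_mul_of_nonneg_left ?_ (by positivity)
    linarith
  have h10 : c * κ ≤ c * ∫ t in s..e, a t := mul_le_mul_of_nonneg_left ha hc.le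
  have h11 : c * κ ≤ (1 + 2 * C * (1 + D)) / Λ := by
    have : (1 + 2 * C * (1 + D)) / Λ = 1 / Λ + 2 * C / Λ * (1 + D) := by ring
    rw [this]; linarith
  rw [le_div_iff₀ hΛ0] at h11
  linarith

lemma ode_forward {W β : ℝ → ℝ} {K : ℝ≥0} {C γ D s Λ : ℝ} (hW : LipschitzWith K W)
    (hW0 : ∀ t, 0 ≤ W t) (hC : 0 < C) (hγ0 : 0 < γ) (hγ1 : γ < 1) (hs : -1 ≤ s) (hs0 : s ≤ 0)
    (hβ0 : ∀ t, 0 ≤ β t) (hβi : IntervalIntegrable β volume (-1) 0) (hβ : ∫ t in (-1)..0, β t ≤ D)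
    (hd : ∀ᵐ t, t ∈ Ioo (-1 : ℝ) 0 → deriv W t ≤ C * (1 + β t) * (1 + W t) ^ γ)
    (hΛ : W s ≤ Λ) {t : ℝ} (ht : t ∈ Icc s 0) :
    1 + W t ≤ (1 + Λ + C * (1 + D)) ^ (1 / (1 - γ)) := by
  obtain ⟨t1, ht1, hmax⟩ := isCompact_Icc.exists_isMaxOn (nonempty_Icc.2 hs0)
    (hW.continuous.continuousOn (s := Icc s 0))
  have hmax' : ∀ τ ∈ Icc s 0, W τ ≤ W t1 := fun τ hτ => hmax hτ
  set S := W t1 with hS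
  have hS0 : 0 ≤ S := hW0 _
  have hSγ : 1 ≤ (1 + S) ^ γ := one_le_rpow (by linarith) hγ0.le
  have hsub : uIcc s t1 ⊆ uIcc (-1) 0 := by
    rw [uIcc_of_le ht1.1, uIcc_of_le (by norm_num)]; exact Icc_subset_Icc hs ht1.2
  have hβi' : IntervalIntegrable β volume s t1 := hβi.mono_set hsub
  have hβ' : ∫ t in s..t1, β t ≤ D :=
    (intervalIntegral.integral_mono_interval hs ht1.1 ht1.2 (Eventually.of_forall hβ0) hβi).trans hβ
  have h1i : IntervalIntegrable (fun t => 1 + β t) volume s t1 :=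
    intervalIntegrable_const.add hβi'
  have key := sub_le_integral_of_deriv_le (Φ := fun t => C * (1 + S) ^ γ * (1 + β t)) ht1.1
    (hW.lipschitzOnWith) (h1i.const_mul _) (by
      filter_upwards [hd] with τ h1 hτ
      refine (h1 ⟨by linarith [hτ.1], by linarith [hτ.2, ht1.2]⟩).trans ?_
      rw [mul_right_comm]
      have h2 : (1 + W τ) ^ γ ≤ (1 + S) ^ γ :=
        rpow_le_rpow (by linarith [hW0 τ])
          (by linarith [hmax' τ ⟨hτ.1.le, hτ.2.le.trans ht1.2⟩]) hγ0.le
      have := hβ0 τ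
      gcongr)
  rw [intervalIntegral.integral_const_mul,
    intervalIntegral.integral_add intervalIntegrable_const hβi'] at key
  simp only [intervalIntegral.integral_const, smul_eq_mul, mul_one] at key
  have h3 : C * (1 + S) ^ γ * (t1 - s + ∫ t in s..t1, β t) ≤ C * (1 + S) ^ γ * (1 + D) := by
    refine mul_le_mul_of_nonneg_left ?_ (by positivity)
    linarith [ht1.2]
  have hΛ0 : 0 ≤ Λ := (hW0 s).trans hΛ
  have h4 : 1 + S ≤ (1 + S) ^ γ * (1 + Λ + C * (1 + D)) := by nlinarith
  have h5 : (1 + S) ^ (1 - γ) ≤ 1 + Λ + C * (1 + D) := by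
    rw [rpow_sub (by linarith), rpow_one, div_le_iff₀ (by linarith), mul_comm]
    exact h4
  have h6 : 1 + S = ((1 + S) ^ (1 - γ)) ^ (1 / (1 - γ)) := by
    rw [← rpow_mul (by linarith), mul_one_div_cancel (by linarith), rpow_one]
  have h7 : 1 + S ≤ (1 + Λ + C * (1 + D)) ^ (1 / (1 - γ)) := by
    rw [h6]
    exact rpow_le_rpow (by positivity) h5 (one_div_nonneg.2 (by linarith))
  linarith [hmax' t ht]

lemma intervalIntegrable_of_abs_le {f : ℝ → ℝ} (hf : Measurable f) {M : ℝ} (hM : ∀ t, |f t| ≤ M) (a b : ℝ) :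
    IntervalIntegrable f volume a b :=
  (intervalIntegrable_const (c := M)).mono_fun hf.aestronglyMeasurable
    (Eventually.of_forall fun t => by
      simp only [Real.norm_eq_abs]; exact (hM t).trans (le_abs_self M))

lemma abs_integral_le_of_ball {f : E3 → ℝ} {M : ℝ} {r : ℝ} (hM : ∀ x, |f x| ≤ M)
    (h0 : ∀ x, r ≤ ‖x‖ → f x = 0) : |∫ x, f x| ≤ M * (volume (ball (0 : E3) r)).toReal := by
  have h1 : ∫ x in ball (0 : E3) r, f x = ∫ x, f x :=
    setIntegral_eq_integral_of_forall_compl_eq_zero fun x hx => h0 x (by simpa using hx)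
  rw [← h1]
  exact norm_setIntegral_le_of_norm_le_const (f := f) (C := M) measure_ball_lt_top fun x _ => hM x

lemma Slab.driftPow_intervalIntegrable {U B : SpT → ℝ} {K : ℝ≥0} {δ : ℝ} (h : Slab U B K δ) {q l : ℝ}
    (hq : 0 < q) (hl : 0 < l) (a b : ℝ) : IntervalIntegrable (driftPow B q l) volume a b := by
  obtain ⟨M, hM⟩ := h.Bb
  have hB : ∀ t, |∫ x, B (t, x) ^ q| ≤ M ^ q * (volume (ball (0 : E3) 2)).toReal := fun t =>
    abs_integral_le_of_ball (fun x => by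
      rw [abs_of_nonneg (rpow_nonneg (h.B0 (t, x)) q)]
      exact rpow_le_rpow (h.B0 (t, x)) (hM (t, x)) hq.le) fun x hx => by
        rw [h.Bs (t, x) hx, zero_rpow hq.ne']
  refine intervalIntegrable_of_abs_le
    (M := (M ^ q * (volume (ball (0 : E3) 2)).toReal) ^ (l / q))
    ((measurable_slice_integral (h.Bm.pow_const q)).pow_const (l / q)) (fun t => ?_) a b
  have hI : 0 ≤ ∫ x, B (t, x) ^ q := integral_nonneg fun x => rpow_nonneg (h.B0 (t, x)) q
  rw [abs_of_nonneg (rpow_nonneg hI (l / q))]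
  exact rpow_le_rpow hI
    ((le_abs_self _).trans (hB t)) (by positivity)

/-- The measure of the part of the slice at time `t` of the ball of radius `5/4` where `U ≥ 1/2`. -/
def highMeas (U : SpT → ℝ) (t : ℝ) : ℝ :=
  (volume {x : E3 | x ∈ closedBall (0 : E3) (5 / 4) ∧ 1 / 2 ≤ U (t, x)}).toReal

lemma highMeas_measurable {U : SpT → ℝ} (hU : Measurable U) : Measurable (highMeas U) := by
  have hs : MeasurableSet {p : SpT | p.2 ∈ closedBall (0 : E3) (5 / 4) ∧ 1 / 2 ≤ U p} :=
    (measurable_snd measurableSet_closedBall).inter (measurableSet_le measurable_const hU)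
  exact (measurable_measure_prodMk_left hs).ennreal_toReal

lemma highMeas_le (U : SpT → ℝ) (t : ℝ) :
    highMeas U t ≤ (volume (closedBall (0 : E3) (5 / 4))).toReal :=
  ENNReal.toReal_mono measure_closedBall_lt_top.ne (measure_mono fun _ hx => hx.1)

lemma highMeas_intervalIntegrable {U : SpT → ℝ} (hU : Measurable U) (a b : ℝ) :
    IntervalIntegrable (highMeas U) volume a b :=
  intervalIntegrable_of_abs_le (highMeas_measurable hU) (fun t => by
    rw [abs_of_nonneg (by exact ENNReal.toReal_nonneg)]; exact highMeas_le U t) a b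

lemma ball54_pos : 0 < (volume (closedBall (0 : E3) (5 / 4))).toReal :=
  ENNReal.toReal_pos (measure_closedBall_pos _ _ (by norm_num)).ne' measure_closedBall_lt_top.ne

/-- If `U ≥ 1/2` on a substantial part of an initial time layer, then `-log U` is bounded in mean
afterwards. -/
lemma log_bound {q l : ℝ} (hq : 3 / 2 < q) (hl : 1 < l) (hql : 3 / (2 * q) + 1 / l < 1) :
    ∃ (K1 : ℝ) (N : ℕ), 1 ≤ K1 ∧ ∀ (U B : SpT → ℝ) (K : ℝ≥0) (δ : ℝ), Slab U B K δ →
      ∀ D, (∫ t in (-1)..0, driftPow B q l t) ≤ D → ∀ Θ, 0 < Θ → Θ ≤ 1 →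
      (volume (closedBall (0 : E3) (5 / 4))).toReal / 8 * Θ ≤
        ∫ t in (-Θ)..(-(3 * Θ / 4)), highMeas U t →
      ∀ t ∈ Icc (-(3 * Θ / 4)) 0,
        ∫ x in closedBall (0 : E3) (5 / 4), -log (U (t, x)) ≤ (K1 * ((1 + D) / Θ)) ^ N := by
  obtain ⟨C, c, γ, j, hC, hc, hγ0, hγ1, hj, hlog⟩ := log_dynamic hq hl hql
  set v := (volume (closedBall (0 : E3) (5 / 4))).toReal with hv
  have hv0 : 0 < v := ball54_pos
  set M0 := 2 * log 2 * ∫ x, cutL x ^ (4 * j) with hM0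
  have hM00 : 0 ≤ M0 := mul_nonneg (by positivity) (integral_nonneg fun x => pow_nonneg (cutL_nonneg x) _)
  obtain ⟨N, hN⟩ := exists_nat_ge (1 / (1 - γ))
  set κ := v / 8
  have hκ : 0 < κ := by positivity
  refine ⟨2 + M0 + 2 * (1 + 2 * C) / (c * κ) + C, N, ?_, ?_⟩
  · have : 0 ≤ 2 * (1 + 2 * C) / (c * κ) := by positivity
    linarith
  intro U B K δ h D hD Θ hΘ0 hΘ1 hhalf t ht
  obtain ⟨⟨K', hW⟩, hW0, hd⟩ := hlog U B K δ h
  set W := sliceInt (fun u => -log u) U fun x => cutL x ^ (4 * j) with hWdef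
  have hβ0 : ∀ t, 0 ≤ driftPow B q l t := h.driftPow_nonneg q l
  have hβi := h.driftPow_intervalIntegrable (q := q) (l := l) (by linarith) (by linarith) (-1) 0
  have hD0 : 0 ≤ D := le_trans (intervalIntegral.integral_nonneg (by norm_num) fun t _ => hβ0 t) hD
  set Λ := 1 + M0 + 2 * (1 + 2 * C * (1 + D)) / (c * (κ * Θ)) with hΛ
  have hE : 0 < 2 * (1 + 2 * C * (1 + D)) / (c * (κ * Θ)) := by positivity
  have hU : Measurable U := h.lip.continuous.measurable
  obtain ⟨s, hs, hsΛ⟩ := ode_low_time (M0 := M0) (κ := κ * Θ) (Λ := Λ) (s := -Θ) (e := -(3 * Θ / 4))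
    (a := highMeas U) hW hC hγ1 (by linarith) (by linarith) (by linarith) hβ0 hβi hD
    (highMeas_intervalIntegrable hU _ _) hhalf (by
      filter_upwards [hd] with t h1 ht h2
      exact (h1 ht).2 h2) hc (by linarith) (by linarith) (by
      have e1 : c * (κ * Θ) * Λ = c * (κ * Θ) * (1 + M0) + 2 * (1 + 2 * C * (1 + D)) := by
        rw [hΛ]; field_simp
      have h2 : 0 < 1 + 2 * C * (1 + D) := by positivity
      have h3 : 0 ≤ c * (κ * Θ) * (1 + M0) := by positivity
      rw [e1]; linarith)
  have hfw := ode_forward (D := D) (Λ := Λ) (s := s) (t := t) hW hW0 hC hγ0 hγ1 (by linarith [hs.1])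
    (by linarith [hs.2]) hβ0 hβi hD (by
      filter_upwards [hd] with t h1 ht
      exact (h1 ht).1) hsΛ ⟨by linarith [hs.2, ht.1], ht.2⟩
  have hX : 1 ≤ (1 + D) / Θ := by rw [le_div_iff₀ hΘ0]; linarith
  have hXD : 1 + D ≤ (1 + D) / Θ := by rw [le_div_iff₀ hΘ0]; nlinarith
  have hbase : 1 + Λ + C * (1 + D) ≤ (2 + M0 + 2 * (1 + 2 * C) / (c * κ) + C) * ((1 + D) / Θ) := by
    have e2 : 2 * (1 + 2 * C * (1 + D)) / (c * (κ * Θ)) ≤ 2 * (1 + 2 * C) / (c * κ) * ((1 + D) / Θ) := by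
      rw [div_mul_div_comm, show c * (κ * Θ) = c * κ * Θ by ring]
      refine div_le_div_of_nonneg_right ?_ (by positivity)
      nlinarith
    have e3 : (2 + M0) * 1 ≤ (2 + M0) * ((1 + D) / Θ) := mul_le_mul_of_nonneg_left hX (by linarith)
    have e4 := mul_le_mul_of_nonneg_left hXD hC.le
    rw [hΛ]; linarith
  have hcmp : (∫ x in closedBall (0 : E3) (5 / 4), -log (U (t, x))) ≤ W t := by
    have hlogm : Measurable fun x => -log (U (t, x)) :=
      (measurable_log.comp (hU.comp measurable_prodMk_left)).neg
    have hlog0 : ∀ x, 0 ≤ -log (U (t, x)) := fun x =>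
      neg_nonneg.2 (log_nonpos (h.hδ.le.trans (h.lb _)) (h.ub _))
    rw [← integral_indicator measurableSet_closedBall, hWdef]
    refine integral_mono_of_nonneg (Eventually.of_forall fun x => ?_)
      (integrable_mul_cutL (M := -log δ) hlogm (fun x => ?_) (by omega)) (Eventually.of_forall fun x => ?_)
    · exact indicator_nonneg (fun x _ => hlog0 x) x
    · rw [abs_of_nonneg (hlog0 x)]
      exact neg_le_neg (log_le_log h.hδ (h.lb _))
    · by_cases hx : x ∈ closedBall (0 : E3) (5 / 4)
      · simp [indicator_of_mem hx, cutL_eq_one hx]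
      · rw [indicator_of_notMem hx]
        exact mul_nonneg (hlog0 x) (pow_nonneg (cutL_nonneg x) _)
  have hb1 : 1 ≤ 1 + Λ + C * (1 + D) := by
    have : 0 ≤ C * (1 + D) := by positivity
    linarith
  calc (∫ x in closedBall (0 : E3) (5 / 4), -log (U (t, x))) ≤ 1 + W t := by linarith
    _ ≤ (1 + Λ + C * (1 + D)) ^ (1 / (1 - γ)) := hfw
    _ ≤ (1 + Λ + C * (1 + D)) ^ (N : ℝ) := rpow_le_rpow_of_exponent_le hb1 hN
    _ = (1 + Λ + C * (1 + D)) ^ N := rpow_natCast _ _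
    _ ≤ _ := pow_le_pow_left₀ (by linarith) hbase N

lemma hasDerivAt_posPart_pow (k s : ℝ) (n : ℕ) :
    HasDerivAt (fun s : ℝ => max (s - k) 0 ^ (n + 2)) ((n + 2 : ℕ) * max (s - k) 0 ^ (n + 1)) s := by
  rcases lt_trichotomy s k with h | h | h
  · rw [max_eq_right (by linarith), zero_pow (by omega), mul_zero]
    refine (hasDerivAt_const s (0 : ℝ)).congr_of_eventuallyEq ?_
    filter_upwards [eventually_lt_nhds h] with y hy
    rw [max_eq_right (by linarith), zero_pow (by omega)]
  · subst h
    rw [sub_self, max_self, zero_pow (by omega), mul_zero, hasDerivAt_iff_isLittleO]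
    simp only [sub_self, max_self, zero_pow (show n + 2 ≠ 0 by omega), sub_zero, smul_zero]
    have h1 : (fun y : ℝ => max (y - s) 0 ^ (n + 2)) =O[𝓝 s] fun y => ‖y - s‖ ^ (n + 2) := by
      refine Asymptotics.isBigO_of_le _ fun y => ?_
      rw [norm_pow, norm_pow, norm_norm]
      refine pow_le_pow_left₀ (norm_nonneg _) ?_ _
      rw [Real.norm_of_nonneg (le_max_right _ _), Real.norm_eq_abs]
      exact max_le (le_abs_self _) (abs_nonneg _)
    exact h1.trans_isLittleO (Asymptotics.isLittleO_pow_sub_sub s (m := n + 2) (by omega))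
  · rw [max_eq_left (by linarith)]
    have h1 : HasDerivAt (fun s : ℝ => (s - k) ^ (n + 2)) ((n + 2 : ℕ) * (s - k) ^ (n + 1)) s := by
      simpa using ((hasDerivAt_id s).sub_const k).fun_pow (n + 2)
    refine h1.congr_of_eventuallyEq ?_
    filter_upwards [eventually_gt_nhds h] with y hy
    rw [max_eq_left (by linarith)]

/-- The fourth root of `1 - log u`. -/
def rootLog (u : ℝ) : ℝ := (1 - log u) ^ (1 / 4 : ℝ)

/-- The first derivative of `rootLog`. -/
def rootLog1 (u : ℝ) : ℝ := -(1 / 4) * (1 - log u) ^ (-(3 / 4) : ℝ) * u⁻¹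

/-- The second derivative of `rootLog`. -/
def rootLog2 (u : ℝ) : ℝ :=
  (1 / 4) * (1 - log u) ^ (-(3 / 4) : ℝ) * (u ^ 2)⁻¹ - (3 / 16) * (1 - log u) ^ (-(7 / 4) : ℝ) * (u ^ 2)⁻¹

lemma one_sub_log_pos {u : ℝ} (hu : u ∈ Ioo (0 : ℝ) 2) : 0 < 1 - log u := by
  have := log_lt_log hu.1 hu.2
  linarith [log_two_lt_d9]

lemma hasDerivAt_one_sub_log {u : ℝ} (hu : u ∈ Ioo (0 : ℝ) 2) :
    HasDerivAt (fun u => 1 - log u) (-u⁻¹) u :=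
  (hasDerivAt_log hu.1.ne').const_sub 1

lemma rootLog_hasDerivAt {u : ℝ} (hu : u ∈ Ioo (0 : ℝ) 2) : HasDerivAt rootLog (rootLog1 u) u := by
  have := (hasDerivAt_one_sub_log hu).rpow_const (p := 1 / 4) (Or.inl (one_sub_log_pos hu).ne')
  refine this.congr_deriv ?_
  rw [rootLog1, show (1 / 4 - 1 : ℝ) = -(3 / 4) by norm_num]; ring

lemma rootLog1_hasDerivAt {u : ℝ} (hu : u ∈ Ioo (0 : ℝ) 2) : HasDerivAt rootLog1 (rootLog2 u) u := by
  have h1 := (hasDerivAt_one_sub_log hu).rpow_const (p := -(3 / 4)) (Or.inl (one_sub_log_pos hu).ne')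
  have := (h1.const_mul (-(1 / 4))).fun_mul (hasDerivAt_inv hu.1.ne')
  refine this.congr_deriv ?_
  rw [rootLog2, show (-(3 / 4) - 1 : ℝ) = -(7 / 4) by norm_num]; ring

lemma rootLog2_nonneg {u : ℝ} (h0 : 0 < u) (h1 : u ≤ 1) : 0 ≤ rootLog2 u := by
  have hl : 1 ≤ 1 - log u := by linarith [log_nonpos h0.le h1]
  have hp : (1 - log u) ^ (-(7 / 4) : ℝ) ≤ (1 - log u) ^ (-(3 / 4) : ℝ) :=
    rpow_le_rpow_of_exponent_le hl (by norm_num)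
  have hn : 0 ≤ (1 - log u) ^ (-(3 / 4) : ℝ) := rpow_nonneg (by linarith) _
  rw [rootLog2, ← sub_mul]
  exact mul_nonneg (by linarith) (by positivity)

lemma rootLog_continuousOn : ContinuousOn rootLog (Ioo 0 2) := fun _ hu =>
  (rootLog_hasDerivAt hu).continuousAt.continuousWithinAt

lemma rootLog1_continuousOn : ContinuousOn rootLog1 (Ioo 0 2) := fun _ hu =>
  (rootLog1_hasDerivAt hu).continuousAt.continuousWithinAt

lemma rootLog2_continuousOn : ContinuousOn rootLog2 (Ioo 0 2) := by
  have hl : ContinuousOn (fun u : ℝ => 1 - log u) (Ioo 0 2) := fun u hu =>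
    (hasDerivAt_one_sub_log hu).continuousAt.continuousWithinAt
  have hp : ∀ p : ℝ, ContinuousOn (fun u : ℝ => (1 - log u) ^ p) (Ioo 0 2) := fun p =>
    hl.rpow_const fun u hu => Or.inl (one_sub_log_pos hu).ne'
  have hi : ContinuousOn (fun u : ℝ => (u ^ 2)⁻¹) (Ioo 0 2) :=
    (continuousOn_id.pow 2).inv₀ fun u hu => pow_ne_zero 2 (ne_of_gt hu.1)
  exact (((hp _).const_mul _).mul hi).sub (((hp _).const_mul _).mul hi)

/-- The truncated power `(rootLog - k)₊²`. -/
def levF (k u : ℝ) : ℝ := max (rootLog u - k) 0 ^ 2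

/-- The derivative of `levF`. -/
def levF1 (k u : ℝ) : ℝ := 2 * max (rootLog u - k) 0 * rootLog1 u

/-- The truncated power `(rootLog - k)₊⁴`. -/
def levH (k u : ℝ) : ℝ := max (rootLog u - k) 0 ^ 4

/-- The first derivative of `levH`. -/
def levH1 (k u : ℝ) : ℝ := 4 * max (rootLog u - k) 0 ^ 3 * rootLog1 u

/-- The second derivative of `levH`. -/
def levH2 (k u : ℝ) : ℝ :=
  12 * max (rootLog u - k) 0 ^ 2 * rootLog1 u ^ 2 + 4 * max (rootLog u - k) 0 ^ 3 * rootLog2 u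

lemma levF_nonneg (k u : ℝ) : 0 ≤ levF k u := sq_nonneg _

lemma levH_eq (k u : ℝ) : levH k u = levF k u ^ 2 := by rw [levH, levF]; ring

lemma levF_hasDerivAt (k : ℝ) {u : ℝ} (hu : u ∈ Ioo (0 : ℝ) 2) : HasDerivAt (levF k) (levF1 k u) u := by
  have := (hasDerivAt_posPart_pow k (rootLog u) 0).comp u (rootLog_hasDerivAt hu)
  refine this.congr_deriv ?_
  rw [levF1]; norm_num

lemma levH_hasDerivAt (k : ℝ) {u : ℝ} (hu : u ∈ Ioo (0 : ℝ) 2) : HasDerivAt (levH k) (levH1 k u) u := by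
  have := (hasDerivAt_posPart_pow k (rootLog u) 2).comp u (rootLog_hasDerivAt hu)
  refine this.congr_deriv ?_
  rw [levH1]; norm_num

lemma levH1_hasDerivAt (k : ℝ) {u : ℝ} (hu : u ∈ Ioo (0 : ℝ) 2) : HasDerivAt (levH1 k) (levH2 k u) u := by
  have h1 : HasDerivAt (fun u => max (rootLog u - k) 0 ^ 3) _ u :=
    (hasDerivAt_posPart_pow k (rootLog u) 1).comp u (rootLog_hasDerivAt hu)
  have := (h1.const_mul 4).fun_mul (rootLog1_hasDerivAt hu)
  refine this.congr_deriv ?_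
  rw [levH2]; push_cast; ring

lemma posPart_rootLog_continuousOn (k : ℝ) : ContinuousOn (fun u => max (rootLog u - k) 0) (Ioo 0 2) :=
  (rootLog_continuousOn.sub continuousOn_const).sup continuousOn_const

lemma levF1_continuousOn (k : ℝ) : ContinuousOn (levF1 k) (Ioo 0 2) :=
  ((posPart_rootLog_continuousOn k).const_mul 2).mul rootLog1_continuousOn

lemma levH1_continuousOn (k : ℝ) : ContinuousOn (levH1 k) (Ioo 0 2) := fun _ hu =>
  (levH1_hasDerivAt k hu).continuousAt.continuousWithinAt

lemma levH2_continuousOn (k : ℝ) : ContinuousOn (levH2 k) (Ioo 0 2) :=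
  ((((posPart_rootLog_continuousOn k).pow 2).const_mul 12).mul (rootLog1_continuousOn.pow 2)).add
    ((((posPart_rootLog_continuousOn k).pow 3).const_mul 4).mul rootLog2_continuousOn)

lemma levH2_ge (k : ℝ) {u : ℝ} (h0 : 0 < u) (h1 : u ≤ 1) : 3 * levF1 k u ^ 2 ≤ levH2 k u := by
  have : 0 ≤ 4 * max (rootLog u - k) 0 ^ 3 * rootLog2 u :=
    mul_nonneg (mul_nonneg (by norm_num) (pow_nonneg (le_max_right _ _) 3)) (rootLog2_nonneg h0 h1)
  rw [levH2, levF1]; linarith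

lemma abs_levH1 (k u : ℝ) : |levH1 k u| = 2 * levF k u * |levF1 k u| := by
  have h0 : 0 ≤ max (rootLog u - k) 0 := le_max_right _ _
  rw [levH1, levF1, levF, abs_mul, abs_mul (2 * max (rootLog u - k) 0),
    abs_of_nonneg (a := 4 * max (rootLog u - k) 0 ^ 3) (by positivity),
    abs_of_nonneg (a := 2 * max (rootLog u - k) 0) (by positivity)]
  ring

/-- The gain of integrability between two levels. -/
lemma levF_sq_gain {k k' : ℝ} (hk : k < k') (u : ℝ) :
    levF k' u ^ 2 ≤ (k' - k) ^ (-(8 / 5) : ℝ) * ((levF k u ^ 2) ^ (4 / 5 : ℝ) * (levF k u ^ 6) ^ (1 / 5 : ℝ)) := by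
  have hd : 0 < k' - k := by linarith
  set s := max (rootLog u - k) 0 with hs
  have hs0 : 0 ≤ s := le_max_right _ _
  rcases le_or_gt (rootLog u) k' with h | h
  · rw [levF, max_eq_right (by linarith)]
    have : 0 ≤ levF k u := levF_nonneg k u
    norm_num
    positivity
  · have hs1 : k' - k ≤ s := le_trans (by linarith) (le_max_left _ _)
    have hsp : 0 < s := by linarith
    have h1 : levF k' u ≤ s ^ 2 := by
      rw [levF, max_eq_left (by linarith)]
      exact pow_le_pow_left₀ (by linarith) (le_trans (by linarith) (le_max_left _ _)) 2
    have e1 : levF k u = s ^ (2 : ℝ) := by rw [levF, ← hs, ← rpow_natCast]; norm_num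
    have h2 : levF k' u ^ 2 ≤ s ^ (4 : ℝ) := by
      have := pow_le_pow_left₀ (levF_nonneg _ _) h1 2
      refine this.trans_eq ?_
      rw [← pow_mul, ← rpow_natCast]; norm_num
    have e2 : (levF k u ^ 2) ^ (4 / 5 : ℝ) * (levF k u ^ 6) ^ (1 / 5 : ℝ) = s ^ (8 / 5 : ℝ) * s ^ (4 : ℝ) := by
      rw [e1, ← rpow_natCast, ← rpow_natCast, ← rpow_mul hs0, ← rpow_mul hs0, ← rpow_mul hs0,
        ← rpow_mul hs0, ← rpow_add hsp, ← rpow_add hsp]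
      norm_num
    rw [e2, ← mul_assoc]
    refine h2.trans (le_mul_of_one_le_left (by positivity) ?_)
    rw [rpow_neg hd.le, ← div_eq_inv_mul, le_div_iff₀ (by positivity), one_mul]
    exact rpow_le_rpow hd.le hs1 (by norm_num)

/-- Young's inequality with three factors in the form used for absorbing the drift. -/
lemma young_three {A L ε β W a g x y z : ℝ} (hA : 0 ≤ A) (hL : 0 ≤ L) (hε : 0 < ε) (hβ : 0 ≤ β)
    (hW : 0 ≤ W) (ha : 0 ≤ a) (hg : 0 ≤ g) (hx : 0 ≤ x) (hy : 0 < y) (hz : 0 ≤ z) (hxyz : x + y + z = 1) :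
    A * L * (β ^ x * W ^ x * a ^ y * g ^ z) ≤
      ε * β * W + (A * L * ε ^ (-x)) ^ (1 / y) * a + g := by
  have hM0 : 0 ≤ A * L * ε ^ (-x) := by positivity
  set M := (A * L * ε ^ (-x)) ^ (1 / y) with hM
  have hMn : 0 ≤ M := rpow_nonneg hM0 _
  have hMy : M ^ y = A * L * ε ^ (-x) := by
    rw [hM, ← rpow_mul hM0, one_div_mul_cancel hy.ne', rpow_one]
  have h := Real.geom_mean_le_arith_mean3_weighted hx hy.le hz (p₁ := ε * β * W) (p₂ := M * a) (p₃ := g)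
    (by positivity) (by positivity) hg hxyz
  have e : (ε * β * W) ^ x * (M * a) ^ y * g ^ z = A * L * (β ^ x * W ^ x * a ^ y * g ^ z) := by
    rw [mul_rpow (by positivity) hW, mul_rpow hε.le hβ, mul_rpow hMn ha, hMy, rpow_neg hε.le]
    have : ε ^ x ≠ 0 := (rpow_pos_of_pos hε x).ne'
    field_simp
  rw [← e]
  refine h.trans ?_
  have h1 : x * (ε * β * W) ≤ 1 * (ε * β * W) := mul_le_mul_of_nonneg_right (by linarith) (by positivity)
  have h2 : y * (M * a) ≤ 1 * (M * a) := mul_le_mul_of_nonneg_right (by linarith) (by positivity)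
  have h3 : z * g ≤ 1 * g := mul_le_mul_of_nonneg_right (by linarith) hg
  linarith

lemma indicator_sq_integrable {F : E3 → ℝ} {M : ℝ} (hm : Measurable F) (h0 : ∀ x, 0 ≤ F x)
    (hM : ∀ x, F x ≤ M) (r : ℝ) : Integrable ((ball (0 : E3) r).indicator fun x => F x ^ 2) := by
  refine IntegrableOn.integrable_indicator ?_ measurableSet_ball
  exact IntegrableOn.of_bound measure_ball_lt_top (hm.pow_const 2).aestronglyMeasurable (M ^ 2)
    (Eventually.of_forall fun x => by
      rw [Real.norm_of_nonneg (sq_nonneg _)]; exact pow_le_pow_left₀ (h0 x) (hM x) 2)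

lemma cutoff_mono_ball {φ : E3 → ℝ} {r : ℝ} (h0 : ∀ x, 0 ≤ φ x) (h1 : ∀ x, φ x ≤ 1)
    (hz : ∀ x, r ≤ ‖x‖ → φ x = 0) {n : ℕ} (hn : n ≠ 0) (F : E3 → ℝ) (x : E3) :
    F x ^ 2 * φ x ^ n ≤ (ball (0 : E3) r).indicator (fun x => F x ^ 2) x := by
  by_cases hx : x ∈ ball (0 : E3) r
  · rw [indicator_of_mem hx]
    exact mul_le_of_le_one_right (sq_nonneg _) (pow_le_one₀ (h0 x) (h1 x))
  · rw [indicator_of_notMem hx, hz x (by simpa using hx), zero_pow hn, mul_zero]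

lemma dg_gradient {F φ : E3 → ℝ} {K L : ℝ≥0} {M r : ℝ} {m : ℕ} (hF : LipschitzWith K F)
    (hF0 : ∀ x, 0 ≤ F x) (hFM : ∀ x, F x ≤ M) (hφ : LipschitzWith L φ) (h0 : ∀ x, 0 ≤ φ x)
    (h1 : ∀ x, φ x ≤ 1) (hr : r ≤ 7 / 4) (hz : ∀ x, r ≤ ‖x‖ → φ x = 0) (hm : 2 ≤ m) :
    ∫ x, 2 * F x * ‖fderiv ℝ F x‖ * ‖fderiv ℝ (fun x => φ x ^ (2 * m)) x‖ ≤
      (∫ x, ‖fderiv ℝ F x‖ ^ 2 * φ x ^ (2 * m)) +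
        4 * m ^ 2 * L ^ 2 * ∫ x in ball (0 : E3) r, F x ^ 2 := by
  have hz' : ∀ x, 7 / 4 ≤ ‖x‖ → φ x ^ (2 * m) = 0 := fun x hx => by
    rw [hz x (hr.trans hx), zero_pow (by omega)]
  have hi1 : Integrable fun x => ‖fderiv ℝ F x‖ ^ 2 * φ x ^ (2 * m) :=
    integrable_mul_cutoff (M := K ^ 2) ((measurable_fderiv ℝ F).norm.pow_const 2)
      (fun x => by
        rw [abs_of_nonneg (sq_nonneg _)]
        exact pow_le_pow_left₀ (norm_nonneg _) (norm_fderiv_le_of_lipschitz ℝ hF) 2)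
      (hφ.continuous.pow _) hz'
  have hi2 := indicator_sq_integrable hF.continuous.measurable hF0 hFM r
  rw [← integral_indicator measurableSet_ball, ← integral_const_mul, ← integral_add hi1 (hi2.const_mul _)]
  refine integral_mono_of_nonneg (Eventually.of_forall fun x =>
    mul_nonneg (mul_nonneg (mul_nonneg zero_le_two (hF0 x)) (norm_nonneg _)) (norm_nonneg _))
    (hi1.add (hi2.const_mul _)) ?_
  filter_upwards [hφ.ae_differentiableAt] with x hx
  have h3 := norm_fderiv_pow_le hφ h0 (2 * m) hx
  have h4 := cutoff_mono_ball h0 h1 hz (n := 2 * m - 2) (by omega) F x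
  have e1 : φ x ^ (2 * m) = (φ x ^ m) ^ 2 := by rw [← pow_mul, mul_comm]
  have e2 : φ x ^ (2 * m - 2) = (φ x ^ (m - 1)) ^ 2 := by
    rw [← pow_mul]; congr 1; omega
  have e3 : φ x ^ (2 * m - 1) = φ x ^ m * φ x ^ (m - 1) := by
    rw [← pow_add]; congr 1; omega
  have h5 : 0 ≤ 4 * (m : ℝ) ^ 2 * L ^ 2 := by positivity
  have h6 := mul_le_mul_of_nonneg_left h4 h5
  refine (mul_le_mul_of_nonneg_left h3
    (mul_nonneg (mul_nonneg zero_le_two (hF0 x)) (norm_nonneg (fderiv ℝ F x)))).trans ?_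
  refine le_trans ?_ (add_le_add le_rfl h6)
  rw [e1, e2, e3]
  push_cast
  nlinarith [sq_nonneg (‖fderiv ℝ F x‖ * φ x ^ m - 2 * m * L * (F x * φ x ^ (m - 1)))]

lemma dg_drift_holder {F B φ : E3 → ℝ} {L : ℝ≥0} {M Nb r q l α : ℝ} {m : ℕ} (hFm : Measurable F)
    (hF0 : ∀ x, 0 ≤ F x) (hFM : ∀ x, F x ≤ M) (hBm : Measurable B) (hB0 : ∀ x, 0 ≤ B x)
    (hBN : ∀ x, B x ≤ Nb) (hBs : ∀ x, 2 ≤ ‖x‖ → B x = 0)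
    (hφ : LipschitzWith L φ) (h0 : ∀ x, 0 ≤ φ x)
    (h1 : ∀ x, φ x ≤ 1) (hz : ∀ x, r ≤ ‖x‖ → φ x = 0) (hm : 2 ≤ m)
    (hq : 0 < q) (hl : 0 < l) (hα : 0 ≤ α) (hsum : 3 / (2 * q) + 1 / l + α = 1)
    (hmα : 1 ≤ 2 * m * α) :
    ∫ x, F x ^ 2 * (B x * ‖fderiv ℝ (fun x => φ x ^ (2 * m)) x‖) ≤
      2 * m * L * ((∫ x, B x ^ q) ^ (1 / q) * (∫ x, F x ^ 2 * φ x ^ (2 * m)) ^ (1 / l) *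
        (∫ x in ball (0 : E3) r, F x ^ 2) ^ α * (∫ x, (F x * φ x ^ m) ^ 6) ^ (1 / (2 * q))) := by
  have hz' : ∀ k, k ≠ 0 → ∀ x, r ≤ ‖x‖ → φ x ^ k = 0 := fun k hk x hx => by
    rw [hz x hx, zero_pow hk]
  have hi2 : Integrable fun x => F x ^ 2 * φ x ^ (2 * m) :=
    integrable_mul_cutoff (M := M ^ 2) (hFm.pow_const 2)
      (fun x => by rw [abs_of_nonneg (sq_nonneg _)]; exact pow_le_pow_left₀ (hF0 x) (hFM x) 2)
      (hφ.continuous.pow _) (hz' _ (by omega))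
  have hi3 := indicator_sq_integrable hFm hF0 hFM r
  have hi4 : Integrable fun x => (F x * φ x ^ m) ^ 6 := by
    have := integrable_mul_cutoff (M := M ^ 6) (hFm.pow_const 6)
      (fun x => by
        rw [abs_of_nonneg (pow_nonneg (hF0 x) _)]; exact pow_le_pow_left₀ (hF0 x) (hFM x) 6)
      (hφ.continuous.pow (m * 6)) (hz' _ (by omega))
    refine this.congr (Eventually.of_forall fun x => ?_)
    simp only [mul_pow, ← pow_mul, Pi.pow_apply]
  have hi1 := drift_rpow_integrable hq hBm hB0 hBN hBs
  have hind0 : ∀ x, 0 ≤ (ball (0 : E3) r).indicator (fun x => F x ^ 2) x := fun x =>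
    indicator_nonneg (fun x _ => sq_nonneg _) x
  have hq3 : 1 / q + 1 / l + α + 1 / (2 * q) = 1 := by
    have : 3 / (2 * q) = 1 / q + 1 / (2 * q) := by field_simp; norm_num
    linarith
  have key := integral_le_prod_rpow (μ := (volume : Measure E3))
    (f := ![fun x => B x ^ q, fun x => F x ^ 2 * φ x ^ (2 * m),
      (ball (0 : E3) r).indicator fun x => F x ^ 2, fun x => (F x * φ x ^ m) ^ 6])
    (θ := ![1 / q, 1 / l, α, 1 / (2 * q)])
    (g := fun x => F x ^ 2 * B x * φ x ^ (2 * m - 1))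
    (fun i => by fin_cases i <;> [exact hi1; exact hi2; exact hi3; exact hi4])
    (fun i x => by
      fin_cases i <;>
      [exact rpow_nonneg (hB0 x) _; exact mul_nonneg (sq_nonneg _) (pow_nonneg (h0 x) _);
       exact hind0 x; exact pow_nonneg (mul_nonneg (hF0 x) (pow_nonneg (h0 x) _)) _])
    (fun i => by
      fin_cases i <;> [exact one_div_nonneg.2 hq.le; exact one_div_nonneg.2 hl.le; exact hα;
        exact one_div_nonneg.2 (by positivity)])
    (by simp [Fin.sum_univ_four] ; simp at hq3; linarith)
    (Eventually.of_forall fun x => by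
      simp only [Fin.prod_univ_four, Matrix.cons_val_zero, Matrix.cons_val_one, Matrix.cons_val]
      by_cases hx : x ∈ ball (0 : E3) r
      · rw [indicator_of_mem hx]
        have hf := hF0 x
        have hp := h0 x
        rcases hf.eq_or_lt with hfz | hfp
        · rw [← hfz]
          simp only [ne_eq, OfNat.ofNat_ne_zero, not_false_eq_true, zero_pow, zero_mul]
          have := rpow_nonneg (rpow_nonneg (hB0 x) q) (1 / q)
          have h4 : ∀ s : ℝ, (0 : ℝ) ≤ 0 ^ s := zero_rpow_nonneg
          exact mul_nonneg (mul_nonneg (mul_nonneg this (h4 _)) (h4 _)) (h4 _)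
        rcases hp.eq_or_lt with hpz | hpp
        · rw [← hpz, zero_pow (show 2 * m - 1 ≠ 0 by omega), zero_pow (show m ≠ 0 by omega),
            zero_pow (show 2 * m ≠ 0 by omega)]
          have := rpow_nonneg (rpow_nonneg (hB0 x) q) (1 / q)
          rw [mul_zero]
          positivity
        have eB : (B x ^ q) ^ (1 / q) = B x := by
          rw [← rpow_mul (hB0 x), mul_one_div_cancel hq.ne', rpow_one]
        have e2 : (F x ^ 2 * φ x ^ (2 * m)) ^ (1 / l) = F x ^ (2 * (1 / l)) * φ x ^ (2 * m * (1 / l)) := by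
          rw [mul_rpow (by positivity) (by positivity), ← rpow_natCast, ← rpow_natCast (φ x), ← rpow_mul hf,
            ← rpow_mul hp]; push_cast; rfl
        have e3 : (F x ^ 2) ^ α = F x ^ (2 * α) := by
          rw [← rpow_natCast, ← rpow_mul hf]; push_cast; rfl
        have e4 : ((F x * φ x ^ m) ^ 6) ^ (1 / (2 * q)) =
            F x ^ (6 * (1 / (2 * q))) * φ x ^ (6 * m * (1 / (2 * q))) := by
          rw [mul_pow, mul_rpow (by positivity) (by positivity), ← pow_mul, ← rpow_natCast,
            ← rpow_natCast (φ x), ← rpow_mul hf, ← rpow_mul hp]; push_cast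
          rw [mul_comm (m : ℝ) 6]
        have e5 : B x * (F x ^ (2 * (1 / l)) * φ x ^ (2 * m * (1 / l))) * F x ^ (2 * α) *
            (F x ^ (6 * (1 / (2 * q))) * φ x ^ (6 * m * (1 / (2 * q)))) =
            B x * (F x ^ (2 * (1 / l)) * F x ^ (2 * α) * F x ^ (6 * (1 / (2 * q)))) *
            (φ x ^ (2 * m * (1 / l)) * φ x ^ (6 * m * (1 / (2 * q)))) := by ring
        have h3q : 6 * (1 / (2 * q)) = 2 * (3 / (2 * q)) := by ring
        rw [eB, e2, e3, e4, e5, ← rpow_add hfp, ← rpow_add hfp, ← rpow_add hpp]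
        have e6 : 2 * (1 / l) + 2 * α + 6 * (1 / (2 * q)) = (2 : ℕ) := by
          rw [h3q]; push_cast; linarith
        have e7 : 2 * (m : ℝ) * (1 / l) + 6 * m * (1 / (2 * q)) = 2 * m - 2 * m * α := by
          have : 6 * (m : ℝ) * (1 / (2 * q)) = 2 * m * (3 / (2 * q)) := by ring
          rw [this, ← mul_add]
          have : 1 / l + 3 / (2 * q) = 1 - α := by linarith
          rw [this]; ring
        rw [e6, rpow_natCast, e7, mul_comm (F x ^ 2) (B x)]
        refine mul_le_mul_of_nonneg_left ?_ (mul_nonneg (hB0 x) (sq_nonneg _))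
        rw [← rpow_natCast]
        refine rpow_le_rpow_of_exponent_ge hpp (h1 x) ?_
        rw [Nat.cast_sub (by omega)]
        push_cast; linarith
      · rw [hz x (by simpa using hx), zero_pow (show 2 * m - 1 ≠ 0 by omega), mul_zero]
        have := rpow_nonneg (rpow_nonneg (hB0 x) q) (1 / q)
        have := rpow_nonneg (hind0 x) α
        rw [zero_pow (show m ≠ 0 by omega), zero_pow (show 2 * m ≠ 0 by omega)]
        simp only [mul_zero, ne_eq, OfNat.ofNat_ne_zero, not_false_eq_true, zero_pow]
        have h4 : (0 : ℝ) ≤ 0 ^ (1 / l) := zero_rpow_nonneg _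
        have h5 : (0 : ℝ) ≤ 0 ^ (1 / (2 * q)) := zero_rpow_nonneg _
        positivity)
  simp only [Fin.prod_univ_four, Matrix.cons_val_zero, Matrix.cons_val_one, Matrix.cons_val] at key
  rw [integral_indicator measurableSet_ball] at key
  refine le_trans ?_ (mul_le_mul_of_nonneg_left key (by positivity))
  rw [← integral_const_mul]
  have hi5 : Integrable fun x => F x ^ 2 * B x * φ x ^ (2 * m - 1) :=
    integrable_mul_cutoff (M := M ^ 2 * Nb) ((hFm.pow_const 2).mul hBm)
      (fun x => by
        rw [abs_of_nonneg (mul_nonneg (sq_nonneg _) (hB0 x))]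
        exact mul_le_mul (pow_le_pow_left₀ (hF0 x) (hFM x) 2) (hBN x) (hB0 x) (sq_nonneg _))
      (hφ.continuous.pow _) (hz' _ (by omega))
  refine integral_mono_of_nonneg (Eventually.of_forall fun x =>
    mul_nonneg (sq_nonneg _) (mul_nonneg (hB0 x) (norm_nonneg _))) (hi5.const_mul _) ?_
  filter_upwards [hφ.ae_differentiableAt] with x hx
  have h3 := norm_fderiv_pow_le hφ h0 (2 * m) hx
  push_cast at h3
  have h4 : 0 ≤ F x ^ 2 * B x := mul_nonneg (sq_nonneg _) (hB0 x)
  calc F x ^ 2 * (B x * ‖fderiv ℝ (fun x => φ x ^ (2 * m)) x‖)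
      = F x ^ 2 * B x * ‖fderiv ℝ (fun x => φ x ^ (2 * m)) x‖ := by ring
    _ ≤ F x ^ 2 * B x * (2 * m * L * φ x ^ (2 * m - 1)) := mul_le_mul_of_nonneg_left h3 h4
    _ = _ := by ring

lemma dg_static {q l : ℝ} (hq : 3 / 2 < q) (hl : 1 < l) (hql : 3 / (2 * q) + 1 / l < 1) :
    ∃ (C : ℝ) (N m : ℕ), 1 ≤ C ∧ 1 ≤ N ∧ 2 ≤ m ∧ ∀ (F B φ : E3 → ℝ) (K L : ℝ≥0) (M Nb r : ℝ),
      LipschitzWith K F → (∀ x, 0 ≤ F x) → (∀ x, F x ≤ M) → Measurable B → (∀ x, 0 ≤ B x) →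
      (∀ x, B x ≤ Nb) → (∀ x, 2 ≤ ‖x‖ → B x = 0) → LipschitzWith L φ → (∀ x, 0 ≤ φ x) →
      (∀ x, φ x ≤ 1) → r ≤ 7 / 4 → (∀ x, r ≤ ‖x‖ → φ x = 0) → 1 ≤ L → ∀ ε : ℝ, 0 < ε → ε ≤ 1 →
      -(3 * ∫ x, ‖fderiv ℝ F x‖ ^ 2 * φ x ^ (2 * m)) +
          (∫ x, 2 * F x * ‖fderiv ℝ F x‖ * ‖fderiv ℝ (fun x => φ x ^ (2 * m)) x‖) +
          (∫ x, F x ^ 2 * (B x * ‖fderiv ℝ (fun x => φ x ^ (2 * m)) x‖)) ≤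
        -(∫ x, ‖fderiv ℝ F x‖ ^ 2 * φ x ^ (2 * m)) +
          ε * (∫ x, B x ^ q) ^ (l / q) * (∫ x, F x ^ 2 * φ x ^ (2 * m)) +
          C * (L / ε) ^ N * ∫ x in ball (0 : E3) r, F x ^ 2 ∧
      ∫ x, (F x * φ x ^ m) ^ 6 ≤ C * ((∫ x, ‖fderiv ℝ F x‖ ^ 2 * φ x ^ (2 * m)) +
          C * (L / ε) ^ N * ∫ x in ball (0 : E3) r, F x ^ 2) ^ 3 := by
  obtain ⟨Cs, hCs, hsob⟩ := sobolev_cut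
  set α := 1 - (3 / (2 * q) + 1 / l) with hα
  have hα0 : 0 < α := by linarith
  obtain ⟨m₀, hm₀⟩ := exists_nat_ge (1 / (2 * α))
  set m := m₀ + 2 with hm
  have hmα : 1 ≤ 2 * (m : ℝ) * α := by
    rw [div_le_iff₀ (by positivity)] at hm₀
    have : (m : ℝ) = m₀ + 2 := by rw [hm]; push_cast; ring
    rw [this]; nlinarith
  obtain ⟨N₀, hN₀⟩ := exists_nat_ge (1 / α)
  set N := N₀ + 2 with hN
  have hNα : 1 / α ≤ (N : ℝ) := by
    rw [hN]; push_cast; linarith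
  set A := 2 * (m : ℝ) * Cs ^ (1 / (2 * q)) with hA
  have hA0 : 0 ≤ A := by positivity
  set A1 := max A 1
  have hA1 : 1 ≤ A1 := le_max_right _ _
  set C := Cs + (A1 ^ N + 5 * m ^ 2) with hC
  have hA1N : 1 ≤ A1 ^ N := one_le_pow₀ hA1
  have hCge : A1 ^ N + 5 * m ^ 2 ≤ C := by linarith
  have hC1 : 1 ≤ C := by
    have : (0 : ℝ) ≤ 5 * m ^ 2 := by positivity
    linarith
  refine ⟨C, N, m, hC1, by omega, by omega, ?_⟩
  intro F B φ K L M Nb r hF hF0 hFM hBm hB0 hBN hBs hφ h0 h1 hr hz hL ε hε hε1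
  set G := ∫ x, ‖fderiv ℝ F x‖ ^ 2 * φ x ^ (2 * m) with hG
  have hG0 : 0 ≤ G := integral_nonneg fun x => mul_nonneg (sq_nonneg _) (pow_nonneg (h0 x) _)
  set a := ∫ x in ball (0 : E3) r, F x ^ 2 with ha
  have ha0 : 0 ≤ a := integral_nonneg fun x => sq_nonneg _
  set W := ∫ x, F x ^ 2 * φ x ^ (2 * m) with hW
  have hW0 : 0 ≤ W := integral_nonneg fun x => mul_nonneg (sq_nonneg _) (pow_nonneg (h0 x) _)
  set I := ∫ x, B x ^ q with hI
  have hI0 : 0 ≤ I := integral_nonneg fun x => rpow_nonneg (hB0 x) _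
  have hL1 : (1 : ℝ) ≤ L := by exact_mod_cast hL
  have hLε : (L : ℝ) ≤ L / ε := by rw [le_div_iff₀ hε]; nlinarith
  have hLε1 : 1 ≤ (L : ℝ) / ε := hL1.trans hLε
  have hL2 : (L : ℝ) ^ 2 ≤ (L / ε) ^ N :=
    (pow_le_pow_left₀ (by positivity) hLε 2).trans (pow_le_pow_right₀ hLε1 (by omega))
  set g := G + m ^ 2 * L ^ 2 * a with hg
  have hg0 : 0 ≤ g := by positivity
  have hM2 : (A * L * ε ^ (-(1 / l))) ^ (1 / α) ≤ A1 ^ N * (L / ε) ^ N := by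
    have e1 : ε ^ (-(1 / l)) ≤ ε⁻¹ := by
      rw [← rpow_neg_one]
      refine rpow_le_rpow_of_exponent_ge hε hε1 ?_
      have : 1 / l ≤ 1 := by rw [div_le_one (by linarith)]; linarith
      linarith
    have e2 : A * L * ε ^ (-(1 / l)) ≤ A1 * (L / ε) := by
      rw [mul_assoc, div_eq_mul_inv]
      exact mul_le_mul (le_max_left _ _) (mul_le_mul_of_nonneg_left e1 (by positivity))
        (by positivity) (by positivity)
    have e3 : 1 ≤ A1 * (L / ε) := one_le_mul_of_one_le_of_one_le hA1 hLε1
    calc (A * L * ε ^ (-(1 / l))) ^ (1 / α) ≤ (A1 * (L / ε)) ^ (1 / α) :=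
          rpow_le_rpow (by positivity) e2 (by positivity)
      _ ≤ (A1 * (L / ε)) ^ (N : ℝ) := rpow_le_rpow_of_exponent_le e3 hNα
      _ = _ := by rw [rpow_natCast, mul_pow]
  have hsob' : ∫ x, (F x * φ x ^ m) ^ 6 ≤ Cs * g ^ 3 := by
    refine (hsob F φ K L M.toNNReal m hF (fun x => ?_) hφ h0 h1 (fun x hx => hz x (hr.trans hx))
      (by omega)).trans ?_
    · rw [abs_of_nonneg (hF0 x)]
      exact (hFM x).trans (le_coe_toNNReal M)
    · refine mul_le_mul_of_nonneg_left (pow_le_pow_left₀ ?_ (add_le_add le_rfl ?_) 3) hCs.le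
      · exact add_nonneg hG0 (mul_nonneg (by positivity)
          (integral_nonneg fun x => mul_nonneg (sq_nonneg _) (pow_nonneg (h0 x) _)))
      · refine mul_le_mul_of_nonneg_left ?_ (by positivity)
        rw [ha, ← integral_indicator measurableSet_ball]
        exact integral_mono_of_nonneg
          (Eventually.of_forall fun x => mul_nonneg (sq_nonneg _) (pow_nonneg (h0 x) _))
          (indicator_sq_integrable hF.continuous.measurable hF0 hFM r)
          (Eventually.of_forall fun x => cutoff_mono_ball h0 h1 hz (by omega) F x)
  have hgle : g ≤ G + C * (L / ε) ^ N * a := by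
    rw [hg]
    have : (m : ℝ) ^ 2 * L ^ 2 ≤ C * (L / ε) ^ N := by
      refine mul_le_mul ?_ hL2 (by positivity) (by positivity)
      nlinarith [sq_nonneg (m : ℝ)]
    have := mul_le_mul_of_nonneg_right this ha0
    linarith
  refine ⟨?_, hsob'.trans ?_⟩
  · have hgrad := dg_gradient hF hF0 hFM hφ h0 h1 hr hz (m := m) (by omega)
    have hdr := dg_drift_holder (q := q) (l := l) (α := α) (m := m) hF.continuous.measurable hF0 hFM hBm hB0 hBN
      hBs hφ h0 h1 hz (by omega) (by linarith) (by linarith) hα0.le (by rw [hα]; ring) hmα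
    rw [← hG, ← ha] at hgrad
    rw [← hW, ← ha, ← hI] at hdr
    have hS0 : 0 ≤ ∫ x, (F x * φ x ^ m) ^ 6 := integral_nonneg fun x => (Even.pow_nonneg (by decide) _)
    have eS : (∫ x, (F x * φ x ^ m) ^ 6) ^ (1 / (2 * q)) ≤ Cs ^ (1 / (2 * q)) * g ^ (3 / (2 * q)) := by
      have hq' : 0 ≤ 1 / (2 * q) := one_div_nonneg.2 (by linarith)
      refine (rpow_le_rpow hS0 hsob' hq').trans_eq ?_
      rw [mul_rpow hCs.le (by positivity), ← rpow_natCast, ← rpow_mul hg0]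
      congr 2; push_cast; ring
    have eI : I ^ (1 / q) = (I ^ (l / q)) ^ (1 / l) := by
      rw [← rpow_mul hI0]; congr 1; field_simp
    have hy := young_three (A := A) (L := L) (ε := ε) (β := I ^ (l / q)) (W := W) (a := a) (g := g)
      (x := 1 / l) (y := α) (z := 3 / (2 * q)) hA0 L.2 hε (rpow_nonneg hI0 _) hW0 ha0 hg0
      (one_div_nonneg.2 (by linarith)) hα0 (div_nonneg (by norm_num) (by linarith)) (by rw [hα]; ring)
    have hP : 0 ≤ I ^ (1 / q) * W ^ (1 / l) * a ^ α :=
      mul_nonneg (mul_nonneg (rpow_nonneg hI0 _) (rpow_nonneg hW0 _)) (rpow_nonneg ha0 _)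
    have hdr2 : (∫ x, F x ^ 2 * (B x * ‖fderiv ℝ (fun x => φ x ^ (2 * m)) x‖)) ≤
        A * L * ((I ^ (l / q)) ^ (1 / l) * W ^ (1 / l) * a ^ α * g ^ (3 / (2 * q))) := by
      refine hdr.trans ((mul_le_mul_of_nonneg_left (mul_le_mul_of_nonneg_left eS hP)
        (by positivity)).trans_eq ?_)
      rw [← eI, hA]; ring
    have hM3 := mul_le_mul_of_nonneg_right hM2 ha0
    have hfin : (A1 ^ N * (L / ε) ^ N + 5 * m ^ 2 * L ^ 2) * a ≤ C * (L / ε) ^ N * a := by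
      refine mul_le_mul_of_nonneg_right ?_ ha0
      have h5 : 5 * (m : ℝ) ^ 2 * L ^ 2 ≤ 5 * m ^ 2 * (L / ε) ^ N :=
        mul_le_mul_of_nonneg_left hL2 (by positivity)
      have h6 := mul_le_mul_of_nonneg_right hCge (show 0 ≤ ((L : ℝ) / ε) ^ N by positivity)
      linarith
    have hgg : g = G + m ^ 2 * L ^ 2 * a := hg
    linarith
  · have h3 := pow_le_pow_left₀ hg0 hgle 3
    have h5 : (0 : ℝ) ≤ 5 * m ^ 2 := by positivity
    have hCsC : Cs ≤ C := by rw [hC]; linarith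
    exact mul_le_mul hCsC h3 (pow_nonneg hg0 3) (by linarith)

lemma dg_ode {W G a β : ℝ → ℝ} {K : ℝ≥0} {D ε M τ' τ : ℝ} (hW : LipschitzWith K W)
    (hW0 : ∀ t, 0 ≤ W t) (hWa : ∀ t, W t ≤ a t) (hG0 : ∀ t, 0 ≤ G t) (hβ0 : ∀ t, 0 ≤ β t)
    (hai : IntervalIntegrable a volume (-1) 0) (hGi : IntervalIntegrable G volume (-1) 0)
    (hβi : IntervalIntegrable β volume (-1) 0) (hβ : ∫ t in (-1)..0, β t ≤ D) (hε : 0 ≤ ε)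
    (hεD : ε * D ≤ 1 / 4) (hM : 0 ≤ M) (h1 : -1 ≤ τ') (h2 : τ' < τ) (h3 : τ ≤ 0)
    (hd : ∀ᵐ t, t ∈ Ioo (-1 : ℝ) 0 → deriv W t ≤ -G t + ε * β t * W t + M * a t) :
    (∀ t ∈ Icc τ 0, W t ≤ 2 * ((1 / (τ - τ') + M) * ∫ t in τ'..0, a t)) ∧
      ∫ t in τ..0, (G t + M * a t) ≤ 3 * ((1 / (τ - τ') + M) * ∫ t in τ'..0, a t) := by
  have ha0 : ∀ t, 0 ≤ a t := fun t => (hW0 t).trans (hWa t)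
  have hsub : ∀ {x y : ℝ}, -1 ≤ x → x ≤ y → y ≤ 0 → uIcc x y ⊆ uIcc (-1) 0 := fun hx hxy hy => by
    rw [uIcc_of_le hxy, uIcc_of_le (by norm_num)]; exact Icc_subset_Icc hx hy
  set A := ∫ t in τ'..0, a t with hA
  have hA0 : 0 ≤ A := intervalIntegral.integral_nonneg (by linarith) fun t _ => ha0 t
  have hdτ : 0 < τ - τ' := by linarith
  obtain ⟨s, hs, hsmin⟩ := isCompact_Icc.exists_isMinOn (nonempty_Icc.2 h2.le) hW.continuous.continuousOn
  have hWs : W s ≤ 1 / (τ - τ') * A := by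
    rw [one_div, ← div_eq_inv_mul, le_div_iff₀ hdτ]
    have e1 : W s * (τ - τ') = ∫ t in τ'..τ, W s := by
      rw [intervalIntegral.integral_const, smul_eq_mul, mul_comm]
    rw [e1]
    have e2 : (∫ t in τ'..τ, W s) ≤ ∫ t in τ'..τ, a t :=
      intervalIntegral.integral_mono_on h2.le intervalIntegrable_const
        (hai.mono_set (hsub h1 h2.le h3)) fun t ht => (hsmin ht).trans (hWa t)
    refine e2.trans ?_
    exact intervalIntegral.integral_mono_interval le_rfl h2.le h3 (Eventually.of_forall ha0)
      (hai.mono_set (hsub h1 (by linarith) le_rfl))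
  have hs1 : -1 ≤ s := h1.trans hs.1
  have hs0 : s ≤ 0 := hs.2.trans h3
  obtain ⟨p, hp, hpmax⟩ := isCompact_Icc.exists_isMaxOn (nonempty_Icc.2 hs0) hW.continuous.continuousOn
  have key : ∀ t ∈ Icc s 0, W t + ∫ r in s..t, G r ≤ 1 / (τ - τ') * A + 1 / 4 * W p + M * A := by
    intro t ht
    have hst := hsub hs1 ht.1 ht.2
    have hGi' := hGi.mono_set hst
    have hβi' := hβi.mono_set hst
    have hai' := hai.mono_set hst
    have h := sub_le_integral_of_deriv_le (Φ := fun t => -G t + ε * W p * β t + M * a t) ht.1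
      hW.lipschitzOnWith ((hGi'.neg.add (hβi'.const_mul _)).add (hai'.const_mul _)) (by
        filter_upwards [hd] with r hr hr'
        have hrs : r ∈ Icc s 0 := ⟨hr'.1.le, hr'.2.le.trans ht.2⟩
        have h4 := hr ⟨lt_of_le_of_lt hs1 hr'.1, lt_of_lt_of_le hr'.2 ht.2⟩
        have h5 : ε * β r * W r ≤ ε * β r * W p :=
          mul_le_mul_of_nonneg_left (hpmax hrs) (mul_nonneg hε (hβ0 r))
        linarith)
    have e1 : ∫ r in s..t, (-G r + ε * W p * β r + M * a r) =
        -(∫ r in s..t, G r) + ε * W p * (∫ r in s..t, β r) + M * ∫ r in s..t, a r := by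
      have hn : IntervalIntegrable (fun r => -G r) volume s t := hGi'.neg
      rw [intervalIntegral.integral_add (f := fun r => -G r + ε * W p * β r)
          (hn.add (hβi'.const_mul _)) (hai'.const_mul _),
        intervalIntegral.integral_add hn (hβi'.const_mul _), intervalIntegral.integral_neg,
        intervalIntegral.integral_const_mul, intervalIntegral.integral_const_mul]
    rw [e1] at h
    have e2 : ∫ r in s..t, β r ≤ D := le_trans
      (intervalIntegral.integral_mono_interval hs1 ht.1 ht.2 (Eventually.of_forall hβ0) hβi) hβ
    have e3 : ∫ r in s..t, a r ≤ A :=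
      intervalIntegral.integral_mono_interval hs.1 ht.1 ht.2 (Eventually.of_forall ha0)
        (hai.mono_set (hsub h1 (by linarith) le_rfl))
    have e4 : ε * W p * (∫ r in s..t, β r) ≤ 1 / 4 * W p := by
      calc ε * W p * (∫ r in s..t, β r) ≤ ε * W p * D :=
            mul_le_mul_of_nonneg_left e2 (mul_nonneg hε (hW0 p))
        _ = ε * D * W p := by ring
        _ ≤ _ := mul_le_mul_of_nonneg_right hεD (hW0 p)
    have e5 := mul_le_mul_of_nonneg_left e3 hM
    linarith
  set Z := 1 / (τ - τ') + M with hZ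
  have hZA : 0 ≤ Z * A := mul_nonneg (by positivity) hA0
  have eZ : Z * A = 1 / (τ - τ') * A + M * A := by rw [hZ]; ring
  have hGn : ∀ t ∈ Icc s 0, 0 ≤ ∫ r in s..t, G r := fun t ht =>
    intervalIntegral.integral_nonneg ht.1 fun r _ => hG0 r
  have hWp : W p ≤ 2 * (Z * A) := by
    have := key p hp
    have := hGn p hp
    linarith [hW0 p]
  refine ⟨fun t ht => ?_, ?_⟩
  · have : t ∈ Icc s 0 := ⟨hs.2.trans ht.1, ht.2⟩
    exact (hpmax this).trans hWp
  · have hτ1 : -1 ≤ τ := by linarith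
    rw [intervalIntegral.integral_add (hGi.mono_set (hsub hτ1 h3 le_rfl))
      ((hai.mono_set (hsub hτ1 h3 le_rfl)).const_mul _), intervalIntegral.integral_const_mul]
    have e1 : ∫ r in τ..0, G r ≤ ∫ r in s..0, G r :=
      intervalIntegral.integral_mono_interval hs.2 h3 le_rfl (Eventually.of_forall hG0)
        (hGi.mono_set (hsub hs1 hs0 le_rfl))
    have e2 : ∫ r in τ..0, a r ≤ A :=
      intervalIntegral.integral_mono_interval h2.le h3 le_rfl (Eventually.of_forall ha0)
        (hai.mono_set (hsub h1 (by linarith) le_rfl))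
    have e3 := mul_le_mul_of_nonneg_left e2 hM
    have e4 := key 0 ⟨hs0, le_rfl⟩
    have e5 := hW0 0
    have e6 : 0 ≤ 1 / (τ - τ') * A := by positivity
    linarith

/-- The truncated energy of `U` over a ball at a fixed time. -/
def levBall (U : SpT → ℝ) (k r t : ℝ) : ℝ := ∫ x in ball (0 : E3) r, levF k (U (t, x)) ^ 2

/-- The truncated energy of `U` over a parabolic cylinder. -/
def levEnergy (U : SpT → ℝ) (k r τ : ℝ) : ℝ := ∫ t in τ..0, levBall U k r t

lemma levBall_nonneg (U : SpT → ℝ) (k r t : ℝ) : 0 ≤ levBall U k r t :=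
  integral_nonneg fun _ => sq_nonneg _

lemma Slab.levF_lip {U B : SpT → ℝ} {K : ℝ≥0} {δ : ℝ} (h : Slab U B K δ) (k : ℝ) :
    ∃ L M : ℝ≥0, LipschitzWith L (fun p => levF k (U p)) ∧ ∀ p, levF k (U p) ≤ M := by
  obtain ⟨L, M, hL, hM⟩ := exists_lip_comp (fun u hu => levF_hasDerivAt k hu) (levF1_continuousOn k)
    h.hδ h.lip h.lb h.ub
  exact ⟨L, M, hL, fun p => (le_abs_self _).trans (hM p)⟩

lemma Slab.levBall_bound {U B : SpT → ℝ} {K : ℝ≥0} {δ : ℝ} (h : Slab U B K δ) (k r : ℝ) :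
    Measurable (levBall U k r) ∧ ∃ M, ∀ t, |levBall U k r t| ≤ M := by
  obtain ⟨L, M, hL, hM⟩ := h.levF_lip k
  have e : ∀ t, levBall U k r t = ∫ x, (ball (0 : E3) r).indicator (fun x => levF k (U (t, x)) ^ 2) x :=
    fun t => (integral_indicator measurableSet_ball).symm
  constructor
  · have hm : Measurable fun p : SpT =>
        (Prod.snd ⁻¹' ball (0 : E3) r).indicator (fun p : SpT => levF k (U p) ^ 2) p :=
      (hL.continuous.measurable.pow_const 2).indicator (measurable_snd measurableSet_ball)
    rw [show levBall U k r = fun t => _ from funext e]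
    exact measurable_slice_integral hm
  · refine ⟨M ^ 2 * (volume (ball (0 : E3) r)).toReal, fun t => ?_⟩
    rw [e]
    refine abs_integral_le_of_ball (fun x => ?_) fun x hx => indicator_of_notMem (by simpa using hx) _
    by_cases hx : x ∈ ball (0 : E3) r
    · rw [indicator_of_mem hx, abs_of_nonneg (sq_nonneg _)]
      exact pow_le_pow_left₀ (levF_nonneg _ _) (hM _) 2
    · rw [indicator_of_notMem hx, abs_zero]; positivity

lemma Slab.levBall_intervalIntegrable {U B : SpT → ℝ} {K : ℝ≥0} {δ : ℝ} (h : Slab U B K δ) (k r a b : ℝ) :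
    IntervalIntegrable (levBall U k r) volume a b := by
  obtain ⟨hm, M, hM⟩ := h.levBall_bound k r
  exact intervalIntegrable_of_abs_le hm hM a b

/-- The weighted Dirichlet energy of the truncation at a fixed time. -/
def levDir (U : SpT → ℝ) (k : ℝ) (ψ : E3 → ℝ) (t : ℝ) : ℝ :=
  ∫ x, ‖fderiv ℝ (fun y => levF k (U (t, y))) x‖ ^ 2 * ψ x

lemma Slab.levDir_intervalIntegrable {U B : SpT → ℝ} {K : ℝ≥0} {δ : ℝ} (h : Slab U B K δ) (k : ℝ)
    {ψ : E3 → ℝ} (hψ : Continuous ψ) (h0 : ∀ x, 0 ≤ ψ x) (h1 : ∀ x, ψ x ≤ 1)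
    (hz : ∀ x, 7 / 4 ≤ ‖x‖ → ψ x = 0) (a b : ℝ) :
    IntervalIntegrable (levDir U k ψ) volume a b := by
  obtain ⟨L, M, hL, hM⟩ := h.levF_lip k
  have hm : Measurable fun p : SpT =>
      ‖fderiv ℝ (fun y => levF k (U (p.1, y))) p.2‖ ^ 2 * ψ p.2 :=
    ((measurable_fderiv_with_param ℝ (f := fun t y => levF k (U (t, y))) hL.continuous).norm.pow_const 2).mul
      (hψ.measurable.comp measurable_snd)
  refine intervalIntegrable_of_abs_le (M := L ^ 2 * (volume (ball (0 : E3) (7 / 4))).toReal)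
    (measurable_slice_integral hm) (fun t => ?_) a b
  refine abs_integral_le_of_ball (fun x => ?_) fun x hx => by rw [hz x hx, mul_zero]
  rw [abs_of_nonneg (mul_nonneg (sq_nonneg _) (h0 x))]
  have := pow_le_pow_left₀ (norm_nonneg _)
    (norm_fderiv_le_of_lipschitz ℝ (lipschitz_slice hL t) (x₀ := x)) 2
  exact (mul_le_of_le_one_right (sq_nonneg _) (h1 x)).trans this

lemma integral_pow_three_fifths {g : ℝ → ℝ} {b : ℝ → ℝ} {c τ : ℝ} (hc : 0 ≤ c) (hτ : -1 ≤ τ) (hτ0 : τ ≤ 0)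
    (hg : IntervalIntegrable g volume τ 0) (hg0 : ∀ t, 0 ≤ g t)
    (hb : ∀ t ∈ Icc τ 0, b t ≤ c * g t ^ (3 / 5 : ℝ)) :
    ∫ t in τ..0, b t ≤ c * (∫ t in τ..0, g t) ^ (3 / 5 : ℝ) := by
  rw [intervalIntegral.integral_of_le hτ0, intervalIntegral.integral_of_le hτ0]
  have key := integral_le_prod_rpow (μ := volume.restrict (Ioc τ 0))
    (f := ![fun _ => c ^ (5 / 2 : ℝ), g]) (θ := ![2 / 5, 3 / 5]) (g := b)
    (fun i => by
      fin_cases i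
      · exact integrable_const _
      · exact (intervalIntegrable_iff_integrableOn_Ioc_of_le hτ0).1 hg)
    (fun i x => by
      fin_cases i
      · exact rpow_nonneg hc _
      · exact hg0 x)
    (fun i => by fin_cases i <;> norm_num)
    (by simp; norm_num)
    (by
      filter_upwards [ae_restrict_mem measurableSet_Ioc] with t ht
      simp only [Fin.prod_univ_two, Matrix.cons_val_zero, Matrix.cons_val_one]
      rw [← rpow_mul hc]
      norm_num
      exact hb t (Ioc_subset_Icc_self ht))
  simp only [Fin.prod_univ_two, Matrix.cons_val_zero, Matrix.cons_val_one] at key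
  refine key.trans (mul_le_mul_of_nonneg_right ?_ (rpow_nonneg (integral_nonneg hg0) _))
  rw [setIntegral_const, smul_eq_mul, measureReal_def, Real.volume_Ioc,
    ENNReal.toReal_ofReal (by linarith)]
  have h1 : (0 - τ) * c ^ (5 / 2 : ℝ) ≤ c ^ (5 / 2 : ℝ) :=
    mul_le_of_le_one_left (rpow_nonneg hc _) (by linarith)
  refine (rpow_le_rpow (mul_nonneg (by linarith) (rpow_nonneg hc _)) h1 (by norm_num)).trans_eq ?_
  rw [← rpow_mul hc]; norm_num

lemma dg_step {q l : ℝ} (hq : 3 / 2 < q) (hl : 1 < l) (hql : 3 / (2 * q) + 1 / l < 1) :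
    ∃ (C : ℝ) (N : ℕ), 1 ≤ C ∧ 1 ≤ N ∧ ∀ (U B : SpT → ℝ) (K : ℝ≥0) (δ : ℝ), Slab U B K δ →
      ∀ D, (∫ t in (-1)..0, driftPow B q l t) ≤ D → ∀ k k' r r' τ' τ : ℝ, k < k' → r < r' →
      r' ≤ 5 / 4 → r' ≤ r + 1 → -1 ≤ τ' → τ' < τ → τ ≤ 0 →
      levEnergy U k' r τ ≤ C * ((k' - k) ^ (-(8 / 5) : ℝ) *
        ((1 / (τ - τ') + C * ((r' - r)⁻¹ * (1 + D)) ^ N) * levEnergy U k r' τ') ^ (7 / 5 : ℝ)) := by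
  obtain ⟨C, N, m, hC, hN, hm, hst⟩ := dg_static hq hl hql
  have hC4 : C ≤ C * 4 ^ N := le_mul_of_one_le_right (by linarith) (one_le_pow₀ (by norm_num))
  refine ⟨6 * (C * 4 ^ N), N, by linarith, hN, ?_⟩
  intro U B K δ h D hD k k' r r' τ' τ hk hr hr1 hr2 h1 h2 h3
  have hβ0 : ∀ t, 0 ≤ driftPow B q l t := h.driftPow_nonneg q l
  have hβi := h.driftPow_intervalIntegrable (q := q) (l := l) (by linarith) (by linarith) (-1) 0
  have hD0 : 0 ≤ D := le_trans (intervalIntegral.integral_nonneg (by norm_num) fun t _ => hβ0 t) hD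
  set ε : ℝ := 1 / (4 * (1 + D)) with hε
  have hε0 : 0 < ε := by positivity
  have hε1 : ε ≤ 1 := by rw [hε, div_le_one (by positivity)]; linarith
  have hεD : ε * D ≤ 1 / 4 := by
    rw [hε, div_mul_eq_mul_div, div_le_iff₀ (by positivity)]; linarith
  set φ := cut r r' with hφ
  set L : ℝ≥0 := (r' - r)⁻¹.toNNReal with hL
  have hrr : 0 < r' - r := by linarith
  have hLr : (L : ℝ) = (r' - r)⁻¹ := Real.coe_toNNReal _ (by positivity)
  have hL1 : 1 ≤ L := by
    rw [← NNReal.coe_le_coe, hLr, NNReal.coe_one]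
    exact (one_le_inv₀ hrr).2 (by linarith)
  have hφL : LipschitzWith L φ := cut_lip hr
  have hφ0 : ∀ x, 0 ≤ φ x := cut_nonneg r r'
  have hφ1 : ∀ x, φ x ≤ 1 := cut_le_one r r'
  have hφa : ∀ x, |φ x| ≤ 1 := fun x => by rw [abs_of_nonneg (hφ0 x)]; exact hφ1 x
  have hφz : ∀ x, r' ≤ ‖x‖ → φ x = 0 := fun x hx => cut_eq_zero hr hx
  set ψ : E3 → ℝ := fun x => φ x ^ (2 * m) with hψ
  have hψL := lip_pow hφL hφa (2 * m)
  have hψ0 : ∀ x, 0 ≤ ψ x := fun x => pow_nonneg (hφ0 x) _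
  have hψ1 : ∀ x, ψ x ≤ 1 := fun x => pow_le_one₀ (hφ0 x) (hφ1 x)
  have hψz : ∀ x, 7 / 4 ≤ ‖x‖ → ψ x = 0 := fun x hx => by
    rw [hψ]; simp only; rw [hφz x (by linarith), zero_pow (by omega)]
  obtain ⟨LF, MF, hLF, hMF⟩ := h.levF_lip k
  obtain ⟨LH, MH, hLH, hMH⟩ := exists_lip_comp (fun u hu => levH_hasDerivAt k hu) (levH1_continuousOn k)
    h.hδ h.lip h.lb h.ub
  obtain ⟨Nb, hNb⟩ := h.Bb
  obtain ⟨KW, hKW⟩ : ∃ K', LipschitzWith K' (sliceInt (levH k) U ψ) :=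
    sliceInt_lip hLH hMH hψL.continuous hψz
  set W := sliceInt (levH k) U ψ with hW
  have hWeq : ∀ t, W t = ∫ x, levF k (U (t, x)) ^ 2 * φ x ^ (2 * m) := fun t => by
    rw [hW, sliceInt]; simp only [levH_eq, hψ]
  have hW0 : ∀ t, 0 ≤ W t := fun t => by
    rw [hWeq]; exact integral_nonneg fun x => mul_nonneg (sq_nonneg _) (hψ0 x)
  set a := levBall U k r' with ha
  set G := levDir U k ψ with hG
  have hG0 : ∀ t, 0 ≤ G t := fun t => integral_nonneg fun x => mul_nonneg (sq_nonneg _) (hψ0 x)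
  have hWa : ∀ t, W t ≤ a t := fun t => by
    rw [hWeq, ha, levBall, ← integral_indicator measurableSet_ball]
    exact integral_mono_of_nonneg (Eventually.of_forall fun x => mul_nonneg (sq_nonneg _) (hψ0 x))
      (indicator_sq_integrable (F := fun x => levF k (U (t, x))) (lipschitz_slice hLF t).continuous.measurable
        (fun x => levF_nonneg _ _) (fun x => hMF _) r')
      (Eventually.of_forall fun x => cutoff_mono_ball (n := 2 * m) hφ0 hφ1 hφz (by omega) (fun x => levF k (U (t, x))) x)
  have hstat := fun t => hst (fun x => levF k (U (t, x))) (fun x => B (t, x)) φ LF L MF Nb r'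
    (lipschitz_slice hLF t) (fun x => levF_nonneg _ _) (fun x => hMF _) (h.slice_measurable t)
    (fun x => h.B0 _) (fun x => hNb _) (fun x hx => h.Bs _ hx) hφL hφ0 hφ1 (by linarith) hφz hL1 ε hε0 hε1
  set M := C * (L / ε) ^ N with hM
  have hM0 : 0 ≤ M := by positivity
  have hd : ∀ᵐ t, t ∈ Ioo (-1 : ℝ) 0 → deriv W t ≤ -G t + ε * driftPow B q l t * W t + M * a t := by
    filter_upwards [h.si (levH k) (levH1 k) (levH2 k) (fun u hu => levH_hasDerivAt k hu)
      (fun u hu => levH1_hasDerivAt k hu) (levH2_continuousOn k) ψ _ hψL hψ0 hψ1 hψz] with t ht ht'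
    have ht := ht ht' 0
    have hs := (hstat t).1
    rw [← hWeq t] at hs
    have hpos : ∀ p, U p ∈ Ioo (0 : ℝ) 2 := fun p =>
      ⟨h.hδ.trans_le (h.lb p), (h.ub p).trans_lt one_lt_two⟩
    have hg : ∀ᵐ x, fderiv ℝ (fun y => levF k (U (t, y))) x = levF1 k (U (t, x)) • gradS U t x := by
      filter_upwards [(lipschitz_slice h.lip t).ae_differentiableAt] with x hx
      exact fderiv_comp_slice (H := levF k) (levF_hasDerivAt k (hpos _)) hx
    have hGint : Integrable fun x => ‖fderiv ℝ (fun y => levF k (U (t, y))) x‖ ^ 2 * ψ x :=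
      integrable_mul_cutoff (M := LF ^ 2) ((measurable_fderiv ℝ _).norm.pow_const 2)
        (fun x => by
          rw [abs_of_nonneg (sq_nonneg _)]
          exact pow_le_pow_left₀ (norm_nonneg _) (norm_fderiv_le_of_lipschitz ℝ (lipschitz_slice hLF t)) 2)
        hψL.continuous hψz
    have hH2int : Integrable fun x => levH2 k (U (t, x)) * ‖gradS U t x‖ ^ 2 * ψ x := by
      obtain ⟨M2, hM2⟩ := (isCompact_Icc (a := δ) (b := 1)).exists_bound_of_continuousOn
        ((levH2_continuousOn k).mono fun x hx => ⟨h.hδ.trans_le hx.1, hx.2.trans_lt one_lt_two⟩)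
      refine integrable_mul_cutoff (M := M2 * K ^ 2) ?_ (fun x => ?_) hψL.continuous hψz
      · refine Measurable.mul ?_ ((gradS_slice_measurable t).norm.pow_const 2)
        have hc : Continuous fun x => levH2 k (U (t, x)) := by
          rw [continuous_iff_continuousAt]
          intro x
          exact ((levH2_continuousOn k).continuousAt (isOpen_Ioo.mem_nhds (hpos _))).comp
            (f := fun x => U (t, x)) (lipschitz_slice h.lip t).continuous.continuousAt
        exact hc.measurable
      · rw [abs_mul, abs_of_nonneg (sq_nonneg ‖gradS U t x‖)]
        exact mul_le_mul (hM2 _ ⟨h.lb _, h.ub _⟩)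
          (pow_le_pow_left₀ (norm_nonneg _) (norm_fderiv_le_of_lipschitz ℝ (lipschitz_slice h.lip t)) 2)
          (sq_nonneg _) ((norm_nonneg _).trans (hM2 _ ⟨h.lb (t, x), h.ub _⟩))
    have e1 : 3 * G t ≤ ∫ x, levH2 k (U (t, x)) * ‖gradS U t x‖ ^ 2 * ψ x := by
      rw [hG, levDir, ← integral_const_mul]
      refine integral_mono_ae (hGint.const_mul 3) hH2int ?_
      filter_upwards [hg] with x hx
      have hk2 := levH2_ge k (hpos (t, x)).1 (h.ub (t, x))
      rw [hx, norm_smul, mul_pow, norm_eq_abs, sq_abs, ← mul_assoc, ← mul_assoc]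
      exact mul_le_mul_of_nonneg_right (mul_le_mul_of_nonneg_right hk2 (sq_nonneg _)) (hψ0 x)
    have e2 : ∫ x, |levH1 k (U (t, x))| * ‖gradS U t x‖ * ‖fderiv ℝ ψ x‖ =
        ∫ x, 2 * levF k (U (t, x)) * ‖fderiv ℝ (fun y => levF k (U (t, y))) x‖ * ‖fderiv ℝ ψ x‖ := by
      refine integral_congr_ae ?_
      filter_upwards [hg] with x hx
      rw [hx, norm_smul, norm_eq_abs, abs_levH1]; ring
    have e3 : ∫ x, |levH k (U (t, x)) - 0| * (B (t, x) * ‖fderiv ℝ ψ x‖) =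
        ∫ x, levF k (U (t, x)) ^ 2 * (B (t, x) * ‖fderiv ℝ ψ x‖) := by
      refine integral_congr_ae (Eventually.of_forall fun x => ?_)
      simp only [sub_zero, levH_eq, abs_of_nonneg (sq_nonneg (levF k (U (t, x))))]
    rw [e2, e3] at ht
    have hs' : -(3 * G t) + _ + _ ≤ -G t + ε * driftPow B q l t * W t + M * a t := hs
    refine le_trans ?_ hs'
    refine ht.trans (add_le_add (add_le_add (neg_le_neg e1) le_rfl) le_rfl)
  have hGi : ∀ x y, IntervalIntegrable G volume x y :=
    h.levDir_intervalIntegrable k hψL.continuous hψ0 hψ1 hψz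
  have hai : ∀ x y, IntervalIntegrable a volume x y := h.levBall_intervalIntegrable k r'
  obtain ⟨hS, hg⟩ := dg_ode hKW hW0 hWa hG0 hβ0 (hai _ _) (hGi _ _) hβi hD hε0.le hεD hM0 h1 h2 h3 hd
  set A := ∫ t in τ'..0, a t with hA
  set Z := 1 / (τ - τ') + M with hZ
  have hdk : 0 < k' - k := by linarith
  have hA0 : 0 ≤ A := intervalIntegral.integral_nonneg (by linarith) fun t _ => levBall_nonneg U k r' t
  have hZ0 : 0 < Z := by have : 0 < τ - τ' := by linarith
                         positivity
  have hZA : 0 ≤ Z * A := mul_nonneg hZ0.le hA0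
  set g : ℝ → ℝ := fun t => G t + M * a t with hgdef
  have hg0 : ∀ t, 0 ≤ g t := fun t => add_nonneg (hG0 t) (mul_nonneg hM0 (levBall_nonneg U k r' t))
  have hslice : ∀ t ∈ Icc τ 0, levBall U k' r t ≤ (k' - k) ^ (-(8 / 5) : ℝ) *
      ((2 * (Z * A)) ^ (4 / 5 : ℝ) * C ^ (1 / 5 : ℝ)) * g t ^ (3 / 5 : ℝ) := by
    intro t ht
    set F : E3 → ℝ := fun x => levF k (U (t, x)) with hF
    have hFm : Measurable F := (lipschitz_slice hLF t).continuous.measurable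
    have hF0 : ∀ x, 0 ≤ F x := fun x => levF_nonneg _ _
    have hFM : ∀ x, F x ≤ MF := fun x => hMF _
    have hi2 : Integrable fun x => F x ^ 2 * φ x ^ (2 * m) :=
      integrable_mul_cutoff (M := MF ^ 2) (hFm.pow_const 2)
        (fun x => by rw [abs_of_nonneg (sq_nonneg _)]; exact pow_le_pow_left₀ (hF0 x) (hFM x) 2)
        hψL.continuous hψz
    have hi4 : Integrable fun x => (F x * φ x ^ m) ^ 6 := by
      have := integrable_mul_cutoff (M := MF ^ 6) (r := r') (ψ := fun x => φ x ^ (m * 6)) (hFm.pow_const 6)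
        (fun x => by
          rw [abs_of_nonneg (pow_nonneg (hF0 x) _)]; exact pow_le_pow_left₀ (hF0 x) (hFM x) 6)
        (hφL.continuous.pow (m * 6)) (fun x hx => by rw [hφz x hx, zero_pow (by omega)])
      refine this.congr (Eventually.of_forall fun x => ?_)
      simp only [mul_pow, ← pow_mul]
    have key := integral_le_prod_rpow (μ := (volume : Measure E3))
      (f := ![fun x => F x ^ 2 * φ x ^ (2 * m), fun x => (F x * φ x ^ m) ^ 6]) (θ := ![4 / 5, 1 / 5])
      (g := fun x => (k' - k) ^ (8 / 5 : ℝ) *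
        (ball (0 : E3) r).indicator (fun x => levF k' (U (t, x)) ^ 2) x)
      (fun i => by fin_cases i <;> [exact hi2; exact hi4])
      (fun i x => by
        fin_cases i <;>
        [exact mul_nonneg (sq_nonneg _) (hψ0 x);
         exact pow_nonneg (mul_nonneg (hF0 x) (pow_nonneg (hφ0 x) _)) _])
      (fun i => by fin_cases i <;> norm_num)
      (by simp; norm_num)
      (Eventually.of_forall fun x => by
        simp only [Fin.prod_univ_two, Matrix.cons_val_zero, Matrix.cons_val_one]
        by_cases hx : x ∈ ball (0 : E3) r
        · have hxr : ‖x‖ ≤ r := by simpa using (mem_ball.1 hx).le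
          rw [indicator_of_mem hx, hφ, cut_eq_one hr hxr, one_pow, one_pow, mul_one, mul_one]
          refine (mul_le_mul_of_nonneg_left (levF_sq_gain hk (U (t, x))) (by positivity)).trans_eq ?_
          rw [← mul_assoc, ← rpow_add hdk]; norm_num; rfl
        · rw [indicator_of_notMem hx, mul_zero]
          exact mul_nonneg (rpow_nonneg (mul_nonneg (sq_nonneg _) (hψ0 x)) _)
            (rpow_nonneg (pow_nonneg (mul_nonneg (hF0 x) (pow_nonneg (hφ0 x) _)) _) _))
    simp only [Fin.prod_univ_two, Matrix.cons_val_zero, Matrix.cons_val_one] at key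
    rw [integral_const_mul, integral_indicator measurableSet_ball] at key
    have hS6 : ∫ x, (F x * φ x ^ m) ^ 6 ≤ C * g t ^ 3 := (hstat t).2
    have hS60 : 0 ≤ ∫ x, (F x * φ x ^ m) ^ 6 :=
      integral_nonneg fun x => pow_nonneg (mul_nonneg (hF0 x) (pow_nonneg (hφ0 x) _)) _
    have h5 : (∫ x, (F x * φ x ^ m) ^ 6) ^ (1 / 5 : ℝ) ≤ C ^ (1 / 5 : ℝ) * g t ^ (3 / 5 : ℝ) := by
      refine (rpow_le_rpow hS60 hS6 (by norm_num)).trans_eq ?_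
      rw [mul_rpow (by linarith) (pow_nonneg (hg0 t) 3), ← rpow_natCast, ← rpow_mul (hg0 t)]
      norm_num
    have h6 : (∫ x, F x ^ 2 * φ x ^ (2 * m)) ^ (4 / 5 : ℝ) ≤ (2 * (Z * A)) ^ (4 / 5 : ℝ) := by
      have := hS t ht
      rw [hWeq] at this
      exact rpow_le_rpow (integral_nonneg fun x => mul_nonneg (sq_nonneg _) (hψ0 x)) this (by norm_num)
    have h7 := key.trans (mul_le_mul h6 h5 (rpow_nonneg hS60 _) (by positivity))
    have h8 := mul_le_mul_of_nonneg_left h7 (rpow_nonneg hdk.le (-(8 / 5)))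
    rw [← mul_assoc, ← rpow_add hdk] at h8
    norm_num at h8
    refine h8.trans_eq ?_
    norm_num
    ring
  have hfin := integral_pow_three_fifths (b := levBall U k' r) (g := g) (by positivity) (by linarith) h3
    ((hGi _ _).add ((hai _ _).const_mul M)) hg0 hslice
  have hgi0 : 0 ≤ ∫ t in τ..0, g t := intervalIntegral.integral_nonneg h3 fun t _ => hg0 t
  have h9 : (∫ t in τ..0, g t) ^ (3 / 5 : ℝ) ≤ (3 * (Z * A)) ^ (3 / 5 : ℝ) :=
    rpow_le_rpow hgi0 hg (by norm_num)
  have hMle : Z ≤ 1 / (τ - τ') + 6 * (C * 4 ^ N) * ((r' - r)⁻¹ * (1 + D)) ^ N := by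
    have e1 : M = C * 4 ^ N * ((r' - r)⁻¹ * (1 + D)) ^ N := by
      rw [hM, hLr, hε, mul_assoc, ← mul_pow]; congr 2; field_simp
    have : 0 ≤ C * 4 ^ N * ((r' - r)⁻¹ * (1 + D)) ^ N := by rw [← e1]; exact hM0
    rw [hZ, e1]; linarith
  have hC5 : C ^ (1 / 5 : ℝ) ≤ C := by
    calc C ^ (1 / 5 : ℝ) ≤ C ^ (1 : ℝ) := rpow_le_rpow_of_exponent_le hC (by norm_num)
      _ = C := rpow_one C
  have h10 : (2 * (Z * A)) ^ (4 / 5 : ℝ) * (3 * (Z * A)) ^ (3 / 5 : ℝ) ≤ 6 * (Z * A) ^ (7 / 5 : ℝ) := by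
    rw [mul_rpow (by norm_num) hZA, mul_rpow (by norm_num) hZA]
    have e1 : (2 : ℝ) ^ (4 / 5 : ℝ) ≤ 2 := by
      calc (2 : ℝ) ^ (4 / 5 : ℝ) ≤ 2 ^ (1 : ℝ) := rpow_le_rpow_of_exponent_le (by norm_num) (by norm_num)
        _ = 2 := rpow_one _
    have e2 : (3 : ℝ) ^ (3 / 5 : ℝ) ≤ 3 := by
      calc (3 : ℝ) ^ (3 / 5 : ℝ) ≤ 3 ^ (1 : ℝ) := rpow_le_rpow_of_exponent_le (by norm_num) (by norm_num)
        _ = 3 := rpow_one _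
    have e3 : (Z * A) ^ (4 / 5 : ℝ) * (Z * A) ^ (3 / 5 : ℝ) = (Z * A) ^ (7 / 5 : ℝ) := by
      rw [← rpow_add_of_nonneg hZA (by norm_num) (by norm_num)]; norm_num
    calc 2 ^ (4 / 5 : ℝ) * (Z * A) ^ (4 / 5 : ℝ) * (3 ^ (3 / 5 : ℝ) * (Z * A) ^ (3 / 5 : ℝ))
        = 2 ^ (4 / 5 : ℝ) * 3 ^ (3 / 5 : ℝ) * (Z * A) ^ (7 / 5 : ℝ) := by rw [← e3]; ring
      _ ≤ 2 * 3 * (Z * A) ^ (7 / 5 : ℝ) := by gcongr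
      _ = _ := by ring
  have h11 : (Z * A) ^ (7 / 5 : ℝ) ≤
      ((1 / (τ - τ') + 6 * (C * 4 ^ N) * ((r' - r)⁻¹ * (1 + D)) ^ N) * A) ^ (7 / 5 : ℝ) :=
    rpow_le_rpow hZA (mul_le_mul_of_nonneg_right hMle hA0) (by norm_num)
  have hdp : 0 ≤ (k' - k) ^ (-(8 / 5) : ℝ) := rpow_nonneg hdk.le _
  calc levEnergy U k' r τ ≤ (k' - k) ^ (-(8 / 5) : ℝ) *
        ((2 * (Z * A)) ^ (4 / 5 : ℝ) * C ^ (1 / 5 : ℝ)) * (∫ t in τ..0, g t) ^ (3 / 5 : ℝ) := hfin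
    _ ≤ (k' - k) ^ (-(8 / 5) : ℝ) *
        ((2 * (Z * A)) ^ (4 / 5 : ℝ) * C ^ (1 / 5 : ℝ)) * (3 * (Z * A)) ^ (3 / 5 : ℝ) :=
      mul_le_mul_of_nonneg_left h9 (by positivity)
    _ = C ^ (1 / 5 : ℝ) * ((k' - k) ^ (-(8 / 5) : ℝ) *
        ((2 * (Z * A)) ^ (4 / 5 : ℝ) * (3 * (Z * A)) ^ (3 / 5 : ℝ))) := by ring
    _ ≤ C * 4 ^ N * ((k' - k) ^ (-(8 / 5) : ℝ) * (6 * ((1 / (τ - τ') +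
        6 * (C * 4 ^ N) * ((r' - r)⁻¹ * (1 + D)) ^ N) * A) ^ (7 / 5 : ℝ))) := by
      refine mul_le_mul (hC5.trans hC4) (mul_le_mul_of_nonneg_left ?_ hdp) (by positivity) (by positivity)
      exact h10.trans (mul_le_mul_of_nonneg_left h11 (by norm_num))
    _ = _ := by rw [levEnergy]; ring

lemma geometric_decay {Y : ℕ → ℝ} {Q A b : ℝ} (hY : ∀ j, 0 ≤ Y j) (hQ : 0 ≤ Q) (hA : 0 ≤ A) (hb : 1 ≤ b)
    (h0 : Y 0 ≤ A) (hstep : ∀ j, Y (j + 1) ≤ Q * (b ^ 2) ^ j * Y j ^ (7 / 5 : ℝ))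
    (hsm : Q * A ^ (2 / 5 : ℝ) * b ^ 5 ≤ 1) (j : ℕ) : Y j ≤ A * (b⁻¹ ^ 5) ^ j := by
  have hb0 : 0 < b := by linarith
  induction j with
  | zero => simpa using h0
  | succ j ih =>
    have e1 : (A * (b⁻¹ ^ 5) ^ j) ^ (7 / 5 : ℝ) = A ^ (2 / 5 : ℝ) * A * (b⁻¹ ^ 7) ^ j := by
      rw [mul_rpow hA (by positivity)]
      congr 1
      · nth_rewrite 3 [← rpow_one A]
        rw [← rpow_add_of_nonneg hA (by norm_num) (by norm_num)]; norm_num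
      · rw [← pow_mul, ← rpow_natCast, ← rpow_mul (by positivity), ← pow_mul, ← rpow_natCast]
        congr 1; push_cast; ring
    have e2 : (b ^ 2) ^ j * (b⁻¹ ^ 7) ^ j = (b⁻¹ ^ 5) ^ j := by
      rw [← mul_pow]; congr 1; field_simp
    calc Y (j + 1) ≤ Q * (b ^ 2) ^ j * Y j ^ (7 / 5 : ℝ) := hstep j
      _ ≤ Q * (b ^ 2) ^ j * (A ^ (2 / 5 : ℝ) * A * (b⁻¹ ^ 7) ^ j) := by
        rw [← e1]
        exact mul_le_mul_of_nonneg_left (rpow_le_rpow (hY j) ih (by norm_num)) (by positivity)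
      _ = Q * A ^ (2 / 5 : ℝ) * (A * ((b ^ 2) ^ j * (b⁻¹ ^ 7) ^ j)) := by ring
      _ = (Q * A ^ (2 / 5 : ℝ) * b ^ 5) * (A * (b⁻¹ ^ 5) ^ (j + 1)) := by
        rw [e2, pow_succ (b⁻¹ ^ 5) j]; field_simp
      _ ≤ 1 * (A * (b⁻¹ ^ 5) ^ (j + 1)) := mul_le_mul_of_nonneg_right hsm (by positivity)
      _ = _ := one_mul _

lemma levF_anti {k k' : ℝ} (hk : k ≤ k') (u : ℝ) : levF k' u ≤ levF k u :=
  pow_le_pow_left₀ (le_max_right _ _) (max_le_max (by linarith) le_rfl) 2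

lemma levF_zero_sq {u : ℝ} (h0 : 0 < u) (h1 : u ≤ 1) : levF 0 u ^ 2 = 1 - log u := by
  have h := one_sub_log_pos ⟨h0, h1.trans_lt one_lt_two⟩
  have hr : 0 ≤ rootLog u := rpow_nonneg h.le _
  rw [levF, sub_zero, max_eq_left hr, rootLog, ← pow_mul, ← rpow_natCast, ← rpow_mul h.le]
  norm_num

lemma le_of_levF_eq_zero {k u : ℝ} (h0 : 0 < u) (h1 : u ≤ 1) (hk : levF k u = 0) :
    exp (-k ^ 4) ≤ u := by
  have h := one_sub_log_pos ⟨h0, h1.trans_lt one_lt_two⟩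
  have hr : 0 ≤ rootLog u := rpow_nonneg h.le _
  have h2 : rootLog u ≤ k := by
    rw [levF, sq_eq_zero_iff] at hk
    have := le_max_left (rootLog u - k) 0
    linarith
  have h3 : 1 - log u ≤ k ^ 4 := by
    have : rootLog u ^ 4 = 1 - log u := by
      rw [rootLog, ← rpow_natCast, ← rpow_mul h.le]; norm_num
    rw [← this]
    exact pow_le_pow_left₀ hr h2 4
  rw [← exp_log h0]
  exact exp_le_exp.2 (by linarith)

lemma Slab.levF_sq_integrableOn {U B : SpT → ℝ} {K : ℝ≥0} {δ : ℝ} (h : Slab U B K δ) (k t r : ℝ) :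
    IntegrableOn (fun x => levF k (U (t, x)) ^ 2) (ball 0 r) := by
  obtain ⟨L, M, hL, hM⟩ := h.levF_lip k
  exact IntegrableOn.of_bound measure_ball_lt_top
    ((lipschitz_slice hL t).continuous.measurable.pow_const 2).aestronglyMeasurable ((M : ℝ) ^ 2)
    (Eventually.of_forall fun x => by
      rw [Real.norm_of_nonneg (sq_nonneg _)]; exact pow_le_pow_left₀ (levF_nonneg _ _) (hM _) 2)

lemma Slab.levEnergy_mono {U B : SpT → ℝ} {K : ℝ≥0} {δ : ℝ} (h : Slab U B K δ) {k k' r r' τ τ' : ℝ}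
    (hk : k ≤ k') (hr : r ≤ r') (hτ : τ' ≤ τ) (hτ0 : τ ≤ 0) :
    levEnergy U k' r τ ≤ levEnergy U k r' τ' := by
  have h1 : ∀ t, levBall U k' r t ≤ levBall U k r' t := fun t =>
    (setIntegral_mono (h.levF_sq_integrableOn k' t r) (h.levF_sq_integrableOn k t r)
      fun x => pow_le_pow_left₀ (levF_nonneg _ _) (levF_anti hk _) 2).trans
      (setIntegral_mono_set (h.levF_sq_integrableOn k t r') (Eventually.of_forall fun x => sq_nonneg _)
        (ball_subset_ball hr).eventuallyLE)
  refine (intervalIntegral.integral_mono hτ0 (h.levBall_intervalIntegrable _ _ _ _)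
    (h.levBall_intervalIntegrable _ _ _ _) h1).trans ?_
  exact intervalIntegral.integral_mono_interval hτ hτ0 le_rfl
    (Eventually.of_forall fun t => levBall_nonneg _ _ _ _) (h.levBall_intervalIntegrable _ _ _ _)

lemma Slab.levF_eq_zero {U B : SpT → ℝ} {K : ℝ≥0} {δ : ℝ} (h : Slab U B K δ) {k r τ : ℝ} (hτ : τ < 0)
    (h0 : levEnergy U k r τ ≤ 0) : ∀ t ∈ Icc τ 0, ∀ x ∈ ball (0 : E3) r, levF k (U (t, x)) = 0 := by
  obtain ⟨L, M, hL, hM⟩ := h.levF_lip k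
  have h1 : levEnergy U k r τ = 0 := le_antisymm h0
    (intervalIntegral.integral_nonneg hτ.le fun t _ => levBall_nonneg U k r t)
  rw [levEnergy, intervalIntegral.integral_eq_zero_iff_of_le_of_nonneg_ae hτ.le
    (Eventually.of_forall fun t => levBall_nonneg U k r t) (h.levBall_intervalIntegrable k r _ _)] at h1
  have h2 : ∀ x ∈ ball (0 : E3) r, EqOn (fun t => levF k (U (t, x))) (fun _ => 0) (Icc τ 0) := by
    intro x hx
    refine Measure.eqOn_Icc_of_ae_eq volume hτ.ne ?_
      (lipschitz_tslice hL x).continuous.continuousOn continuousOn_const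
    rw [← restrict_Ioc_eq_restrict_Icc]
    filter_upwards [h1] with t ht
    have ht' : levBall U k r t = 0 := ht
    rw [levBall, setIntegral_eq_zero_iff_of_nonneg_ae (Eventually.of_forall fun x => sq_nonneg _)
      (h.levF_sq_integrableOn k t r)] at ht'
    have := Measure.eqOn_open_of_ae_eq (g := 0) ht' isOpen_ball
      ((lipschitz_slice hL t).continuous.pow 2).continuousOn continuousOn_const hx
    simpa using this
  exact fun t ht x hx => h2 x hx ht

/-- One step of the iteration along dyadic levels, radii and times. -/
lemma dg_dyadic {C X D Θ k : ℝ} {N j : ℕ} (hC : 1 ≤ C) (hN : 1 ≤ N) (hX : X = (1 + D) / Θ) (hΘ : 0 < Θ)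
    (hΘ1 : Θ ≤ 1) (hD : 0 ≤ D) (hk : 1 ≤ k) {y : ℝ} (hy : 0 ≤ y) :
    C * ((k * 2⁻¹ ^ (j + 1)) ^ (-(8 / 5) : ℝ) *
      ((1 / (Θ / 4 * 2⁻¹ ^ (j + 1)) + C * ((4⁻¹ * 2⁻¹ ^ (j + 1) : ℝ)⁻¹ * (1 + D)) ^ N) * y) ^ (7 / 5 : ℝ)) ≤
    (4 * C * (2 * C * (8 * X) ^ N) ^ 2 / k) * ((2 ^ (N + 1)) ^ 2) ^ j * y ^ (7 / 5 : ℝ) := by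
  have hX1 : 1 ≤ X := by rw [hX, le_div_iff₀ hΘ]; linarith
  have hDX : 1 + D ≤ X := by rw [hX, le_div_iff₀ hΘ]; nlinarith
  have h1X : 1 / Θ ≤ X := by rw [hX]; gcongr; linarith
  set P := 2 * C * (8 * X) ^ N with hP
  have h8 : (1 : ℝ) ≤ (8 * X) ^ N := one_le_pow₀ (by linarith)
  have hP1 : 1 ≤ P := by
    rw [hP]; nlinarith
  have hs : ((2⁻¹ : ℝ) ^ (j + 1))⁻¹ = 2 * 2 ^ j := by rw [inv_pow, inv_inv, pow_succ]; ring
  have h2j : (1 : ℝ) ≤ 2 ^ j := one_le_pow₀ (by norm_num)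
  have e1 : 1 / (Θ / 4 * 2⁻¹ ^ (j + 1)) ≤ C * ((8 * X) ^ N * (2 ^ N) ^ j) := by
    have : 1 / (Θ / 4 * 2⁻¹ ^ (j + 1)) = 8 * (1 / Θ) * 2 ^ j := by
      rw [one_div, mul_inv, hs]; field_simp; norm_num
    rw [this, ← pow_mul, mul_comm N j, pow_mul, ← mul_pow]
    calc 8 * (1 / Θ) * 2 ^ j ≤ 8 * X * 2 ^ j := by gcongr
      _ ≤ (8 * X * 2 ^ j) ^ N := le_self_pow₀ (by nlinarith) (by omega)
      _ ≤ C * (8 * X * 2 ^ j) ^ N := le_mul_of_one_le_left (by positivity) hC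
  have e2 : C * ((4⁻¹ * 2⁻¹ ^ (j + 1) : ℝ)⁻¹ * (1 + D)) ^ N ≤ C * ((8 * X) ^ N * (2 ^ N) ^ j) := by
    rw [mul_inv, hs, ← pow_mul, mul_comm N j, pow_mul, ← mul_pow]
    refine mul_le_mul_of_nonneg_left (pow_le_pow_left₀ (by positivity) ?_ _) (by linarith)
    calc (4⁻¹ : ℝ)⁻¹ * (2 * 2 ^ j) * (1 + D) = 8 * (1 + D) * 2 ^ j := by norm_num; ring
      _ ≤ _ := by gcongr
  have e3 : (1 / (Θ / 4 * 2⁻¹ ^ (j + 1)) + C * ((4⁻¹ * 2⁻¹ ^ (j + 1) : ℝ)⁻¹ * (1 + D)) ^ N) ≤ P * (2 ^ N) ^ j := by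
    rw [hP]; linarith
  have hPj : 1 ≤ P * (2 ^ N) ^ j := one_le_mul_of_one_le_of_one_le hP1 (one_le_pow₀ (one_le_pow₀ (by norm_num)))
  have e4 : ((1 / (Θ / 4 * 2⁻¹ ^ (j + 1)) + C * ((4⁻¹ * 2⁻¹ ^ (j + 1) : ℝ)⁻¹ * (1 + D)) ^ N) * y) ^ (7 / 5 : ℝ) ≤
      (P * (2 ^ N) ^ j) ^ 2 * y ^ (7 / 5 : ℝ) := by
    refine (rpow_le_rpow (by positivity) (mul_le_mul_of_nonneg_right e3 hy) (by norm_num)).trans ?_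
    rw [mul_rpow (by linarith) hy]
    refine mul_le_mul_of_nonneg_right ?_ (rpow_nonneg hy _)
    rw [← rpow_natCast (P * (2 ^ N) ^ j) 2]
    exact rpow_le_rpow_of_exponent_le hPj (by norm_num)
  have e5 : (k * 2⁻¹ ^ (j + 1)) ^ (-(8 / 5) : ℝ) ≤ k⁻¹ * (4 * 4 ^ j) := by
    rw [mul_rpow (by linarith) (by positivity)]
    refine mul_le_mul ?_ ?_ (by positivity) (by positivity)
    · rw [← rpow_neg_one]
      exact rpow_le_rpow_of_exponent_le hk (by norm_num)
    · rw [rpow_neg (by positivity), ← inv_rpow (by positivity), hs]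
      calc (2 * 2 ^ j : ℝ) ^ (8 / 5 : ℝ) ≤ (2 * 2 ^ j) ^ (2 : ℝ) :=
            rpow_le_rpow_of_exponent_le (by linarith) (by norm_num)
        _ = 4 * 4 ^ j := by
          rw [rpow_two, mul_pow, ← pow_mul, mul_comm j, pow_mul]; norm_num
  calc _ ≤ C * (k⁻¹ * (4 * 4 ^ j) * ((P * (2 ^ N) ^ j) ^ 2 * y ^ (7 / 5 : ℝ))) := by
        refine mul_le_mul_of_nonneg_left (mul_le_mul e5 e4 (by positivity) (by positivity)) (by linarith)
    _ = _ := by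
      have : ((2 ^ (N + 1)) ^ 2 : ℝ) ^ j = 4 ^ j * ((2 ^ N) ^ j) ^ 2 := by
        rw [show (4 : ℝ) = 2 ^ 2 by norm_num]
        simp only [← pow_mul, ← pow_add]
        congr 1; ring
      rw [this]; ring

/-- Pointwise lower bound: if `U ≥ 1/2` on a substantial part of an initial time layer, then `U` is
bounded below afterwards. -/
lemma lower_bound {q l : ℝ} (hq : 3 / 2 < q) (hl : 1 < l) (hql : 3 / (2 * q) + 1 / l < 1) :
    ∃ (K1 : ℝ) (N : ℕ), 1 ≤ K1 ∧ ∀ (U B : SpT → ℝ) (K : ℝ≥0) (δ : ℝ), Slab U B K δ →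
      ∀ D, (∫ t in (-1)..0, driftPow B q l t) ≤ D → ∀ Θ, 0 < Θ → Θ ≤ 1 →
      (volume (closedBall (0 : E3) (5 / 4))).toReal / 8 * Θ ≤
        ∫ t in (-Θ)..(-(3 * Θ / 4)), highMeas U t →
      ∀ t ∈ Icc (-(Θ / 2)) 0, ∀ x ∈ ball (0 : E3) 1,
        exp (-(K1 * ((1 + D) / Θ)) ^ N) ≤ U (t, x) := by
  obtain ⟨C, N, hC, hN, hst⟩ := dg_step hq hl hql
  obtain ⟨K1, N', hK1, hlog⟩ := log_bound hq hl hql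
  set v := (volume (closedBall (0 : E3) (5 / 4))).toReal with hv
  have hv0 : 0 < v := ball54_pos
  set c := 4 * C * (2 * C * 8 ^ N) ^ 2 * ((v + 2) * K1 ^ N') * (2 ^ (N + 1)) ^ 5 with hc
  have h8 : (1 : ℝ) ≤ 8 ^ N := one_le_pow₀ (by norm_num)
  have hc1 : 1 ≤ c := by
    refine one_le_mul_of_one_le_of_one_le (one_le_mul_of_one_le_of_one_le
      (one_le_mul_of_one_le_of_one_le (by linarith) (one_le_pow₀ (by nlinarith)))
      (one_le_mul_of_one_le_of_one_le (by linarith) (one_le_pow₀ hK1)))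
      (one_le_pow₀ (one_le_pow₀ (by norm_num)))
  set M := (2 * N + N') * 4 with hM
  refine ⟨c ^ 4, M, one_le_pow₀ hc1, fun U B K δ h D hD Θ hΘ hΘ1 hmeas t ht x hx => ?_⟩
  have hD0 : 0 ≤ D := (intervalIntegral.integral_nonneg (by norm_num)
    fun t _ => h.driftPow_nonneg q l t).trans hD
  set X := (1 + D) / Θ with hX
  have hX1 : 1 ≤ X := by rw [hX, le_div_iff₀ hΘ]; linarith
  set k := c * X ^ (2 * N + N') with hk
  have hk1 : 1 ≤ k := one_le_mul_of_one_le_of_one_le hc1 (one_le_pow₀ hX1)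
  have hk0 : 0 < k := by linarith
  set A := (v + 2) * (K1 * X) ^ N' with hA
  have hKX : 1 ≤ (K1 * X) ^ N' := one_le_pow₀ (one_le_mul_of_one_le_of_one_le hK1 hX1)
  have hA1 : 1 ≤ A := by rw [hA]; nlinarith
  set Y : ℕ → ℝ := fun j => levEnergy U (k * (1 - 2⁻¹ ^ j)) (1 + 4⁻¹ * 2⁻¹ ^ j)
    (-(Θ / 2) - Θ / 4 * 2⁻¹ ^ j) with hY
  have hp : ∀ j : ℕ, 0 < (2⁻¹ : ℝ) ^ j ∧ (2⁻¹ : ℝ) ^ j ≤ 1 := fun j =>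
    ⟨by positivity, pow_le_one₀ (by norm_num) (by norm_num)⟩
  have hs : ∀ j : ℕ, (2⁻¹ : ℝ) ^ j = 2 * 2⁻¹ ^ (j + 1) := fun j => by rw [pow_succ]; ring
  have hneg : ∀ j : ℕ, -(Θ / 2) - Θ / 4 * 2⁻¹ ^ j ≤ 0 := fun j => by
    have := hp j
    have : 0 ≤ Θ / 4 * 2⁻¹ ^ j := by positivity
    linarith
  have hY0 : ∀ j, 0 ≤ Y j := fun j =>
    intervalIntegral.integral_nonneg (hneg j) fun t _ => levBall_nonneg U _ _ t
  have hstep : ∀ j, Y (j + 1) ≤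
      (4 * C * (2 * C * (8 * X) ^ N) ^ 2 / k) * ((2 ^ (N + 1)) ^ 2) ^ j * Y j ^ (7 / 5 : ℝ) := by
    intro j
    refine le_trans ?_ (dg_dyadic hC hN hX hΘ hΘ1 hD0 hk1 (hY0 j))
    have hpj := hp (j + 1)
    have hpj' := hp j
    have hsj := hs j
    have e1 := hst U B K δ h D hD (k * (1 - 2⁻¹ ^ j)) (k * (1 - 2⁻¹ ^ (j + 1)))
      (1 + 4⁻¹ * 2⁻¹ ^ (j + 1)) (1 + 4⁻¹ * 2⁻¹ ^ j) (-(Θ / 2) - Θ / 4 * 2⁻¹ ^ j)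
      (-(Θ / 2) - Θ / 4 * 2⁻¹ ^ (j + 1))
      (mul_lt_mul_of_pos_left (by linarith) hk0) (by linarith) (by linarith) (by linarith)
      (by nlinarith) (by nlinarith) (hneg _)
    rw [show k * (1 - 2⁻¹ ^ (j + 1)) - k * (1 - 2⁻¹ ^ j) = k * 2⁻¹ ^ (j + 1) by rw [hsj]; ring,
      show -(Θ / 2) - Θ / 4 * 2⁻¹ ^ (j + 1) - (-(Θ / 2) - Θ / 4 * 2⁻¹ ^ j) = Θ / 4 * 2⁻¹ ^ (j + 1) by
        rw [hsj]; ring,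
      show 1 + 4⁻¹ * 2⁻¹ ^ j - (1 + 4⁻¹ * 2⁻¹ ^ (j + 1)) = (4⁻¹ * 2⁻¹ ^ (j + 1) : ℝ) by rw [hsj]; ring] at e1
    exact e1
  have hYA : Y 0 ≤ A := by
    have e1 : ∀ t ∈ Icc (-(3 * Θ / 4)) 0, levBall U 0 (5 / 4) t ≤ A := by
      intro t ht
      have h1 := hlog U B K δ h D hD Θ hΘ hΘ1 hmeas t ht
      have hcl : ContinuousOn (fun x => log (U (t, x))) (closedBall (0 : E3) (5 / 4)) := fun x _ =>
        ((continuousAt_log (h.hδ.trans_le (h.lb _)).ne').comp (f := fun x => U (t, x))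
          (lipschitz_slice h.lip t).continuous.continuousAt).continuousWithinAt
      have hintg : IntegrableOn (fun x => -log (U (t, x))) (closedBall (0 : E3) (5 / 4)) :=
        hcl.neg.integrableOn_compact (isCompact_closedBall _ _)
      have hintg1 : IntegrableOn (fun _ => (1 : ℝ)) (closedBall (0 : E3) (5 / 4)) :=
        continuousOn_const.integrableOn_compact (isCompact_closedBall _ _)
      have e2 : levBall U 0 (5 / 4) t ≤ ∫ x in closedBall (0 : E3) (5 / 4), (1 + -log (U (t, x))) := by
        rw [levBall, setIntegral_congr_fun (g := fun x => 1 + -log (U (t, x))) measurableSet_ball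
          (fun x _ => by simp only; rw [levF_zero_sq (h.hδ.trans_le (h.lb _)) (h.ub _)]; ring)]
        refine setIntegral_mono_set (hintg1.add hintg) (Eventually.of_forall fun x => ?_)
          ball_subset_closedBall.eventuallyLE
        have := log_nonpos (h.hδ.le.trans (h.lb (t, x))) (h.ub _)
        simp only [Pi.zero_apply]
        linarith
      rw [integral_add (f := fun _ => (1 : ℝ)) (g := fun x => -log (U (t, x))) hintg1 hintg] at e2
      simp only [integral_const, smul_eq_mul, mul_one, measureReal_restrict_apply MeasurableSet.univ,
        univ_inter] at e2
      have e3 : volume.real (closedBall (0 : E3) (5 / 4)) = v := rfl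
      rw [e3] at e2
      have : A = (v + 2) * (K1 * X) ^ N' := rfl
      nlinarith
    have e4 : Y 0 = ∫ t in (-(3 * Θ / 4))..0, levBall U 0 (5 / 4) t := by
      rw [hY]
      simp only [levEnergy, pow_zero, sub_self, mul_zero, mul_one]
      congr 1
      · funext t; congr 1; norm_num
      · ring
    rw [e4]
    refine (intervalIntegral.integral_mono_on (by linarith) (h.levBall_intervalIntegrable _ _ _ _)
      intervalIntegrable_const e1).trans ?_
    rw [intervalIntegral.integral_const, smul_eq_mul]
    nlinarith
  have hsm : 4 * C * (2 * C * (8 * X) ^ N) ^ 2 / k * A ^ (2 / 5 : ℝ) * (2 ^ (N + 1)) ^ 5 ≤ 1 := by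
    have e1 : A ^ (2 / 5 : ℝ) ≤ A := by
      calc A ^ (2 / 5 : ℝ) ≤ A ^ (1 : ℝ) := rpow_le_rpow_of_exponent_le hA1 (by norm_num)
        _ = A := rpow_one A
    calc _ ≤ 4 * C * (2 * C * (8 * X) ^ N) ^ 2 / k * A * (2 ^ (N + 1)) ^ 5 := by gcongr
      _ = 1 := by
        have : 4 * C * (2 * C * (8 * X) ^ N) ^ 2 * A * (2 ^ (N + 1)) ^ 5 = k := by
          rw [hk, hc, hA, mul_pow 8 X, mul_pow K1 X]; ring
        rw [div_mul_eq_mul_div, div_mul_eq_mul_div, this, div_self hk0.ne']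
  have hdec := geometric_decay (b := 2 ^ (N + 1)) hY0 (by positivity) (by linarith)
    (one_le_pow₀ (by norm_num)) hYA hstep hsm
  have hlim : levEnergy U k 1 (-(Θ / 2)) ≤ 0 := by
    have hb : ((2 ^ (N + 1) : ℝ)⁻¹ ^ 5) < 1 :=
      pow_lt_one₀ (by positivity) (inv_lt_one_of_one_lt₀ (one_lt_pow₀ (by norm_num) (by omega))) (by norm_num)
    have := (tendsto_pow_atTop_nhds_zero_of_lt_one (by positivity) hb).const_mul A
    rw [mul_zero] at this
    refine ge_of_tendsto' this fun j => le_trans ?_ (hdec j)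
    have hpj := hp j
    have : 0 ≤ Θ / 4 * 2⁻¹ ^ j := by positivity
    exact h.levEnergy_mono (mul_le_of_le_one_right hk0.le (by linarith)) (by linarith) (by linarith) (by linarith)
  have hz := h.levF_eq_zero (by linarith) hlim t ht x hx
  refine le_trans (exp_le_exp.2 ?_) (le_of_levF_eq_zero (h.hδ.trans_le (h.lb _)) (h.ub _) hz)
  have hc4 : c ^ 4 ≤ (c ^ 4) ^ M := le_self_pow₀ (one_le_pow₀ hc1) (by rw [hM]; omega)
  rw [neg_le_neg_iff, hk, mul_pow c, mul_pow (c ^ 4), ← pow_mul X]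
  exact mul_le_mul_of_nonneg_right hc4 (by positivity)

lemma fderiv_affine (f : E3 → ℝ) (c d : ℝ) (x : E3) :
    fderiv ℝ (fun y => c * f y + d) x = c • fderiv ℝ f x := by
  rw [fderiv_add_const]
  rcases eq_or_ne c 0 with rfl | hc
  · simp
  · by_cases hf : DifferentiableAt ℝ f x
    · exact fderiv_const_mul hf c
    · rw [fderiv_zero_of_not_differentiableAt hf, smul_zero, fderiv_zero_of_not_differentiableAt]
      intro h
      refine hf ((h.const_mul c⁻¹).congr_of_eventuallyEq (Eventually.of_forall fun y => ?_))
      simp only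
      rw [inv_mul_cancel_left₀ hc]

lemma weakInt_affine (V φ : SpT → ℝ) (b : ℝ → E3 → E3) (c d : ℝ) (p : SpT) :
    weakInt (fun p => c * V p + d) b φ p = c * weakInt V b φ p := by
  have h1 : pdt (fun p => c * V p + d) p = c * pdt V p := by
    rw [pdt, pdt, deriv_add_const]; exact deriv_const_mul_field c
  have h2 : ∀ i, pdx (fun p => c * V p + d) i p = c * pdx V i p := fun i => by
    rw [pdx, pdx, fderiv_affine (fun y => V (p.1, y)) c d]; rfl
  simp only [weakInt, h1, h2, Fin.sum_univ_three]
  ring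

lemma WSol.affine {V : SpT → ℝ} {b : ℝ → E3 → E3} {K : ℝ≥0} (h : WSol V b K) (c d : ℝ) :
    WSol (fun p => c * V p + d) b (‖c‖₊ * K) where
  lip := LipschitzWith.of_dist_le_mul fun x y => by
    rw [dist_eq, show c * V x + d - (c * V y + d) = c * (V x - V y) by ring, abs_mul]
    have := h.lip.dist_le_mul x y
    rw [dist_eq] at this
    push_cast
    rw [mul_assoc]
    exact mul_le_mul_of_nonneg_left this (abs_nonneg c)
  cont := h.cont
  weak := fun φ h1 h2 h3 => by
    simp only [weakInt_affine, integral_const_mul, h.weak φ h1 h2 h3, mul_zero]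

lemma WeakSolOn.congr {V W : SpT → ℝ} {b : ℝ → E3 → E3} {Q : Set SpT} (h : WeakSolOn V b Q)
    (he : EqOn V W Q) : WeakSolOn W b Q := by
  intro φ h1 h2 h3
  rw [← h φ h1 h2 h3]
  refine integral_congr_ae (Eventually.of_forall fun p => ?_)
  by_cases hp : p ∈ interior Q
  · have hev : W =ᶠ[𝓝 p] V := by
      filter_upwards [isOpen_interior.mem_nhds hp] with z hz using (he (interior_subset hz)).symm
    have e1 : pdt W p = pdt V p :=
      Filter.EventuallyEq.deriv_eq ((Continuous.prodMk_left p.2).continuousAt (x := p.1) |>.eventually hev)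
    have e2 : ∀ i, pdx W i p = pdx V i p := fun i => by
      rw [pdx, pdx, Filter.EventuallyEq.fderiv_eq (f := fun y => V (p.1, y))
        ((Continuous.prodMk_right p.1).continuousAt (x := p.2) |>.eventually hev)]
    simp only [weakInt, e1, e2]
  · have hp' : p ∉ tsupport φ := fun hh => hp (h3 hh)
    have hev : φ =ᶠ[𝓝 p] 0 := notMem_tsupport_iff_eventuallyEq.1 hp'
    have e1 : φ p = 0 := hev.eq_of_nhds
    have e2 : ∀ i, pdx φ i p = 0 := fun i => by
      rw [pdx, Filter.EventuallyEq.fderiv_eq (f := fun _ => (0 : ℝ))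
        ((Continuous.prodMk_right p.1).continuousAt (x := p.2) |>.eventually hev)]
      simp
    simp only [weakInt, e1, e2, mul_zero, Finset.sum_const_zero, add_zero]

lemma highMeas_add_ge {U U' : SpT → ℝ} (h : ∀ p, 1 ≤ U p + U' p) (t : ℝ) :
    (volume (closedBall (0 : E3) (5 / 4))).toReal ≤ highMeas U t + highMeas U' t := by
  have hlt : ∀ W : SpT → ℝ, volume {x : E3 | x ∈ closedBall (0 : E3) (5 / 4) ∧ 1 / 2 ≤ W (t, x)} ≠ ⊤ :=
    fun W => ((measure_mono fun x hx => hx.1).trans_lt measure_closedBall_lt_top).ne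
  rw [highMeas, highMeas, ← ENNReal.toReal_add (hlt _) (hlt _)]
  refine ENNReal.toReal_mono (ENNReal.add_ne_top.2 ⟨hlt _, hlt _⟩) ((measure_mono fun x hx => ?_).trans
    (measure_union_le _ _))
  rcases le_or_gt (1 / 2) (U (t, x)) with h1 | h1
  · exact Or.inl ⟨hx, h1⟩
  · exact Or.inr ⟨hx, by have := h (t, x); linarith⟩

/-- Oscillation decay on the unit cylinder for globally bounded, globally Lipschitz solutions. -/
lemma osc_unit {q l : ℝ} (hq : 3 / 2 < q) (hl : 1 < l) (hql : 3 / (2 * q) + 1 / l < 1) :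
    ∃ (K1 : ℝ) (N : ℕ), 1 ≤ K1 ∧ ∀ (V : SpT → ℝ) (b : ℝ → E3 → E3) (K : ℝ≥0), WSol V b K →
      ContDiffOn ℝ 1 (fun p : SpT => b p.1 p.2) (Qlt 1 2 1) →
      (∀ p ∈ Om, divb b p = 0 ∨ V p = 0) →
      ∀ D, (∫ t in (-1)..0, driftPow (driftB b) q l t) ≤ D → ∀ Θ, 0 < Θ → Θ ≤ 1 →
      ∀ m M : ℝ, (∀ p, m ≤ V p) → (∀ p, V p ≤ M) →
      ∀ p ∈ Icc (-(Θ / 2)) 0 ×ˢ ball (0 : E3) 1, ∀ p' ∈ Icc (-(Θ / 2)) 0 ×ˢ ball (0 : E3) 1,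
        V p - V p' ≤ (1 - exp (-(K1 * ((1 + D) / Θ)) ^ N)) * (M - m) := by
  obtain ⟨K1, N, hK1, hlow⟩ := lower_bound hq hl hql
  refine ⟨K1, N, hK1, fun V b K h hb hd D hD Θ hΘ hΘ1 m M hm hM p hp p' hp' => ?_⟩
  set η := exp (-(K1 * ((1 + D) / Θ)) ^ N) with hη
  have hη0 : 0 < η := exp_pos _
  have hmM : m ≤ M := (hm 0).trans (hM 0)
  have hdich : ∀ t ∈ Ioo (-1 : ℝ) 0, (∀ x ∈ ball (0 : E3) 2, divb b (t, x) = 0) ∨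
      ∀ x ∈ ball (0 : E3) 2, V (t, x) = 0 := fun t ht => h.dichotomy hb hd ht
  have key : ∀ ε : ℝ, 0 < ε → V p - V p' ≤ (1 - η) * (M - m + ε) + ε := by
    intro ε hε
    set s := M - m + ε with hs
    have hs0 : 0 < s := by linarith
    set U : SpT → ℝ := fun p => s⁻¹ * V p + s⁻¹ * (ε - m) with hU
    set U' : SpT → ℝ := fun p => -s⁻¹ * V p + s⁻¹ * (M + ε) with hU'
    have hUe : ∀ p, U p = (V p - m + ε) / s := fun p => by rw [hU]; field_simp; ring
    have hUe' : ∀ p, U' p = (M - V p + ε) / s := fun p => by rw [hU']; field_simp; ring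
    have hslab := (h.affine s⁻¹ (s⁻¹ * (ε - m))).slab (δ := ε / s) hb
      (fun t ht => (hdich t ht).imp id fun h0 => ⟨_, fun x hx => by simp only [h0 x hx]; rfl⟩)
      (by positivity)
      (fun p => by
        show _ ≤ U p
        rw [hUe]; gcongr; linarith [hm p])
      (fun p => by
        show U p ≤ 1
        rw [hUe, div_le_one hs0]; linarith [hM p])
    have hslab' := (h.affine (-s⁻¹) (s⁻¹ * (M + ε))).slab (δ := ε / s) hb
      (fun t ht => (hdich t ht).imp id fun h0 => ⟨_, fun x hx => by simp only [h0 x hx]; rfl⟩)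
      (by positivity)
      (fun p => by
        show _ ≤ U' p
        rw [hUe']; gcongr; linarith [hM p])
      (fun p => by
        show U' p ≤ 1
        rw [hUe', div_le_one hs0]; linarith [hm p])
    have hsum : ∀ p, 1 ≤ U p + U' p := fun p => by
      rw [hUe, hUe', ← add_div, le_div_iff₀ hs0]; linarith
    have hm1 := highMeas_intervalIntegrable (U := U) hslab.lip.continuous.measurable (-Θ) (-(3 * Θ / 4))
    have hm2 := highMeas_intervalIntegrable (U := U') hslab'.lip.continuous.measurable (-Θ) (-(3 * Θ / 4))
    have hI := intervalIntegral.integral_mono_on (μ := volume) (a := -Θ) (b := -(3 * Θ / 4)) (by linarith)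
      intervalIntegrable_const (hm1.add hm2) fun t _ => highMeas_add_ge hsum t
    rw [intervalIntegral.integral_const, smul_eq_mul, intervalIntegral.integral_add hm1 hm2] at hI
    set v := (volume (closedBall (0 : E3) (5 / 4))).toReal with hv
    rcases le_or_gt (v / 8 * Θ) (∫ t in (-Θ)..(-(3 * Θ / 4)), highMeas U t) with h1 | h1
    · have := hlow U _ _ _ hslab D hD Θ hΘ hΘ1 h1 p'.1 hp'.1 p'.2 hp'.2
      rw [← hη, Prod.mk.eta, hUe, le_div_iff₀ hs0] at this
      have := hM p
      nlinarith
    · have := hlow U' _ _ _ hslab' D hD Θ hΘ hΘ1 (by linarith) p.1 hp.1 p.2 hp.2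
      rw [← hη, Prod.mk.eta, hUe', le_div_iff₀ hs0] at this
      have := hm p'
      nlinarith
  have hlim : Tendsto (fun ε : ℝ => (1 - η) * (M - m + ε) + ε) (𝓝[>] 0) (𝓝 ((1 - η) * (M - m + 0) + 0)) :=
    (Continuous.tendsto (by fun_prop) 0).mono_left nhdsWithin_le_nhds
  rw [add_zero, add_zero] at hlim
  exact ge_of_tendsto hlim (eventually_mem_nhdsWithin.mono fun ε hε => key ε hε)

/-- Parabolic dilation by `R` as a linear equivalence of space-time. -/
def parDil (R : ℝ) (hR : R ≠ 0) : SpT ≃L[ℝ] SpT :=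
  LinearEquiv.toContinuousLinearEquiv
    { toFun := fun p => (R ^ 2 * p.1, R • p.2)
      map_add' := fun p q => by ext1 <;> simp [mul_add]
      map_smul' := fun c p => by
        ext1
        · simp only [Prod.smul_fst, smul_eq_mul, RingHom.id_apply]; ring
        · simp only [Prod.smul_snd, RingHom.id_apply]; rw [smul_comm]
      invFun := fun p => ((R ^ 2)⁻¹ * p.1, R⁻¹ • p.2)
      left_inv := fun p => by
        ext1
        · simp only; field_simp
        · simp only; rw [inv_smul_smul₀ hR]
      right_inv := fun p => by
        ext1
        · simp only; field_simp
        · simp only; rw [smul_inv_smul₀ hR] }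

lemma parDil_apply (R : ℝ) (hR : R ≠ 0) (p : SpT) : parDil R hR p = (R ^ 2 * p.1, R • p.2) := rfl

lemma integral_comp_parDil_eq_zero {R : ℝ} (hR : R ≠ 0) {g : SpT → ℝ} (hg : ∫ p, g p = 0) :
    ∫ p, g (parDil R hR p) = 0 := by
  set L := parDil R hR
  have hdet : LinearMap.det (L.toLinearEquiv : SpT →ₗ[ℝ] SpT) ≠ 0 :=
    (LinearEquiv.isUnit_det' L.toLinearEquiv).ne_zero
  have : (volume : Measure SpT).IsAddHaarMeasure := by
    rw [Measure.volume_eq_prod]; infer_instance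
  have hmap := Measure.map_linearMap_addHaar_eq_smul_addHaar (volume : Measure SpT) hdet
  have h1 : ∫ p, g p ∂(Measure.map L volume) = ∫ p, g (L p) :=
    L.toHomeomorph.isClosedEmbedding.measurableEmbedding.integral_map g
  have h2 : Measure.map L (volume : Measure SpT) = _ := hmap
  rw [← h1, h2, integral_smul_measure, hg, smul_zero]

lemma parDil_mem_Qlt {R lam θ : ℝ} (hR : 0 < R) (p : SpT) :
    parDil R hR.ne' p ∈ Qlt R lam θ ↔ p ∈ Qlt 1 lam θ := by
  rw [parDil_apply, Qlt, Qlt, mem_prod, mem_prod, mem_Icc, mem_Icc, mem_ball_zero_iff, mem_ball_zero_iff,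
    norm_smul, norm_of_nonneg hR.le]
  have hR2 : 0 < R ^ 2 := by positivity
  refine and_congr (and_congr ?_ ?_) ?_
  · constructor <;> intro h <;> nlinarith
  · constructor <;> intro h <;> nlinarith
  · constructor <;> intro h <;> nlinarith

lemma pdt_parDil {V : SpT → ℝ} {R : ℝ} (hR : R ≠ 0) (p : SpT) :
    pdt (fun p => V (parDil R hR p)) p = R ^ 2 * pdt V (parDil R hR p) := by
  rw [pdt, pdt]
  exact deriv_comp_mul_left (R ^ 2) (fun s => V (s, R • p.2)) p.1

lemma pdx_parDil {V : SpT → ℝ} {R : ℝ} (hR : R ≠ 0) (i : Fin 3) (p : SpT) :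
    pdx (fun p => V (parDil R hR p)) i p = R * pdx V i (parDil R hR p) := by
  have := fderiv_comp_smul (f := fun y => V (R ^ 2 * p.1, y)) (x := p.2) R
  rw [pdx, pdx]
  exact congrArg (fun T : E3 →L[ℝ] ℝ => T (EuclideanSpace.single i 1)) this

lemma divb_parDil {b : ℝ → E3 → E3} {R : ℝ} (hR : R ≠ 0) (p : SpT) :
    divb (fun t x => R • b (R ^ 2 * t) (R • x)) p = R ^ 2 * divb b (parDil R hR p) := by
  rw [divb, divb, Finset.mul_sum]
  refine Finset.sum_congr rfl fun i _ => ?_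
  have h1 := fderiv_comp_smul (f := fun y => R * b (R ^ 2 * p.1) y i + 0) (x := p.2) R
  rw [fderiv_affine (fun y => b (R ^ 2 * p.1) y i) R 0] at h1
  simp only [add_zero] at h1
  refine (congrArg (fun T : E3 →L[ℝ] ℝ => T (EuclideanSpace.single i 1)) h1).trans ?_
  show R * (R * _) = R ^ 2 * _
  rw [← mul_assoc, ← sq]; rfl

lemma weakSolOn_parDil {V : SpT → ℝ} {b : ℝ → E3 → E3} {R : ℝ} (hR : 0 < R)
    (h : WeakSolOn V b (Qlt R 2 1)) :
    WeakSolOn (fun p => V (parDil R hR.ne' p)) (fun t x => R • b (R ^ 2 * t) (R • x)) (Qlt 1 2 1) := by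
  intro φ h1 h2 h3
  set L := parDil R hR.ne' with hL
  set ψ : SpT → ℝ := φ ∘ L.symm with hψ
  have hφ : ∀ p, φ p = ψ (L p) := fun p => by rw [hψ, Function.comp_apply, L.symm_apply_apply]
  have hQ : L ⁻¹' (Qlt R 2 1) = Qlt 1 2 1 := by ext p; exact parDil_mem_Qlt hR p
  have hts : tsupport ψ ⊆ interior (Qlt R 2 1) := by
    have e1 : tsupport ψ = L.symm ⁻¹' tsupport φ := tsupport_comp_eq_preimage φ L.symm.toHomeomorph
    have e2 : L ⁻¹' interior (Qlt R 2 1) = interior (Qlt 1 2 1) := by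
      rw [← hQ]; exact L.toHomeomorph.preimage_interior _
    rw [e1]
    intro p hp
    have := h3 hp
    rw [← e2, mem_preimage, L.apply_symm_apply] at this
    exact this
  have h0 := h ψ (h1.comp L.symm.contDiff) (h2.comp_homeomorph L.symm.toHomeomorph) hts
  have key : ∀ p, weakInt (fun p => V (L p)) (fun t x => R • b (R ^ 2 * t) (R • x)) φ p =
      R ^ 2 * weakInt V b ψ (L p) := by
    intro p
    have e1 : φ = fun p => ψ (L p) := funext hφ
    have e2 : ∀ i, pdx φ i p = R * pdx ψ i (L p) := fun i => by rw [e1]; exact pdx_parDil hR.ne' i p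
    simp only [weakInt, pdt_parDil hR.ne' p, hL, pdx_parDil hR.ne', e2, Fin.sum_univ_three,
      PiLp.smul_apply, smul_eq_mul]
    rw [hφ p, ← hL]
    simp only [hL, parDil_apply]
    ring
  simp only [key]
  have h4 : ∫ p, weakInt V b ψ (L p) = 0 := integral_comp_parDil_eq_zero hR.ne' h0
  rw [integral_const_mul, h4, mul_zero]

lemma contDiffOn_parDil {b : ℝ → E3 → E3} {R : ℝ} (hR : 0 < R)
    (hb : ContDiffOn ℝ 1 (fun p : SpT => b p.1 p.2) (Qlt R 2 1)) :
    ContDiffOn ℝ 1 (fun p : SpT => R • b (R ^ 2 * p.1) (R • p.2)) (Qlt 1 2 1) :=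
  (hb.comp (parDil R hR.ne').contDiff.contDiffOn fun p hp => (parDil_mem_Qlt hR p).2 hp).const_smul R

lemma lintegral_comp_dilation {E : Type*} [NormedAddCommGroup E] [NormedSpace ℝ E]
    [MeasurableSpace E] [BorelSpace E] [FiniteDimensional ℝ E] (μ : Measure E) [μ.IsAddHaarMeasure]
    (f : E → ℝ≥0∞) {r : ℝ} (hr : r ≠ 0) :
    ∫⁻ x, f (r • x) ∂μ = ENNReal.ofReal |(r ^ Module.finrank ℝ E)⁻¹| * ∫⁻ x, f x ∂μ := by
  have he : MeasurableEmbedding fun x : E => r • x :=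
    (Homeomorph.smulOfNeZero r hr).isClosedEmbedding.measurableEmbedding
  have h2 : Measure.map (fun x : E => r • x) μ = _ := Measure.map_addHaar_smul μ hr
  rw [← he.lintegral_map f, h2, lintegral_smul_measure, smul_eq_mul]

/-- The `L^p` functional behind `spaceNorm` and `mixedNorm`. -/
def lebesgueNorm {X : Type*} [MeasurableSpace X] (f : X → ℝ≥0∞) (p : ℝ≥0∞) (μ : Measure X) : ℝ≥0∞ :=
  if p = ⊤ then essSup f μ else (∫⁻ x, f x ^ p.toReal ∂μ) ^ (1 / p.toReal)

lemma lintegral_rpow_dilation_le {E : Type*} [NormedAddCommGroup E] [NormedSpace ℝ E]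
    [MeasurableSpace E] [BorelSpace E] [FiniteDimensional ℝ E] (μ : Measure E) [μ.IsAddHaarMeasure]
    (f : E → ℝ≥0∞) {p : ℝ≥0∞} {s : ℝ} (hs : 0 < s) (hps : p ≠ ⊤ → s = p.toReal)
    {r : ℝ} (hr : 0 < r) {A B : Set E} (hB : MeasurableSet B)
    (hAB : A = (fun x : E => r • x) ⁻¹' B) :
    ∫⁻ x in A, f (r • x) ^ s ∂μ ≤ max 1 (μ A) *
      ENNReal.ofReal (r ^ (-(Module.finrank ℝ E / p.toReal) * s)) *
        lebesgueNorm f p (μ.restrict B) ^ s := by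
  have hm : Measurable fun x : E => r • x := by fun_prop
  have hA : MeasurableSet A := hAB ▸ hm hB
  have hpos : 0 < (r ^ Module.finrank ℝ E)⁻¹ := by positivity
  have hsc : ∀ g : E → ℝ≥0∞, ∫⁻ x in A, g (r • x) ∂μ =
      ENNReal.ofReal (r ^ Module.finrank ℝ E)⁻¹ * ∫⁻ x in B, g x ∂μ := by
    intro g
    rw [← lintegral_indicator hA, ← lintegral_indicator hB, ← abs_of_pos hpos,
      ← lintegral_comp_dilation μ _ hr.ne']
    refine lintegral_congr fun x => ?_
    have hx : x ∈ A ↔ r • x ∈ B := by rw [hAB]; rfl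
    by_cases h : x ∈ A
    · rw [indicator_of_mem h, indicator_of_mem (hx.1 h)]
    · rw [indicator_of_notMem h, indicator_of_notMem (mt hx.2 h)]
  rcases eq_or_ne p ⊤ with h | h
  · have h1 : ∫⁻ x in B, f x ^ s ∂μ ≤ ∫⁻ x in B, (lebesgueNorm f p (μ.restrict B)) ^ s ∂μ := by
      refine lintegral_mono_ae ?_
      filter_upwards [ENNReal.ae_le_essSup f] with x hx
      rw [lebesgueNorm, if_pos h]
      exact ENNReal.rpow_le_rpow hx hs.le
    have h2 := hsc fun _ => 1
    simp only [lintegral_one, Measure.restrict_apply_univ] at h2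
    rw [hsc (fun y => f y ^ s)]
    refine (mul_le_mul_right h1 _).trans ?_
    rw [setLIntegral_const, h]
    simp only [ENNReal.toReal_top, div_zero, neg_zero, zero_mul, rpow_zero, ENNReal.ofReal_one, mul_one]
    rw [mul_comm (_ ^ s), ← mul_assoc, ← h2]
    exact mul_le_mul_left (le_max_right _ _) _
  · have hs' := hps h
    rw [hsc (fun y => f y ^ s), lebesgueNorm, if_neg h, ← hs', one_div, ENNReal.rpow_inv_rpow hs.ne',
      neg_mul, div_mul_cancel₀ _ hs.ne', rpow_neg hr.le, rpow_natCast]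
    refine mul_le_mul_left ?_ _
    conv_lhs => rw [← one_mul (ENNReal.ofReal _)]
    exact mul_le_mul_left (le_max_left _ _) _

lemma spaceNorm_eq (g : E3 → E3) (q : ℝ≥0∞) (S : Set E3) :
    spaceNorm g q S = lebesgueNorm (fun x => ‖g x‖ₑ) q (volume.restrict S) := rfl

lemma mixedNorm_eq (b : ℝ → E3 → E3) (l q : ℝ≥0∞) (I : Set ℝ) (S : Set E3) :
    mixedNorm b l q I S = lebesgueNorm (fun t => spaceNorm (b t) q S) l (volume.restrict I) := rfl

/-- Real exponents below the given ones, equal to them when they are finite. -/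
lemma exists_real_exponents {q l : ℝ≥0∞} (hq : 1 < q) (hl : 1 < l)
    (h1 : 3 / q.toReal + 2 / l.toReal < 2) (h0 : 1 ≤ 3 / q.toReal + 2 / l.toReal) :
    ∃ s m : ℝ, 3 / 2 < s ∧ 1 < m ∧ 3 / (2 * s) + 1 / m < 1 ∧ (q ≠ ⊤ → s = q.toReal) ∧
      (l ≠ ⊤ → m = l.toReal) := by
  have key : ∀ s m : ℝ, 0 < s → 0 < m → 3 / s + 2 / m < 2 →
      3 / 2 < s ∧ 1 < m ∧ 3 / (2 * s) + 1 / m < 1 := by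
    intro s m hs hm h
    have a1 : 0 < 3 / s := by positivity
    have a2 : 0 < 2 / m := by positivity
    refine ⟨?_, ?_, ?_⟩
    · have : 3 / s < 2 := by linarith
      rw [div_lt_iff₀ hs] at this; linarith
    · have : 2 / m < 2 := by linarith
      rw [div_lt_iff₀ hm] at this; linarith
    · have : 3 / (2 * s) + 1 / m = (3 / s + 2 / m) / 2 := by field_simp
      linarith
  rcases eq_or_ne q ⊤ with hq' | hq' <;> rcases eq_or_ne l ⊤ with hl' | hl'
  · rw [hq', hl'] at h0; norm_num at h0
  · have hm : 0 < l.toReal := ENNReal.toReal_pos (by positivity) hl'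
    rw [hq'] at h1; simp only [ENNReal.toReal_top, div_zero, zero_add] at h1
    have hd : 0 < 2 - 2 / l.toReal := by linarith
    obtain ⟨h2, h3, h4⟩ := key (4 / (2 - 2 / l.toReal)) l.toReal (by positivity) hm (by
      rw [div_div_eq_mul_div]; linarith)
    exact ⟨_, _, h2, h3, h4, fun h => absurd hq' h, fun _ => rfl⟩
  · have hs : 0 < q.toReal := ENNReal.toReal_pos (by positivity) hq'
    rw [hl'] at h1; simp only [ENNReal.toReal_top, div_zero, add_zero] at h1
    have hd : 0 < 2 - 3 / q.toReal := by linarith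
    obtain ⟨h2, h3, h4⟩ := key q.toReal (4 / (2 - 3 / q.toReal)) hs (by positivity) (by
      rw [div_div_eq_mul_div]; linarith)
    exact ⟨_, _, h2, h3, h4, fun _ => rfl, fun h => absurd hl' h⟩
  · have hm : 0 < l.toReal := ENNReal.toReal_pos (by positivity) hl'
    have hs : 0 < q.toReal := ENNReal.toReal_pos (by positivity) hq'
    obtain ⟨h2, h3, h4⟩ := key q.toReal l.toReal hs hm h1
    exact ⟨_, _, h2, h3, h4, fun _ => rfl, fun _ => rfl⟩

lemma drift_bound {q l : ℝ≥0∞} {s m : ℝ} (hs : 3 / 2 < s) (hm : 1 < m)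
    (hqs : q ≠ ⊤ → s = q.toReal) (hlm : l ≠ ⊤ → m = l.toReal) :
    ∃ c : ℝ, 1 ≤ c ∧ ∀ (R : ℝ), 0 < R → ∀ (b : ℝ → E3 → E3) (n : ℝ), 0 ≤ n →
      mixedNorm b l q (Icc (-(2 * R) ^ 2) 0) (ball 0 (2 * R)) ≤
        ENNReal.ofReal (R ^ (3 / q.toReal + 2 / l.toReal - 1) * n) →
      ∫ t in (-1)..0, driftPow (driftB fun t x => R • b (R ^ 2 * t) (R • x)) s m t ≤ (c * n) ^ m := by
  have hs0 : 0 < s := by linarith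
  have hm0 : 0 < m := by linarith
  have hc1 : max 1 (volume (ball (0 : E3) 2)) ≠ ⊤ :=
    (max_lt ENNReal.one_lt_top measure_ball_lt_top).ne
  set c1 : ℝ := (max 1 (volume (ball (0 : E3) 2))).toReal with hc1d
  have hc1o : max 1 (volume (ball (0 : E3) 2)) = ENNReal.ofReal c1 := (ENNReal.ofReal_toReal hc1).symm
  have hc11 : 1 ≤ c1 := by
    rw [hc1d, ← ENNReal.toReal_one]
    exact ENNReal.toReal_mono hc1 (le_max_left _ _)
  refine ⟨c1 ^ (1 / s), one_le_rpow hc11 (by positivity), fun R hR b n hn hb => ?_⟩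
  set b' : ℝ → E3 → E3 := fun t x => R • b (R ^ 2 * t) (R • x) with hb'
  set S : ℝ → ℝ≥0∞ := fun t => spaceNorm (b t) q (ball 0 (2 * R)) with hS
  set X : ℝ := c1 * R ^ (s * (1 - 3 / q.toReal)) with hX
  have hX0 : 0 ≤ X := by positivity
  have hsl : ∀ t, ∫⁻ x, ‖driftB b' (t, x) ^ s‖ₑ ≤ ENNReal.ofReal X * S (R ^ 2 * t) ^ s := by
    intro t
    have e1 : ∀ x, ‖driftB b' (t, x) ^ s‖ₑ ≤ (ball (0 : E3) 2).indicator (fun x =>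
        ENNReal.ofReal (R ^ s) * ‖b (R ^ 2 * t) (R • x)‖ₑ ^ s) x := by
      intro x
      by_cases hx : (t, x) ∈ Icc (-1 : ℝ) 0 ×ˢ closedBall (0 : E3) (15 / 8)
      · have hx2 : x ∈ ball (0 : E3) 2 := closedBall_subset_ball (by norm_num) hx.2
        rw [indicator_of_mem hx2, driftB, indicator_of_mem hx, Real.enorm_rpow_of_nonneg (norm_nonneg _) hs0.le,
          enorm_norm, hb', enorm_smul, ENNReal.mul_rpow_of_nonneg _ _ hs0.le, Real.enorm_of_nonneg hR.le,
          ENNReal.ofReal_rpow_of_pos hR]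
      · rw [driftB, indicator_of_notMem hx, zero_rpow hs0.ne', enorm_zero]; exact zero_le
    refine (lintegral_mono e1).trans ?_
    rw [lintegral_indicator measurableSet_ball, lintegral_const_mul' _ _ ENNReal.ofReal_ne_top]
    have h := lintegral_rpow_dilation_le (volume : Measure E3) (fun y => ‖b (R ^ 2 * t) y‖ₑ)
      (p := q) hs0 hqs hR (A := ball 0 2) (B := ball 0 (2 * R)) measurableSet_ball (by
        ext x
        rw [mem_preimage, mem_ball_zero_iff, mem_ball_zero_iff, norm_smul, norm_of_nonneg hR.le, mul_comm 2 R,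
          mul_lt_mul_iff_right₀ hR])
    refine (mul_le_mul_right h _).trans (le_of_eq ?_)
    rw [← spaceNorm_eq, hc1o, ← mul_assoc, ← mul_assoc, ← ENNReal.ofReal_mul (by positivity),
      ← ENNReal.ofReal_mul (by positivity), hX]
    congr 2
    rw [show s * (1 - 3 / q.toReal) = s + (-(3 / q.toReal) * s) by ring, rpow_add hR, finrank_euclideanSpace,
      Fintype.card_fin]
    push_cast; ring
  have hdp : ∀ t, ‖driftPow (driftB b') s m t‖ₑ ≤
      ENNReal.ofReal (X ^ (m / s)) * S (R ^ 2 * t) ^ m := by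
    intro t
    have h0 : 0 ≤ ∫ x, driftB b' (t, x) ^ s := integral_nonneg fun x =>
      rpow_nonneg (indicator_nonneg (fun _ _ => norm_nonneg _) _) _
    rw [driftPow, Real.enorm_rpow_of_nonneg h0 (by positivity)]
    refine (ENNReal.rpow_le_rpow ((enorm_integral_le_lintegral_enorm _).trans (hsl t))
      (by positivity)).trans (le_of_eq ?_)
    rw [ENNReal.mul_rpow_of_nonneg _ _ (by positivity), ENNReal.ofReal_rpow_of_nonneg hX0 (by positivity),
      ← ENNReal.rpow_mul, mul_div_cancel₀ _ hs0.ne']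
  have hR2 : 0 < R ^ 2 := by positivity
  have htot : ∫⁻ t in Icc (-1 : ℝ) 0, ‖driftPow (driftB b') s m t‖ₑ ≤
      ENNReal.ofReal ((c1 ^ (1 / s) * n) ^ m) := by
    refine (lintegral_mono hdp).trans ?_
    rw [lintegral_const_mul' _ _ ENNReal.ofReal_ne_top]
    have h := lintegral_rpow_dilation_le (volume : Measure ℝ) S
      (p := l) hm0 hlm hR2 (A := Icc (-1) 0) (B := Icc (-R ^ 2) 0) measurableSet_Icc (by
        ext x
        rw [mem_preimage, mem_Icc, mem_Icc, smul_eq_mul]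
        refine and_congr ?_ ?_ <;> constructor <;> intro h <;> nlinarith)
    have hmn : lebesgueNorm S l (volume.restrict (Icc (-R ^ 2) 0)) ≤
        mixedNorm b l q (Icc (-(2 * R) ^ 2) 0) (ball 0 (2 * R)) := by
      have hle : (volume : Measure ℝ).restrict (Icc (-R ^ 2) 0) ≤
          volume.restrict (Icc (-(2 * R) ^ 2) 0) :=
        Measure.restrict_mono (Icc_subset_Icc_left (by nlinarith)) le_rfl
      rw [mixedNorm_eq, lebesgueNorm, lebesgueNorm]
      split_ifs
      · exact essSup_mono_measure hle.absolutelyContinuous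
      · exact ENNReal.rpow_le_rpow (lintegral_mono' hle le_rfl) (by positivity)
    refine (mul_le_mul_right (h.trans (mul_le_mul_right
      (ENNReal.rpow_le_rpow (hmn.trans hb) hm0.le) _)) _).trans (le_of_eq ?_)
    rw [Real.volume_Icc, zero_sub, neg_neg, ENNReal.ofReal_one, max_self, one_mul,
      ENNReal.ofReal_rpow_of_nonneg (by positivity) hm0.le, ← ENNReal.ofReal_mul (by positivity),
      ← ENNReal.ofReal_mul (by positivity), Module.finrank_self]
    congr 1
    rw [hX, mul_rpow (by positivity) (by positivity), mul_rpow (by positivity) hn,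
      mul_rpow (by positivity) hn, ← rpow_mul hR.le, ← rpow_mul hR.le, ← rpow_mul (by positivity : 0 ≤ c1),
      ← rpow_natCast R 2, ← rpow_mul hR.le]
    have e : R ^ (s * (1 - 3 / q.toReal) * (m / s)) *
        (R ^ (((2 : ℕ) : ℝ) * (-(((1 : ℕ) : ℝ) / l.toReal) * m)) *
          R ^ ((3 / q.toReal + 2 / l.toReal - 1) * m)) = 1 := by
      rw [← rpow_add hR, ← rpow_add hR, ← rpow_zero R]
      congr 1
      push_cast
      field_simp
      ring
    calc _ = c1 ^ (m / s) * n ^ m * (R ^ (s * (1 - 3 / q.toReal) * (m / s)) *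
        (R ^ (((2 : ℕ) : ℝ) * (-(((1 : ℕ) : ℝ) / l.toReal) * m)) *
          R ^ ((3 / q.toReal + 2 / l.toReal - 1) * m))) := by ring
      _ = _ := by rw [e, mul_one, one_div_mul_eq_div]
  have hfin : ‖∫ t in (-1)..0, driftPow (driftB b') s m t‖ₑ ≤
      ENNReal.ofReal ((c1 ^ (1 / s) * n) ^ m) := by
    rw [intervalIntegral.integral_of_le (by norm_num)]
    exact (enorm_integral_le_lintegral_enorm _).trans
      ((lintegral_mono_set Ioc_subset_Icc_self).trans htot)
  rw [← ofReal_norm, ENNReal.ofReal_le_ofReal_iff (by positivity)] at hfin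
  exact (le_abs_self _).trans hfin

lemma exists_exponent {K c m : ℝ} (hK : 1 ≤ K) (hc : 1 ≤ c) (N : ℕ) :
    ∃ C : ℝ, 1 < C ∧ ∀ n : ℝ, 2 ≤ n →
      (K * ((1 + (2 * c * n) ^ m) / (C ^ 2 * n)⁻¹)) ^ N ≤ n ^ C := by
  obtain ⟨k, hk⟩ := exists_nat_ge m
  set P := (k + 1) * N with hP
  set A : ℝ := 2 * K * (2 * c) ^ k with hA
  have hA0 : 0 < A := by positivity
  have hev := (tendsto_pow_const_div_const_pow_of_one_lt (2 * N) (one_lt_two : (1 : ℝ) < 2)).eventually_lt_const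
    (show (0 : ℝ) < (A ^ N * 2 ^ P)⁻¹ by positivity)
  obtain ⟨j, hj, hj2, hjP⟩ := (hev.and ((eventually_ge_atTop 2).and (eventually_ge_atTop P))).exists
  refine ⟨j, by exact_mod_cast hj2, fun n hn => ?_⟩
  have hn0 : 0 < n := by linarith
  have hb1 : 1 ≤ 2 * c * n := by nlinarith
  have h1 : (2 * c * n) ^ m ≤ (2 * c * n) ^ k := by
    rw [← rpow_natCast]; exact rpow_le_rpow_of_exponent_le hb1 hk
  have h2 : (1 : ℝ) ≤ (2 * c * n) ^ k := one_le_pow₀ hb1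
  have h3 : K * ((1 + (2 * c * n) ^ m) / ((j : ℝ) ^ 2 * n)⁻¹) ≤ A * j ^ 2 * n ^ (k + 1) := by
    rw [div_inv_eq_mul]
    calc K * ((1 + (2 * c * n) ^ m) * ((j : ℝ) ^ 2 * n))
        ≤ K * ((2 * (2 * c * n) ^ k) * ((j : ℝ) ^ 2 * n)) := by gcongr; linarith
      _ = _ := by rw [hA, mul_pow (2 * c) n]; ring
  have h4 : (0 : ℝ) ≤ K * ((1 + (2 * c * n) ^ m) / ((j : ℝ) ^ 2 * n)⁻¹) := by positivity
  have h5 : A ^ N * (j : ℝ) ^ (2 * N) * 2 ^ P ≤ 2 ^ j := by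
    rw [div_lt_iff₀ (by positivity), inv_mul_eq_div, lt_div_iff₀ (by positivity)] at hj
    linarith
  have h6 : A ^ N * (j : ℝ) ^ (2 * N) ≤ n ^ (j - P) := by
    refine le_trans ?_ (pow_le_pow_left₀ (by norm_num) hn _)
    refine le_of_mul_le_mul_right (h5.trans ?_) (by positivity : (0 : ℝ) < 2 ^ P)
    rw [← pow_add, Nat.sub_add_cancel hjP]
  calc _ ≤ (A * j ^ 2 * n ^ (k + 1)) ^ N := pow_le_pow_left₀ h4 h3 N
    _ = A ^ N * (j : ℝ) ^ (2 * N) * n ^ P := by rw [hP]; ring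
    _ ≤ n ^ (j - P) * n ^ P := by gcongr
    _ = n ^ j := by rw [← pow_add, Nat.sub_add_cancel hjP]
    _ = n ^ (j : ℝ) := (rpow_natCast _ _).symm

lemma isBounded_Qlt_one : Bornology.IsBounded (Qlt 1 2 1) := by
  unfold Qlt
  exact (isBounded_Icc _ _).prod isBounded_ball

lemma zero_mem_Qlt {R lam θ : ℝ} (hR : 0 < R) (hlam : 0 < lam) (hθ : 0 ≤ θ) : (0 : SpT) ∈ Qlt R lam θ := by
  refine ⟨⟨?_, le_rfl⟩, mem_ball_self (by positivity)⟩
  have := mul_nonneg hθ (sq_nonneg R)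
  simpa using this

lemma osc_le_of_forall {X : Type*} {f : X → ℝ} {S : Set X} {a : ℝ} (hS : S.Nonempty)
    (h : ∀ p ∈ S, ∀ p' ∈ S, f p - f p' ≤ a) : osc f S ≤ a := by
  have hne := hS.image f
  have h1 : ∀ p' ∈ S, sSup (f '' S) ≤ a + f p' := fun p' hp' => by
    refine csSup_le hne ?_
    rintro _ ⟨p, hp, rfl⟩
    linarith [h p hp p' hp']
  have h2 : sSup (f '' S) - a ≤ sInf (f '' S) := by
    refine le_csInf hne ?_
    rintro _ ⟨p', hp', rfl⟩
    linarith [h1 p' hp']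
  unfold osc; linarith

/-- Extension of a solution, Lipschitz on the unit cylinder, with the same bounds. -/
lemma exists_extension {W : SpT → ℝ} {b : ℝ → E3 → E3} {K : ℝ≥0} (hW : LipschitzOnWith K W (Qlt 1 2 1))
    (hb : ContDiffOn ℝ 1 (fun p : SpT => b p.1 p.2) (Qlt 1 2 1)) (h : WeakSolOn W b (Qlt 1 2 1)) {m M : ℝ}
    (hm : ∀ p ∈ Qlt 1 2 1, m ≤ W p) (hM : ∀ p ∈ Qlt 1 2 1, W p ≤ M) :
    ∃ (U : SpT → ℝ) (K' : ℝ≥0), WSol U b K' ∧ EqOn W U (Qlt 1 2 1) ∧ (∀ p, m ≤ U p) ∧ ∀ p, U p ≤ M := by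
  obtain ⟨g, hg, hgW⟩ := hW.extend_real
  have h0 := zero_mem_Qlt one_pos two_pos zero_le_one
  have hmM : m ≤ M := (hm 0 h0).trans (hM 0 h0)
  have hEq : EqOn W (fun p => max m (min M (g p))) (Qlt 1 2 1) := fun p hp => by
    simp only [← hgW hp, min_eq_right (hM p hp), max_eq_right (hm p hp)]
  refine ⟨fun p => max m (min M (g p)), K, ⟨(hg.const_min M).const_max m, hb.continuousOn, h.congr hEq⟩, hEq,
    fun p => le_max_left _ _, fun p => max_le hmM (min_le_left _ _)⟩

/-- Oscillation decay for weak solutions of the drift-diffusion equation. -/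
theorem stmt19 (q l : ℝ≥0∞) (hq : 1 < q) (hl : 1 < l) (α : ℝ)
    (hαdef : α = 3 / q.toReal + 2 / l.toReal - 1) (hα0 : 0 ≤ α) (hα1 : α < 1) :
    ∃ C : ℝ, 1 < C ∧
      ∀ R : ℝ, 0 < R →
        ∀ (b : ℝ → E3 → E3) (V : ℝ × E3 → ℝ),
          ContDiffOn ℝ 1 (fun p : ℝ × E3 => b p.1 p.2) (Qlt R 2 1) →
          (⨆ (R' : ℝ) (_ : 0 < R') (_ : R' ≤ 2 * R),
              ENNReal.ofReal (R' ^ (-α)) *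
                mixedNorm b l q (Set.Icc (-(R' ^ 2)) 0) (Metric.ball 0 R')) < ⊤ →
          (∃ K : ℝ≥0, LipschitzOnWith K V (Qlt R 2 1)) →
          WeakSolOn V b (Qlt R 2 1) →
          (∀ p ∈ Qlt R 2 1, divb b p = 0 ∨ V p = 0) →
          osc V (Qlt R 1 ((C ^ 2 * (2 + (⨆ (R' : ℝ) (_ : 0 < R') (_ : R' ≤ 2 * R),
              ENNReal.ofReal (R' ^ (-α)) *
                mixedNorm b l q (Set.Icc (-(R' ^ 2)) 0)
                  (Metric.ball 0 R')).toReal))⁻¹ / 2)) ≤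
            (1 - Real.exp (-((2 + (⨆ (R' : ℝ) (_ : 0 < R') (_ : R' ≤ 2 * R),
                ENNReal.ofReal (R' ^ (-α)) *
                  mixedNorm b l q (Set.Icc (-(R' ^ 2)) 0)
                    (Metric.ball 0 R')).toReal) ^ C))) *
              osc V (Qlt R 2 1) := by
  obtain ⟨s, m, hs, hm, hsm, hqs, hlm⟩ := exists_real_exponents hq hl (by linarith) (by linarith)
  obtain ⟨c, hc, hdrift⟩ := drift_bound hs hm hqs hlm
  obtain ⟨K1, N, hK1, hosc⟩ := osc_unit hs hm hsm
  obtain ⟨C, hC, hexp⟩ := exists_exponent hK1 hc N (m := m)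
  refine ⟨C, hC, fun R hR b V hb hfin hLip hweak hdiv => ?_⟩
  set S := ⨆ (R' : ℝ) (_ : 0 < R') (_ : R' ≤ 2 * R),
    ENNReal.ofReal (R' ^ (-α)) * mixedNorm b l q (Set.Icc (-(R' ^ 2)) 0) (Metric.ball 0 R') with hS
  set n : ℝ := 2 + S.toReal with hn
  have hS0 : 0 ≤ S.toReal := ENNReal.toReal_nonneg
  have hn2 : 2 ≤ n := by linarith
  set Θ : ℝ := (C ^ 2 * n)⁻¹ with hΘ
  have hΘ0 : 0 < Θ := by positivity
  have hΘ1 : Θ ≤ 1 := inv_le_one_of_one_le₀ (by nlinarith)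
  have hR2 : 0 < 2 * R := by linarith
  have hmix : mixedNorm b l q (Icc (-(2 * R) ^ 2) 0) (ball 0 (2 * R)) ≤
      ENNReal.ofReal (R ^ (3 / q.toReal + 2 / l.toReal - 1) * (2 * n)) := by
    have h1 : ENNReal.ofReal ((2 * R) ^ (-α)) *
        mixedNorm b l q (Icc (-(2 * R) ^ 2) 0) (ball 0 (2 * R)) ≤ S :=
      le_iSup_of_le (2 * R) (le_iSup_of_le hR2 (le_iSup_of_le le_rfl le_rfl))
    have h2 : mixedNorm b l q (Icc (-(2 * R) ^ 2) 0) (ball 0 (2 * R)) =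
        ENNReal.ofReal ((2 * R) ^ α) * (ENNReal.ofReal ((2 * R) ^ (-α)) *
          mixedNorm b l q (Icc (-(2 * R) ^ 2) 0) (ball 0 (2 * R))) := by
      rw [← mul_assoc, ← ENNReal.ofReal_mul (by positivity), ← rpow_add hR2, add_neg_cancel, rpow_zero,
        ENNReal.ofReal_one, one_mul]
    rw [h2, ← hαdef]
    refine (mul_le_mul_right (h1.trans (ENNReal.ofReal_toReal hfin.ne).ge) _).trans ?_
    rw [← ENNReal.ofReal_mul (by positivity)]
    refine ENNReal.ofReal_le_ofReal ?_
    rw [mul_rpow zero_le_two hR.le]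
    have h3 : (2 : ℝ) ^ α ≤ 2 := by
      conv_rhs => rw [← rpow_one (2 : ℝ)]
      exact rpow_le_rpow_of_exponent_le one_le_two hα1.le
    calc (2 : ℝ) ^ α * R ^ α * S.toReal = R ^ α * (2 ^ α * S.toReal) := by ring
      _ ≤ R ^ α * (2 * n) := by gcongr; linarith
  have hD := hdrift R hR b (2 * n) (by linarith) hmix
  rw [show c * (2 * n) = 2 * c * n by ring] at hD
  set L := parDil R hR.ne' with hL
  obtain ⟨K, hK⟩ := hLip
  have hmaps : MapsTo L (Qlt 1 2 1) (Qlt R 2 1) := fun p hp => (parDil_mem_Qlt hR p).2 hp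
  have hW : LipschitzOnWith _ (V ∘ L) (Qlt 1 2 1) := hK.comp (L.toContinuousLinearMap.lipschitz.lipschitzOnWith (s := Qlt 1 2 1)) hmaps
  have himg : V '' Qlt R 2 1 = (V ∘ L) '' Qlt 1 2 1 := by
    rw [image_comp]
    congr 1
    refine Subset.antisymm (fun p hp => ?_) hmaps.image_subset
    exact ⟨L.symm p, (parDil_mem_Qlt hR _).1 (by rw [← hL, L.apply_symm_apply]; exact hp),
      L.apply_symm_apply p⟩
  have hbdd : Bornology.IsBounded (V '' Qlt R 2 1) := by
    obtain ⟨g, hg, hgW⟩ := LipschitzOnWith.extend_real hW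
    rw [himg, hgW.image_eq]
    exact hg.isBounded_image isBounded_Qlt_one
  have hmV : ∀ p ∈ Qlt 1 2 1, sInf (V '' Qlt R 2 1) ≤ (V ∘ L) p := fun p hp =>
    csInf_le hbdd.bddBelow (mem_image_of_mem V (hmaps hp))
  have hMV : ∀ p ∈ Qlt 1 2 1, (V ∘ L) p ≤ sSup (V '' Qlt R 2 1) := fun p hp =>
    le_csSup hbdd.bddAbove (mem_image_of_mem V (hmaps hp))
  obtain ⟨U, K', hU, hVU, hmU, hMU⟩ := exists_extension (W := V ∘ L) hW (contDiffOn_parDil hR hb)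
    (weakSolOn_parDil hR hweak) hmV hMV
  have hdivU : ∀ p ∈ Om, divb (fun t x => R • b (R ^ 2 * t) (R • x)) p = 0 ∨ U p = 0 := by
    intro p hp
    have hpQ := Om_subset_Qlt hp
    rw [divb_parDil hR.ne', ← hVU hpQ]
    exact (hdiv _ (hmaps hpQ)).imp (fun h => by rw [← hL, h, mul_zero]) id
  have key := hosc U _ K' hU (contDiffOn_parDil hR hb) hdivU _ hD Θ hΘ0 hΘ1 _ _ hmU hMU
  refine osc_le_of_forall ⟨0, zero_mem_Qlt hR one_pos (by positivity)⟩ fun p hp p' hp' => ?_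
  have hpull : ∀ p ∈ Qlt R 1 (Θ / 2), ∃ x ∈ Icc (-(Θ / 2)) 0 ×ˢ ball (0 : E3) 1, V p = U x := by
    intro p hp
    have e : L (L.symm p) = p := L.apply_symm_apply p
    have h1 : L.symm p ∈ Qlt 1 1 (Θ / 2) := (parDil_mem_Qlt hR _).1 (by rw [← hL, e]; exact hp)
    rw [Qlt, one_pow, mul_one, mul_one] at h1
    refine ⟨_, h1, ?_⟩
    rw [← hVU (x := L.symm p), Function.comp_apply, e]
    rw [Qlt, one_pow, mul_one, mul_one]
    exact prod_mono (Icc_subset_Icc_left (by linarith)) (ball_subset_ball one_le_two) h1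
  obtain ⟨x, hx, hVx⟩ := hpull p hp
  obtain ⟨x', hx', hVx'⟩ := hpull p' hp'
  rw [hVx, hVx']
  refine (key x hx x' hx').trans ?_
  have hmM : 0 ≤ sSup (V '' Qlt R 2 1) - sInf (V '' Qlt R 2 1) :=
    sub_nonneg.2 ((hmU 0).trans (hMU 0))
  refine mul_le_mul_of_nonneg_right ?_ hmM
  have := exp_le_exp.2 (neg_le_neg (hexp n hn2))
  linarith
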